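/- Let Φ be a local Zhou weight related to |f₀|²e^{-2φ₀} near o. Then for any psh function ψ near o and any small enough neighborhood U of o, σ(ψ, Φ) = lim_{t→+∞} [ ∫_{{Φ<-t}∩U} |f₀|²e^{-2φ₀}·(-ψ) ] / [ t·∫_{{Φ<-t}∩U} |f₀|²e^{-2φ₀} ]. -/

import Mathlib

open MeasureTheory Filter Topology
open scoped ENNReal NNReal

noncomputable section

/-- `ℂⁿ`. -/
abbrev Cn (n : ℕ) : Type := Fin n → ℂ

variable {n : ℕ}

/-- The exponential function `EReal → ℝ≥0∞`, with `exp ⊥ = 0` and `exp ⊤ = ⊤`. -/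
def expE (x : EReal) : ℝ≥0∞ :=
  if x = ⊥ then 0 else if x = ⊤ then ⊤ else ENNReal.ofReal (Real.exp x.toReal)

/-- The logarithm `ℝ → EReal`, with value `⊥` for `x ≤ 0`. -/
def elog (x : ℝ) : EReal := if x ≤ 0 then (⊥ : EReal) else ((Real.log x : ℝ) : EReal)

/-- The density `e^{c·φ} : ℂⁿ → [0,∞]` associated to an extended-real-valued `φ`. -/
def wexp (c : ℝ) (φ : Cn n → EReal) (z : Cn n) : ℝ≥0∞ := expE ((c : EReal) * φ z)

/-- `|f₀|² = ∑ⱼ |f₀ⱼ|²` as a `[0,∞]`-valued density, for a tuple `f₀` of functions. -/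
def normSq2 {m : ℕ} (f₀ : Fin m → Cn n → ℂ) (z : Cn n) : ℝ≥0∞ :=
  ∑ j, (‖f₀ j z‖₊ : ℝ≥0∞) ^ 2

/-- `log |f₀| = (1/2) log ∑ⱼ |f₀ⱼ|²` for a tuple `f₀`. -/
def logAbsT {m : ℕ} (f₀ : Fin m → Cn n → ℂ) (z : Cn n) : EReal :=
  elog (Real.sqrt (∑ j, ‖f₀ j z‖ ^ 2))

/-- The weight `|f₀|² e^{-2φ₀}`. -/
def dens0 {m : ℕ} (f₀ : Fin m → Cn n → ℂ) (φ₀ : Cn n → EReal) (z : Cn n) : ℝ≥0∞ :=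
  normSq2 f₀ z * wexp (-2) φ₀ z

/-- A nonnegative function is (Lebesgue-)integrable near the origin. -/
def IntNear (g : Cn n → ℝ≥0∞) : Prop := ∃ U ∈ 𝓝 (0 : Cn n), (∫⁻ z in U, g z) < ⊤

/-- `ψ ≤ φ + O(1)` near the origin. -/
def leO (ψ φ : Cn n → EReal) : Prop := ∃ C : ℝ, ∀ᶠ z in 𝓝 (0 : Cn n), ψ z ≤ φ z + (C : EReal)

/-- `ψ = φ + O(1)` near the origin. -/
def eqO (ψ φ : Cn n → EReal) : Prop := leO ψ φ ∧ leO φ ψ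

/-- The truncated average of `u` over the circle `θ ↦ z + r e^{iθ} w`, truncated below at `-m`. -/
def circleAvg (u : Cn n → EReal) (z w : Cn n) (r : ℝ) (m : ℕ) : ℝ :=
  (2 * Real.pi)⁻¹ * ∫ θ in (0:ℝ)..(2 * Real.pi),
    (max (u (z + ((r : ℂ) * Complex.exp (Complex.I * (θ : ℂ))) • w)) ((-(m : ℝ) : ℝ) : EReal)).toReal

/-- `u` is plurisubharmonic on `Ω`: it is upper semicontinuous on `Ω`, takes values in
`[-∞, ∞)`, is not identically `-∞` on any connected component of `Ω`, and satisfies the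
sub-mean value inequality on all small circles inside complex lines. -/
structure PSHOn (u : Cn n → EReal) (Ω : Set (Cn n)) : Prop where
  usc : UpperSemicontinuousOn u Ω
  lt_top : ∀ z ∈ Ω, u z < ⊤
  not_botOnComponents : ∀ z ∈ Ω, ∃ w ∈ connectedComponentIn Ω z, u w ≠ ⊥
  submean : ∀ z ∈ Ω, ∀ w : Cn n, ∃ ε > 0, ∀ r : ℝ, 0 < r → r < ε →
    u z ≤ ⨅ m : ℕ, ((circleAvg u z w r m : ℝ) : EReal)

/-- `u` is plurisubharmonic near the origin. -/
def PSHNear (u : Cn n → EReal) : Prop := ∃ U ∈ 𝓝 (0 : Cn n), IsOpen U ∧ PSHOn u U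

/-- `f` is holomorphic near the origin. -/
def HoloNear (f : Cn n → ℂ) : Prop := ∃ U ∈ 𝓝 (0 : Cn n), IsOpen U ∧ DifferentiableOn ℂ f U

/-- `Φ` is a (local) Zhou weight near the origin related to a general nonnegative
weight `W`. -/
structure IsZhouWeightFor (W : Cn n → ℝ≥0∞) (Φ : Cn n → EReal) : Prop where
  psh : PSHNear Φ
  intN : ∃ N₁ : ℕ, ∀ N₀ : ℕ, N₁ ≤ N₀ →
    IntNear fun z => W z * ENNReal.ofReal (‖z‖ ^ (2 * N₀)) * wexp (-2) Φ z
  nonint : ¬ IntNear fun z => W z * wexp (-2) Φ z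
  maximal : ∀ φ' : Cn n → EReal, PSHNear φ' → leO Φ φ' →
    (¬ IntNear fun z => W z * wexp (-2) φ' z) → eqO φ' Φ

/-- `Φ` is a local Zhou weight related to `|f₀|² e^{-2φ₀}` near the origin (including the
standing assumptions that `f₀` is a tuple of holomorphic functions near `o`, `φ₀` is
plurisubharmonic near `o`, and `|f₀|² e^{-2φ₀}` is integrable near `o`). -/
structure IsLocalZhouWeight {m : ℕ} (f₀ : Fin m → Cn n → ℂ) (φ₀ : Cn n → EReal)
    (Φ : Cn n → EReal) : Prop where
  holo : ∀ j, HoloNear (f₀ j)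
  psh₀ : PSHNear φ₀
  int₀ : IntNear (dens0 f₀ φ₀)
  zhou : IsZhouWeightFor (dens0 f₀ φ₀) Φ

/-- The Zhou number (relative type) `σ(ψ, Φ) = sup { b ≥ 0 : ψ ≤ bΦ + O(1) near o }`. -/
def zhouNumber (ψ Φ : Cn n → EReal) : ℝ :=
  sSup {b : ℝ | 0 ≤ b ∧ leO ψ fun z => (b : EReal) * Φ z}

/-- `log ‖f‖ : ℂⁿ → EReal`. -/
def logAbs (f : Cn n → ℂ) (z : Cn n) : EReal := elog ‖f z‖

/-- `ν(f, Φ) = σ(log|f|, Φ)`. -/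
def nuNumber (f : Cn n → ℂ) (Φ : Cn n → EReal) : ℝ := zhouNumber (logAbs f) Φ

/-- The jumping number `c_o^G(Φ) = sup { c ≥ 0 : |G|² e^{-2cΦ} integrable near o }`. -/
def jumping (G : Cn n → ℂ) (Φ : Cn n → EReal) : ℝ :=
  sSup {c : ℝ | 0 ≤ c ∧ IntNear fun z => (‖G z‖₊ : ℝ≥0∞) ^ 2 * wexp (-2 * c) Φ z}

/-- The inclusion `ℐ(φ)ₒ ⊆ ℐ(ψ)ₒ` of multiplier ideals at the origin. -/
def mIdealLE (φ ψ : Cn n → EReal) : Prop :=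
  ∀ f : Cn n → ℂ, HoloNear f →
    (IntNear fun z => (‖f z‖₊ : ℝ≥0∞) ^ 2 * wexp (-2) φ z) →
    IntNear fun z => (‖f z‖₊ : ℝ≥0∞) ^ 2 * wexp (-2) ψ z

/-- The Tian function `Tn(t; f, v, φ₀) = sup { c ≥ 0 : |f|^{2t} e^{-2cv - 2φ₀} integrable near o }`. -/
def tian (t : ℝ) (f : Cn n → ℂ) (v φ₀ : Cn n → EReal) : ℝ :=
  sSup {c : ℝ | 0 ≤ c ∧
    IntNear fun z => ENNReal.ofReal (‖f z‖ ^ (2 * t)) * wexp (-2 * c) v z * wexp (-2) φ₀ z}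

/-- The monomial `z^β`. -/
def mono (z : Cn n) (β : Fin n → ℕ) : ℂ := ∏ i, z i ^ β i

lemma cons_mem_ball {R : ℝ} {w : ℂ} {z : Cn n} (hw : ‖w‖ < R) (hz : ‖z‖ < R) :
    (Fin.cons w z : Cn (n + 1)) ∈ Metric.ball (0 : Cn (n + 1)) R := by
  have hR : 0 < R := (norm_nonneg _).trans_lt hw
  rw [mem_ball_zero_iff, pi_norm_lt_iff hR]
  intro i
  refine Fin.cases ?_ (fun j => ?_) i
  · simpa using hw
  · simpa using (norm_le_pi_norm z j).trans_lt hz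

lemma differentiable_cons_right (w : ℂ) :
    Differentiable ℂ (fun z : Cn n => (Fin.cons w z : Cn (n + 1))) := by
  rw [differentiable_pi]
  intro i
  refine Fin.cases ?_ (fun j => ?_) i
  · simp
  · simp only [Fin.cons_succ]; fun_prop

lemma differentiable_cons_left (z : Cn n) :
    Differentiable ℂ (fun w : ℂ => (Fin.cons w z : Cn (n + 1))) := by
  rw [differentiable_pi]
  intro i
  refine Fin.cases ?_ (fun j => ?_) i
  · simp only [Fin.cons_zero]; fun_prop
  · simp

/-- The `k`-th Taylor coefficient in the first variable is holomorphic in the others. -/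
lemma differentiableOn_circleAverage_cons {R M ρ : ℝ} {F : Cn (n + 1) → ℂ} (hρ : 0 < ρ)
    (hρR : ρ < R) (hF : DifferentiableOn ℂ F (Metric.ball 0 R))
    (hM : ∀ z ∈ Metric.ball 0 R, ‖F z‖ ≤ M) (k : ℕ) :
    DifferentiableOn ℂ (fun z : Cn n => Real.circleAverage
      (fun w => (w⁻¹) ^ k * F (Fin.cons w z)) 0 ρ) (Metric.ball 0 R) := by
  intro z₀ hz₀
  rw [mem_ball_zero_iff] at hz₀
  have hcm : ∀ θ, ‖circleMap 0 ρ θ‖ = ρ := fun θ => by simp [abs_of_pos hρ]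
  obtain ⟨d, hd0, hd1, hd2⟩ : ∃ d : ℝ, 0 < d ∧ ‖z₀‖ + 2 * d < R ∧ ρ + 2 * d < R :=
    ⟨min (R - ‖z₀‖) (R - ρ) / 3, by have := lt_min (sub_pos.2 hz₀) (sub_pos.2 hρR); linarith,
      by have := min_le_left (R - ‖z₀‖) (R - ρ); linarith [sub_pos.2 hz₀],
      by have := min_le_right (R - ‖z₀‖) (R - ρ); linarith⟩
  have hdiff : ∀ z ∈ Metric.ball z₀ d, ∀ θ, HasFDerivAt (𝕜 := ℂ)
      (fun z : Cn n => ((circleMap 0 ρ θ)⁻¹) ^ k * F (Fin.cons (circleMap 0 ρ θ) z))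
      (fderiv ℂ (fun z : Cn n => ((circleMap 0 ρ θ)⁻¹) ^ k * F (Fin.cons (circleMap 0 ρ θ) z)) z) z
      := by
    intro z hz θ
    apply DifferentiableAt.hasFDerivAt
    have hz' : ‖z‖ < R := by
      have := norm_sub_norm_le z z₀
      rw [mem_ball_iff_norm] at hz; linarith
    refine DifferentiableAt.const_mul ?_ _
    exact (hF.differentiableAt (Metric.isOpen_ball.mem_nhds
      (cons_mem_ball (by rw [hcm]; exact hρR) hz'))).comp z (differentiable_cons_right _ z)
  have hbd : ∀ z ∈ Metric.ball z₀ d, ∀ θ, ‖fderiv ℂ (fun z : Cn n =>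
      ((circleMap 0 ρ θ)⁻¹) ^ k * F (Fin.cons (circleMap 0 ρ θ) z)) z‖
      ≤ (ρ⁻¹ ^ k * M + ρ⁻¹ ^ k * M) / d := by
    intro z hz θ
    have hz' : ∀ y ∈ Metric.ball z d, ‖y‖ < R := by
      intro y hy
      have h1 := norm_sub_norm_le z z₀
      have h2 := norm_sub_norm_le y z
      rw [mem_ball_iff_norm] at hz hy; linarith
    have hb : ∀ y ∈ Metric.ball z d,
        ‖((circleMap 0 ρ θ)⁻¹) ^ k * F (Fin.cons (circleMap 0 ρ θ) y)‖ ≤ ρ⁻¹ ^ k * M := by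
      intro y hy
      rw [norm_mul, norm_pow, norm_inv, hcm]
      gcongr
      exact hM _ (cons_mem_ball (by rw [hcm]; exact hρR) (hz' y hy))
    refine Complex.norm_fderiv_le_div_of_mapsTo_ball ?_ ?_ hd0
    · intro y hy
      refine DifferentiableAt.differentiableWithinAt (DifferentiableAt.const_mul ?_ _)
      exact (hF.differentiableAt (Metric.isOpen_ball.mem_nhds
        (cons_mem_ball (by rw [hcm]; exact hρR) (hz' y hy)))).comp y
          (differentiable_cons_right _ y)
    · intro y hy
      rw [mem_closedBall_iff_norm]
      exact (norm_sub_le _ _).trans (add_le_add (hb y hy) (hb z (Metric.mem_ball_self hd0)))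
  have hcont : ∀ z ∈ Metric.ball z₀ d, Continuous (fun θ : ℝ =>
      ((circleMap 0 ρ θ)⁻¹) ^ k * F (Fin.cons (circleMap 0 ρ θ) z)) := by
    intro z hz
    have hz' : ‖z‖ < R := by
      have := norm_sub_norm_le z z₀
      rw [mem_ball_iff_norm] at hz; linarith
    have h1 : Continuous (fun θ : ℝ => (circleMap 0 ρ θ)⁻¹) :=
      (continuous_circleMap 0 ρ).inv₀ fun θ => by
        rw [← norm_pos_iff, hcm]; exact hρ
    refine (h1.pow k).mul ?_
    refine hF.continuousOn.comp_continuous ?_ (fun θ => cons_mem_ball (by rw [hcm]; exact hρR) hz')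
    exact (differentiable_cons_left z).continuous.comp (continuous_circleMap 0 ρ)
  have hmeas : Measurable (fun θ : ℝ => fderiv ℂ (fun z : Cn n =>
      ((circleMap 0 ρ θ)⁻¹) ^ k * F (Fin.cons (circleMap 0 ρ θ) z)) z₀) := by
    have : (fun θ : ℝ => fderiv ℂ (fun z : Cn n =>
      ((circleMap 0 ρ θ)⁻¹) ^ k * F (Fin.cons (circleMap 0 ρ θ) z)) z₀) = fun θ : ℝ =>
        (((circleMap 0 ρ θ)⁻¹) ^ k) • ((fderiv ℂ F (Fin.cons (circleMap 0 ρ θ) z₀)).comp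
          (fderiv ℂ (fun z : Cn n => (Fin.cons (0 : ℂ) z : Cn (n + 1))) z₀)) := by
      funext θ
      have hFd := hF.differentiableAt (Metric.isOpen_ball.mem_nhds
        (cons_mem_ball (w := circleMap 0 ρ θ) (by rw [hcm]; exact hρR) hz₀))
      have hc := differentiable_cons_right (circleMap 0 ρ θ) z₀
      have e1 : fderiv ℂ (fun z : Cn n => (Fin.cons (circleMap 0 ρ θ) z : Cn (n + 1))) z₀
          = fderiv ℂ (fun z : Cn n => (Fin.cons (0 : ℂ) z : Cn (n + 1))) z₀ := by
        have : (fun z : Cn n => (Fin.cons (circleMap 0 ρ θ) z : Cn (n + 1)))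
            = fun z : Cn n => (Fin.cons (0 : ℂ) z : Cn (n + 1))
              + (Fin.cons (circleMap 0 ρ θ) 0 : Cn (n + 1)) := by
          funext z i
          refine Fin.cases ?_ (fun j => ?_) i <;> simp
        rw [this, fderiv_add_const]
      have hcomp : DifferentiableAt ℂ (fun z : Cn n => F (Fin.cons (circleMap 0 ρ θ) z)) z₀ :=
        hFd.comp z₀ hc
      rw [fderiv_const_mul hcomp]
      congr 1
      have := fderiv_comp z₀ hFd hc
      rw [e1] at this
      exact this
    rw [this]
    have hm1 : Measurable (fun θ : ℝ => ((circleMap 0 ρ θ)⁻¹) ^ k) := by fun_prop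
    have hm2 : Measurable (fun θ : ℝ => fderiv ℂ F (Fin.cons (circleMap 0 ρ θ) z₀)) :=
      (measurable_fderiv ℂ F).comp
        ((differentiable_cons_left z₀).continuous.comp (continuous_circleMap 0 ρ)).measurable
    have hL : Continuous (fun L : Cn (n + 1) →L[ℂ] ℂ => L.comp
          (fderiv ℂ (fun z : Cn n => (Fin.cons (0 : ℂ) z : Cn (n + 1))) z₀)) :=
      ((ContinuousLinearMap.compL ℂ (Cn n) (Cn (n + 1)) ℂ).flip _).continuous
    exact hm1.smul (hL.measurable.comp hm2)
  have key := hasFDerivAt_integral_of_dominated_of_fderiv_le (𝕜 := ℂ)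
    (μ := volume.restrict (Set.Ioc (0 : ℝ) (2 * Real.pi)))
    (F := fun (z : Cn n) θ => ((circleMap 0 ρ θ)⁻¹) ^ k * F (Fin.cons (circleMap 0 ρ θ) z))
    (F' := fun z θ => fderiv ℂ (fun z : Cn n =>
      ((circleMap 0 ρ θ)⁻¹) ^ k * F (Fin.cons (circleMap 0 ρ θ) z)) z)
    (bound := fun _ => (ρ⁻¹ ^ k * M + ρ⁻¹ ^ k * M) / d)
    (x₀ := z₀) (Metric.ball_mem_nhds z₀ hd0)
    (by filter_upwards [Metric.ball_mem_nhds z₀ hd0] with z hz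
        exact (hcont z hz).aestronglyMeasurable)
    ((hcont z₀ (Metric.mem_ball_self hd0)).integrableOn_Ioc)
    hmeas.aestronglyMeasurable
    (ae_of_all _ fun θ z hz => hbd z hz θ)
    (integrable_const _)
    (ae_of_all _ fun θ z hz => hdiff z hz θ)
  have h2 : (fun z : Cn n => Real.circleAverage
      (fun w => (w⁻¹) ^ k * F (Fin.cons w z)) 0 ρ) = fun z : Cn n =>
      ((2 * Real.pi)⁻¹ : ℝ) • ∫ θ in Set.Ioc (0 : ℝ) (2 * Real.pi),
        ((circleMap 0 ρ θ)⁻¹) ^ k * F (Fin.cons (circleMap 0 ρ θ) z) := by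
    funext z
    rw [Real.circleAverage, intervalIntegral.integral_of_le Real.two_pi_pos.le]
  rw [h2]
  exact (key.differentiableAt.const_smul ((2 * Real.pi)⁻¹ : ℝ)).differentiableWithinAt

/-- One-variable Taylor expansion through circle averages. -/
lemma hasSum_circleAverage {R ρ : ℝ} {f : ℂ → ℂ} (hρ : 0 < ρ) (hρR : ρ < R)
    (hf : DifferentiableOn ℂ f (Metric.ball 0 R)) {w : ℂ} (hw : ‖w‖ < ρ) :
    HasSum (fun k : ℕ => Real.circleAverage (fun y => (y⁻¹) ^ k * f y) 0 ρ * w ^ k) (f w) := by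
  have hsub : Metric.closedBall (0 : ℂ) ρ ⊆ Metric.ball 0 R := Metric.closedBall_subset_ball hρR
  have hc : ContinuousOn f (Metric.closedBall 0 ρ) := hf.continuousOn.mono hsub
  have hci : CircleIntegrable f 0 ρ := (hc.mono Metric.sphere_subset_closedBall).circleIntegrable hρ.le
  have h1 := hasSum_cauchyPowerSeries_integral hci hw
  have h2 := Complex.two_pi_I_inv_smul_circleIntegral_sub_inv_smul_of_differentiable_on_off_countable
    (s := ∅) Set.countable_empty (w := w) (c := 0) (R := ρ) (f := f) (by simpa using hw) hc
    (fun x hx => hf.differentiableAt (Metric.isOpen_ball.mem_nhds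
      (hsub (Metric.ball_subset_closedBall hx.1))))
  rw [zero_add, h2] at h1
  refine h1.congr_fun fun k => ?_
  rw [cauchyPowerSeries_apply, Real.circleAverage_eq_circleIntegral hρ.ne', smul_eq_mul, smul_eq_mul,
    mul_assoc]
  congr 1
  rw [mul_comm, ← circleIntegral.integral_const_mul]
  congr 1
  funext z
  simp only [sub_zero, smul_eq_mul, div_pow, inv_pow]
  ring

lemma norm_circleAverage_le {f : ℂ → ℂ} {ρ C : ℝ} (hρ : 0 < ρ)
    (h : ∀ w, ‖w‖ = ρ → ‖f w‖ ≤ C) : ‖Real.circleAverage f 0 ρ‖ ≤ C := by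
  rw [Real.circleAverage, norm_smul]
  have := intervalIntegral.norm_integral_le_of_norm_le_const (a := 0) (b := 2 * Real.pi)
    (f := fun θ => f (circleMap 0 ρ θ)) (C := C)
    (fun θ _ => h _ (by simp [abs_of_pos hρ]))
  have hp := Real.two_pi_pos
  rw [sub_zero, abs_of_pos hp] at this
  rw [norm_inv, Real.norm_of_nonneg hp.le, inv_mul_le_iff₀ hp]
  linarith

lemma summable_pow_sum {x : ℝ} (hx : 0 ≤ x) (hx1 : x < 1) :
    ∀ n : ℕ, Summable (fun β : Fin n → ℕ => x ^ (∑ i, β i))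
  | 0 => Summable.of_finite
  | n + 1 => by
    rw [← (Fin.consEquiv (fun _ : Fin (n + 1) => ℕ)).summable_iff]
    have := (summable_geometric_of_lt_one hx hx1).mul_of_nonneg (summable_pow_sum hx hx1 n)
      (fun k => by positivity) (fun β => by positivity)
    refine this.congr fun p => ?_
    simp [Fin.consEquiv, Fin.sum_univ_succ, pow_add]

lemma mono_cons (w : ℂ) (z : Cn n) (k : ℕ) (β : Fin n → ℕ) :
    mono (Fin.cons w z : Cn (n + 1)) (Fin.cons k β) = w ^ k * mono z β := by
  simp [mono, Fin.prod_univ_succ]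

lemma norm_mono_le (z : Cn n) {x : ℝ} (hx : ‖z‖ ≤ x) (β : Fin n → ℕ) :
    ‖mono z β‖ ≤ x ^ (∑ i, β i) := by
  rw [mono, norm_prod, ← Finset.prod_pow_eq_pow_sum]
  refine Finset.prod_le_prod (fun i _ => norm_nonneg _) fun i _ => ?_
  rw [norm_pow]
  exact pow_le_pow_left₀ (norm_nonneg _) ((norm_le_pi_norm z i).trans hx) _

lemma summable_mul_mono {a : (Fin n → ℕ) → ℂ} {M ρ : ℝ} (hρ : 0 < ρ)
    (ha : ∀ β, ‖a β‖ * ρ ^ (∑ i, β i) ≤ M) {z : Cn n} (hz : ‖z‖ < ρ) :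
    Summable fun β => ‖a β * mono z β‖ := by
  have hx : ‖z‖ / ρ < 1 := (div_lt_one hρ).2 hz
  refine Summable.of_nonneg_of_le (fun _ => norm_nonneg _) (fun β => ?_)
    ((summable_pow_sum (by positivity : 0 ≤ ‖z‖ / ρ) hx n).mul_left M)
  rw [norm_mul]
  calc ‖a β‖ * ‖mono z β‖ ≤ ‖a β‖ * ‖z‖ ^ (∑ i, β i) := by gcongr; exact norm_mono_le z le_rfl β
    _ = (‖a β‖ * ρ ^ (∑ i, β i)) * (‖z‖ / ρ) ^ (∑ i, β i) := by
      rw [div_pow]; field_simp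
    _ ≤ _ := by gcongr; exact ha β

/-- Bounded holomorphic functions on a polydisc have a power series with Cauchy estimates. -/
theorem exists_powerSeries {R M ρ : ℝ} (hρ : 0 < ρ) (hρR : ρ < R) : ∀ {n : ℕ} {F : Cn n → ℂ},
    DifferentiableOn ℂ F (Metric.ball 0 R) → (∀ z ∈ Metric.ball 0 R, ‖F z‖ ≤ M) →
    ∃ a : (Fin n → ℕ) → ℂ, (∀ β, ‖a β‖ * ρ ^ (∑ i, β i) ≤ M) ∧
      ∀ z ∈ Metric.ball 0 ρ, HasSum (fun β => a β * mono z β) (F z)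
  | 0, F, hF, hM => by
    refine ⟨fun _ => F 0, fun β => ?_, fun z _ => ?_⟩
    · simpa using hM 0 (Metric.mem_ball_self (hρ.trans hρR))
    · have hz : z = 0 := Subsingleton.elim _ _
      subst hz
      simpa only [mono, Finset.univ_eq_empty, Finset.prod_empty, mul_one] using
        hasSum_unique (fun β : Fin 0 → ℕ => F 0 * mono (0 : Cn 0) β)
  | n + 1, F, hF, hM => by
    have hex : ∀ k : ℕ, ∃ a : (Fin n → ℕ) → ℂ,
        (∀ β, ‖a β‖ * ρ ^ (∑ i, β i) ≤ ρ⁻¹ ^ k * M) ∧ ∀ z ∈ Metric.ball (0 : Cn n) ρ,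
        HasSum (fun β => a β * mono z β)
          (Real.circleAverage (fun w => (w⁻¹) ^ k * F (Fin.cons w z)) 0 ρ) := by
      intro k
      refine exists_powerSeries (M := ρ⁻¹ ^ k * M) hρ hρR
        (differentiableOn_circleAverage_cons hρ hρR hF hM k) fun z hz => ?_
      refine norm_circleAverage_le hρ fun w hw => ?_
      rw [norm_mul, norm_pow, norm_inv, hw]
      gcongr
      exact hM _ (cons_mem_ball (by rw [hw]; exact hρR) (by simpa using hz))
    choose a ha hs using hex
    have hbd : ∀ β : Fin (n + 1) → ℕ, ‖a (β 0) (Fin.tail β)‖ * ρ ^ (∑ i, β i) ≤ M := by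
      intro β
      have := ha (β 0) (Fin.tail β)
      rw [Fin.sum_univ_succ, pow_add]
      have h2 := mul_le_mul_of_nonneg_left this (pow_nonneg hρ.le (β 0))
      rw [inv_pow, mul_inv_cancel_left₀ (by positivity)] at h2
      simp only [Fin.tail] at h2 ⊢
      linarith
    refine ⟨fun β => a (β 0) (Fin.tail β), hbd, fun z hz => ?_⟩
    rw [mem_ball_zero_iff] at hz
    have hsum := (summable_mul_mono hρ hbd hz).of_norm
    obtain ⟨w, z', rfl⟩ : ∃ w z', z = (Fin.cons w z' : Cn (n + 1)) :=
      ⟨z 0, Fin.tail z, (Fin.cons_self_tail z).symm⟩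
    have hw : ‖w‖ < ρ := by simpa using (norm_le_pi_norm (Fin.cons w z' : Cn (n + 1)) 0).trans_lt hz
    have hz' : ‖z'‖ < ρ := by
      rw [pi_norm_lt_iff hρ]
      intro i
      simpa using (norm_le_pi_norm (Fin.cons w z' : Cn (n + 1)) i.succ).trans_lt hz
    rw [← (Fin.consEquiv (fun _ : Fin (n + 1) => ℕ)).hasSum_iff]
    rw [← (Fin.consEquiv (fun _ : Fin (n + 1) => ℕ)).summable_iff] at hsum
    have h1 : ∀ k : ℕ, HasSum (fun β' : Fin n → ℕ => ((fun β : Fin (n + 1) → ℕ =>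
        a (β 0) (Fin.tail β) * mono (Fin.cons w z' : Cn (n + 1)) β) ∘
          (Fin.consEquiv (fun _ : Fin (n + 1) => ℕ))) (k, β'))
        (Real.circleAverage (fun y => (y⁻¹) ^ k * F (Fin.cons y z')) 0 ρ * w ^ k) := by
      intro k
      have := (hs k z' (by simpa using hz')).mul_right (w ^ k)
      refine this.congr_fun fun β' => ?_
      simp only [Function.comp, Fin.consEquiv, Equiv.coe_fn_mk, Fin.cons_zero, Fin.tail_cons,
        mono_cons]
      ring
    have h2 := hsum.hasSum.prod_fiberwise h1
    have h3 := hasSum_circleAverage (f := fun y => F (Fin.cons y z')) hρ hρR (by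
      intro y hy
      rw [mem_ball_zero_iff] at hy
      exact ((hF.differentiableAt (Metric.isOpen_ball.mem_nhds
        (cons_mem_ball hy (hz'.trans hρR)))).comp y
          (differentiable_cons_left z' y)).differentiableWithinAt) hw
    rw [← h2.unique h3]
    exact hsum.hasSum

section

/-- The prime attached to the `i`-th variable. -/
def pr (i : ℕ) : ℕ := Nat.nth Nat.Prime i

lemma pr_prime (i : ℕ) : (pr i).Prime := Nat.prime_nth_prime i

lemma pr_inj : Function.Injective pr := Nat.nth_injective Nat.infinite_setOfPred_prime

/-- An injective multiplicative weight on exponents, used to order monomials. -/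
def mw (β : Fin n → ℕ) : ℕ := ∏ i : Fin n, pr i ^ β i

lemma mw_pos (β : Fin n → ℕ) : 0 < mw β :=
  Finset.prod_pos fun i _ => pow_pos (pr_prime i).pos _

lemma mw_add (β γ : Fin n → ℕ) : mw (β + γ) = mw β * mw γ := by
  simp [mw, pow_add, Finset.prod_mul_distrib]

lemma mw_injective : Function.Injective (mw : (Fin n → ℕ) → ℕ) := by
  intro β γ h
  have key : ∀ δ : Fin n → ℕ, ∀ j : Fin n, (mw δ).factorization (pr j) = δ j := by
    intro δ j
    rw [mw, Nat.factorization_prod (fun (i : Fin n) _ => pow_ne_zero (δ i) (pr_prime i).ne_zero)]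
    simp only [(pr_prime _).factorization_pow]
    rw [Finsupp.finsetSum_apply, Finset.sum_eq_single j]
    · simp
    · intro b _ hb
      rw [Finsupp.single_apply, if_neg]
      intro h
      exact hb (Fin.ext (pr_inj h))
    · simp
  funext j
  rw [← key β j, h, key γ j]

/-- The weight of the monomial `z^β` on the polydisc with radii `pᵢ^{-s}`. -/
def wt (s : ℕ) (β : Fin n → ℕ) : ℝ := ((mw β : ℝ) ^ s)⁻¹

lemma wt_pos (s : ℕ) (β : Fin n → ℕ) : 0 < wt s β := by
  have := mw_pos β
  unfold wt; positivity

lemma wt_add (s : ℕ) (β γ : Fin n → ℕ) : wt s (β + γ) = wt s β * wt s γ := by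
  simp [wt, mw_add, mul_pow, mul_comm]

lemma wt_le_pow (s : ℕ) (β : Fin n → ℕ) : wt s β ≤ ((1 / 2 : ℝ) ^ s) ^ (∑ i, β i) := by
  have h : (2 : ℝ) ^ (∑ i, β i) ≤ mw β := by
    rw [mw, ← Finset.prod_pow_eq_pow_sum]
    push_cast
    refine Finset.prod_le_prod (fun i _ => by positivity) fun i _ => ?_
    have := (pr_prime i).two_le
    gcongr
    exact_mod_cast this
  rw [wt, ← pow_mul, mul_comm, pow_mul, div_pow, one_pow, one_div, inv_pow]
  gcongr

/-- Radius of a ball contained in the polydisc with radii `pᵢ^{-s}`. -/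
def rad (n s : ℕ) : ℝ := ((pr n : ℝ) ^ s)⁻¹

lemma rad_pos (n s : ℕ) : 0 < rad n s := by
  have := (pr_prime n).pos
  unfold rad; positivity

lemma norm_mono_le_wt {s : ℕ} {z : Cn n} (hz : ‖z‖ ≤ rad n s) (β : Fin n → ℕ) :
    ‖mono z β‖ ≤ wt s β := by
  have : wt s β = ∏ i : Fin n, (((pr i : ℝ) ^ s)⁻¹) ^ β i := by
    simp only [wt, mw]
    push_cast
    rw [← Finset.prod_pow, ← Finset.prod_inv_distrib]
    refine Finset.prod_congr rfl fun i _ => ?_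
    rw [inv_pow, ← pow_mul, ← pow_mul, mul_comm]
  rw [this, mono, norm_prod]
  refine Finset.prod_le_prod (fun i _ => norm_nonneg _) fun i _ => ?_
  rw [norm_pow]
  refine pow_le_pow_left₀ (norm_nonneg _) ((norm_le_pi_norm z i).trans (hz.trans ?_)) _
  have h1 := (pr_prime i).pos
  have h2 : pr i ≤ pr n := (Nat.nth_strictMono Nat.infinite_setOfPred_prime).monotone i.2.le
  unfold rad
  gcongr

lemma mono_add (z : Cn n) (β γ : Fin n → ℕ) : mono z (β + γ) = mono z β * mono z γ := by
  simp [mono, pow_add, Finset.prod_mul_distrib]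

/-- Absolutely summable families indexed by exponents. -/
abbrev Ell (n : ℕ) : Type := lp (fun _ : Fin n → ℕ => ℂ) 1

lemma Ell.hasSum_norm (f : Ell n) : HasSum (fun β => ‖f β‖) ‖f‖ := by
  simpa using lp.hasSum_norm (p := 1) (by simp) f

/-- Build an element of `Ell` from a summable family. -/
def Ell.mk (a : (Fin n → ℕ) → ℂ) (h : Summable fun β => ‖a β‖) : Ell n :=
  ⟨a, memℓp_gen (by simpa using h)⟩

lemma Ell.norm_mk (a : (Fin n → ℕ) → ℂ) (h : Summable fun β => ‖a β‖) :
    ‖Ell.mk a h‖ = ∑' β, ‖a β‖ := (Ell.hasSum_norm (Ell.mk a h)).tsum_eq.symm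

section sumCLM
variable {Y : Type*} [NormedAddCommGroup Y] [NormedSpace ℂ Y]

lemma Ell.summable_smul (c : (Fin n → ℕ) → Y) {K : ℝ} (hc : ∀ β, ‖c β‖ ≤ K) (f : Ell n) :
    Summable fun β => ‖f β • c β‖ := by
  refine Summable.of_nonneg_of_le (fun _ => norm_nonneg _) (fun β => ?_)
    ((Ell.hasSum_norm f).summable.mul_right K)
  rw [norm_smul]; gcongr; exact hc β

variable [CompleteSpace Y]

/-- The continuous linear map on `Ell` sending the `β`-th unit vector to `c β`. -/
def Ell.sumCLM (c : (Fin n → ℕ) → Y) (K : ℝ) (hc : ∀ β, ‖c β‖ ≤ K) : Ell n →L[ℂ] Y :=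
  LinearMap.mkContinuous
    { toFun := fun f => ∑' β, f β • c β
      map_add' := fun f g => by
        rw [← (Ell.summable_smul c hc f).of_norm.tsum_add (Ell.summable_smul c hc g).of_norm]
        simp [add_smul]
      map_smul' := fun t f => by
        rw [RingHom.id_apply, ← (Ell.summable_smul c hc f).of_norm.tsum_const_smul]
        simp [mul_smul] } K (fun f => by
    refine (norm_tsum_le_tsum_norm (Ell.summable_smul c hc f)).trans ?_
    rw [← (Ell.hasSum_norm f).tsum_eq, ← tsum_mul_left]
    refine (Ell.summable_smul c hc f).tsum_le_tsum (fun β => ?_)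
      ((Ell.hasSum_norm f).summable.mul_left K)
    rw [norm_smul, mul_comm]; gcongr; exact hc β)

lemma Ell.sumCLM_apply (c : (Fin n → ℕ) → Y) (K : ℝ) (hc : ∀ β, ‖c β‖ ≤ K) (f : Ell n) :
    Ell.sumCLM c K hc f = ∑' β, f β • c β := rfl

lemma Ell.norm_sumCLM_le (c : (Fin n → ℕ) → Y) (K : ℝ) (hK : 0 ≤ K) (hc : ∀ β, ‖c β‖ ≤ K) :
    ‖Ell.sumCLM c K hc‖ ≤ K := LinearMap.mkContinuous_norm_le _ hK _

end sumCLM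

/-- Evaluation of a normalised power series at a point. -/
def evz (s : ℕ) (z : Cn n) (hz : ‖z‖ ≤ rad n s) : Ell n →L[ℂ] ℂ :=
  Ell.sumCLM (fun β => mono z β / (wt s β : ℂ)) 1 (fun β => by
    rw [norm_div, Complex.norm_real, Real.norm_of_nonneg (wt_pos s β).le]
    exact div_le_one_of_le₀ (norm_mono_le_wt hz β) (wt_pos s β).le)

/-- The sum of a power series. -/
def ev (a : (Fin n → ℕ) → ℂ) (z : Cn n) : ℂ := ∑' β, a β * mono z β

lemma evz_apply (s : ℕ) (z : Cn n) (hz : ‖z‖ ≤ rad n s) (f : Ell n) :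
    evz s z hz f = ev (fun β => f β / (wt s β : ℂ)) z := by
  rw [evz, Ell.sumCLM_apply, ev]
  congr 1; funext β; rw [smul_eq_mul]; ring

/-- Summability at the `s`-th polyradius. -/
def ConvAt (s : ℕ) (a : (Fin n → ℕ) → ℂ) : Prop := Summable fun β => ‖a β‖ * wt s β

lemma wt_anti {s t : ℕ} (h : s ≤ t) (β : Fin n → ℕ) : wt t β ≤ wt s β := by
  have h1 : (1 : ℝ) ≤ mw β := by exact_mod_cast mw_pos β
  have h0 : (0 : ℝ) < mw β := by linarith
  unfold wt
  gcongr

lemma ConvAt.mono {s t : ℕ} (h : s ≤ t) {a : (Fin n → ℕ) → ℂ} (ha : ConvAt s a) : ConvAt t a :=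
  Summable.of_nonneg_of_le (fun β => mul_nonneg (norm_nonneg _) (wt_pos t β).le)
    (fun β => mul_le_mul_of_nonneg_left (wt_anti h β) (norm_nonneg _)) ha

open Classical in
/-- Multiplication of a power series by the monomial `z^δ`. -/
def shiftBy (δ : Fin n → ℕ) (a : (Fin n → ℕ) → ℂ) (γ : Fin n → ℕ) : ℂ :=
  if δ ≤ γ then a (γ - δ) else 0

lemma shiftBy_add (δ : Fin n → ℕ) (a : (Fin n → ℕ) → ℂ) (γ : Fin n → ℕ) :
    shiftBy δ a (γ + δ) = a γ := by
  rw [shiftBy, if_pos (le_add_of_nonneg_left (by positivity)), add_tsub_cancel_right]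

lemma shiftBy_eq_zero {δ : Fin n → ℕ} {a : (Fin n → ℕ) → ℂ} {γ : Fin n → ℕ}
    (h : γ ∉ Set.range (fun x : Fin n → ℕ => x + δ)) : shiftBy δ a γ = 0 := by
  rw [shiftBy, if_neg]
  intro h'
  exact h ⟨γ - δ, tsub_add_cancel_of_le h'⟩

lemma add_right_inj_fun (δ : Fin n → ℕ) : Function.Injective (fun x : Fin n → ℕ => x + δ) :=
  fun _ _ h => add_right_cancel h

lemma ev_shiftBy (δ : Fin n → ℕ) (a : (Fin n → ℕ) → ℂ) (z : Cn n) :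
    ev (shiftBy δ a) z = mono z δ * ev a z := by
  rw [ev, ev, ← tsum_mul_left, ← (add_right_inj_fun δ).tsum_eq (f := fun β => shiftBy δ a β * mono z β)]
  · congr 1; funext β
    rw [shiftBy_add, mono_add]; ring
  · intro γ hγ
    by_contra hc
    exact hγ (by simp [shiftBy_eq_zero hc])

lemma convAt_shiftBy {s : ℕ} (δ : Fin n → ℕ) {a : (Fin n → ℕ) → ℂ} (ha : ConvAt s a) :
    ConvAt s (shiftBy δ a) := by
  unfold ConvAt
  rw [← (add_right_inj_fun δ).summable_iff (fun γ hγ => by simp [shiftBy_eq_zero hγ])]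
  refine (Summable.mul_right (wt s δ) ha).congr fun β => ?_
  simp only [Function.comp, shiftBy_add, wt_add]; ring

lemma continuousOn_tsum_mono {ι : Type*} {s : ℕ} (c : ι → ℂ) (e : ι → Fin n → ℕ)
    (h : Summable fun i => ‖c i‖ * wt s (e i)) :
    ContinuousOn (fun z : Cn n => ∑' i, c i * mono z (e i)) (Metric.ball 0 (rad n s)) := by
  refine continuousOn_tsum (u := fun i => ‖c i‖ * wt s (e i)) (fun i => ?_) h fun i z hz => ?_
  · unfold mono; fun_prop
  · rw [norm_mul]
    gcongr
    exact norm_mono_le_wt (by simpa using (mem_ball_zero_iff.1 hz).le) _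

end

lemma tsum_shiftBy (s : ℕ) (δ : Fin n → ℕ) (a : (Fin n → ℕ) → ℂ) :
    ∑' γ, ‖shiftBy δ a γ‖ * wt s γ = wt s δ * ∑' γ, ‖a γ‖ * wt s γ := by
  rw [← tsum_mul_left, ← (add_right_inj_fun δ).tsum_eq (f := fun γ => ‖shiftBy δ a γ‖ * wt s γ)]
  · congr 1; funext β
    rw [shiftBy_add, wt_add]; ring
  · intro γ hγ
    by_contra hc
    exact hγ (by simp [shiftBy_eq_zero hc])

lemma eventually_tail_small {s₀ : ℕ} {h : (Fin n → ℕ) → ℂ} (hh : ConvAt s₀ h) (α : Fin n → ℕ)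
    (hα : ∀ γ, h γ ≠ 0 → mw α < mw γ) :
    ∀ᶠ s in atTop, (∑' γ, ‖h γ‖ * wt s γ) / wt s α ≤ 1 / 2 := by
  set q : ℝ := (mw α : ℝ) / (mw α + 1) with hq
  have hpos : (0 : ℝ) < mw α := by exact_mod_cast mw_pos α
  have hq0 : 0 ≤ q := by positivity
  have hq1 : q < 1 := by rw [hq, div_lt_one (by positivity)]; linarith
  have hlim : Tendsto (fun t : ℕ => q ^ t * ((∑' γ, ‖h γ‖ * wt s₀ γ) / wt s₀ α)) atTop (𝓝 0) := by
    simpa using (tendsto_pow_atTop_nhds_zero_of_lt_one hq0 hq1).mul_const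
      ((∑' γ, ‖h γ‖ * wt s₀ γ) / wt s₀ α)
  have hev := hlim.eventually (Iic_mem_nhds (show (0 : ℝ) < 1 / 2 by norm_num))
  rw [eventually_atTop] at hev ⊢
  obtain ⟨T, hT⟩ := hev
  refine ⟨s₀ + T, fun s hs => ?_⟩
  obtain ⟨t, rfl⟩ := Nat.exists_eq_add_of_le (show s₀ ≤ s by omega)
  refine le_trans ?_ (hT t (by omega))
  have hterm : ∀ γ, ‖h γ‖ * wt (s₀ + t) γ ≤
      (q ^ t * (wt (s₀ + t) α / wt s₀ α)) * (‖h γ‖ * wt s₀ γ) := by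
    intro γ
    by_cases h0 : h γ = 0
    · simp [h0]
    have hg := hα γ h0
    have hγ : (0 : ℝ) < mw γ := by exact_mod_cast mw_pos γ
    have hg' : (mw α : ℝ) + 1 ≤ mw γ := by exact_mod_cast hg
    have e1 : wt (s₀ + t) α / wt s₀ α = ((mw α : ℝ) ^ t)⁻¹ := by
      unfold wt; rw [pow_add]; field_simp
    have e2 : wt (s₀ + t) γ = wt s₀ γ * ((mw γ : ℝ) ^ t)⁻¹ := by
      unfold wt; rw [pow_add, mul_inv]
    have e3 : ((mw γ : ℝ) ^ t)⁻¹ ≤ q ^ t * ((mw α : ℝ) ^ t)⁻¹ := by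
      rw [hq, div_pow, div_mul_eq_mul_div, mul_inv_cancel₀ (by positivity), one_div]
      gcongr
    rw [e1, e2]
    have := mul_le_mul_of_nonneg_left e3 (mul_nonneg (norm_nonneg (h γ)) (wt_pos s₀ γ).le)
    linarith
  have hsum := (hh.mono (Nat.le_add_right s₀ t)).tsum_le_tsum hterm (hh.mul_left _)
  rw [tsum_mul_left] at hsum
  rw [div_le_iff₀ (wt_pos _ _)]
  refine hsum.trans_eq ?_
  ring

/-- A class of germs that is an ideal under multiplication by continuous functions. -/
structure GermIdeal (P : (Cn n → ℂ) → Prop) : Prop where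
  zero : P 0
  add : ∀ f g, P f → P g → P (f + g)
  congr : ∀ f g, f =ᶠ[𝓝 0] g → P f → P g
  mul : ∀ h f, (∃ r > 0, ContinuousOn h (Metric.ball 0 r)) → P f → P (fun z => h z * f z)

lemma GermIdeal.sum {P : (Cn n → ℂ) → Prop} (hP : GermIdeal P) {ι : Type*} (t : Finset ι)
    (f : ι → Cn n → ℂ) (h : ∀ i ∈ t, P (f i)) : P (fun z => ∑ i ∈ t, f i z) := by
  classical
  induction t using Finset.induction_on with
  | empty => exact hP.congr _ _ (Eventually.of_forall fun z => by simp) hP.zero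
  | insert a t ha ih =>
    have := hP.add _ _ (h a (Finset.mem_insert_self a t))
      (ih fun i hi => h i (Finset.mem_insert_of_mem hi))
    refine hP.congr _ _ (Eventually.of_forall fun z => ?_) this
    simp [Finset.sum_insert ha]

/-- `a` is a convergent series in the ideal with leading exponent `α` and leading coefficient 1. -/
structure IsLead (P : (Cn n → ℂ) → Prop) (α : Fin n → ℕ) (a : (Fin n → ℕ) → ℂ) : Prop where
  conv : ∃ s, ConvAt s a
  mem : P (ev a)
  one : a α = 1
  lt : ∀ γ, γ ≠ α → a γ ≠ 0 → mw α < mw γ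

lemma convAt_const_mul {s : ℕ} {a : (Fin n → ℕ) → ℂ} (c : ℂ) (h : ConvAt s a) :
    ConvAt s (fun β => c * a β) := by
  refine (Summable.mul_left ‖c‖ h).congr fun β => ?_
  rw [norm_mul]; ring

/-- Every nonzero convergent series in the ideal has a leading exponent. -/
lemma exists_isLead {P : (Cn n → ℂ) → Prop} (hP : GermIdeal P) {s : ℕ} {r : (Fin n → ℕ) → ℂ}
    (hr : ConvAt s r) (hPr : P (ev r)) (hne : r ≠ 0) : ∃ α a, r α ≠ 0 ∧ IsLead P α a := by
  have hex : ∃ β, r β ≠ 0 := by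
    by_contra h; push Not at h; exact hne (funext h)
  obtain ⟨α, hα, hmin⟩ := exists_minimalFor_of_wellFoundedLT (fun β => r β ≠ 0) mw hex
  refine ⟨α, fun β => (r α)⁻¹ * r β, hα, ⟨s, convAt_const_mul _ hr⟩, ?_, inv_mul_cancel₀ hα, ?_⟩
  · refine hP.congr _ _ (Eventually.of_forall fun z => ?_)
      (hP.mul (fun _ => (r α)⁻¹) _ ⟨1, one_pos, continuousOn_const⟩ hPr)
    simp only [ev, ← tsum_mul_left, mul_assoc]
  · intro γ hγ h0
    have h1 : r γ ≠ 0 := right_ne_zero_of_mul h0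
    rcases le_total (mw γ) (mw α) with h | h
    · exact lt_of_le_of_ne (hmin h1 h) fun h => hγ (mw_injective h.symm)
    · exact lt_of_le_of_ne h fun h => hγ (mw_injective h.symm)

open Classical in
/-- The part of a series after its leading term. -/
def tail (α : Fin n → ℕ) (a : (Fin n → ℕ) → ℂ) (γ : Fin n → ℕ) : ℂ := if γ = α then 0 else a γ

lemma norm_tail_le (α : Fin n → ℕ) (a : (Fin n → ℕ) → ℂ) (γ : Fin n → ℕ) :
    ‖tail α a γ‖ ≤ ‖a γ‖ := by
  unfold tail; split_ifs <;> simp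

lemma convAt_tail {s : ℕ} (α : Fin n → ℕ) {a : (Fin n → ℕ) → ℂ} (h : ConvAt s a) :
    ConvAt s (tail α a) :=
  Summable.of_nonneg_of_le (fun β => mul_nonneg (norm_nonneg _) (wt_pos s β).le)
    (fun β => mul_le_mul_of_nonneg_right (norm_tail_le α a β) (wt_pos s β).le) h

lemma convAt_summable {s : ℕ} {a : (Fin n → ℕ) → ℂ} (h : ConvAt s a) {z : Cn n}
    (hz : ‖z‖ ≤ rad n s) : Summable fun β => a β * mono z β := by
  refine Summable.of_norm (Summable.of_nonneg_of_le (fun _ => norm_nonneg _) (fun β => ?_) h)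
  rw [norm_mul]; gcongr; exact norm_mono_le_wt hz β

lemma ev_tail {s : ℕ} {α : Fin n → ℕ} {a : (Fin n → ℕ) → ℂ} (h : ConvAt s a) (h1 : a α = 1)
    {z : Cn n} (hz : ‖z‖ ≤ rad n s) : ev (tail α a) z = ev a z - mono z α := by
  classical
  rw [eq_sub_iff_add_eq, ev, ev]
  have e : mono z α = ∑' β, (if β = α then mono z α else 0) := (tsum_ite_eq α (fun _ => mono z α)).symm
  rw [e, ← (convAt_summable (convAt_tail α h) hz).tsum_add ((hasSum_ite_eq α (mono z α)).summable)]
  congr 1; funext β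
  unfold tail
  split_ifs with hb
  · rw [hb, h1]; ring
  · ring

/-- Division with remainder by a class of germs: for every large `s` there is an automorphism of
`Ell` which identifies the ideal with the series supported on the leading exponents. -/
lemma exists_division {P : (Cn n → ℂ) → Prop} (hP : GermIdeal P) :
    ∃ S : Set (Fin n → ℕ), ∀ᶠ s in atTop, ∃ A : (Ell n →L[ℂ] Ell n)ˣ, ∀ f : Ell n,
      P (ev fun β => (A : Ell n →L[ℂ] Ell n) f β / (wt s β : ℂ)) ↔ ∀ β ∉ S, f β = 0 := by
  classical
  set S : Set (Fin n → ℕ) := {α | ∃ a, IsLead P α a} with hS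
  set M₀ : Set (Fin n → ℕ) := {α | Minimal (· ∈ S) α} with hM₀
  have hfin : M₀.Finite := WellQuasiOrderedLE.finite_of_isAntichain (setOfPred_minimal_antichain _)
  have hlead : ∀ α : Fin n → ℕ, ∃ a, α ∈ S → IsLead P α a := fun α => by
    by_cases h : α ∈ S
    · obtain ⟨a, ha⟩ := h; exact ⟨a, fun _ => ha⟩
    · exact ⟨0, fun h' => absurd h' h⟩
  choose g hg using hlead
  have hmin : ∀ β : Fin n → ℕ, ∃ α, β ∈ S → α ∈ M₀ ∧ α ≤ β := fun β => by
    by_cases h : β ∈ S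
    · obtain ⟨α, h1, h2⟩ := exists_minimal_le_of_wellFoundedLT (· ∈ S) β h
      exact ⟨α, fun _ => ⟨h2, h1⟩⟩
    · exact ⟨0, fun h' => absurd h' h⟩
  choose m hm using hmin
  refine ⟨S, ?_⟩
  have hev1 : ∀ᶠ s in atTop, ∀ α ∈ M₀, ConvAt s (g α) := by
    rw [eventually_all_finite hfin]
    intro α hα
    obtain ⟨s, hs⟩ := (hg α hα.1).conv
    filter_upwards [eventually_ge_atTop s] with t ht using hs.mono ht
  have hev2 : ∀ᶠ s in atTop, ∀ α ∈ M₀, (∑' γ, ‖tail α (g α) γ‖ * wt s γ) / wt s α ≤ 1 / 2 := by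
    rw [eventually_all_finite hfin]
    intro α hα
    obtain ⟨s, hs⟩ := (hg α hα.1).conv
    refine eventually_tail_small (convAt_tail α hs) α fun γ hγ => ?_
    unfold tail at hγ
    split_ifs at hγ with h
    · exact absurd rfl hγ
    · exact (hg α hα.1).lt γ h hγ
  filter_upwards [hev1, hev2] with s hs1 hs2
  have hsumτ : ∀ β ∈ S, Summable fun γ =>
      ‖shiftBy (β - m β) (tail (m β) (g (m β))) γ * (wt s γ : ℂ) / (wt s β : ℂ)‖ := by
    intro β hβ
    have := (convAt_shiftBy (β - m β) (convAt_tail (m β) (hs1 _ (hm β hβ).1))).div_const (wt s β)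
    refine this.congr fun γ => ?_
    rw [norm_div, norm_mul, Complex.norm_real, Complex.norm_real,
      Real.norm_of_nonneg (wt_pos s γ).le, Real.norm_of_nonneg (wt_pos s β).le]
  set τ : (Fin n → ℕ) → Ell n := fun β => if h : β ∈ S then Ell.mk _ (hsumτ β h) else 0 with hτ
  have hτn : ∀ β, ‖τ β‖ ≤ 1 / 2 := by
    intro β
    by_cases hβ : β ∈ S
    · simp only [hτ, dif_pos hβ]
      rw [Ell.norm_mk]
      simp only [norm_div, norm_mul, Complex.norm_real, Real.norm_of_nonneg (wt_pos s _).le]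
      rw [tsum_div_const, tsum_shiftBy]
      refine le_trans (le_of_eq ?_) (hs2 _ (hm β hβ).1)
      have e : wt s β = wt s (β - m β) * wt s (m β) := by
        rw [← wt_add, tsub_add_cancel_of_le (hm β hβ).2]
      rw [e, mul_div_mul_left _ _ (wt_pos s _).ne']
    · simp only [hτ, dif_neg hβ]; norm_num
  set T : Ell n →L[ℂ] Ell n := Ell.sumCLM τ (1 / 2) hτn with hT
  have hTn : ‖-T‖ < 1 := by
    rw [norm_neg]
    exact (Ell.norm_sumCLM_le τ (1 / 2) (by norm_num) hτn).trans_lt (by norm_num)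
  refine ⟨Units.oneSub (-T) hTn, fun f => ?_⟩
  have hq : ∀ α ∈ M₀, Summable fun β : Fin n → ℕ =>
      ‖if β ∈ S ∧ m β = α then f β / (wt s β : ℂ) else 0‖ * wt s (β - α) := by
    intro α hα
    refine Summable.of_nonneg_of_le (fun β => mul_nonneg (norm_nonneg _) (wt_pos _ _).le)
      (fun β => ?_) ((Ell.hasSum_norm f).summable.div_const (wt s α))
    split_ifs with h
    · rw [norm_div, Complex.norm_real, Real.norm_of_nonneg (wt_pos s β).le]
      have e : wt s β = wt s (β - α) * wt s α := by
        rw [← wt_add, tsub_add_cancel_of_le (h.2 ▸ (hm β h.1).2)]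
      have h1 := wt_pos s (β - α)
      have h2 := wt_pos s α
      rw [e]; apply le_of_eq; field_simp
    · rw [norm_zero, zero_mul]; exact div_nonneg (norm_nonneg _) (wt_pos _ _).le
  set r : (Fin n → ℕ) → ℂ := fun β => if β ∈ S then 0 else f β / (wt s β : ℂ) with hr
  have hrc : ConvAt s r := by
    refine Summable.of_nonneg_of_le (fun β => mul_nonneg (norm_nonneg _) (wt_pos s β).le)
      (fun β => ?_) (Ell.hasSum_norm f).summable
    simp only [hr]
    split_ifs with h
    · simp
    · rw [norm_div, Complex.norm_real, Real.norm_of_nonneg (wt_pos s β).le,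
        div_mul_cancel₀ _ (wt_pos s β).ne']
  have hdec : ∀ z : Cn n, ‖z‖ ≤ rad n s →
      ev (fun β => ((Units.oneSub (-T) hTn : (Ell n →L[ℂ] Ell n)ˣ) : Ell n →L[ℂ] Ell n) f β
        / (wt s β : ℂ)) z =
      (∑ α ∈ hfin.toFinset, (∑' β : Fin n → ℕ,
        (if β ∈ S ∧ m β = α then f β / (wt s β : ℂ) else 0) * mono z (β - α)) * ev (g α) z)
        + ev r z := by
    intro z hz
    rw [← evz_apply s z hz]
    have e1 : ((Units.oneSub (-T) hTn : (Ell n →L[ℂ] Ell n)ˣ) : Ell n →L[ℂ] Ell n) f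
        = f + T f := by simp
    rw [e1, map_add, evz_apply, hT, Ell.sumCLM_apply,
      ContinuousLinearMap.map_tsum _ (Ell.summable_smul τ hτn f).of_norm]
    have e2 : ∀ α ∈ hfin.toFinset, (∑' β : Fin n → ℕ,
        (if β ∈ S ∧ m β = α then f β / (wt s β : ℂ) else 0) * mono z (β - α)) * ev (g α) z
        = ∑' β : Fin n → ℕ, (if β ∈ S ∧ m β = α then f β / (wt s β : ℂ) else 0)
          * mono z (β - α) * ev (g α) z := fun α _ => tsum_mul_right.symm
    have hsm : ∀ α ∈ hfin.toFinset, Summable fun β : Fin n → ℕ =>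
        (if β ∈ S ∧ m β = α then f β / (wt s β : ℂ) else 0) * mono z (β - α) * ev (g α) z := by
      intro α hα
      refine Summable.mul_right _ (Summable.of_norm (Summable.of_nonneg_of_le
        (fun _ => norm_nonneg _) (fun β => ?_) (hq α (hfin.mem_toFinset.1 hα))))
      rw [norm_mul]; gcongr; exact norm_mono_le_wt hz _
    rw [Finset.sum_congr rfl e2, ← Summable.tsum_finsetSum hsm, ev, ev,
      ← (summable_sum hsm).tsum_add (convAt_summable hrc hz)]
    have hs3 : Summable fun β => f β / (wt s β : ℂ) * mono z β := by
      refine ((Ell.summable_smul (K := 1) (fun β => mono z β / (wt s β : ℂ)) (fun β => ?_) f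
        ).of_norm).congr fun β => by rw [smul_eq_mul]; ring
      rw [norm_div, Complex.norm_real, Real.norm_of_nonneg (wt_pos s β).le]
      exact div_le_one_of_le₀ (norm_mono_le_wt hz β) (wt_pos s β).le
    have hs4 : Summable fun β => (evz s z hz) (f β • τ β) :=
      ((Ell.summable_smul τ hτn f).of_norm.hasSum.mapL (evz s z hz)).summable
    rw [← hs3.tsum_add hs4]
    congr 1; funext β
    rw [map_smul, smul_eq_mul]
    by_cases hβ : β ∈ S
    · have e3 : evz s z hz (τ β) = mono z (β - m β) * (ev (g (m β)) z - mono z (m β))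
          / (wt s β : ℂ) := by
        rw [evz_apply, ← ev_tail (hs1 _ (hm β hβ).1) (hg _ (hm β hβ).1.1).one hz, ← ev_shiftBy,
          ev, ev, ← tsum_div_const]
        congr 1; funext γ
        simp only [hτ, dif_pos hβ, Ell.mk]
        have := wt_pos s γ
        have h' : (wt s γ : ℂ) ≠ 0 := by exact_mod_cast this.ne'
        field_simp
      rw [e3, Finset.sum_eq_single (m β)]
      · have e4 : mono z β = mono z (β - m β) * mono z (m β) := by
          rw [← mono_add, tsub_add_cancel_of_le (hm β hβ).2]
        simp only [hβ, true_and, if_true, hr, e4]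
        ring
      · intro α _ hα
        rw [if_neg (fun h => hα h.2.symm)]; ring
      · intro h
        exact absurd (hfin.mem_toFinset.2 (hm β hβ).1) h
    · have e3 : evz s z hz (τ β) = 0 := by simp only [hτ, dif_neg hβ, map_zero]
      rw [e3, Finset.sum_eq_zero]
      · simp [hr, hβ]
      · intro α _
        rw [if_neg (fun h => hβ h.1)]; ring
  have hPG : P (fun z => ∑ α ∈ hfin.toFinset, (∑' β : Fin n → ℕ,
        (if β ∈ S ∧ m β = α then f β / (wt s β : ℂ) else 0) * mono z (β - α)) * ev (g α) z) := by
    refine hP.sum _ _ fun α hα => hP.mul _ _ ⟨rad n s, rad_pos n s, ?_⟩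
      (hg α (hfin.mem_toFinset.1 hα).1).mem
    exact continuousOn_tsum_mono _ _ (hq α (hfin.mem_toFinset.1 hα))
  have hball : ∀ᶠ z in 𝓝 (0 : Cn n), ‖z‖ ≤ rad n s := by
    filter_upwards [Metric.ball_mem_nhds (0 : Cn n) (rad_pos n s)] with z hz
    exact (mem_ball_zero_iff.1 hz).le
  constructor
  · intro hA
    have hPr : P (ev r) := by
      refine hP.congr _ _ ?_ (hP.add _ _ hA (hP.mul (fun _ => -1) _
        ⟨1, one_pos, continuousOn_const⟩ hPG))
      filter_upwards [hball] with z hz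
      rw [Pi.add_apply, hdec z hz]; ring
    have hr0 : r = 0 := by
      by_contra hne
      obtain ⟨α, a, h1, h2⟩ := exists_isLead hP hrc hPr hne
      exact h1 (if_pos ⟨a, h2⟩)
    intro β hβ
    have := congrFun hr0 β
    simp only [hr, if_neg hβ, Pi.zero_apply] at this
    have h' : (wt s β : ℂ) ≠ 0 := by exact_mod_cast (wt_pos s β).ne'
    exact (div_eq_zero_iff.1 this).resolve_right h'
  · intro h0
    have hr0 : r = 0 := by
      funext β
      simp only [hr]
      split_ifs with h
      · rfl
      · simp [h0 β h]
    refine hP.congr _ _ ?_ hPG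
    filter_upwards [hball] with z hz
    rw [hdec z hz, hr0]; simp [ev]

/-- Germ ideals are closed under uniform convergence on a fixed polydisc. -/
theorem GermIdeal.closed {P : (Cn n → ℂ) → Prop} (hP : GermIdeal P) {R : ℝ} (hR : 0 < R)
    {F : Cn n → ℂ} {G : ℕ → Cn n → ℂ} {M : ℝ} {ε : ℕ → ℝ} (hε : Tendsto ε atTop (𝓝 0))
    (hF : DifferentiableOn ℂ F (Metric.ball 0 R)) (hM : ∀ z ∈ Metric.ball 0 R, ‖F z‖ ≤ M)
    (hG : ∀ k, DifferentiableOn ℂ (G k) (Metric.ball 0 R))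
    (hGF : ∀ k, ∀ z ∈ Metric.ball 0 R, ‖G k z - F z‖ ≤ ε k) (hPG : ∀ k, P (G k)) : P F := by
  have hρ : 0 < R / 2 := by positivity
  have hρR : R / 2 < R := by linarith
  obtain ⟨a, ha, hsa⟩ := exists_powerSeries hρ hρR hF hM
  choose b hb hsb using fun k => exists_powerSeries hρ hρR ((hG k).sub hF) (hGF k)
  obtain ⟨S, hS⟩ := exists_division hP
  have hlim : Tendsto (fun s : ℕ => (1 / 2 : ℝ) ^ s) atTop (𝓝 0) :=
    tendsto_pow_atTop_nhds_zero_of_lt_one (by norm_num) (by norm_num)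
  obtain ⟨s, ⟨A, hA⟩, hs⟩ := (hS.and (hlim.eventually (Iio_mem_nhds
    (show (0 : ℝ) < R / 2 / 2 by positivity)))).exists
  replace hs : (1 / 2 : ℝ) ^ s < R / 2 / 2 := hs
  set C : ℝ := ∑' β : Fin n → ℕ, (1 / 2 : ℝ) ^ (∑ i, β i) with hC
  have hCs : Summable fun β : Fin n → ℕ => (1 / 2 : ℝ) ^ (∑ i, β i) :=
    summable_pow_sum (by norm_num) (by norm_num) n
  have hbound : ∀ (c : (Fin n → ℕ) → ℂ) (M : ℝ), (∀ β, ‖c β‖ * (R / 2) ^ (∑ i, β i) ≤ M) →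
      ∀ β, ‖c β * (wt s β : ℂ)‖ ≤ M * (1 / 2 : ℝ) ^ (∑ i, β i) := by
    intro c M hc β
    rw [norm_mul, Complex.norm_real, Real.norm_of_nonneg (wt_pos s β).le]
    calc ‖c β‖ * wt s β ≤ ‖c β‖ * ((R / 2) * (1 / 2)) ^ (∑ i, β i) := by
          gcongr
          exact (wt_le_pow s β).trans (by gcongr; linarith)
      _ = (‖c β‖ * (R / 2) ^ (∑ i, β i)) * (1 / 2 : ℝ) ^ (∑ i, β i) := by rw [mul_pow]; ring
      _ ≤ _ := by gcongr; exact hc β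
  have hsumm : ∀ (c : (Fin n → ℕ) → ℂ) (M : ℝ), (∀ β, ‖c β‖ * (R / 2) ^ (∑ i, β i) ≤ M) →
      Summable fun β => ‖c β * (wt s β : ℂ)‖ := fun c M hc =>
    Summable.of_nonneg_of_le (fun _ => norm_nonneg _) (hbound c M hc) (hCs.mul_left M)
  set x : Ell n := Ell.mk _ (hsumm a M ha) with hx
  set y : ℕ → Ell n := fun k => Ell.mk _ (hsumm (b k) (ε k) (hb k)) with hy
  have hyn : ∀ k, ‖y k‖ ≤ ε k * C := by
    intro k
    rw [hy, Ell.norm_mk, hC, ← tsum_mul_left]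
    exact (hsumm (b k) (ε k) (hb k)).tsum_le_tsum (hbound (b k) (ε k) (hb k)) (hCs.mul_left _)
  have hy0 : Tendsto y atTop (𝓝 0) := by
    rw [tendsto_zero_iff_norm_tendsto_zero]
    refine squeeze_zero (fun _ => norm_nonneg _) hyn ?_
    simpa using hε.mul_const C
  have hwt : ∀ β : Fin n → ℕ, (wt s β : ℂ) ≠ 0 := fun β => by exact_mod_cast (wt_pos s β).ne'
  have hAinv : ∀ v : Ell n, (A : Ell n →L[ℂ] Ell n) (((A⁻¹ : (Ell n →L[ℂ] Ell n)ˣ) :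
      Ell n →L[ℂ] Ell n) v) = v := fun v =>
    DFunLike.congr_fun A.mul_inv v
  have hball : ∀ᶠ z in 𝓝 (0 : Cn n), z ∈ Metric.ball (0 : Cn n) (R / 2) :=
    Metric.ball_mem_nhds _ hρ
  have hevF : (ev fun β => x β / (wt s β : ℂ)) =ᶠ[𝓝 0] F := by
    filter_upwards [hball] with z hz
    rw [← (hsa z hz).tsum_eq, ev]
    congr 1; funext β
    simp only [hx, Ell.mk]
    rw [mul_div_cancel_right₀ _ (hwt β)]
  have hevG : ∀ k, (ev fun β => (x + y k) β / (wt s β : ℂ)) =ᶠ[𝓝 0] G k := by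
    intro k
    filter_upwards [hball] with z hz
    have := (hsa z hz).add (hsb k z hz)
    simp only [Pi.sub_apply, add_sub_cancel] at this
    rw [← this.tsum_eq, ev]
    congr 1; funext β
    have e : (x + y k) β = a β * (wt s β : ℂ) + b k β * (wt s β : ℂ) := rfl
    rw [e, ← add_mul, mul_div_cancel_right₀ _ (hwt β)]; ring
  have hfk : ∀ k, ∀ β ∉ S, (((A⁻¹ : (Ell n →L[ℂ] Ell n)ˣ) : Ell n →L[ℂ] Ell n) (x + y k)) β = 0 := by
    intro k
    rw [← hA, hAinv]
    exact hP.congr _ _ (hevG k).symm (hPG k)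
  have hf : ∀ β ∉ S, (((A⁻¹ : (Ell n →L[ℂ] Ell n)ˣ) : Ell n →L[ℂ] Ell n) x) β = 0 := by
    intro β hβ
    have ht : Tendsto (fun k => ((A⁻¹ : (Ell n →L[ℂ] Ell n)ˣ) : Ell n →L[ℂ] Ell n) (x + y k)) atTop
        (𝓝 (((A⁻¹ : (Ell n →L[ℂ] Ell n)ˣ) : Ell n →L[ℂ] Ell n) (x + 0))) :=
      (ContinuousLinearMap.continuous _).continuousAt.tendsto.comp (tendsto_const_nhds.add hy0)
    rw [add_zero] at ht
    have ht2 : Tendsto (fun k => (((A⁻¹ : (Ell n →L[ℂ] Ell n)ˣ) : Ell n →L[ℂ] Ell n) (x + y k)) β)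
        atTop (𝓝 ((((A⁻¹ : (Ell n →L[ℂ] Ell n)ˣ) : Ell n →L[ℂ] Ell n) x) β)) :=
      ((lp.uniformContinuous_coe (E := fun _ : Fin n → ℕ => ℂ) (p := 1)).continuous.tendsto _
        |>.comp ht).apply_nhds β
    refine tendsto_nhds_unique ht2 ?_
    simp only [hfk _ β hβ]
    exact tendsto_const_nhds
  rw [← hA, hAinv] at hf
  exact hP.congr _ _ hevF hf

section

/-- The squared Euclidean norm on `ℂⁿ`. -/
def nsq (z : Cn n) : ℝ := ∑ i, Complex.normSq (z i)

lemma nsq_nonneg (z : Cn n) : 0 ≤ nsq z := Finset.sum_nonneg fun _ _ => Complex.normSq_nonneg _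

lemma contDiff_nsq : ContDiff ℝ (⊤ : ℕ∞) (nsq : Cn n → ℝ) := by
  unfold nsq
  refine ContDiff.sum fun i _ => ?_
  have h : ContDiff ℝ (⊤ : ℕ∞) (fun z : Cn n => z i) := contDiff_apply ℝ ℂ i
  simp only [Complex.normSq_apply]
  have hre := Complex.reCLM.contDiff.comp h
  have him := Complex.imCLM.contDiff.comp h
  exact (hre.mul hre).add (him.mul him)

lemma nsq_smul (c : ℂ) (z : Cn n) : nsq (c • z) = ‖c‖ ^ 2 * nsq z := by
  simp [nsq, Finset.mul_sum, Complex.normSq_eq_norm_sq, mul_pow]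

lemma norm_sq_le_nsq (z : Cn n) : ‖z‖ ^ 2 ≤ nsq z := by
  have h : ‖z‖ ≤ Real.sqrt (nsq z) := by
    refine (pi_norm_le_iff_of_nonneg (Real.sqrt_nonneg _)).2 fun i => Real.le_sqrt_of_sq_le ?_
    rw [← Complex.normSq_eq_norm_sq]
    exact Finset.single_le_sum (f := fun i => Complex.normSq (z i))
      (fun _ _ => Complex.normSq_nonneg _) (Finset.mem_univ i)
  calc ‖z‖ ^ 2 ≤ Real.sqrt (nsq z) ^ 2 := by gcongr
    _ = nsq z := Real.sq_sqrt (nsq_nonneg z)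

lemma nsq_le (z : Cn n) : nsq z ≤ n * ‖z‖ ^ 2 := by
  unfold nsq
  calc ∑ i, Complex.normSq (z i) ≤ ∑ _i : Fin n, ‖z‖ ^ 2 := by
        refine Finset.sum_le_sum fun i _ => ?_
        rw [Complex.normSq_eq_norm_sq]
        gcongr; exact norm_le_pi_norm z i
    _ = _ := by simp

/-- An unnormalized circle-invariant bump of radius `δ`. -/
def bmp (δ : ℝ) (y : Cn n) : ℝ := Real.smoothTransition (1 - δ⁻¹ ^ 2 * nsq y)

/-- A circle-invariant mollifier of radius `δ`. -/
def mol (δ : ℝ) (y : Cn n) : ℝ := (∫ x : Cn n, bmp δ x)⁻¹ * bmp δ y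

lemma contDiff_bmp (δ : ℝ) : ContDiff ℝ (⊤ : ℕ∞) (bmp δ : Cn n → ℝ) :=
  Real.smoothTransition.contDiff.comp (contDiff_const.sub (contDiff_const.mul contDiff_nsq))

lemma bmp_nonneg (δ : ℝ) (y : Cn n) : 0 ≤ bmp δ y := Real.smoothTransition.nonneg _

lemma bmp_eq_zero {δ : ℝ} (hδ : 0 < δ) {y : Cn n} (hy : δ ≤ ‖y‖) : bmp δ y = 0 := by
  refine Real.smoothTransition.zero_of_nonpos ?_
  have h1 := norm_sq_le_nsq y
  have h2 : δ ^ 2 ≤ nsq y := le_trans (by gcongr) h1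
  have h3 : 1 ≤ δ⁻¹ ^ 2 * nsq y := by
    rw [inv_pow, ← div_eq_inv_mul, one_le_div (by positivity)]; exact h2
  linarith

lemma hasCompactSupport_bmp {δ : ℝ} (hδ : 0 < δ) : HasCompactSupport (bmp δ : Cn n → ℝ) :=
  HasCompactSupport.intro (isCompact_closedBall (0 : Cn n) δ) fun y hy => by
    rw [Metric.mem_closedBall, dist_zero_right, not_le] at hy
    exact bmp_eq_zero hδ hy.le

lemma integral_bmp_pos {δ : ℝ} (hδ : 0 < δ) : 0 < ∫ x : Cn n, bmp δ x := by
  refine (contDiff_bmp δ).continuous.integral_pos_of_hasCompactSupport_nonneg_nonzero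
    (hasCompactSupport_bmp hδ) (bmp_nonneg δ) (x := 0) ?_
  have : nsq (0 : Cn n) = 0 := by simp [nsq]
  simp [bmp, this]

lemma contDiff_mol (δ : ℝ) : ContDiff ℝ (⊤ : ℕ∞) (mol δ : Cn n → ℝ) :=
  contDiff_const.mul (contDiff_bmp δ)

lemma mol_nonneg (δ : ℝ) (y : Cn n) : 0 ≤ mol δ y :=
  mul_nonneg (inv_nonneg.2 (integral_nonneg (bmp_nonneg δ))) (bmp_nonneg δ y)

lemma mol_eq_zero {δ : ℝ} (hδ : 0 < δ) {y : Cn n} (hy : δ ≤ ‖y‖) : mol δ y = 0 := by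
  rw [mol, bmp_eq_zero hδ hy, mul_zero]

lemma hasCompactSupport_mol {δ : ℝ} (hδ : 0 < δ) : HasCompactSupport (mol δ : Cn n → ℝ) :=
  (hasCompactSupport_bmp hδ).mul_left

lemma continuous_mol (δ : ℝ) : Continuous (mol δ : Cn n → ℝ) := (contDiff_mol δ).continuous

lemma integrable_mol {δ : ℝ} (hδ : 0 < δ) : Integrable (mol δ : Cn n → ℝ) :=
  (continuous_mol δ).integrable_of_hasCompactSupport (hasCompactSupport_mol hδ)

lemma integral_mol {δ : ℝ} (hδ : 0 < δ) : ∫ y : Cn n, mol δ y = 1 := by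
  simp only [mol, integral_const_mul]
  exact inv_mul_cancel₀ (integral_bmp_pos hδ).ne'

lemma mol_smul (δ : ℝ) {c : ℂ} (hc : ‖c‖ = 1) (y : Cn n) : mol δ (c • y) = mol δ y := by
  simp [mol, bmp, nsq_smul, hc]

lemma mol_neg (δ : ℝ) (y : Cn n) : mol δ (-y) = mol δ y := by
  simpa using mol_smul δ (c := -1) (by simp) y

lemma measurePreserving_circle_smul (θ : ℝ) :
    MeasurePreserving (fun y : Cn n => Complex.exp (Complex.I * θ) • y) volume volume := by
  have h := volume_preserving_pi (fun _ : Fin n =>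
    ((rotation (Circle.exp θ)).measurePreserving : MeasurePreserving _ volume volume))
  have e : (fun y : Cn n => Complex.exp (Complex.I * θ) • y) =
      fun a i => rotation (Circle.exp θ) (a i) := by
    funext y i
    simp [mul_comm]
  rw [e]; exact h

lemma norm_exp_I (θ : ℝ) : ‖Complex.exp (Complex.I * θ)‖ = 1 := by
  rw [mul_comm]; exact Complex.norm_exp_ofReal_mul_I θ

section average
variable {V : Type*} [NormedAddCommGroup V] [NormedSpace ℝ V]

lemma integral_mol_rotate (δ : ℝ) (f : Cn n → V) (z : Cn n) (θ : ℝ) :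
    ∫ y, mol δ y • f (z + Complex.exp (Complex.I * θ) • y) = ∫ y, mol δ y • f (z + y) := by
  have hemb : MeasurableEmbedding (fun y : Cn n => Complex.exp (Complex.I * θ) • y) :=
    (Homeomorph.smulOfNeZero (α := Cn n) (Complex.exp (Complex.I * θ))
      (Complex.exp_ne_zero _)).measurableEmbedding
  rw [← (measurePreserving_circle_smul θ).integral_comp hemb (fun y => mol δ y • f (z + y))]
  simp only [mol_smul δ (norm_exp_I θ)]

lemma integrable_mol_smul {δ : ℝ} (hδ : 0 < δ) {f : Cn n → V} (hf : StronglyMeasurable f) {M : ℝ}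
    (hM : ∀ z, ‖f z‖ ≤ M) (z : Cn n) : Integrable fun y => mol δ y • f (z + y) := by
  refine (integrable_mol hδ).smul_bdd M ?_ (Eventually.of_forall fun y => hM _)
  exact (hf.comp_measurable (measurable_const_add z)).aestronglyMeasurable

lemma integral_mol_average [CompleteSpace V] {δ : ℝ} (hδ : 0 < δ) {f : Cn n → V} (hf : StronglyMeasurable f) {M : ℝ}
    (hM : ∀ z, ‖f z‖ ≤ M) (z : Cn n) :
    ∫ y, mol δ y • f (z + y) = ∫ y, mol δ y • ((2 * Real.pi)⁻¹ •
      ∫ θ in (0:ℝ)..(2 * Real.pi), f (z + Complex.exp (Complex.I * θ) • y)) := by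
  have hpi : (0:ℝ) ≤ 2 * Real.pi := by positivity
  have hmeas : Measurable fun p : Cn n × ℝ => z + Complex.exp (Complex.I * p.2) • p.1 := by
    fun_prop
  have hI : Integrable (Function.uncurry fun (y : Cn n) (θ : ℝ) =>
      mol δ y • f (z + Complex.exp (Complex.I * θ) • y))
      (volume.prod (volume.restrict (Set.Ioc 0 (2 * Real.pi)))) := by
    have h1 : Integrable (fun p : Cn n × ℝ => mol δ p.1)
        (volume.prod (volume.restrict (Set.Ioc 0 (2 * Real.pi)))) := (integrable_mol hδ).comp_fst _
    exact h1.smul_bdd M (hf.comp_measurable hmeas).aestronglyMeasurable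
      (Eventually.of_forall fun y => hM _)
  have key := integral_integral_swap hI
  simp only [intervalIntegral.integral_of_le hpi]
  have e : ∀ y : Cn n, mol δ y • ((2 * Real.pi)⁻¹ • ∫ θ in Set.Ioc 0 (2 * Real.pi),
      f (z + Complex.exp (Complex.I * (θ : ℂ)) • y)) = (2 * Real.pi)⁻¹ •
      ∫ θ in Set.Ioc 0 (2 * Real.pi), mol δ y • f (z + Complex.exp (Complex.I * (θ : ℂ)) • y) := by
    intro y
    rw [integral_smul, smul_comm]
  simp only [e]
  rw [integral_smul, key]
  simp only [integral_mol_rotate]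
  rw [setIntegral_const, smul_smul]
  simp only [Measure.real, Real.volume_Ioc, sub_zero, ENNReal.toReal_ofReal hpi]
  rw [inv_mul_cancel₀ (by positivity), one_smul]

end average

end

lemma lintegral_mul_sq_le {α : Type*} [MeasurableSpace α] (μ : Measure α) {f g : α → ℝ≥0∞}
    (hf : AEMeasurable f μ) (hg : AEMeasurable g μ) :
    (∫⁻ x, f x * g x ∂μ) ^ 2 ≤ (∫⁻ x, f x ∂μ) * ∫⁻ x, f x * g x ^ 2 ∂μ := by
  have h := ENNReal.lintegral_mul_le_Lp_mul_Lq μ (p := 2) (q := 2) (by constructor <;> norm_num)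
    (f := fun x => f x ^ (1 / 2 : ℝ)) (g := fun x => f x ^ (1 / 2 : ℝ) * g x)
    (hf.pow_const _) ((hf.pow_const _).mul hg)
  have e0 : ∀ a : ℝ≥0∞, a ^ (1 / 2 : ℝ) * a ^ (1 / 2 : ℝ) = a := fun a => by
    rw [← ENNReal.rpow_add_of_nonneg _ _ (by norm_num) (by norm_num)]; norm_num
  have e1 : ∀ a : ℝ≥0∞, (a ^ (1 / 2 : ℝ)) ^ (2 : ℝ) = a := fun a => by
    rw [← ENNReal.rpow_mul]; norm_num
  simp only [Pi.mul_apply, ← mul_assoc, e0, e1] at h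
  have e2 : ∀ x, (f x ^ (1 / 2 : ℝ) * g x) ^ (2 : ℝ) = f x * g x ^ 2 := fun x => by
    rw [ENNReal.mul_rpow_of_nonneg _ _ (by norm_num), e1, ENNReal.rpow_two]
  simp only [e2] at h
  calc (∫⁻ x, f x * g x ∂μ) ^ 2 ≤ ((∫⁻ x, f x ∂μ) ^ (1 / 2 : ℝ) *
        (∫⁻ x, f x * g x ^ 2 ∂μ) ^ (1 / 2 : ℝ)) ^ 2 := by gcongr
    _ = _ := by rw [mul_pow, sq, sq, e0, e0]

lemma lintegral_ofReal_mol {δ : ℝ} (hδ : 0 < δ) (z : Cn n) :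
    ∫⁻ y : Cn n, ENNReal.ofReal (mol δ (z - y)) = 1 := by
  rw [← ofReal_integral_eq_lintegral_ofReal, integral_sub_left_eq_self (fun y => mol δ y),
    integral_mol hδ, ENNReal.ofReal_one]
  · exact (integrable_mol hδ).comp_sub_left z
  · exact Eventually.of_forall fun y => mol_nonneg δ _

lemma exists_mol_le {δ : ℝ} (hδ : 0 < δ) : ∃ C : ℝ, ∀ y : Cn n, mol δ y ≤ C := by
  obtain ⟨C, hC⟩ := (continuous_mol δ).bounded_above_of_compact_support
    (hasCompactSupport_mol (n := n) hδ)
  exact ⟨C, fun y => (le_abs_self _).trans (hC y)⟩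

/-- Mean value property of holomorphic functions on complex lines. -/
lemma circle_average_holo {F : Cn n → ℂ} {R : ℝ} (hF : DifferentiableOn ℂ F (Metric.ball 0 R))
    {z y : Cn n} (hzy : ‖z‖ + ‖y‖ < R) :
    ((2 * Real.pi)⁻¹ : ℝ) • ∫ θ in (0:ℝ)..(2 * Real.pi), F (z + Complex.exp (Complex.I * θ) • y)
      = F z := by
  have hd : DifferentiableOn ℂ (fun ζ : ℂ => F (z + ζ • y)) (Metric.closedBall 0 1) := by
    intro ζ hζ
    have hm : z + ζ • y ∈ Metric.ball (0 : Cn n) R := by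
      rw [mem_ball_zero_iff]
      rw [mem_closedBall_zero_iff] at hζ
      calc ‖z + ζ • y‖ ≤ ‖z‖ + ‖ζ‖ * ‖y‖ := (norm_add_le _ _).trans (by rw [norm_smul])
        _ ≤ ‖z‖ + 1 * ‖y‖ := by gcongr
        _ < R := by linarith
    have h2 : DifferentiableAt ℂ F (z + ζ • y) := hF.differentiableAt (Metric.isOpen_ball.mem_nhds hm)
    exact (h2.comp ζ (by fun_prop : DifferentiableAt ℂ (fun ζ : ℂ => z + ζ • y) ζ)).differentiableWithinAt
  have hdc : DiffContOnCl ℂ (fun ζ : ℂ => F (z + ζ • y)) (Metric.ball 0 |1|) := by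
    rw [abs_one]
    exact DifferentiableOn.diffContOnCl (by rwa [closure_ball _ one_ne_zero])
  have := hdc.circleAverage
  simp only [zero_smul, add_zero] at this
  rw [← this, Real.circleAverage]
  congr 2; funext θ
  simp [circleMap, mul_comm]

lemma stronglyMeasurable_indicator_ball {V : Type*} [NormedAddCommGroup V]
    {F : Cn n → V} {R : ℝ} [SecondCountableTopology V]
    (hF : ContinuousOn F (Metric.ball 0 R)) :
    StronglyMeasurable ((Metric.ball (0 : Cn n) R).indicator F) := by
  classical
  borelize V
  refine Measurable.stronglyMeasurable ?_
  rw [← Set.piecewise_eq_indicator]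
  exact hF.measurable_piecewise continuousOn_const Metric.isOpen_ball.measurableSet

/-- Holomorphic functions are fixed by circle-invariant mollification. -/
lemma integral_mol_holo {F : Cn n → ℂ} {R M δ : ℝ} (hδ : 0 < δ)
    (hF : DifferentiableOn ℂ F (Metric.ball 0 R)) (hM : ∀ z ∈ Metric.ball 0 R, ‖F z‖ ≤ M)
    {z : Cn n} (hz : ‖z‖ + δ < R) : ∫ y, mol δ y • F (z + y) = F z := by
  set f := (Metric.ball (0 : Cn n) R).indicator F with hf
  have hR : 0 < R := by linarith [norm_nonneg z]
  have hM0 : 0 ≤ M := (norm_nonneg _).trans (hM 0 (Metric.mem_ball_self hR))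
  have hfm : StronglyMeasurable f := stronglyMeasurable_indicator_ball hF.continuousOn
  have hfb : ∀ z, ‖f z‖ ≤ M := fun z => by
    by_cases h : z ∈ Metric.ball (0 : Cn n) R
    · rw [hf, Set.indicator_of_mem h]; exact hM z h
    · rw [hf, Set.indicator_of_notMem h, norm_zero]; exact hM0
  have hin : ∀ (y : Cn n) (c : ℂ), ‖c‖ = 1 → ‖y‖ < δ → f (z + c • y) = F (z + c • y) := by
    intro y c hc hy
    refine Set.indicator_of_mem ?_ _
    rw [mem_ball_zero_iff]
    calc ‖z + c • y‖ ≤ ‖z‖ + ‖y‖ := (norm_add_le _ _).trans (by rw [norm_smul, hc, one_mul])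
      _ < R := by linarith
  have key := integral_mol_average hδ hfm hfb z
  have e1 : ∀ y, mol δ y • f (z + y) = mol δ y • F (z + y) := by
    intro y
    rcases lt_or_ge ‖y‖ δ with h | h
    · have := hin y 1 (by simp) h
      rw [one_smul] at this; rw [this]
    · rw [mol_eq_zero hδ h, zero_smul, zero_smul]
  have e2 : ∀ y, mol δ y • ((2 * Real.pi)⁻¹ • ∫ θ in (0:ℝ)..(2 * Real.pi),
      f (z + Complex.exp (Complex.I * θ) • y)) = mol δ y • F z := by
    intro y
    rcases lt_or_ge ‖y‖ δ with h | h
    · rw [← circle_average_holo hF (z := z) (y := y) (by linarith)]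
      congr 3; funext θ
      exact hin y _ (norm_exp_I θ) h
    · rw [mol_eq_zero hδ h, zero_smul, zero_smul]
  simp only [e1, e2] at key
  rw [key, integral_smul_const, integral_mol hδ, one_smul]

/-- Pointwise bound of holomorphic functions by their `L²` norm. -/
lemma exists_sup_le_L2 {R' R : ℝ} (hR : R' < R) : ∃ C : ℝ≥0, ∀ F : Cn n → ℂ,
    DifferentiableOn ℂ F (Metric.ball 0 R) → ∀ z ∈ Metric.ball (0 : Cn n) R',
      ‖F z‖ₑ ^ 2 ≤ C * ∫⁻ y in Metric.ball 0 R, ‖F y‖ₑ ^ 2 := by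
  set δ := (R - R') / 2 with hδ
  have hδ0 : 0 < δ := by rw [hδ]; linarith
  obtain ⟨C, hC⟩ := exists_mol_le (n := n) hδ0
  refine ⟨C.toNNReal, fun F hF z hz => ?_⟩
  rw [mem_ball_zero_iff] at hz
  set R₁ := (‖z‖ + δ + R) / 2 with hR1
  have h1 : ‖z‖ + δ < R₁ := by rw [hR1, hδ]; linarith
  have h2 : R₁ < R := by rw [hR1, hδ]; linarith
  obtain ⟨M, hM⟩ := (isCompact_closedBall (0 : Cn n) R₁).exists_bound_of_continuousOn
    (hF.continuousOn.mono (Metric.closedBall_subset_ball h2))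
  have hF1 := hF.mono (Metric.ball_subset_ball h2.le)
  have e := integral_mol_holo hδ0 hF1 (fun w hw => hM w (Metric.ball_subset_closedBall hw)) h1
  have hmeas := (stronglyMeasurable_indicator_ball hF.continuousOn).measurable
  set f := (Metric.ball (0 : Cn n) R).indicator F with hf
  calc ‖F z‖ₑ ^ 2 ≤ (∫⁻ y, ENNReal.ofReal (mol δ y) * ‖f (z + y)‖ₑ) ^ 2 := by
        gcongr
        rw [← e]
        refine (enorm_integral_le_lintegral_enorm _).trans (lintegral_mono fun y => ?_)
        rw [enorm_smul, Real.enorm_of_nonneg (mol_nonneg δ y)]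
        rcases lt_or_ge ‖y‖ δ with h | h
        · rw [hf, Set.indicator_of_mem]
          rw [mem_ball_zero_iff]
          exact (norm_add_le _ _).trans_lt (by linarith)
        · simp [mol_eq_zero hδ0 h]
    _ ≤ (∫⁻ y : Cn n, ENNReal.ofReal (mol δ y)) * ∫⁻ y, ENNReal.ofReal (mol δ y) * ‖f (z + y)‖ₑ ^ 2 :=
        lintegral_mul_sq_le _ (continuous_mol δ).measurable.ennreal_ofReal.aemeasurable
          (hmeas.comp (measurable_const_add z)).enorm.aemeasurable
    _ ≤ 1 * ∫⁻ y, (C.toNNReal : ℝ≥0∞) * ‖f (z + y)‖ₑ ^ 2 := by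
        gcongr with y
        · have := lintegral_ofReal_mol (n := n) hδ0 0
          simp only [zero_sub, mol_neg] at this
          exact this.le
        · exact ENNReal.ofReal_le_ofReal (hC y)
    _ = C.toNNReal * ∫⁻ y in Metric.ball 0 R, ‖F y‖ₑ ^ 2 := by
        have hm2 : Measurable fun y => ‖f (z + y)‖ₑ ^ 2 :=
          (hmeas.comp (measurable_const_add z)).enorm.pow_const 2
        rw [one_mul, lintegral_const_mul _ hm2, lintegral_add_left_eq_self (fun y => ‖f y‖ₑ ^ 2) z,
          ← lintegral_indicator Metric.isOpen_ball.measurableSet]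
        congr 2; funext y
        by_cases h : y ∈ Metric.ball (0 : Cn n) R
        · simp [hf, h]
        · simp [hf, h]

/-- A uniform limit of holomorphic functions on a polydisc is holomorphic on smaller ones. -/
lemma differentiableOn_of_uniform {R' R : ℝ} (hR : R' < R) {G : ℕ → Cn n → ℂ} {F : Cn n → ℂ}
    {ε : ℕ → ℝ} (hε : Tendsto ε atTop (𝓝 0)) (hG : ∀ k, DifferentiableOn ℂ (G k) (Metric.ball 0 R))
    (hGF : ∀ k, ∀ z ∈ Metric.ball 0 R, ‖G k z - F z‖ ≤ ε k) :
    DifferentiableOn ℂ F (Metric.ball 0 R') := by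
  have hd : 0 < R - R' := by linarith
  have hder : ∀ k l, ∀ z ∈ Metric.ball (0 : Cn n) R',
      ‖fderiv ℂ (G k) z - fderiv ℂ (G l) z‖ ≤ (2 * (ε k + ε l)) / (R - R') := by
    intro k l z hz
    rw [mem_ball_zero_iff] at hz
    have hsub : Metric.ball z (R - R') ⊆ Metric.ball 0 R := by
      refine Metric.ball_subset_ball' ?_
      rw [dist_zero_right]; linarith
    have hzR : Metric.ball (0 : Cn n) R ∈ 𝓝 z :=
      Metric.isOpen_ball.mem_nhds (by rw [mem_ball_zero_iff]; linarith)
    rw [← fderiv_sub ((hG k).differentiableAt hzR) ((hG l).differentiableAt hzR)]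
    refine Complex.norm_fderiv_le_div_of_mapsTo_ball (((hG k).sub (hG l)).mono hsub) ?_ hd
    have hb : ∀ w ∈ Metric.ball (0 : Cn n) R, ‖(G k - G l) w‖ ≤ ε k + ε l := by
      intro w hw
      have e : (G k - G l) w = (G k w - F w) - (G l w - F w) := by simp
      rw [e]
      exact (norm_sub_le _ _).trans (add_le_add (hGF k w hw) (hGF l w hw))
    intro w hw
    rw [Metric.mem_closedBall, dist_eq_norm]
    calc _ ≤ _ := norm_sub_le _ _
      _ ≤ (ε k + ε l) + (ε k + ε l) := add_le_add (hb w (hsub hw)) (hb z (mem_of_mem_nhds hzR))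
      _ = _ := by ring
  have hcau : UniformCauchySeqOn (fun k => fderiv ℂ (G k)) atTop (Metric.ball (0 : Cn n) R') := by
    rw [Metric.uniformCauchySeqOn_iff]
    intro η hη
    have : ∀ᶠ k in atTop, ε k < η * (R - R') / 4 :=
      hε.eventually (Iio_mem_nhds (by positivity))
    obtain ⟨N, hN⟩ := eventually_atTop.1 this
    refine ⟨N, fun k hk l hl z hz => ?_⟩
    rw [dist_eq_norm]
    refine (hder k l z hz).trans_lt ?_
    rw [div_lt_iff₀ hd]
    linarith [hN k hk, hN l hl]
  have hlim : ∀ z ∈ Metric.ball (0 : Cn n) R', ∃ L, Tendsto (fun k => fderiv ℂ (G k) z) atTop (𝓝 L) :=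
    fun z hz => cauchySeq_tendsto_of_complete (hcau.cauchySeq hz)
  choose! L hL using hlim
  have hunif := hcau.tendstoUniformlyOn_of_tendsto hL
  intro z hz
  refine (hasFDerivAt_of_tendstoUniformlyOn (f := G) Metric.isOpen_ball hunif (fun k w hw => ?_)
    (fun w hw => ?_) hz).differentiableAt.differentiableWithinAt
  · exact ((hG k).differentiableAt (Metric.isOpen_ball.mem_nhds
      (Metric.ball_subset_ball hR.le hw))).hasFDerivAt
  · rw [tendsto_iff_norm_sub_tendsto_zero]
    exact squeeze_zero (fun _ => norm_nonneg _)
      (fun k => hGF k w (Metric.ball_subset_ball hR.le hw)) hε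

/-- Montel's theorem on polydiscs. -/
theorem montel {R M : ℝ} (hR : 0 < R) {G : ℕ → Cn n → ℂ}
    (hG : ∀ k, DifferentiableOn ℂ (G k) (Metric.ball 0 R))
    (hM : ∀ k, ∀ z ∈ Metric.ball 0 R, ‖G k z‖ ≤ M) :
    ∃ (φ : ℕ → ℕ) (F : Cn n → ℂ) (ε : ℕ → ℝ), StrictMono φ ∧
      DifferentiableOn ℂ F (Metric.ball 0 (R / 8)) ∧ Tendsto ε atTop (𝓝 0) ∧
      ∀ k, ∀ z ∈ Metric.ball 0 (R / 8), ‖G (φ k) z - F z‖ ≤ ε k := by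
  have hρ : 0 < R / 2 := by positivity
  choose a ha hsa using fun k => exists_powerSeries hρ (by linarith : R / 2 < R) (hG k) (hM k)
  set b : ℕ → (Fin n → ℕ) → ℂ := fun k β => a k β * ((R / 2 : ℝ) : ℂ) ^ (∑ i, β i) with hb
  have hbM : ∀ k β, ‖b k β‖ ≤ M := by
    intro k β
    simp only [hb, norm_mul, norm_pow, Complex.norm_real, Real.norm_of_nonneg hρ.le]
    exact ha k β
  obtain ⟨c, hc, φ, hφ, hlim⟩ := (isCompact_univ_pi fun _ : Fin n → ℕ =>
    isCompact_closedBall (0 : ℂ) M).tendsto_subseq (x := b)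
    (fun k β _ => mem_closedBall_zero_iff.2 (hbM k β))
  have hcM : ∀ β, ‖c β‖ ≤ M := fun β => mem_closedBall_zero_iff.1 (hc β (Set.mem_univ β))
  rw [tendsto_pi_nhds] at hlim
  have hCs : Summable fun β : Fin n → ℕ => (1 / 2 : ℝ) ^ (∑ i, β i) :=
    summable_pow_sum (by norm_num) (by norm_num) n
  set ε : ℕ → ℝ := fun k => ∑' β : Fin n → ℕ, ‖b (φ k) β - c β‖ * (1 / 2 : ℝ) ^ (∑ i, β i) with hεdef
  have hε : Tendsto ε atTop (𝓝 0) := by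
    have := tendsto_tsum_of_dominated_convergence (𝓕 := atTop)
      (f := fun k (β : Fin n → ℕ) => ‖b (φ k) β - c β‖ * (1 / 2 : ℝ) ^ (∑ i, β i))
      (g := fun _ => 0) (bound := fun β => (M + M) * (1 / 2 : ℝ) ^ (∑ i, β i)) (hCs.mul_left _) ?_ ?_
    · simpa only [tsum_zero] using this
    · intro β
      have h := (hlim β).sub_const (c β)
      simp only [sub_self, Function.comp_apply] at h
      simpa using (tendsto_norm_zero.comp h).mul_const ((1 / 2 : ℝ) ^ (∑ i, β i))
    · refine Eventually.of_forall fun k β => ?_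
      rw [norm_mul, norm_norm, norm_pow, Real.norm_of_nonneg (by norm_num : (0:ℝ) ≤ 1 / 2)]
      gcongr
      exact (norm_sub_le _ _).trans (add_le_add (hbM _ β) (hcM β))
  set F : Cn n → ℂ := fun z => ∑' β, c β / ((R / 2 : ℝ) : ℂ) ^ (∑ i, β i) * mono z β with hF
  have hsc : ∀ d : (Fin n → ℕ) → ℂ, ∀ z ∈ Metric.ball (0 : Cn n) (R / 4), ∀ β,
      ‖d β / ((R / 2 : ℝ) : ℂ) ^ (∑ i, β i) * mono z β‖ ≤ ‖d β‖ * (1 / 2 : ℝ) ^ (∑ i, β i) := by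
    intro d z hz β
    rw [mem_ball_zero_iff] at hz
    rw [norm_mul, norm_div, norm_pow, Complex.norm_real, Real.norm_of_nonneg hρ.le]
    have h1 : ‖mono z β‖ ≤ (R / 4) ^ (∑ i, β i) := norm_mono_le z hz.le β
    calc _ ≤ ‖d β‖ / (R / 2) ^ (∑ i, β i) * (R / 4) ^ (∑ i, β i) := by gcongr
      _ = ‖d β‖ * (1 / 2 : ℝ) ^ (∑ i, β i) := by
        rw [div_mul_eq_mul_div, mul_div_assoc, ← div_pow]
        congr 2; field_simp; norm_num
  have hmain : ∀ k, ∀ z ∈ Metric.ball (0 : Cn n) (R / 4), ‖G (φ k) z - F z‖ ≤ ε k := by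
    intro k z hz
    have h1 := hsa (φ k) z (Metric.ball_subset_ball (by linarith) hz)
    have hcs : Summable fun β => c β / ((R / 2 : ℝ) : ℂ) ^ (∑ i, β i) * mono z β := by
      refine Summable.of_norm (Summable.of_nonneg_of_le (fun _ => norm_nonneg _)
        (fun β => (hsc c z hz β).trans ?_) (hCs.mul_left M))
      gcongr; exact hcM β
    have h2 := h1.sub hcs.hasSum
    have hterm : ∀ β, a (φ k) β * mono z β - c β / ((R / 2 : ℝ) : ℂ) ^ (∑ i, β i) * mono z β
        = (b (φ k) β - c β) / ((R / 2 : ℝ) : ℂ) ^ (∑ i, β i) * mono z β := by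
      intro β
      have : ((R / 2 : ℝ) : ℂ) ^ (∑ i, β i) ≠ 0 :=
        pow_ne_zero _ (by exact_mod_cast hρ.ne')
      simp only [hb, sub_div, mul_div_cancel_right₀ _ this]; ring
    simp only [hterm] at h2
    refine (h2.norm_le_of_bounded (Summable.hasSum ?_) fun β =>
      hsc (fun β => b (φ k) β - c β) z hz β).trans_eq rfl
    refine Summable.of_nonneg_of_le (fun _ => by positivity) (fun β => ?_) (hCs.mul_left (M + M))
    gcongr
    exact (norm_sub_le _ _).trans (add_le_add (hbM _ β) (hcM β))
  refine ⟨φ, F, ε, hφ, ?_, hε, fun k z hz =>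
    hmain k z (Metric.ball_subset_ball (by linarith) hz)⟩
  exact differentiableOn_of_uniform (by linarith : R / 8 < R / 4) hε
    (fun k => (hG (φ k)).mono (Metric.ball_subset_ball (by linarith))) hmain

section

/-- Smooth complex valued functions on `ℂⁿ`. -/
abbrev Sm (f : Cn n → ℂ) : Prop := ContDiff ℝ (⊤ : ℕ∞) f

/-- The operator `½(∂/∂xⱼ + c ∂/∂yⱼ)`. -/
def wirt (c : ℂ) (j : Fin n) (f : Cn n → ℂ) (z : Cn n) : ℂ :=
  (1 / 2) * (fderiv ℝ f z (Pi.single j 1) + c * fderiv ℝ f z (Pi.single j Complex.I))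

/-- `∂/∂z̄ⱼ`. -/
abbrev dbar (j : Fin n) (f : Cn n → ℂ) : Cn n → ℂ := wirt Complex.I j f

/-- `∂/∂zⱼ`. -/
abbrev del (j : Fin n) (f : Cn n → ℂ) : Cn n → ℂ := wirt (-Complex.I) j f

lemma Sm.differentiable {f : Cn n → ℂ} (hf : Sm f) : Differentiable ℝ f :=
  ContDiff.differentiable hf (by simp)

lemma Sm.fderiv_apply {f : Cn n → ℂ} (hf : Sm f) (v : Cn n) : Sm fun z => fderiv ℝ f z v :=
  (ContDiff.fderiv_right (m := ((⊤ : ℕ∞) : WithTop ℕ∞)) hf (by exact le_rfl)).clm_apply contDiff_const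

lemma Sm.wirt {f : Cn n → ℂ} (hf : Sm f) (c : ℂ) (j : Fin n) : Sm (wirt c j f) :=
  contDiff_const.mul ((hf.fderiv_apply _).add (contDiff_const.mul (hf.fderiv_apply _)))

lemma HasCompactSupport.wirt {f : Cn n → ℂ} (hf : HasCompactSupport f) (c : ℂ) (j : Fin n) :
    HasCompactSupport (wirt c j f) := by
  refine HasCompactSupport.intro hf.isCompact fun z hz => ?_
  have : fderiv ℝ f z = 0 := by
    have h := (tsupport_fderiv_subset ℝ (f := f))
    exact image_eq_zero_of_notMem_tsupport fun h' => hz (h h')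
  simp [_root_.wirt, this]

lemma wirt_add (c : ℂ) (j : Fin n) {f g : Cn n → ℂ} {z : Cn n} (hf : DifferentiableAt ℝ f z)
    (hg : DifferentiableAt ℝ g z) : wirt c j (fun z => f z + g z) z = wirt c j f z + wirt c j g z := by
  simp only [wirt, fderiv_fun_add hf hg, add_apply]; ring

lemma wirt_neg (c : ℂ) (j : Fin n) (f : Cn n → ℂ) (z : Cn n) :
    wirt c j (fun z => -f z) z = -wirt c j f z := by
  simp only [wirt, fderiv_fun_neg, neg_apply]; ring

lemma wirt_mul (c : ℂ) (j : Fin n) {f g : Cn n → ℂ} {z : Cn n} (hf : DifferentiableAt ℝ f z)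
    (hg : DifferentiableAt ℝ g z) :
    wirt c j (fun z => f z * g z) z = wirt c j f z * g z + f z * wirt c j g z := by
  simp only [wirt, fderiv_fun_mul hf hg, add_apply,
    smul_apply, smul_eq_mul]
  ring

lemma wirt_const_mul (c : ℂ) (j : Fin n) {f : Cn n → ℂ} {z : Cn n} (hf : DifferentiableAt ℝ f z)
    (a : ℂ) : wirt c j (fun z => a * f z) z = a * wirt c j f z := by
  simp only [wirt, fderiv_const_mul hf, smul_apply, smul_eq_mul]
  ring

lemma wirt_conj (c : ℂ) (j : Fin n) {f : Cn n → ℂ} {z : Cn n} (hf : DifferentiableAt ℝ f z) :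
    wirt c j (fun z => starRingEnd ℂ (f z)) z
      = starRingEnd ℂ (wirt (starRingEnd ℂ c) j f z) := by
  have h : fderiv ℝ (fun z => starRingEnd ℂ (f z)) z
      = (Complex.conjCLE : ℂ →L[ℝ] ℂ).comp (fderiv ℝ f z) :=
    ((Complex.conjCLE : ℂ →L[ℝ] ℂ).hasFDerivAt.comp z hf.hasFDerivAt).fderiv
  simp [wirt, h, show (starRingEnd ℂ) (2 : ℂ) = 2 from map_ofNat _ 2]

lemma two_le_smooth : (1 + 1 : WithTop ℕ∞) ≤ ((⊤ : ℕ∞) : WithTop ℕ∞) := by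
  have : ((1 + 1 : ℕ∞) : WithTop ℕ∞) ≤ ((⊤ : ℕ∞) : WithTop ℕ∞) := WithTop.coe_le_coe.2 le_top
  simpa using this

lemma wirt_comm (c d : ℂ) (j k : Fin n) {f : Cn n → ℂ} (hf : Sm f) (z : Cn n) :
    wirt c j (wirt d k f) z = wirt d k (wirt c j f) z := by
  have h2 : ∀ v w : Cn n, fderiv ℝ (fun y => fderiv ℝ f y v) z w = fderiv ℝ (fderiv ℝ f) z w v := by
    intro v w
    have hd : DifferentiableAt ℝ (fderiv ℝ f) z :=
      (ContDiff.fderiv_right (m := 1) hf two_le_smooth).differentiable (by simp) z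
    rw [fderiv_clm_apply hd (differentiableAt_const _)]
    simp
  have hsymm : ∀ v w : Cn n, fderiv ℝ (fderiv ℝ f) z v w = fderiv ℝ (fderiv ℝ f) z w v := by
    intro v w
    exact (ContDiff.contDiffAt hf).isSymmSndFDerivAt (by simpa only [minSmoothness_of_isRCLikeNormedField, one_add_one_eq_two] using two_le_smooth) v w
  have h3 : ∀ (c : ℂ) (j : Fin n) (w : Cn n), fderiv ℝ (wirt c j f) z w = (1 / 2) *
      (fderiv ℝ (fderiv ℝ f) z w (Pi.single j 1) + c * fderiv ℝ (fderiv ℝ f) z w (Pi.single j Complex.I)) := by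
    intro c j w
    have hd : ∀ v, DifferentiableAt ℝ (fun y => fderiv ℝ f y v) z :=
      fun v => (hf.fderiv_apply v).differentiable z
    have : wirt c j f = fun z => (1 / 2 : ℂ) * (fderiv ℝ f z (Pi.single j 1) +
      c * fderiv ℝ f z (Pi.single j Complex.I)) := rfl
    rw [this, fderiv_const_mul ((hd _).fun_add ((hd _).const_mul c)),
      fderiv_fun_add (hd _) ((hd _).const_mul c), fderiv_const_mul (hd _)]
    simp [h2, mul_add]
  rw [wirt, wirt, h3, h3, h3, h3, hsymm (Pi.single k 1) (Pi.single j 1),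
    hsymm (Pi.single k 1) (Pi.single j Complex.I), hsymm (Pi.single k Complex.I) (Pi.single j 1),
    hsymm (Pi.single k Complex.I) (Pi.single j Complex.I)]
  ring

/-- Integration by parts against locally integrable functions is reduced to this smooth case. -/
lemma integral_wirt_mul (c : ℂ) (j : Fin n) {f g : Cn n → ℂ} (hf : Sm f) (hg : Sm g)
    (hc : HasCompactSupport g) :
    ∫ z, wirt c j f z * g z = -∫ z, f z * wirt c j g z := by
  have hi : ∀ p q : Cn n → ℂ, Sm p → Sm q → HasCompactSupport q → Integrable fun z => p z * q z :=
    fun p q hp hq hcq =>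
      (hp.continuous.mul hq.continuous).integrable_of_hasCompactSupport hcq.mul_left
  have hcd : ∀ v : Cn n, HasCompactSupport fun z => fderiv ℝ g z v := fun v =>
    hc.fderiv_apply (𝕜 := ℝ) v
  have key : ∀ v : Cn n, ∫ z, fderiv ℝ f z v * g z = -∫ z, f z * fderiv ℝ g z v := by
    intro v
    rw [integral_mul_fderiv_eq_neg_fderiv_mul_of_integrable (hi _ _ (hf.fderiv_apply v) hg hc)
      (hi _ _ hf (hg.fderiv_apply v) (hcd v)) (hi _ _ hf hg hc) (fun z _ => hf.differentiable z)
      (fun z _ => hg.differentiable z), neg_neg]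
  have e1 : ∀ z, wirt c j f z * g z = (1 / 2) * (fderiv ℝ f z (Pi.single j 1) * g z)
      + (1 / 2 * c) * (fderiv ℝ f z (Pi.single j Complex.I) * g z) := fun z => by
    rw [wirt]; ring
  have e2 : ∀ z, f z * wirt c j g z = (1 / 2) * (f z * fderiv ℝ g z (Pi.single j 1))
      + (1 / 2 * c) * (f z * fderiv ℝ g z (Pi.single j Complex.I)) := fun z => by
    rw [wirt]; ring
  simp only [e1, e2]
  rw [integral_add ((hi _ _ (hf.fderiv_apply _) hg hc).const_mul _)
      ((hi _ _ (hf.fderiv_apply _) hg hc).const_mul _),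
    integral_add ((hi _ _ hf (hg.fderiv_apply _) (hcd _)).const_mul _)
      ((hi _ _ hf (hg.fderiv_apply _) (hcd _)).const_mul _)]
  simp only [integral_const_mul, key]
  ring

/-- Test functions. -/
structure TF (f : Cn n → ℂ) : Prop where
  sm : Sm f
  cs : HasCompactSupport f

lemma Sm.conj {f : Cn n → ℂ} (hf : Sm f) : Sm fun z => starRingEnd ℂ (f z) :=
  (Complex.conjCLE : ℂ →L[ℝ] ℂ).contDiff.comp hf

lemma TF.conj {f : Cn n → ℂ} (hf : TF f) : TF fun z => starRingEnd ℂ (f z) :=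
  ⟨hf.sm.conj, hf.cs.comp_left (map_zero _)⟩

lemma TF.mul_left {f g : Cn n → ℂ} (hf : Sm f) (hg : TF g) : TF fun z => f z * g z :=
  ⟨ContDiff.mul hf hg.sm, hg.cs.mul_left⟩

lemma TF.wirt {f : Cn n → ℂ} (hf : TF f) (c : ℂ) (j : Fin n) : TF (wirt c j f) :=
  ⟨hf.sm.wirt c j, hf.cs.wirt c j⟩

lemma TF.add {f g : Cn n → ℂ} (hf : TF f) (hg : TF g) : TF fun z => f z + g z :=
  ⟨ContDiff.add hf.sm hg.sm, hf.cs.add hg.cs⟩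

lemma TF.neg {f : Cn n → ℂ} (hf : TF f) : TF fun z => -f z :=
  ⟨ContDiff.neg hf.sm, hf.cs.neg⟩

lemma TF.sub {f g : Cn n → ℂ} (hf : TF f) (hg : TF g) : TF fun z => f z - g z := by
  simpa only [sub_eq_add_neg] using hf.add hg.neg

lemma TF.zero : TF (fun _ : Cn n => (0 : ℂ)) := ⟨contDiff_const, HasCompactSupport.zero⟩

lemma TF.sum {ι : Type*} (s : Finset ι) {f : ι → Cn n → ℂ} (hf : ∀ i ∈ s, TF (f i)) :
    TF fun z => ∑ i ∈ s, f i z := by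
  classical
  induction s using Finset.induction_on with
  | empty => simpa using TF.zero
  | insert a s ha ih =>
    simp only [Finset.sum_insert ha]
    exact (hf a (Finset.mem_insert_self _ _)).add (ih fun i hi => hf i (Finset.mem_insert_of_mem hi))

lemma TF.integrable {f : Cn n → ℂ} (hf : TF f) : Integrable f :=
  hf.sm.continuous.integrable_of_hasCompactSupport hf.cs

lemma TF.memLp {f : Cn n → ℂ} (hf : TF f) : MemLp f 2 :=
  hf.sm.continuous.memLp_of_hasCompactSupport hf.cs

section twisted
variable (ω : Cn n → ℂ)

/-- `Dⱼ = ∂̄ⱼ + ½ ∂̄ⱼω`, the operator `∂̄ⱼ` conjugated by `e^{ω/2}`. -/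
def Dt (j : Fin n) (f : Cn n → ℂ) (z : Cn n) : ℂ := dbar j f z + (1 / 2) * dbar j ω z * f z

/-- The formal adjoint of `Dⱼ`. -/
def Ds (j : Fin n) (f : Cn n → ℂ) (z : Cn n) : ℂ := -del j f z + (1 / 2) * del j ω z * f z

variable {ω}

lemma TF.Dt (hω : Sm ω) {f : Cn n → ℂ} (hf : TF f) (j : Fin n) : TF (Dt ω j f) :=
  (hf.wirt _ j).add (TF.mul_left (contDiff_const.mul (hω.wirt _ j)) hf)

lemma TF.Ds (hω : Sm ω) {f : Cn n → ℂ} (hf : TF f) (j : Fin n) : TF (Ds ω j f) :=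
  (hf.wirt _ j).neg.add (TF.mul_left (contDiff_const.mul (hω.wirt _ j)) hf)

lemma Dt_Ds_comm (hω : Sm ω) {f : Cn n → ℂ} (hf : Sm f) (j k : Fin n) (z : Cn n) :
    Dt ω k (Ds ω j f) z = Ds ω j (Dt ω k f) z + dbar k (del j ω) z * f z := by
  have d1 : DifferentiableAt ℝ f z := hf.differentiable z
  have d2 : ∀ c j, DifferentiableAt ℝ (wirt c j f) z := fun c j => (hf.wirt c j).differentiable z
  have d3 : ∀ c j, DifferentiableAt ℝ (wirt c j ω) z := fun c j => (hω.wirt c j).differentiable z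
  have e1 : dbar k (Ds ω j f) z = -dbar k (del j f) z + (1 / 2) * dbar k (del j ω) z * f z +
      (1 / 2) * del j ω z * dbar k f z := by
    have : Ds ω j f = fun z => -del j f z + (1 / 2) * del j ω z * f z := rfl
    rw [this, dbar, wirt_add _ _ (d2 _ _).fun_neg (((d3 _ _).const_mul _).fun_mul d1), wirt_neg,
      wirt_mul _ _ ((d3 _ _).const_mul _) d1, wirt_const_mul _ _ (d3 _ _)]
    ring
  have e2 : del j (Dt ω k f) z = del j (dbar k f) z + (1 / 2) * del j (dbar k ω) z * f z +
      (1 / 2) * dbar k ω z * del j f z := by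
    have : Dt ω k f = fun z => dbar k f z + (1 / 2) * dbar k ω z * f z := rfl
    rw [this, del, wirt_add _ _ (d2 _ _) (((d3 _ _).const_mul _).fun_mul d1),
      wirt_mul _ _ ((d3 _ _).const_mul _) d1, wirt_const_mul _ _ (d3 _ _)]
    ring
  have c1 : del j (dbar k f) z = dbar k (del j f) z := wirt_comm _ _ j k hf z
  have c2 : del j (dbar k ω) z = dbar k (del j ω) z := wirt_comm _ _ j k hω z
  change dbar k (Ds ω j f) z + (1 / 2) * dbar k ω z * Ds ω j f z =
    -del j (Dt ω k f) z + (1 / 2) * del j ω z * Dt ω k f z + _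
  rw [e1, e2, c1, c2, Ds, Dt]
  ring

lemma Dt_Dt_comm (hω : Sm ω) {f : Cn n → ℂ} (hf : Sm f) (j k : Fin n) (z : Cn n) :
    Dt ω k (Dt ω j f) z = Dt ω j (Dt ω k f) z := by
  have d1 : DifferentiableAt ℝ f z := hf.differentiable z
  have d2 : ∀ c j, DifferentiableAt ℝ (wirt c j f) z := fun c j => (hf.wirt c j).differentiable z
  have d3 : ∀ c j, DifferentiableAt ℝ (wirt c j ω) z := fun c j => (hω.wirt c j).differentiable z
  have e2 : ∀ j k, dbar j (Dt ω k f) z = dbar j (dbar k f) z + (1 / 2) * dbar j (dbar k ω) z * f z +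
      (1 / 2) * dbar k ω z * dbar j f z := by
    intro j k
    have : Dt ω k f = fun z => dbar k f z + (1 / 2) * dbar k ω z * f z := rfl
    rw [this, dbar, wirt_add _ _ (d2 _ _) (((d3 _ _).const_mul _).fun_mul d1),
      wirt_mul _ _ ((d3 _ _).const_mul _) d1, wirt_const_mul _ _ (d3 _ _)]
    ring
  have c1 : dbar j (dbar k f) z = dbar k (dbar j f) z := wirt_comm _ _ j k hf z
  have c2 : dbar j (dbar k ω) z = dbar k (dbar j ω) z := wirt_comm _ _ j k hω z
  change dbar k (Dt ω j f) z + (1 / 2) * dbar k ω z * Dt ω j f z =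
    dbar j (Dt ω k f) z + (1 / 2) * dbar j ω z * Dt ω k f z
  rw [e2, e2, c1, c2, Dt, Dt]
  ring

lemma conj_Ds (hω : Sm ω) (hr : ∀ z, starRingEnd ℂ (ω z) = ω z) {g : Cn n → ℂ} (hg : Sm g)
    (j : Fin n) (z : Cn n) : starRingEnd ℂ (Ds ω j g z) =
      -dbar j (fun z => starRingEnd ℂ (g z)) z + (1 / 2) * dbar j ω z * starRingEnd ℂ (g z) := by
  have h1 : starRingEnd ℂ (del j ω z) = dbar j ω z := by
    have := wirt_conj Complex.I j (hω.differentiable z)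
    simp only [hr, Complex.conj_I] at this
    exact this.symm
  rw [dbar, wirt_conj _ _ (hg.differentiable z), Complex.conj_I, Ds]
  simp only [map_add, map_neg, map_mul, h1, map_div₀, map_one, map_ofNat]

lemma integral_Dt_mul_conj (hω : Sm ω) (hr : ∀ z, starRingEnd ℂ (ω z) = ω z) {f g : Cn n → ℂ}
    (hf : Sm f) (hg : TF g) (j : Fin n) :
    ∫ z, Dt ω j f z * starRingEnd ℂ (g z) = ∫ z, f z * starRingEnd ℂ (Ds ω j g z) := by
  simp only [conj_Ds hω hr hg.sm, Dt, add_mul, mul_add]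
  have hi : ∀ p q : Cn n → ℂ, Sm p → TF q → Integrable fun z => p z * q z :=
    fun p q hp hq => (TF.mul_left hp hq).integrable
  rw [integral_add (hi _ _ (hf.wirt _ _) hg.conj)
      (hi _ _ ((contDiff_const.mul (hω.wirt _ _)).mul hf) hg.conj),
    integral_add (hi _ _ hf (hg.conj.wirt _ _).neg)
      (hi _ _ hf (TF.mul_left (contDiff_const.mul (hω.wirt _ _)) hg.conj)),
    integral_wirt_mul _ _ hf hg.conj.sm hg.conj.cs, ← integral_neg]
  congr 1
  · congr 1; funext z; ring
  · congr 1; funext z; ring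

lemma integral_Ds_mul_conj (hω : Sm ω) (hr : ∀ z, starRingEnd ℂ (ω z) = ω z) {f g : Cn n → ℂ}
    (hf : TF f) (hg : Sm g) (j : Fin n) :
    ∫ z, Ds ω j f z * starRingEnd ℂ (g z) = ∫ z, f z * starRingEnd ℂ (Dt ω j g z) := by
  have h := congrArg (starRingEnd ℂ) (integral_Dt_mul_conj hω hr hg hf j)
  rw [← integral_conj, ← integral_conj] at h
  simp only [map_mul, Complex.conj_conj] at h
  simp only [mul_comm (Ds ω j f _), mul_comm (f _)]
  exact h.symm

/-- The Levi form of `ω` at `z`. -/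
def levi (ω : Cn n → ℂ) (z : Cn n) (β : Fin n → ℂ) : ℝ :=
  (∑ j, ∑ k, dbar k (del j ω) z * (β j * starRingEnd ℂ (β k))).re

/-- The Bochner–Kodaira inequality. -/
lemma integral_levi_le (hω : Sm ω) (hr : ∀ z, starRingEnd ℂ (ω z) = ω z) {α : Fin n → Cn n → ℂ}
    (hα : ∀ j, TF (α j)) :
    ∫ z, levi ω z (fun j => α j z) ≤ (∫ z, ‖∑ j, Ds ω j (α j) z‖ ^ 2) +
      ∑ j, ∑ k, (1 / 2) * ∫ z, ‖Dt ω j (α k) z - Dt ω k (α j) z‖ ^ 2 := by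
  have hI : ∀ p q : Cn n → ℂ, TF p → TF q → Integrable fun z => p z * starRingEnd ℂ (q z) :=
    fun p q hp hq => (TF.mul_left hp.sm hq.conj).integrable
  have hA : ((∫ z, ‖∑ j, Ds ω j (α j) z‖ ^ 2 : ℝ) : ℂ) =
      (∑ j, ∑ k, ∫ z, Dt ω k (α j) z * starRingEnd ℂ (Dt ω j (α k) z)) +
        ∫ z, ∑ j, ∑ k, dbar k (del j ω) z * (α j z * starRingEnd ℂ (α k z)) := by
    have hL : ∀ j k, Integrable fun z => dbar k (del j ω) z * (α j z * starRingEnd ℂ (α k z)) :=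
      fun j k => (TF.mul_left ((hω.wirt _ j).wirt _ k)
        (TF.mul_left (hα j).sm (hα k).conj)).integrable
    rw [integral_finsetSum _ fun j _ => integrable_finsetSum _ fun k _ => hL j k]
    simp only [integral_finsetSum _ fun k _ => hL _ k]
    simp only [← Finset.sum_add_distrib]
    rw [← integral_complex_ofReal]
    have e : ∀ z, ((‖∑ j, Ds ω j (α j) z‖ ^ 2 : ℝ) : ℂ) =
        ∑ j, ∑ k, Ds ω j (α j) z * starRingEnd ℂ (Ds ω k (α k) z) := by
      intro z
      rw [← Finset.sum_mul_sum, ← map_sum, Complex.mul_conj, Complex.normSq_eq_norm_sq]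
    simp only [e]
    rw [integral_finsetSum _ fun j _ => integrable_finsetSum _ fun k _ =>
      hI _ _ ((hα j).Ds hω j) ((hα k).Ds hω k)]
    refine Finset.sum_congr rfl fun j _ => ?_
    rw [integral_finsetSum _ fun k _ => hI _ _ ((hα j).Ds hω j) ((hα k).Ds hω k)]
    refine Finset.sum_congr rfl fun k _ => ?_
    rw [← integral_Dt_mul_conj hω hr ((hα j).Ds hω j).sm (hα k) k]
    simp only [Dt_Ds_comm hω (hα j).sm, add_mul, mul_assoc]
    rw [integral_add (hI _ _ (((hα j).Dt hω k).Ds hω j) (hα k)) (hL j k),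
      integral_Ds_mul_conj hω hr ((hα j).Dt hω k) (hα k).sm]
  have hre := congrArg Complex.re hA
  rw [Complex.ofReal_re, Complex.add_re] at hre
  have hLint : Integrable fun z => ∑ j, ∑ k, dbar k (del j ω) z * (α j z * starRingEnd ℂ (α k z)) :=
    integrable_finsetSum _ fun j _ => integrable_finsetSum _ fun k _ =>
      (TF.mul_left ((hω.wirt _ j).wirt _ k) (TF.mul_left (hα j).sm (hα k).conj)).integrable
  have hB : (∫ z, ∑ j, ∑ k, dbar k (del j ω) z * (α j z * starRingEnd ℂ (α k z))).re =
      ∫ z, levi ω z (fun j => α j z) := (integral_re hLint).symm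
  have hC : ∀ j k, ∫ z, ‖Dt ω j (α k) z - Dt ω k (α j) z‖ ^ 2 =
      (∫ z, ‖Dt ω j (α k) z‖ ^ 2) + (∫ z, ‖Dt ω k (α j) z‖ ^ 2) -
        2 * (∫ z, Dt ω k (α j) z * starRingEnd ℂ (Dt ω j (α k) z)).re := by
    intro j k
    have hp := (hα k).Dt hω j
    have hq := (hα j).Dt hω k
    have hsq : ∀ p : Cn n → ℂ, TF p → Integrable fun z => ‖p z‖ ^ 2 := fun p hp =>
      (hp.memLp.integrable_norm_pow (by norm_num : (2 : ℕ) ≠ 0))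
    have hre' : (∫ z, Dt ω k (α j) z * starRingEnd ℂ (Dt ω j (α k) z)).re =
        ∫ z, (Dt ω k (α j) z * starRingEnd ℂ (Dt ω j (α k) z)).re :=
      (integral_re (hI _ _ hq hp)).symm
    rw [hre', ← integral_const_mul, ← integral_add (hsq _ hp) (hsq _ hq), ← integral_sub
      (f := fun z => ‖Dt ω j (α k) z‖ ^ 2 + ‖Dt ω k (α j) z‖ ^ 2)
      (g := fun z => 2 * (Dt ω k (α j) z * starRingEnd ℂ (Dt ω j (α k) z)).re)
      ((hsq _ hp).add (hsq _ hq)) ((hI _ _ hq hp).re.const_mul 2)]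
    congr 1; funext z
    simp only [← Complex.normSq_eq_norm_sq, Complex.normSq_sub]
    have : (Dt ω k (α j) z * starRingEnd ℂ (Dt ω j (α k) z)).re =
        (Dt ω j (α k) z * starRingEnd ℂ (Dt ω k (α j) z)).re := by
      rw [← Complex.conj_re]; simp [mul_comm]
    rw [this]
  have hsum : ∑ j, ∑ k, (1 / 2) * ∫ z, ‖Dt ω j (α k) z - Dt ω k (α j) z‖ ^ 2 =
      (∑ j, ∑ k, ∫ z, ‖Dt ω j (α k) z‖ ^ 2) -
        (∑ j, ∑ k, ∫ z, Dt ω k (α j) z * starRingEnd ℂ (Dt ω j (α k) z)).re := by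
    simp only [hC, mul_sub, mul_add, Finset.sum_sub_distrib, Finset.sum_add_distrib, Complex.re_sum]
    have e1 : ∑ j, ∑ k, (1 / 2 : ℝ) * ∫ z, ‖Dt ω k (α j) z‖ ^ 2 =
        ∑ j, ∑ k, (1 / 2) * ∫ z, ‖Dt ω j (α k) z‖ ^ 2 := Finset.sum_comm
    rw [e1]
    simp only [← Finset.sum_add_distrib, ← Finset.sum_sub_distrib]
    refine Finset.sum_congr rfl fun j _ => Finset.sum_congr rfl fun k _ => ?_
    ring
  have hpos : 0 ≤ ∑ j, ∑ k, ∫ z, ‖Dt ω j (α k) z‖ ^ 2 :=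
    Finset.sum_nonneg fun j _ => Finset.sum_nonneg fun k _ => integral_nonneg fun z => by positivity
  rw [hsum, hre, hB]
  linarith

end twisted

end

/-- The complex valued mollifier. -/
def molC (δ : ℝ) (y : Cn n) : ℂ := (mol δ y : ℂ)

lemma sm_molC (δ : ℝ) : Sm (molC δ : Cn n → ℂ) :=
  Complex.ofRealCLM.contDiff.comp (contDiff_mol δ)

lemma tf_molC {δ : ℝ} (hδ : 0 < δ) : TF (molC δ : Cn n → ℂ) :=
  ⟨sm_molC δ, (hasCompactSupport_mol hδ).comp_left (g := fun x : ℝ => (x : ℂ)) (by simp)⟩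

/-- Mollification. -/
def mf (δ : ℝ) (f : Cn n → ℂ) (z : Cn n) : ℂ := ∫ y, f y * molC δ (z - y)

lemma integrable_mul_comp_sub {f g : Cn n → ℂ} (hf : LocallyIntegrable f) (hg : TF g) (z : Cn n) :
    Integrable fun y => f y * g (z - y) :=
  hg.cs.convolutionExists_right (ContinuousLinearMap.mul ℝ ℂ) hf hg.sm.continuous z

lemma sm_mf {δ : ℝ} (hδ : 0 < δ) {f : Cn n → ℂ} (hf : LocallyIntegrable f) : Sm (mf δ f) :=
  (tf_molC hδ).cs.contDiff_convolution_right (ContinuousLinearMap.mul ℝ ℂ) hf (sm_molC δ)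

lemma wirt_mf {δ : ℝ} (hδ : 0 < δ) {f : Cn n → ℂ} (hf : LocallyIntegrable f) (c : ℂ) (j : Fin n)
    (z : Cn n) : wirt c j (mf δ f) z = ∫ y, f y * wirt c j (molC δ) (z - y) := by
  have ht := tf_molC (n := n) hδ
  have h := ht.cs.hasFDerivAt_convolution_right (ContinuousLinearMap.mul ℝ ℂ) hf
    (ht.sm.of_le (by exact_mod_cast le_top)) z
  have h1 : ∀ v, fderiv ℝ (mf δ f) z v = ∫ y, f y * fderiv ℝ (molC δ) (z - y) v := by
    intro v
    have h' : fderiv ℝ (mf δ f) z = _ := h.fderiv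
    rw [h', convolution_precompR_apply _ hf (ht.cs.fderiv ℝ)
      (ht.sm.continuous_fderiv (by simp))]
    rfl
  have hi : ∀ v, Integrable fun y => f y * fderiv ℝ (molC δ) (z - y) v := fun v =>
    integrable_mul_comp_sub hf ⟨ht.sm.fderiv_apply v, ht.cs.fderiv_apply (𝕜 := ℝ) v⟩ z
  simp only [wirt, h1]
  rw [← integral_const_mul, ← integral_add (hi _) ((hi _).const_mul c), ← integral_const_mul]
  congr 1; funext y; ring

lemma enorm_molC (δ : ℝ) (y : Cn n) : ‖molC δ y‖ₑ = ENNReal.ofReal (mol δ y) := by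
  rw [molC, ← ofReal_norm, Complex.norm_real, Real.norm_of_nonneg (mol_nonneg δ y)]

/-- Averaging against the mollifier is a contraction of `L²`. -/
lemma eLpNorm_le_of_kernel {δ : ℝ} (hδ : 0 < δ) {T : Cn n → ℂ} {g : Cn n → ℝ}
    (hg : AEStronglyMeasurable g)
    (hT : ∀ z, ‖T z‖ₑ ≤ ∫⁻ y, ENNReal.ofReal (mol δ (z - y)) * ‖g y‖ₑ) :
    eLpNorm T 2 ≤ eLpNorm g 2 := by
  have key : ∫⁻ z, ‖T z‖ₑ ^ 2 ≤ ∫⁻ y, ‖g y‖ₑ ^ 2 := by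
    have hm : Measurable fun p : Cn n × Cn n => ENNReal.ofReal (mol δ (p.1 - p.2)) :=
      ((continuous_mol δ).comp (continuous_fst.sub continuous_snd)).measurable.ennreal_ofReal
    calc ∫⁻ z, ‖T z‖ₑ ^ 2
        ≤ ∫⁻ z, ∫⁻ y, ENNReal.ofReal (mol δ (z - y)) * ‖g y‖ₑ ^ 2 := by
          refine lintegral_mono fun z => ?_
          calc ‖T z‖ₑ ^ 2 ≤ (∫⁻ y, ENNReal.ofReal (mol δ (z - y)) * ‖g y‖ₑ) ^ 2 := by
                gcongr; exact hT z
            _ ≤ _ := lintegral_mul_sq_le _ (hm.comp measurable_prodMk_left).aemeasurable hg.enorm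
            _ = _ := by rw [lintegral_ofReal_mol hδ, one_mul]
      _ = ∫⁻ y, ∫⁻ z, ENNReal.ofReal (mol δ (z - y)) * ‖g y‖ₑ ^ 2 := by
          refine lintegral_lintegral_swap ?_
          have h2 : AEMeasurable (fun p : Cn n × Cn n => ‖g p.2‖ₑ ^ 2) (volume.prod volume) :=
            (hg.enorm.comp_quasiMeasurePreserving Measure.quasiMeasurePreserving_snd).pow_const 2
          exact AEMeasurable.mul (f := fun p : Cn n × Cn n => ENNReal.ofReal (mol δ (p.1 - p.2)))
            hm.aemeasurable h2
      _ = ∫⁻ y, ‖g y‖ₑ ^ 2 := by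
          refine lintegral_congr fun y => ?_
          have e1 : ∀ z, ENNReal.ofReal (mol δ (z - y)) = ENNReal.ofReal (mol δ (y - z)) := by
            intro z
            rw [← mol_neg δ (z - y), neg_sub]
          simp only [e1]
          have h2 : Measurable fun z : Cn n => ENNReal.ofReal (mol δ (y - z)) :=
            ((continuous_mol δ).comp (continuous_const.sub continuous_id)).measurable.ennreal_ofReal
          rw [lintegral_mul_const _ h2, lintegral_ofReal_mol hδ, one_mul]
  rw [eLpNorm_eq_lintegral_rpow_enorm_toReal (by norm_num) (by norm_num),
    eLpNorm_eq_lintegral_rpow_enorm_toReal (by norm_num) (by norm_num)]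
  simp only [ENNReal.toReal_ofNat, ENNReal.rpow_ofNat]
  exact ENNReal.rpow_le_rpow key (by norm_num)

lemma wirt_comp_sub (c : ℂ) (j : Fin n) {f : Cn n → ℂ} (hf : Sm f) (z y : Cn n) :
    wirt c j (fun y => f (z - y)) y = -wirt c j f (z - y) := by
  have h : fderiv ℝ (fun y => f (z - y)) y = -fderiv ℝ f (z - y) := by
    have h1 := (hf.differentiable (z - y)).hasFDerivAt.comp y
      ((hasFDerivAt_const z y).sub (hasFDerivAt_id y))
    have h2 : fderiv ℝ (fun y => f (z - y)) y = _ := h1.fderiv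
    rw [h2]; ext v; simp
  simp only [wirt, h, neg_apply]; ring

lemma TF.comp_sub {f : Cn n → ℂ} (hf : TF f) (z : Cn n) : TF fun y => f (z - y) :=
  ⟨ContDiff.comp hf.sm (contDiff_const.sub contDiff_id),
    hf.cs.comp_homeomorph (Homeomorph.subLeft z)⟩

lemma _root_.MeasureTheory.MemLp.integrable_mul_tf {f g : Cn n → ℂ} (hf : MemLp f 2) (hg : TF g) :
    Integrable fun z => f z * g z := hf.integrable_mul hg.memLp

/-- Friedrichs' lemma for a first order operator `∑ aᵢ ∂ᵢ + bᵢ`. -/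
lemma friedrichs {ι : Type*} [Fintype ι] {u : ι → Cn n → ℂ} (hu : ∀ i, MemLp (u i) 2)
    {s : Cn n → ℂ} (hs : MemLp s 2) (a : ι → ℂ) (c : ℂ) (j : ι → Fin n) {b : ι → Cn n → ℂ}
    (hb : ∀ i, Sm (b i))
    (hw : ∀ h : Cn n → ℂ, TF h →
      ∑ i, ∫ y, u i y * (-a i * wirt c (j i) h y + b i y * h y) = ∫ y, s y * h y)
    {θ : Cn n → ℂ} (hθ : TF θ) (hθ1 : ∀ y, ‖θ y‖ ≤ 1) {κ : ℝ}
    (hκ : ∀ i y, ‖wirt c (j i) θ y‖ ≤ κ) {τ : ℝ} (hτ : 0 < τ) :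
    ∃ δ₀ > 0, ∀ δ, 0 < δ → δ < δ₀ →
      eLpNorm (fun z => ∑ i, (a i * wirt c (j i) (mf δ fun y => θ y * u i y) z +
        b i z * mf δ (fun y => θ y * u i y) z)) 2 ≤
      eLpNorm (fun y => ‖s y‖ + ∑ i, (κ * ‖a i‖ + τ) * ‖u i y‖) 2 := by
  have hunif : ∃ δ₀ > 0, ∀ i, ∀ y ∈ tsupport θ, ∀ z, dist y z < δ₀ → ‖b i z - b i y‖ ≤ τ := by
    have h1 : ∀ i, ∀ᶠ p : Cn n × Cn n in uniformity (Cn n),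
        p.1 ∈ tsupport θ → ‖b i p.2 - b i p.1‖ ≤ τ := by
      intro i
      have := hθ.cs.isCompact.uniformContinuousAt_of_continuousAt (b i)
        (fun a _ => (hb i).continuous.continuousAt) (Metric.dist_mem_uniformity hτ)
      filter_upwards [this] with p hp hp1
      have := hp hp1
      simp only [dist_eq_norm] at this
      rw [norm_sub_rev]; exact this.le
    have h2 := Filter.eventually_all.2 h1
    obtain ⟨δ₀, hδ₀, h⟩ := Metric.mem_uniformity_dist.1 h2
    exact ⟨δ₀, hδ₀, fun i y hy z hyz => h hyz i hy⟩
  obtain ⟨δ₀, hδ₀, hun⟩ := hunif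
  refine ⟨δ₀, hδ₀, fun δ hδ hδδ => ?_⟩
  have hmolz : ∀ z y : Cn n, molC δ (z - y) ≠ 0 → dist y z < δ₀ := by
    intro z y h
    by_contra hcon
    refine h ?_
    rw [molC, mol_eq_zero hδ, Complex.ofReal_zero]
    rw [← dist_eq_norm, dist_comm]; linarith [not_lt.1 hcon]
  have ht := tf_molC (n := n) hδ
  have hloc : ∀ i, LocallyIntegrable fun y => θ y * u i y := fun i =>
    ((hu i).integrable_mul_tf hθ |>.congr (Eventually.of_forall fun y => mul_comm _ _)).locallyIntegrable
  have hg : AEStronglyMeasurable (fun y => ‖s y‖ + ∑ i, (κ * ‖a i‖ + τ) * ‖u i y‖) := by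
    refine hs.1.norm.add ?_
    refine Finset.aestronglyMeasurable_fun_sum _ fun i _ => (hu i).1.norm.const_mul _
  refine eLpNorm_le_of_kernel hδ hg fun z => ?_
  have htz : TF fun y => molC δ (z - y) := ht.comp_sub z
  have hh : TF fun y => θ y * molC δ (z - y) := TF.mul_left hθ.sm htz
  have hwz := hw _ hh
  have hid : ∑ i, (a i * wirt c (j i) (mf δ fun y => θ y * u i y) z +
        b i z * mf δ (fun y => θ y * u i y) z) =
      ∫ y, (s y * (θ y * molC δ (z - y)) + ∑ i, u i y * (a i * wirt c (j i) θ y * molC δ (z - y) +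
        (b i z - b i y) * (θ y * molC δ (z - y)))) := by
    have t1 : ∀ i, TF fun y => a i * wirt c (j i) θ y * molC δ (z - y) +
        (b i z - b i y) * (θ y * molC δ (z - y)) := fun i =>
      (TF.mul_left (contDiff_const.mul (hθ.sm.wirt _ _)) htz).add
        (TF.mul_left (contDiff_const.sub (hb i)) hh)
    have t2 : ∀ i, TF fun y => -a i * wirt c (j i) (fun y => θ y * molC δ (z - y)) y +
        b i y * (θ y * molC δ (z - y)) := fun i =>
      (TF.mul_left contDiff_const (hh.wirt _ _)).add (TF.mul_left (hb i) hh)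
    rw [integral_add (hs.integrable_mul_tf hh)
      (integrable_finsetSum _ fun i _ => (hu i).integrable_mul_tf (t1 i)), ← hwz,
      integral_finsetSum _ (fun i _ => (hu i).integrable_mul_tf (t1 i)), ← Finset.sum_add_distrib]
    refine Finset.sum_congr rfl fun i _ => ?_
    rw [← integral_add ((hu i).integrable_mul_tf (t2 i)) ((hu i).integrable_mul_tf (t1 i)),
      wirt_mf hδ (hloc i), mf, ← integral_const_mul, ← integral_const_mul, ← integral_add
        ((integrable_mul_comp_sub (hloc i) (ht.wirt c (j i)) z).const_mul _)
        ((integrable_mul_comp_sub (hloc i) ht z).const_mul _)]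
    congr 1; funext y
    rw [wirt_mul _ _ (hθ.sm.differentiable y) (htz.sm.differentiable y),
      wirt_comp_sub _ _ ht.sm]
    ring
  rw [hid]
  refine (enorm_integral_le_lintegral_enorm _).trans (lintegral_mono fun y => ?_)
  by_cases hm : molC δ (z - y) = 0
  · simp [hm]
  have hbt : ∀ i, ‖(b i z - b i y) * θ y‖ ≤ τ := by
    intro i
    by_cases hy : y ∈ tsupport θ
    · rw [norm_mul]
      calc _ ≤ τ * 1 := mul_le_mul (hun i y hy z (hmolz z y hm)) (hθ1 y) (norm_nonneg _) hτ.le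
        _ = τ := mul_one τ
    · rw [image_eq_zero_of_notMem_tsupport hy, mul_zero, norm_zero]; exact hτ.le
  have e : (s y * (θ y * molC δ (z - y)) + ∑ i, u i y * (a i * wirt c (j i) θ y * molC δ (z - y) +
        (b i z - b i y) * (θ y * molC δ (z - y)))) =
      molC δ (z - y) * (s y * θ y + ∑ i, u i y * (a i * wirt c (j i) θ y + (b i z - b i y) * θ y)) := by
    rw [mul_add, Finset.mul_sum]
    congr 1
    · ring
    · exact Finset.sum_congr rfl fun i _ => by ring
  rw [e, enorm_mul, enorm_molC]
  gcongr
  rw [enorm_le_iff_norm_le]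
  refine (norm_add_le _ _).trans ?_
  refine le_trans ?_ (le_abs_self _)
  refine add_le_add ?_ ((norm_sum_le _ _).trans (Finset.sum_le_sum fun i _ => ?_))
  · rw [norm_mul]
    exact mul_le_of_le_one_right (norm_nonneg _) (hθ1 y)
  · rw [norm_mul, mul_comm]
    gcongr
    refine (norm_add_le _ _).trans (add_le_add ?_ (hbt i))
    rw [norm_mul, mul_comm]
    gcongr
    exact hκ i y

lemma integral_mf_mul {δ : ℝ} (hδ : 0 < δ) {f p : Cn n → ℂ} (hf : Integrable f) (hp : TF p) :
    ∫ z, mf δ f z * p z = ∫ y, f y * mf δ p y := by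
  have hI : Integrable (Function.uncurry fun (z y : Cn n) => f y * molC δ (z - y) * p z)
      (volume.prod volume) := by
    obtain ⟨C, hC⟩ := (tf_molC (n := n) hδ).sm.continuous.bounded_above_of_compact_support
      (tf_molC (n := n) hδ).cs
    have h1 : Integrable (fun q : Cn n × Cn n => p q.1 * f q.2) (volume.prod volume) :=
      hp.integrable.mul_prod hf
    have h2 := h1.mul_bdd (c := C) (g := fun q : Cn n × Cn n => molC δ (q.1 - q.2))
      ((sm_molC δ).continuous.comp (continuous_fst.sub continuous_snd)).aestronglyMeasurable
      (Eventually.of_forall fun q => hC _)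
    refine h2.congr (Eventually.of_forall fun q => ?_)
    simp only [Function.uncurry]; ring
  simp only [mf, ← integral_mul_const, ← integral_const_mul]
  rw [integral_integral_swap hI]
  congr 1; funext y; congr 1; funext z
  have : molC δ (z - y) = molC δ (y - z) := by
    rw [molC, ← mol_neg, neg_sub]; rfl
  rw [this]; ring

lemma integral_molC {δ : ℝ} (hδ : 0 < δ) (z : Cn n) : ∫ y, molC δ (z - y) = 1 := by
  rw [integral_sub_left_eq_self (fun y => molC δ y)]
  simp only [molC]
  rw [integral_complex_ofReal, integral_mol hδ, Complex.ofReal_one]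

lemma norm_mf_sub_le {δ τ : ℝ} (hδ : 0 < δ) {p : Cn n → ℂ} (hp : LocallyIntegrable p) {z : Cn n}
    (h : ∀ y, dist y z < δ → ‖p y - p z‖ ≤ τ) : ‖mf δ p z - p z‖ ≤ τ := by
  have ht := tf_molC (n := n) hδ
  have e : mf δ p z - p z = ∫ y, (p y - p z) * molC δ (z - y) := by
    simp only [sub_mul]
    rw [integral_sub (integrable_mul_comp_sub hp ht z)
      ((ht.comp_sub z).integrable.const_mul _), integral_const_mul, integral_molC hδ, mul_one, mf]
  rw [e]
  have hi : Integrable fun y => τ * mol δ (z - y) := ((integrable_mol hδ).comp_sub_left z).const_mul τ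
  calc _ ≤ ∫ y, τ * mol δ (z - y) := by
        refine norm_integral_le_of_norm_le hi (Eventually.of_forall fun y => ?_)
        rw [norm_mul, molC, Complex.norm_real, Real.norm_of_nonneg (mol_nonneg _ _)]
        by_cases hy : dist y z < δ
        · exact mul_le_mul_of_nonneg_right (h y hy) (mol_nonneg _ _)
        · have : mol δ (z - y) = 0 := mol_eq_zero hδ (by
            rw [← dist_eq_norm, dist_comm]; exact not_lt.1 hy)
          simp [this]
    _ = τ := by
        rw [integral_const_mul, integral_sub_left_eq_self (fun y => mol δ y), integral_mol hδ, mul_one]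

lemma tendsto_integral_mf_mul {f p : Cn n → ℂ} (hf : Integrable f) (hp : TF p) :
    Tendsto (fun δ => ∫ z, mf δ f z * p z) (𝓝[>] 0) (𝓝 (∫ z, f z * p z)) := by
  rw [Metric.tendsto_nhds]
  intro ε hε
  set τ := ε / (2 * ((∫ z, ‖f z‖) + 1)) with hτ
  have hN : 0 ≤ ∫ z, ‖f z‖ := integral_nonneg fun _ => norm_nonneg _
  have hτ0 : 0 < τ := by positivity
  obtain ⟨δ₀, hδ₀, hu⟩ := Metric.uniformContinuous_iff.1
    (hp.sm.continuous.uniformContinuous_of_tendsto_cocompact hp.cs.is_zero_at_infty) τ hτ0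
  filter_upwards [Ioo_mem_nhdsGT hδ₀] with δ hδ
  have hl := hp.integrable.locallyIntegrable
  rw [integral_mf_mul hδ.1 hf hp, dist_eq_norm]
  have hb : ∀ z, ‖mf δ p z - p z‖ ≤ τ := fun z => norm_mf_sub_le hδ.1 hl fun y hy => by
    rw [← dist_eq_norm]; exact (hu (hy.trans hδ.2)).le
  obtain ⟨C, hC⟩ := hp.sm.continuous.bounded_above_of_compact_support hp.cs
  have i2 : Integrable fun z => f z * p z :=
    hf.mul_bdd (c := C) hp.sm.continuous.aestronglyMeasurable (Eventually.of_forall hC)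
  have i1 : Integrable fun z => f z * mf δ p z :=
    hf.mul_bdd (c := C + τ) (sm_mf hδ.1 hl).continuous.aestronglyMeasurable (Eventually.of_forall fun z => by
      have := hb z
      have := hC z
      have := norm_add_le (mf δ p z - p z) (p z)
      rw [sub_add_cancel] at this
      linarith)
  rw [← integral_sub i1 i2]
  calc _ ≤ ∫ z, ‖f z‖ * τ := norm_integral_le_of_norm_le (hf.norm.mul_const τ)
        (Eventually.of_forall fun z => by
          rw [← mul_sub, norm_mul]; exact mul_le_mul_of_nonneg_left (hb z) (norm_nonneg _))
    _ = (∫ z, ‖f z‖) * τ := integral_mul_const _ _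
    _ < ε := by
        rw [hτ, mul_div_assoc', div_lt_iff₀ (by positivity)]
        nlinarith

lemma tf_mf {δ : ℝ} (hδ : 0 < δ) {f : Cn n → ℂ} (hf : LocallyIntegrable f)
    (hc : HasCompactSupport f) : TF (mf δ f) :=
  ⟨sm_mf hδ hf, HasCompactSupport.convolution (L := ContinuousLinearMap.mul ℝ ℂ) (μ := volume)
    hc (tf_molC hδ).cs⟩

/-- Cutoff functions with small derivative. -/
lemma exists_cutoff (R κ : ℝ) (hκ : 0 < κ) : ∃ θ : Cn n → ℂ, TF θ ∧ (∀ y, ‖θ y‖ ≤ 1) ∧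
    (∀ y ∈ Metric.closedBall (0 : Cn n) R, θ y = 1) ∧ ∀ c j y, ‖c‖ ≤ 1 → ‖wirt c j θ y‖ ≤ κ := by
  set Θ : Cn n → ℂ := fun y => ((Real.smoothTransition (2 - nsq y) : ℝ) : ℂ) with hΘ
  have hsm : Sm Θ := Complex.ofRealCLM.contDiff.comp
    (Real.smoothTransition.contDiff.comp (contDiff_const.sub contDiff_nsq))
  have hcs : HasCompactSupport Θ :=
    HasCompactSupport.intro (isCompact_closedBall (0 : Cn n) 2) fun y hy => by
      rw [Metric.mem_closedBall, dist_zero_right, not_le] at hy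
      have := norm_sq_le_nsq y
      simp only [hΘ]
      rw [Real.smoothTransition.zero_of_nonpos (by nlinarith), Complex.ofReal_zero]
  obtain ⟨C, hC⟩ := (hsm.continuous_fderiv (by simp)).bounded_above_of_compact_support
    (hcs.fderiv ℝ)
  have hC0 : 0 ≤ C := (norm_nonneg _).trans (hC 0)
  obtain ⟨ε, hε0, hε1, hε2⟩ : ∃ ε : ℝ, 0 < ε ∧ ε * C ≤ κ ∧ n * (ε * R) ^ 2 ≤ 1 := by
    have t1 : Tendsto (fun ε : ℝ => ε * C) (𝓝[>] 0) (𝓝 (0 * C)) :=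
      ((continuous_id.mul continuous_const).tendsto 0).mono_left nhdsWithin_le_nhds
    have t2 : Tendsto (fun ε : ℝ => n * (ε * R) ^ 2) (𝓝[>] 0) (𝓝 (n * (0 * R) ^ 2)) :=
      ((continuous_const.mul ((continuous_id.mul continuous_const).pow 2)).tendsto 0).mono_left
        nhdsWithin_le_nhds
    rw [zero_mul] at t1
    have e2 : (n : ℝ) * (0 * R) ^ 2 = 0 := by simp
    rw [e2] at t2
    obtain ⟨ε, h⟩ := (((t1.eventually_le_const hκ).and (t2.eventually_le_const one_pos)).and
      self_mem_nhdsWithin).exists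
    exact ⟨ε, h.2, h.1.1, h.1.2⟩
  have hsm' : Sm fun y => Θ (ε • y) := ContDiff.comp hsm (contDiff_const_smul ε)
  refine ⟨fun y => Θ (ε • y), ⟨hsm', hcs.comp_smul hε0.ne'⟩, fun y => ?_, fun y hy => ?_,
    fun c j y hc => ?_⟩
  · simp only [hΘ, Complex.norm_real, Real.norm_of_nonneg (Real.smoothTransition.nonneg _)]
    exact Real.smoothTransition.le_one _
  · have h1 := nsq_le (ε • y)
    rw [norm_smul, Real.norm_of_nonneg hε0.le] at h1
    rw [Metric.mem_closedBall, dist_zero_right] at hy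
    have h2 : (ε * ‖y‖) ^ 2 ≤ (ε * R) ^ 2 := by gcongr
    have h3 : (n : ℝ) * (ε * ‖y‖) ^ 2 ≤ n * (ε * R) ^ 2 := by gcongr
    simp only [hΘ]
    rw [Real.smoothTransition.one_of_one_le (by linarith), Complex.ofReal_one]
  · have hf : fderiv ℝ (fun y => Θ (ε • y)) y = ε • fderiv ℝ Θ (ε • y) := fderiv_comp_smul ε
    have hv : ∀ a : ℂ, ‖a‖ = 1 → ‖fderiv ℝ (fun y => Θ (ε • y)) y (Pi.single j a)‖ ≤ κ := by
      intro a ha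
      rw [hf, smul_apply, norm_smul, Real.norm_of_nonneg hε0.le]
      refine le_trans ?_ hε1
      gcongr
      refine (ContinuousLinearMap.le_opNorm _ _).trans ?_
      have : ‖(Pi.single j a : Cn n)‖ = 1 := by rw [Pi.norm_single, ha]
      rw [this, mul_one]; exact hC _
    have h1 := hv 1 (by simp)
    have h2 := hv Complex.I (by simp)
    rw [wirt, norm_mul]
    have h3 : ‖c * fderiv ℝ (fun y => Θ (ε • y)) y (Pi.single j Complex.I)‖ ≤ κ := by
      rw [norm_mul]
      exact (mul_le_of_le_one_left (norm_nonneg _) hc).trans h2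
    have h4 := norm_add_le (fderiv ℝ (fun y => Θ (ε • y)) y (Pi.single j 1))
      (c * fderiv ℝ (fun y => Θ (ε • y)) y (Pi.single j Complex.I))
    have h5 : ‖(1 / 2 : ℂ)‖ = 1 / 2 := by norm_num
    rw [h5]; linarith

section

lemma toReal_eLpNorm_two_sq {V : Type*} [NormedAddCommGroup V] {f : Cn n → V} (hf : MemLp f 2) :
    (eLpNorm f 2).toReal ^ 2 = ∫ z, ‖f z‖ ^ 2 := by
  rw [hf.eLpNorm_eq_integral_rpow_norm (by norm_num) (by norm_num)]
  have h0 : 0 ≤ ∫ z, ‖f z‖ ^ 2 := integral_nonneg fun _ => by positivity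
  simp only [ENNReal.toReal_ofNat, Real.rpow_ofNat]
  rw [ENNReal.toReal_ofReal (by positivity), ← Real.rpow_natCast, ← Real.rpow_mul h0]
  norm_num

lemma eLpNorm_two_sq {V : Type*} [NormedAddCommGroup V] (f : Cn n → V) :
    (eLpNorm f 2) ^ 2 = ∫⁻ z, ‖f z‖ₑ ^ 2 := by
  rw [eLpNorm_eq_lintegral_rpow_enorm_toReal (by norm_num) (by norm_num)]
  simp only [ENNReal.toReal_ofNat, ENNReal.rpow_ofNat]
  rw [← ENNReal.rpow_natCast, ← ENNReal.rpow_mul]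
  norm_num

lemma integral_mul_sq_le {f g : Cn n → ℝ} (hf : ∀ z, 0 ≤ f z) (hg : ∀ z, 0 ≤ g z)
    (hfi : Integrable f) (hgi : Integrable g) :
    (∫ z, √(f z) * √(g z)) ^ 2 ≤ (∫ z, f z) * ∫ z, g z := by
  have hm : ∀ f : Cn n → ℝ, (∀ z, 0 ≤ f z) → Integrable f →
      MemLp (fun z => √(f z)) (ENNReal.ofReal 2) := by
    intro f hf hfi
    rw [ENNReal.ofReal_ofNat, memLp_two_iff_integrable_sq
      (Real.continuous_sqrt.comp_aestronglyMeasurable hfi.1)]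
    simpa only [Real.sq_sqrt (hf _)] using hfi
  have h := integral_mul_le_Lp_mul_Lq_of_nonneg (p := 2) (q := 2) (μ := (volume : Measure (Cn n)))
    (by constructor <;> norm_num) (f := fun z => √(f z)) (g := fun z => √(g z))
    (Eventually.of_forall fun z => Real.sqrt_nonneg _)
    (Eventually.of_forall fun z => Real.sqrt_nonneg _) (hm f hf hfi) (hm g hg hgi)
  simp only [Real.rpow_ofNat, Real.sq_sqrt (hf _), Real.sq_sqrt (hg _)] at h
  have h0 : 0 ≤ ∫ z, √(f z) * √(g z) := integral_nonneg fun _ => by positivity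
  have hf0 : 0 ≤ ∫ z, f z := integral_nonneg hf
  have hg0 : 0 ≤ ∫ z, g z := integral_nonneg hg
  calc _ ≤ ((∫ z, f z) ^ (1 / 2 : ℝ) * (∫ z, g z) ^ (1 / 2 : ℝ)) ^ 2 := by gcongr
    _ = _ := by
      rw [← Real.sqrt_eq_rpow, ← Real.sqrt_eq_rpow, mul_pow, Real.sq_sqrt hf0, Real.sq_sqrt hg0]

section twisted
variable {ω : Cn n → ℂ}

lemma integrable_levi (hω : Sm ω) {α : Fin n → Cn n → ℂ} (hα : ∀ j, TF (α j)) :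
    Integrable fun z => levi ω z (fun j => α j z) :=
  (integrable_finsetSum _ fun j _ => integrable_finsetSum _ fun k _ =>
      (TF.mul_left ((hω.wirt _ j).wirt _ k) (TF.mul_left (hα j).sm (hα k).conj)).integrable).re

lemma conj_Dt (hω : Sm ω) (hr : ∀ z, starRingEnd ℂ (ω z) = ω z) {g : Cn n → ℂ} (hg : Sm g)
    (j : Fin n) (z : Cn n) : starRingEnd ℂ (Dt ω j g z) =
      del j (fun z => starRingEnd ℂ (g z)) z + (1 / 2) * del j ω z * starRingEnd ℂ (g z) := by
  have h1 : starRingEnd ℂ (dbar j ω z) = del j ω z := by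
    have := wirt_conj (-Complex.I) j (hω.differentiable z)
    simp only [hr, map_neg, Complex.conj_I, neg_neg] at this
    exact this.symm
  rw [del, wirt_conj _ _ (hg.differentiable z), map_neg, Complex.conj_I, neg_neg, Dt]
  simp only [map_add, map_mul, h1, map_div₀, map_one, map_ofNat]

/-- The a priori estimate for test forms. -/
lemma pairing_test_le (hω : Sm ω) (hr : ∀ z, starRingEnd ℂ (ω z) = ω z)
    (hlevi : ∀ z β, 0 ≤ levi ω z β) {g : Cn n → ℂ} (hg : TF g) {a : Cn n → ℝ}
    (ha0 : ∀ z, 0 ≤ a z) (hai : Integrable a)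
    (ha : ∀ z (β : Fin n → ℂ), ‖∑ k, β k * starRingEnd ℂ (Dt ω k g z)‖ ^ 2 ≤ a z * levi ω z β)
    {η : Fin n → Cn n → ℂ} (hη : ∀ k, TF (η k)) :
    ‖∑ k, ∫ z, η k z * starRingEnd ℂ (Dt ω k g z)‖ ^ 2 ≤
      (∫ z, a z) * ((∫ z, ‖∑ j, Ds ω j (η j) z‖ ^ 2) +
      ∑ j, ∑ k, (1 / 2) * ∫ z, ‖Dt ω j (η k) z - Dt ω k (η j) z‖ ^ 2) := by
  have hi : ∀ k, Integrable fun z => η k z * starRingEnd ℂ (Dt ω k g z) := fun k =>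
    (TF.mul_left (hη k).sm (hg.Dt hω k).conj).integrable
  have hA : 0 ≤ ∫ z, a z := integral_nonneg ha0
  refine le_trans ?_ (mul_le_mul_of_nonneg_left (integral_levi_le hω hr hη) hA)
  have hl := integrable_levi hω hη
  refine le_trans ?_ (integral_mul_sq_le ha0 (fun z => hlevi z _) hai hl)
  rw [← integral_finsetSum _ fun k _ => hi k]
  gcongr
  have hm : Integrable fun z => √(a z) * √(levi ω z (fun j => η j z)) := by
    refine Integrable.mono' (hai.add hl) ((Real.continuous_sqrt.comp_aestronglyMeasurable hai.1).mul
      (Real.continuous_sqrt.comp_aestronglyMeasurable hl.1)) (Eventually.of_forall fun z => ?_)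
    have h1 := Real.sq_sqrt (ha0 z)
    have h2 := Real.sq_sqrt (hlevi z (fun j => η j z))
    rw [Real.norm_of_nonneg (by positivity)]
    simp only [Pi.add_apply]
    nlinarith [sq_nonneg (√(a z) - √(levi ω z (fun j => η j z))), Real.sqrt_nonneg (a z),
      Real.sqrt_nonneg (levi ω z (fun j => η j z))]
  refine norm_integral_le_of_norm_le hm (Eventually.of_forall fun z => ?_)
  rw [← Real.sqrt_mul (ha0 z)]
  exact Real.le_sqrt_of_sq_le (ha z fun j => η j z)

set_option maxHeartbeats 1000000 in
/-- The a priori estimate for square integrable forms that are closed in the weak sense. -/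
lemma pairing_weak_le (hω : Sm ω) (hr : ∀ z, starRingEnd ℂ (ω z) = ω z)
    (hlevi : ∀ z β, 0 ≤ levi ω z β) {g : Cn n → ℂ} (hg : TF g) {a : Cn n → ℝ}
    (ha0 : ∀ z, 0 ≤ a z) (hai : Integrable a)
    (ha : ∀ z (β : Fin n → ℂ), ‖∑ k, β k * starRingEnd ℂ (Dt ω k g z)‖ ^ 2 ≤ a z * levi ω z β)
    {β : Fin n → Cn n → ℂ} (hβ : ∀ k, MemLp (β k) 2) {s : Cn n → ℂ} (hs : MemLp s 2)
    (hw1 : ∀ h : Cn n → ℂ, TF h →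
      ∑ j, ∫ y, β j y * (del j h y + (1 / 2) * del j ω y * h y) = ∫ y, s y * h y)
    (hw2 : ∀ j k, ∀ h : Cn n → ℂ, TF h →
      ∫ y, β k y * (-dbar j h y + (1 / 2) * dbar j ω y * h y) =
        ∫ y, β j y * (-dbar k h y + (1 / 2) * dbar k ω y * h y)) :
    ‖∑ k, ∫ z, β k z * starRingEnd ℂ (Dt ω k g z)‖ ^ 2 ≤ (∫ z, a z) * (eLpNorm s 2).toReal ^ 2 := by
  set A := ∫ z, a z
  have hA : 0 ≤ A := integral_nonneg ha0
  set S := (eLpNorm s 2).toReal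
  obtain ⟨B, hB⟩ : ∃ B, B = ∑ k, (eLpNorm (β k) 2).toReal := ⟨_, rfl⟩
  have hBi : ∀ i, eLpNorm (β i) 2 ≤ ENNReal.ofReal B := by
    intro i
    refine (ENNReal.ofReal_toReal (hβ i).2.ne).symm.le.trans (ENNReal.ofReal_le_ofReal ?_)
    rw [hB]
    have hsl : ∀ f : Fin n → ℝ, (∀ i, 0 ≤ f i) → f i ≤ ∑ k, f k := fun f hf =>
      Finset.single_le_sum (fun k _ => hf k) (Finset.mem_univ i)
    exact hsl (fun k => (eLpNorm (β k) 2 (volume : Measure (Cn n))).toReal)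
      fun _ => ENNReal.toReal_nonneg
  have hB0 : 0 ≤ B := hB ▸ Finset.sum_nonneg fun _ _ => ENNReal.toReal_nonneg
  obtain ⟨R, hR⟩ : ∃ R, tsupport g ⊆ Metric.closedBall (0 : Cn n) R :=
    hg.cs.isCompact.isBounded.subset_closedBall 0
  have key : ∀ τ : ℝ, 0 < τ → ‖∑ k, ∫ z, β k z * starRingEnd ℂ (Dt ω k g z)‖ ^ 2 ≤
      A * ((S + 2 * τ * B) ^ 2 + ∑ _j : Fin n, ∑ _k : Fin n, (1 / 2) * (2 * τ * (B + B)) ^ 2) := by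
    intro τ hτ
    obtain ⟨θ, hθ, hθ1, hθR, hθd⟩ := exists_cutoff (n := n) R τ hτ
    have hloc : ∀ i, Integrable fun y => θ y * β i y := fun i =>
      ((hβ i).integrable_mul_tf hθ).congr (Eventually.of_forall fun y => mul_comm _ _)
    obtain ⟨δ₁, hδ₁, h1⟩ := friedrichs (ι := Fin n) hβ hs (fun _ => -1) (-Complex.I) id
      (b := fun j z => (1 / 2) * del j ω z) (fun j => contDiff_const.mul (hω.wirt _ j))
      (fun h hh => by simpa using hw1 h hh) hθ hθ1
      (fun i y => hθd (-Complex.I) i y (by simp)) hτ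
    have h2 : ∀ j k : Fin n, ∃ δ₀ > 0, ∀ δ, 0 < δ → δ < δ₀ → eLpNorm (fun z =>
        Dt ω j (mf δ fun y => θ y * β k y) z - Dt ω k (mf δ fun y => θ y * β j y) z) 2 ≤
        ENNReal.ofReal (2 * τ * (B + B)) := by
      intro j k
      obtain ⟨δ₀, hδ₀, h⟩ := friedrichs (ι := Fin 2) (u := ![β k, β j]) (s := fun _ => 0)
        (by intro i; fin_cases i <;> simp [hβ]) MemLp.zero' ![1, -1] Complex.I ![j, k]
        (b := ![fun z => (1 / 2) * dbar j ω z, fun z => -((1 / 2) * dbar k ω z)])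
        (by
          intro i
          fin_cases i
          · exact contDiff_const.mul (hω.wirt _ j)
          · exact (contDiff_const.mul (hω.wirt _ k)).neg)
        (by
          intro h hh
          have := hw2 j k h hh
          simp only [Fin.sum_univ_two, Matrix.cons_val_zero, Matrix.cons_val_one, zero_mul,
            integral_zero]
          rw [show (∫ y, β j y * (-(-1) * wirt Complex.I k h y + -(1 / 2 * dbar k ω y) * h y)) =
            -∫ y, β j y * (-dbar k h y + (1 / 2) * dbar k ω y * h y) from by
              rw [← integral_neg]; congr 1; funext y; ring, ← this]
          rw [← sub_eq_add_neg, sub_eq_zero]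
          congr 1; funext y; ring)
        hθ hθ1 (fun i y => hθd Complex.I _ y (by simp)) hτ
      refine ⟨δ₀, hδ₀, fun δ hδ hδ' => ?_⟩
      have h' := h δ hδ hδ'
      simp only [Fin.sum_univ_two, Matrix.cons_val_zero, Matrix.cons_val_one, norm_zero, zero_add,
        norm_one, norm_neg, mul_one] at h'
      refine le_trans (le_of_eq ?_) (h'.trans ?_)
      · congr 1; funext z; simp only [Dt]; ring
      · have hf : ∀ i, eLpNorm (fun y => (τ + τ) * ‖β i y‖) 2 ≤ ENNReal.ofReal (2 * τ * B) := by
          intro i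
          have e : eLpNorm (fun y => (τ + τ) * ‖β i y‖) 2 =
              ENNReal.ofReal (2 * τ) * eLpNorm (β i) 2 := by
            have := eLpNorm_const_smul (τ + τ) (fun y => ‖β i y‖) 2 (volume : Measure (Cn n))
            rw [eLpNorm_norm] at this
            rw [← two_mul] at this ⊢
            rw [← Real.enorm_of_nonneg (by positivity)]
            exact this
          rw [e, show ENNReal.ofReal (2 * τ * B) = ENNReal.ofReal (2 * τ) * ENNReal.ofReal B from
            ENNReal.ofReal_mul (by positivity)]
          gcongr
          exact hBi i
        rw [mul_add, ENNReal.ofReal_add (by positivity) (by positivity)]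
        exact (eLpNorm_add_le ((hβ k).1.norm.const_mul _) ((hβ j).1.norm.const_mul _)
          (by norm_num)).trans (add_le_add (hf k) (hf j))
    choose δ₂ hδ₂ h2 using h2
    have hev : ∀ᶠ δ in 𝓝[>] (0 : ℝ), ‖∑ k, ∫ z, mf δ (fun y => θ y * β k y) z *
        starRingEnd ℂ (Dt ω k g z)‖ ^ 2 ≤
        A * ((S + 2 * τ * B) ^ 2 + ∑ _j : Fin n, ∑ _k : Fin n, (1 / 2) * (2 * τ * (B + B)) ^ 2) := by
      have hall : ∀ᶠ δ in 𝓝[>] (0 : ℝ), ∀ j k, δ < δ₂ j k :=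
        eventually_all.2 fun j => eventually_all.2 fun k =>
          (eventually_lt_nhds (hδ₂ j k)).filter_mono nhdsWithin_le_nhds
      filter_upwards [hall, (eventually_lt_nhds hδ₁).filter_mono nhdsWithin_le_nhds,
        self_mem_nhdsWithin] with δ hδ2 hδ1 hδ0
      have hδ0 : 0 < δ := hδ0
      have hη : ∀ k, TF (mf δ fun y => θ y * β k y) := fun k =>
        tf_mf hδ0 (hloc k).locallyIntegrable hθ.cs.mul_right
      refine (pairing_test_le hω hr hlevi hg ha0 hai ha hη).trans ?_
      have hDs : TF fun z => ∑ j, Ds ω j (mf δ fun y => θ y * β j y) z :=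
        TF.sum _ fun j _ => (hη j).Ds hω j
      have b1 : ∫ z, ‖∑ j, Ds ω j (mf δ fun y => θ y * β j y) z‖ ^ 2 ≤ (S + 2 * τ * B) ^ 2 := by
        rw [← toReal_eLpNorm_two_sq hDs.memLp]
        gcongr
        refine ENNReal.toReal_le_of_le_ofReal (by positivity) ?_
        have := h1 δ hδ0 hδ1
        refine le_trans (le_of_eq ?_) (this.trans ?_)
        · congr 1; funext z
          refine Finset.sum_congr rfl fun j _ => ?_
          simp only [Ds, id]; ring
        · simp only [norm_neg, norm_one, mul_one]
          have m1 : MemLp (fun y => ‖s y‖) 2 := hs.norm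
          have m2 : ∀ i, AEStronglyMeasurable (fun y => (τ + τ) * ‖β i y‖) := fun i =>
            (hβ i).1.norm.const_mul _
          have e : ∀ i, eLpNorm (fun y => (τ + τ) * ‖β i y‖) 2 =
              ENNReal.ofReal (2 * τ) * eLpNorm (β i) 2 := by
            intro i
            have := eLpNorm_const_smul (τ + τ) (fun y => ‖β i y‖) 2 (volume : Measure (Cn n))
            rw [eLpNorm_norm] at this
            rw [← two_mul] at this ⊢
            rw [← Real.enorm_of_nonneg (by positivity)]
            exact this
          refine (eLpNorm_add_le m1.1 (Finset.aestronglyMeasurable_fun_sum _ fun i _ => m2 i)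
            (by norm_num)).trans ?_
          rw [ENNReal.ofReal_add ENNReal.toReal_nonneg (by positivity), eLpNorm_norm,
            ENNReal.ofReal_toReal hs.2.ne]
          gcongr
          have hsum := eLpNorm_sum_le (s := Finset.univ) (f := fun i y => (τ + τ) * ‖β i y‖)
            (p := 2) (μ := (volume : Measure (Cn n))) (fun i _ => m2 i) (by norm_num)
          have e' : (∑ i : Fin n, fun y => (τ + τ) * ‖β i y‖) = fun y => ∑ i, (τ + τ) * ‖β i y‖ := by
            funext y; simp
          rw [e'] at hsum
          refine hsum.trans (le_of_eq ?_)
          simp only [e]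
          rw [← Finset.mul_sum, show ENNReal.ofReal (2 * τ * B) =
            ENNReal.ofReal (2 * τ) * ENNReal.ofReal B from ENNReal.ofReal_mul (by positivity), hB,
            ENNReal.ofReal_sum_of_nonneg fun _ _ => ENNReal.toReal_nonneg]
          congr 1
          exact Finset.sum_congr rfl fun i _ => (ENNReal.ofReal_toReal (hβ i).2.ne).symm
      have b2 : ∀ j k, ∫ z, ‖Dt ω j (mf δ fun y => θ y * β k y) z -
          Dt ω k (mf δ fun y => θ y * β j y) z‖ ^ 2 ≤ (2 * τ * (B + B)) ^ 2 := by
        intro j k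
        have ht : TF fun z => Dt ω j (mf δ fun y => θ y * β k y) z -
          Dt ω k (mf δ fun y => θ y * β j y) z := ((hη k).Dt hω j).sub ((hη j).Dt hω k)
        rw [← toReal_eLpNorm_two_sq ht.memLp]
        gcongr
        exact ENNReal.toReal_le_of_le_ofReal (by positivity) (h2 j k δ hδ0 (hδ2 j k))
      gcongr with j _ k _
      exact b2 j k
    refine le_of_tendsto ?_ hev
    have hlim : Tendsto (fun δ => ∑ k, ∫ z, mf δ (fun y => θ y * β k y) z *
        starRingEnd ℂ (Dt ω k g z)) (𝓝[>] 0)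
        (𝓝 (∑ k, ∫ z, (θ z * β k z) * starRingEnd ℂ (Dt ω k g z))) :=
      tendsto_finsetSum _ fun k _ => tendsto_integral_mf_mul (hloc k) (hg.Dt hω k).conj
    have e : ∀ k z, (θ z * β k z) * starRingEnd ℂ (Dt ω k g z) =
        β k z * starRingEnd ℂ (Dt ω k g z) := by
      intro k z
      by_cases hz : z ∈ tsupport g
      · rw [hθR z (hR hz), one_mul]
      · have h0 : g z = 0 := image_eq_zero_of_notMem_tsupport hz
        have h1 : dbar k g z = 0 := by
          have : fderiv ℝ g z = 0 := image_eq_zero_of_notMem_tsupport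
            fun h' => hz (tsupport_fderiv_subset ℝ h')
          simp [dbar, wirt, this]
        simp [Dt, h0, h1]
    simp only [e] at hlim
    exact (hlim.norm).pow 2
  have hcont : Tendsto (fun τ : ℝ => A * ((S + 2 * τ * B) ^ 2 +
      ∑ _j : Fin n, ∑ _k : Fin n, (1 / 2) * (2 * τ * (B + B)) ^ 2)) (𝓝[>] 0) (𝓝 (A * S ^ 2)) := by
    have : Continuous (fun τ : ℝ => A * ((S + 2 * τ * B) ^ 2 +
      ∑ _j : Fin n, ∑ _k : Fin n, (1 / 2) * (2 * τ * (B + B)) ^ 2)) := by fun_prop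
    have h := (this.tendsto 0).mono_left (nhdsWithin_le_nhds (s := Set.Ioi 0))
    simpa using h
  exact ge_of_tendsto hcont (by filter_upwards [self_mem_nhdsWithin] with τ hτ using key τ hτ)

end twisted

end

section

lemma inner_toLp_two {f g : Cn n → ℂ} (hf : MemLp f 2) (hg : MemLp g 2) :
    inner ℂ (hf.toLp f) (hg.toLp g) = ∫ z, g z * starRingEnd ℂ (f z) := by
  rw [L2.inner_def]
  refine integral_congr_ae ?_
  filter_upwards [hf.coeFn_toLp, hg.coeFn_toLp] with z h1 h2
  rw [h1, h2, RCLike.inner_apply]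

lemma norm_toLp_two_sq {f : Cn n → ℂ} (hf : MemLp f 2) :
    ‖hf.toLp f‖ ^ 2 = (eLpNorm f 2).toReal ^ 2 := by
  rw [Lp.norm_toLp]

lemma exists_orthogonal_part {H : Type*} [NormedAddCommGroup H] [InnerProductSpace ℂ H]
    [CompleteSpace H] (K : Submodule ℂ H) (x : H) :
    ∃ y ∈ Kᗮ, ∀ v ∈ Kᗮ, inner ℂ v x = inner ℂ v y := by
  refine ⟨Kᗮ.starProjection x, Submodule.starProjection_apply_mem _ _, fun v hv => ?_⟩
  have h := Submodule.sub_starProjection_mem_orthogonal (K := Kᗮ) x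
  have h := (Submodule.mem_orthogonal _ _).1 h v hv
  rw [inner_sub_right] at h
  exact sub_eq_zero.1 h

/-- A functional dominated on a subspace is represented there by a vector with the same bound. -/
lemma exists_representative {H : Type*} [NormedAddCommGroup H] [InnerProductSpace ℂ H]
    [CompleteSpace H] (S : Submodule ℂ H) (g : H) {A : ℝ} (hA : 0 ≤ A)
    (hS : ∀ x ∈ S, ‖inner ℂ g x‖ ^ 2 ≤ A * ‖x‖ ^ 2) :
    ∃ u : H, ‖u‖ ^ 2 ≤ A ∧ ∀ x ∈ S, inner ℂ x (g - u) = 0 := by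
  let M := S.topologicalClosure
  have hcl : ∀ x ∈ M, ‖inner ℂ g x‖ ^ 2 ≤ A * ‖x‖ ^ 2 := by
    intro x hx
    have hc : IsClosed {x : H | ‖inner ℂ g x‖ ^ 2 ≤ A * ‖x‖ ^ 2} :=
      isClosed_le (by fun_prop) (by fun_prop)
    exact closure_minimal hS hc (show x ∈ closure (S : Set H) from hx)
  have : CompleteSpace M := S.isClosed_topologicalClosure.completeSpace_coe
  let u := M.starProjection g
  have hu : u ∈ M := Submodule.starProjection_apply_mem _ _
  have hperp : g - u ∈ Mᗮ := Submodule.sub_starProjection_mem_orthogonal _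
  have hsq : inner ℂ g u = ((‖u‖ ^ 2 : ℝ) : ℂ) := by
    have := (Submodule.mem_orthogonal' _ _).1 hperp u hu
    rw [inner_sub_left, sub_eq_zero] at this
    rw [this, inner_self_eq_norm_sq_to_K]
    norm_cast
  refine ⟨u, ?_, fun x hx => (Submodule.mem_orthogonal _ _).1 hperp x
    (S.le_topologicalClosure hx)⟩
  have h := hcl u hu
  rw [hsq, Complex.norm_real, Real.norm_of_nonneg (by positivity)] at h
  by_contra hlt
  push Not at hlt
  nlinarith [lt_of_le_of_lt hA hlt]

section twisted
variable {ω : Cn n → ℂ}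

lemma Ds_add {f g : Cn n → ℂ} (hf : Sm f) (hg : Sm g) (k : Fin n) (z : Cn n) :
    Ds ω k (fun z => f z + g z) z = Ds ω k f z + Ds ω k g z := by
  simp only [Ds, del, wirt_add _ _ (hf.differentiable z) (hg.differentiable z)]; ring

lemma Ds_const_mul {f : Cn n → ℂ} (hf : Sm f) (c : ℂ) (k : Fin n) (z : Cn n) :
    Ds ω k (fun z => c * f z) z = c * Ds ω k f z := by
  simp only [Ds, del, wirt_const_mul _ _ (hf.differentiable z)]; ring

lemma Ds_zero (k : Fin n) (z : Cn n) : Ds ω k (fun _ => 0) z = 0 := by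
  simp [Ds, del, wirt]

abbrev L2n (n : ℕ) := Lp ℂ 2 (volume : Measure (Cn n))

lemma inner_single_left (k : Fin n) (a : L2n n) (β : PiLp 2 fun _ : Fin n => L2n n) :
    inner ℂ (WithLp.toLp 2 (Pi.single k a)) β = inner ℂ a (β k) := by
  rw [PiLp.inner_apply, Finset.sum_eq_single k]
  · simp
  · intro b _ hb
    simp [Pi.single_eq_of_ne hb]
  · simp

lemma pairing_sum_Ds_le (hω : Sm ω) (hr : ∀ z, starRingEnd ℂ (ω z) = ω z)
    (hlevi : ∀ z β, 0 ≤ levi ω z β) {g : Cn n → ℂ} (hg : TF g) {a : Cn n → ℝ}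
    (ha0 : ∀ z, 0 ≤ a z) (hai : Integrable a)
    (ha : ∀ z (β : Fin n → ℂ), ‖∑ k, β k * starRingEnd ℂ (Dt ω k g z)‖ ^ 2 ≤ a z * levi ω z β)
    {α : Fin n → Cn n → ℂ} (hα : ∀ k, TF (α k)) :
    ‖∫ z, (∑ k, Ds ω k (α k) z) * starRingEnd ℂ (g z)‖ ^ 2 ≤
      (∫ z, a z) * (eLpNorm (fun z => ∑ k, Ds ω k (α k) z) 2).toReal ^ 2 := by
  have hs : TF fun z => ∑ k, Ds ω k (α k) z := TF.sum _ fun k _ => (hα k).Ds hω k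
  have mD : ∀ {η : Cn n → ℂ} (hη : TF η) (j : Fin n), MemLp (Ds ω j η) 2 := fun hη j =>
    (hη.Ds hω j).memLp
  have mT : ∀ {η : Cn n → ℂ} (hη : TF η) (j : Fin n), MemLp (Dt ω j η) 2 := fun hη j =>
    (hη.Dt hω j).memLp
  let K : Submodule ℂ (PiLp 2 fun _ : Fin n => L2n n) := Submodule.span ℂ
    {x | ∃ (j k : Fin n) (η : Cn n → ℂ) (hη : TF η),
      x = WithLp.toLp 2 (Pi.single k ((mD hη j).toLp _)) -
        WithLp.toLp 2 (Pi.single j ((mD hη k).toLp _))}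
  have memK : ∀ β, β ∈ Kᗮ ↔ ∀ (j k : Fin n) (η : Cn n → ℂ) (hη : TF η),
      inner ℂ ((mD hη j).toLp _) (β k) = inner ℂ ((mD hη k).toLp _) (β j) := by
    intro β
    rw [Submodule.mem_orthogonal]
    constructor
    · intro h j k η hη
      have := h _ (Submodule.subset_span ⟨j, k, η, hη, rfl⟩)
      rw [inner_sub_left, inner_single_left, inner_single_left] at this
      exact sub_eq_zero.1 this
    · intro h u hu
      induction hu using Submodule.span_induction with
      | mem x hx =>
        obtain ⟨j, k, η, hη, rfl⟩ := hx
        rw [inner_sub_left, inner_single_left, inner_single_left, h j k η hη, sub_self]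
      | zero => simp
      | add x y _ _ hx hy => rw [inner_add_left, hx, hy, add_zero]
      | smul c x _ hx => rw [inner_smul_left, hx, mul_zero]
  let Dv : ∀ h : Cn n → ℂ, TF h → PiLp 2 fun _ : Fin n => L2n n := fun h hh =>
    WithLp.toLp 2 fun k => (mT hh k).toLp _
  have hDv : ∀ h hh, Dv h hh ∈ Kᗮ := by
    intro h hh
    rw [memK]
    intro j k η hη
    simp only [Dv, inner_toLp_two]
    rw [← integral_Dt_mul_conj hω hr (hh.Dt hω k).sm hη,
      ← integral_Dt_mul_conj hω hr (hh.Dt hω j).sm hη]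
    simp only [Dt_Dt_comm hω hh.sm]
  let αv : PiLp 2 fun _ : Fin n => L2n n := WithLp.toLp 2 fun k => (hα k).memLp.toLp _
  obtain ⟨β, hβK, hβ⟩ := exists_orthogonal_part K αv
  have hproj : ∀ h hh, inner ℂ (Dv h hh) αv = inner ℂ (Dv h hh) β := fun h hh => hβ _ (hDv h hh)
  have mβ : ∀ k, MemLp (β k) 2 := fun k => Lp.memLp _
  have innβ : ∀ h hh, inner ℂ (Dv h hh) β = ∑ k, ∫ z, β k z * starRingEnd ℂ (Dt ω k h z) := by
    intro h hh
    rw [PiLp.inner_apply]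
    refine Finset.sum_congr rfl fun k _ => ?_
    rw [← inner_toLp_two (mT hh k) (mβ k), Lp.toLp_coeFn]
  have innα : ∀ h hh, inner ℂ (Dv h hh) αv =
      ∫ z, (∑ k, Ds ω k (α k) z) * starRingEnd ℂ (h z) := by
    intro h hh
    rw [PiLp.inner_apply]
    simp only [Dv, αv, inner_toLp_two, Finset.sum_mul]
    rw [integral_finsetSum _ fun k _ => (TF.mul_left ((hα k).Ds hω k).sm hh.conj).integrable]
    exact Finset.sum_congr rfl fun k _ => (integral_Ds_mul_conj hω hr (hα k) hh.sm k).symm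
  rw [← innα g hg, hproj g hg, innβ g hg]
  refine pairing_weak_le hω hr hlevi hg ha0 hai ha mβ hs.memLp ?_ ?_
  · intro h hh
    have := innβ _ hh.conj
    rw [← hproj _ hh.conj, innα _ hh.conj] at this
    simp only [Complex.conj_conj, conj_Dt hω hr hh.conj.sm] at this
    exact this.symm
  · intro j k h hh
    have := (memK β).1 hβK j k _ hh.conj
    rw [← Lp.toLp_coeFn (β k) (mβ k), ← Lp.toLp_coeFn (β j) (mβ j), inner_toLp_two,
      inner_toLp_two] at this
    simpa only [Complex.conj_conj, conj_Ds hω hr hh.conj.sm] using this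

/-- Weak form of the `L²` existence theorem for `∂̄`, after conjugation by `e^{ω/2}`. -/
lemma hormander_weak (hω : Sm ω) (hr : ∀ z, starRingEnd ℂ (ω z) = ω z)
    (hlevi : ∀ z β, 0 ≤ levi ω z β) {g : Cn n → ℂ} (hg : TF g) {a : Cn n → ℝ}
    (ha0 : ∀ z, 0 ≤ a z) (hai : Integrable a)
    (ha : ∀ z (β : Fin n → ℂ), ‖∑ k, β k * starRingEnd ℂ (Dt ω k g z)‖ ^ 2 ≤ a z * levi ω z β) :
    ∃ u : Cn n → ℂ, MemLp u 2 ∧ ∫⁻ z, ‖u z‖ₑ ^ 2 ≤ ENNReal.ofReal (∫ z, a z) ∧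
      ∀ k, ∀ η : Cn n → ℂ, TF η → ∫ z, (g z - u z) * starRingEnd ℂ (Ds ω k η z) = 0 := by
  have tS : ∀ {α : Fin n → Cn n → ℂ}, (∀ k, TF (α k)) → TF fun z => ∑ k, Ds ω k (α k) z :=
    fun hα => TF.sum _ fun k _ => (hα k).Ds hω k
  have hA : 0 ≤ ∫ z, a z := integral_nonneg ha0
  let S : Submodule ℂ (L2n n) :=
    { carrier := {x | ∃ α : Fin n → Cn n → ℂ, (∀ k, TF (α k)) ∧
        x =ᵐ[volume] fun z => ∑ k, Ds ω k (α k) z}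
      zero_mem' := by
        refine ⟨fun _ _ => 0, fun _ => TF.zero, ?_⟩
        filter_upwards [Lp.coeFn_zero ℂ 2 (volume : Measure (Cn n))] with z _
        simp [Ds_zero]
      add_mem' := by
        rintro x y ⟨α, hα, hx⟩ ⟨α', hα', hy⟩
        refine ⟨fun k z => α k z + α' k z, fun k => (hα k).add (hα' k), ?_⟩
        filter_upwards [Lp.coeFn_add x y, hx, hy] with z hz h1 h2
        simp only [hz, Pi.add_apply, h1, h2, Ds_add (hα _).sm (hα' _).sm, Finset.sum_add_distrib]
      smul_mem' := by
        rintro c x ⟨α, hα, hx⟩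
        refine ⟨fun k z => c * α k z, fun k => TF.mul_left contDiff_const (hα k), ?_⟩
        filter_upwards [Lp.coeFn_smul c x, hx] with z hz h1
        simp only [hz, Pi.smul_apply, smul_eq_mul, h1, Ds_const_mul (hα _).sm, Finset.mul_sum] }
  let gL : L2n n := hg.memLp.toLp g
  obtain ⟨u, hub, hperp⟩ := exists_representative S gL hA (by
    rintro x ⟨α, hα, hx⟩
    have e : x = (tS hα).memLp.toLp _ := Lp.ext (hx.trans (MemLp.coeFn_toLp _).symm)
    simp only [gL]
    rw [e, inner_toLp_two, norm_toLp_two_sq]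
    exact pairing_sum_Ds_le hω hr hlevi hg ha0 hai ha hα)
  have mu : MemLp u 2 := Lp.memLp u
  refine ⟨u, mu, ?_, fun k η hη => ?_⟩
  · rw [← eLpNorm_two_sq]
    have : eLpNorm u 2 = ENNReal.ofReal ‖u‖ := by
      rw [Lp.norm_def, ENNReal.ofReal_toReal mu.2.ne]
    rw [this, ← ENNReal.ofReal_pow (norm_nonneg _)]
    exact ENNReal.ofReal_le_ofReal hub
  · have hT : ∀ j, TF (Pi.single (M := fun _ => Cn n → ℂ) k η j) := by
      intro j
      by_cases h : j = k
      · subst h; simpa using hη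
      · rw [Pi.single_eq_of_ne h]; exact TF.zero
    have e : (fun z => ∑ j, Ds ω j (Pi.single (M := fun _ => Cn n → ℂ) k η j) z) = Ds ω k η := by
      funext z
      rw [Finset.sum_eq_single k]
      · simp
      · intro b _ hb
        rw [Pi.single_eq_of_ne hb]; exact Ds_zero b z
      · simp
    have hmem : (hη.Ds hω k).memLp.toLp _ ∈ S :=
      ⟨_, hT, by rw [e]; exact MemLp.coeFn_toLp _⟩
    have := hperp _ hmem
    rw [← Lp.toLp_coeFn u mu, show gL - mu.toLp u = (hg.memLp.sub mu).toLp _ from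
      (MemLp.toLp_sub _ _).symm, inner_toLp_two] at this
    exact this

end twisted

end

section

/-- The Cauchy–Riemann equations. -/
lemma differentiableAt_of_dbar_eq_zero {f : Cn n → ℂ} {z : Cn n} (hf : DifferentiableAt ℝ f z)
    (h : ∀ k, dbar k f z = 0) : DifferentiableAt ℂ f z := by
  rw [differentiableAt_iff_restrictScalars ℝ hf]
  set L := fderiv ℝ f z with hL
  have hI : ∀ k, L (Pi.single k Complex.I) = Complex.I * L (Pi.single k 1) := by
    intro k
    have hk := h k
    rw [dbar, wirt, mul_eq_zero] at hk
    have h0 : L (Pi.single k 1) + Complex.I * L (Pi.single k Complex.I) = 0 :=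
      hk.resolve_left (by norm_num)
    linear_combination (-Complex.I) * h0 + L (Pi.single k Complex.I) * Complex.I_mul_I
  have hs : ∀ k (c : ℂ), L (Pi.single k c) = c * L (Pi.single k 1) := by
    intro k c
    have e : (Pi.single k c : Cn n) = c.re • (Pi.single k 1 : Cn n) +
        c.im • (Pi.single k Complex.I : Cn n) := by
      rw [← Pi.single_smul, ← Pi.single_smul, ← Pi.single_add]
      congr 1
      simp [Complex.re_add_im]
    conv_lhs => rw [e, map_add, map_smul, map_smul, hI]
    conv_rhs => rw [← Complex.re_add_im c]
    simp only [Complex.real_smul]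
    ring
  refine ⟨∑ k, (L (Pi.single k 1)) • ContinuousLinearMap.proj (R := ℂ) (φ := fun _ : Fin n => ℂ) k, ?_⟩
  ext v
  have hv : v = ∑ k, Pi.single k (v k) := (Finset.univ_sum_single v).symm
  conv_rhs => rw [hv, map_sum]
  simp only [hs _ (v _)]
  simp [mul_comm]

/-- Weyl's lemma. -/
theorem weyl {G : Cn n → ℂ} {R : ℝ} (hR : 0 < R) (hGm : ∀ r, MemLp ((Metric.ball (0 : Cn n) r).indicator G) 2)
    (hG : ∀ k, ∀ ξ : Cn n → ℂ, TF ξ → ∫ z, G z * dbar k ξ z = 0) :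
    ∃ F : Cn n → ℂ, DifferentiableOn ℂ F (Metric.ball 0 R) ∧
      ∀ᵐ z, z ∈ Metric.ball (0 : Cn n) R → G z = F z := by
  set G₁ := (Metric.ball (0 : Cn n) (8 * R + 2)).indicator G with hG₁
  have m1 : MemLp G₁ 2 := hGm _
  have i1 : Integrable G₁ := by
    have : IsFiniteMeasure (volume.restrict (Metric.ball (0 : Cn n) (8 * R + 2))) :=
      isFiniteMeasure_restrict.2 measure_ball_lt_top.ne
    have h := (m1.restrict (Metric.ball (0 : Cn n) (8 * R + 2))).integrable (by norm_num)
    refine (integrableOn_iff_integrable_of_support_subset ?_).1 h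
    exact Set.support_indicator_subset
  have hol : ∀ δ, 0 < δ → δ < 1 →
      DifferentiableOn ℂ (mf δ G₁) (Metric.ball 0 (8 * R + 1)) := by
    intro δ hδ hδ1 z hz
    refine (differentiableAt_of_dbar_eq_zero
      ((sm_mf hδ i1.locallyIntegrable).differentiable z) fun k => ?_).differentiableWithinAt
    rw [dbar, wirt_mf hδ i1.locallyIntegrable]
    have hk := hG k _ ((tf_molC hδ).comp_sub z)
    simp only [dbar, wirt_comp_sub _ _ (sm_molC δ), mul_neg, integral_neg, neg_eq_zero] at hk
    rw [← hk]
    congr 1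
    funext y
    by_cases hy : y ∈ Metric.ball (0 : Cn n) (8 * R + 2)
    · rw [hG₁, Set.indicator_of_mem hy]
    · have : wirt Complex.I k (molC δ) (z - y) = 0 := by
        have hts : z - y ∉ tsupport (molC δ : Cn n → ℂ) := by
          intro hmem
          have hsub : tsupport (molC δ : Cn n → ℂ) ⊆ Metric.closedBall 0 δ := by
            refine closure_minimal (fun x hx => ?_) Metric.isClosed_closedBall
            rw [Metric.mem_closedBall, dist_zero_right]
            by_contra hlt
            push Not at hlt
            exact hx (by simp [molC, mol_eq_zero hδ hlt.le])
          have h1 := hsub hmem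
          rw [Metric.mem_closedBall, dist_zero_right] at h1
          rw [mem_ball_zero_iff] at hz
          rw [mem_ball_zero_iff, not_lt] at hy
          have := norm_sub_norm_le y z
          rw [norm_sub_rev] at this
          linarith
        have h0 : fderiv ℝ (molC δ : Cn n → ℂ) (z - y) = 0 :=
          image_eq_zero_of_notMem_tsupport fun h' => hts (tsupport_fderiv_subset ℝ h')
        simp [wirt, h0]
      rw [this, mul_zero, mul_zero]
  have hL2 : ∀ δ, 0 < δ → eLpNorm (mf δ G₁) 2 ≤ eLpNorm G₁ 2 := by
    intro δ hδ
    rw [← eLpNorm_norm G₁]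
    refine eLpNorm_le_of_kernel hδ m1.1.norm fun z => ?_
    refine (enorm_integral_le_lintegral_enorm _).trans (le_of_eq ?_)
    refine lintegral_congr fun y => ?_
    rw [enorm_mul, enorm_molC, enorm_norm, mul_comm]
  obtain ⟨C, hC⟩ := exists_sup_le_L2 (n := n) (R' := 8 * R) (R := 8 * R + 1) (by linarith)
  set δs : ℕ → ℝ := fun k => 1 / ((k : ℝ) + 2) with hδs
  have hδ0 : ∀ k, 0 < δs k := fun k => by positivity
  have hδ1 : ∀ k, δs k < 1 := fun k => by
    rw [hδs, div_lt_one (by positivity)]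
    have : (0:ℝ) ≤ k := Nat.cast_nonneg k
    linarith
  have hδt : Tendsto δs atTop (𝓝[>] 0) := by
    refine tendsto_nhdsWithin_iff.2 ⟨?_, Eventually.of_forall hδ0⟩
    have h := tendsto_one_div_add_atTop_nhds_zero_nat (𝕜 := ℝ)
    have h2 := (tendsto_add_atTop_iff_nat 1).2 h
    refine h2.congr fun k => ?_
    simp only [hδs]; push_cast; ring
  have hbd : ∀ k, ∀ z ∈ Metric.ball (0 : Cn n) (8 * R),
      ‖mf (δs k) G₁ z‖ ≤ √((C * (eLpNorm G₁ 2) ^ 2 : ℝ≥0∞)).toReal := by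
    intro k z hz
    refine Real.le_sqrt_of_sq_le ?_
    have h1 := hC _ (hol _ (hδ0 k) (hδ1 k)) z hz
    have h2 : ∫⁻ y in Metric.ball 0 (8 * R + 1), ‖mf (δs k) G₁ y‖ₑ ^ 2 ≤ (eLpNorm G₁ 2) ^ 2 := by
      refine (setLIntegral_le_lintegral _ _).trans ?_
      rw [← eLpNorm_two_sq]
      gcongr
      exact hL2 _ (hδ0 k)
    have h3 := h1.trans (mul_le_mul_right h2 (C : ℝ≥0∞))
    have h4 : (C * (eLpNorm G₁ 2) ^ 2 : ℝ≥0∞) ≠ ⊤ :=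
      ENNReal.mul_ne_top ENNReal.coe_ne_top (ENNReal.pow_ne_top m1.2.ne)
    have h5 := ENNReal.toReal_mono h4 h3
    simpa [ENNReal.toReal_pow] using h5
  obtain ⟨φ, F, ε, hφ, hF, hε, hu⟩ := montel (R := 8 * R) (by positivity)
    (fun k => (hol _ (hδ0 k) (hδ1 k)).mono (Metric.ball_subset_ball (by linarith))) hbd
  rw [show 8 * R / 8 = R by ring] at hF hu
  refine ⟨F, hF, ?_⟩
  have hFi : LocallyIntegrableOn F (Metric.ball 0 R) :=
    hF.continuousOn.locallyIntegrableOn Metric.isOpen_ball.measurableSet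
  have hli : LocallyIntegrableOn (fun z => G₁ z - F z) (Metric.ball 0 R) :=
    (i1.locallyIntegrable.locallyIntegrableOn _).sub hFi
  have hae := Metric.isOpen_ball.ae_eq_zero_of_integral_contDiff_smul_eq_zero hli ?_
  · filter_upwards [hae] with z hz hzR
    have := hz hzR
    rw [sub_eq_zero] at this
    rw [← this, hG₁, Set.indicator_of_mem]
    exact Metric.ball_subset_ball (by linarith) hzR
  · intro p hp hpc hpR
    set q : Cn n → ℂ := fun z => (p z : ℂ) with hq
    have tq : TF q := ⟨Complex.ofRealCLM.contDiff.comp hp,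
      hpc.comp_left (g := fun x : ℝ => (x : ℂ)) (by simp)⟩
    have q0 : ∀ z, z ∉ Metric.ball (0 : Cn n) R → q z = 0 := fun z hz => by
      simp [hq, image_eq_zero_of_notMem_tsupport fun h => hz (hpR h)]
    have hFq : Integrable fun z => F z * q z := by
      have hco : Continuous fun z => F z * q z := by
        rw [continuous_iff_continuousAt]
        intro z
        by_cases hz : z ∈ tsupport p
        · exact (hF.continuousOn.continuousAt (Metric.isOpen_ball.mem_nhds (hpR hz))).mul
            tq.sm.continuous.continuousAt
        · have : (fun z => F z * q z) =ᶠ[𝓝 z] fun _ => 0 := by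
            filter_upwards [(isClosed_tsupport p).isOpen_compl.mem_nhds hz] with y hy
            simp [hq, image_eq_zero_of_notMem_tsupport hy]
          exact continuousAt_const.congr this.symm
      exact hco.integrable_of_hasCompactSupport tq.cs.mul_left
    have l1 : Tendsto (fun k => ∫ z, mf (δs (φ k)) G₁ z * q z) atTop (𝓝 (∫ z, G₁ z * q z)) :=
      (tendsto_integral_mf_mul i1 tq).comp (hδt.comp hφ.tendsto_atTop)
    have l2 : Tendsto (fun k => ∫ z, mf (δs (φ k)) G₁ z * q z) atTop (𝓝 (∫ z, F z * q z)) := by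
      rw [tendsto_iff_norm_sub_tendsto_zero]
      refine squeeze_zero (fun _ => norm_nonneg _) (g := fun k => ε k * ∫ z, ‖q z‖) (fun k => ?_)
        (by simpa using hε.mul_const _)
      have hmi : Integrable fun z => mf (δs (φ k)) G₁ z * q z :=
        (TF.mul_left (sm_mf (hδ0 _) i1.locallyIntegrable) tq).integrable
      rw [← integral_sub hmi hFq, ← integral_const_mul]
      refine norm_integral_le_of_norm_le (tq.integrable.norm.const_mul _)
        (Eventually.of_forall fun z => ?_)
      rw [← sub_mul, norm_mul]
      by_cases hz : z ∈ Metric.ball (0 : Cn n) R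
      · gcongr; exact hu k z hz
      · simp [q0 z hz]
    have heq := tendsto_nhds_unique l1 l2
    have hGq : Integrable fun z => G₁ z * q z := m1.integrable_mul_tf tq
    have : (fun z => p z • (G₁ z - F z)) = fun z => G₁ z * q z - F z * q z := by
      funext z; simp only [hq, Complex.real_smul]; ring
    rw [this, integral_sub hGq hFq, heq, sub_self]

section twisted
variable {ω : Cn n → ℂ}

lemma sm_exp (hω : Sm ω) (c : ℂ) : Sm fun z => Complex.exp (c * ω z) :=
  Complex.contDiff_exp.comp (contDiff_const.mul hω)

lemma wirt_exp (hω : Sm ω) (c d : ℂ) (k : Fin n) (z : Cn n) :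
    wirt d k (fun z => Complex.exp (c * ω z)) z = c * wirt d k ω z * Complex.exp (c * ω z) := by
  have h : HasFDerivAt (fun z => Complex.exp (c * ω z))
      (Complex.exp (c * ω z) • (c • fderiv ℝ ω z)) z :=
    ((hω.differentiable z).hasFDerivAt.const_mul c).cexp
  simp only [wirt, h.fderiv, smul_apply, smul_eq_mul]
  ring

/-- The `L²` existence theorem for `∂̄`, after conjugation by `e^{ω/2}`. -/
theorem hormander (hω : Sm ω) (hr : ∀ z, starRingEnd ℂ (ω z) = ω z)
    (hlevi : ∀ z β, 0 ≤ levi ω z β) {g : Cn n → ℂ} (hg : TF g) {a : Cn n → ℝ}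
    (ha0 : ∀ z, 0 ≤ a z) (hai : Integrable a)
    (ha : ∀ z (β : Fin n → ℂ), ‖∑ k, β k * starRingEnd ℂ (Dt ω k g z)‖ ^ 2 ≤ a z * levi ω z β)
    {R : ℝ} (hR : 0 < R) :
    ∃ F : Cn n → ℂ, DifferentiableOn ℂ F (Metric.ball 0 R) ∧
      ∫⁻ z in Metric.ball (0 : Cn n) R, ‖g z - Complex.exp (-(1 / 2) * ω z) * F z‖ₑ ^ 2 ≤
        ENNReal.ofReal (∫ z, a z) := by
  obtain ⟨u, hu, hub, huw⟩ := hormander_weak hω hr hlevi hg ha0 hai ha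
  set G : Cn n → ℂ := fun z => Complex.exp ((1 / 2) * ω z) * (g z - u z) with hG
  have hgu : MemLp (fun z => g z - u z) 2 := hg.memLp.sub hu
  have hGm : ∀ r, MemLp ((Metric.ball (0 : Cn n) r).indicator G) 2 := by
    intro r
    obtain ⟨C, hC⟩ := (isCompact_closedBall (0 : Cn n) r).exists_bound_of_continuousOn
      (sm_exp hω (1 / 2)).continuous.continuousOn
    refine MemLp.of_le_mul (c := max C 0) hgu (((sm_exp hω (1 / 2)).continuous.aestronglyMeasurable.mul
      hgu.1).indicator measurableSet_ball) (Eventually.of_forall fun z => ?_)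
    by_cases hz : z ∈ Metric.ball (0 : Cn n) r
    · rw [Set.indicator_of_mem hz, hG, norm_mul]
      gcongr
      exact (hC z (Metric.ball_subset_closedBall hz)).trans (le_max_left _ _)
    · rw [Set.indicator_of_notMem hz, norm_zero]
      positivity
  have hGd : ∀ k, ∀ ξ : Cn n → ℂ, TF ξ → ∫ z, G z * dbar k ξ z = 0 := by
    intro k ξ hξ
    have t1 : TF fun z => Complex.exp ((1 / 2) * ω z) * ξ z := TF.mul_left (sm_exp hω _) hξ
    have h := huw k _ t1.conj
    simp only [conj_Ds hω hr t1.conj.sm, Complex.conj_conj] at h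
    rw [← neg_eq_zero, ← integral_neg, ← h]
    congr 1
    funext z
    simp only [dbar, hG, wirt_mul _ _ ((sm_exp hω _).differentiable z) (hξ.sm.differentiable z),
      wirt_exp hω]
    ring
  obtain ⟨F, hF, hae⟩ := weyl hR hGm hGd
  refine ⟨F, hF, le_trans ?_ hub⟩
  refine le_trans (le_of_eq ?_) (setLIntegral_le_lintegral (Metric.ball (0 : Cn n) R) _)
  refine setLIntegral_congr_fun_ae measurableSet_ball ?_
  filter_upwards [hae] with z hz hzR
  rw [← hz hzR, hG]
  congr 2
  rw [← mul_assoc, ← Complex.exp_add]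
  simp
end twisted

end

/-- A real function viewed as a complex one. -/
def rc (f : Cn n → ℝ) (z : Cn n) : ℂ := (f z : ℂ)

abbrev SmR (f : Cn n → ℝ) : Prop := ContDiff ℝ (⊤ : ℕ∞) f

lemma SmR.rc {f : Cn n → ℝ} (hf : SmR f) : Sm (rc f) := Complex.ofRealCLM.contDiff.comp hf

lemma conj_rc (f : Cn n → ℝ) (z : Cn n) : starRingEnd ℂ (rc f z) = rc f z := Complex.conj_ofReal _

lemma fderiv_rc {f : Cn n → ℝ} (hf : SmR f) (z v : Cn n) :
    fderiv ℝ (rc f) z v = (fderiv ℝ f z v : ℂ) := by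
  have h : fderiv ℝ (rc f) z = Complex.ofRealCLM.comp (fderiv ℝ f z) :=
    (Complex.ofRealCLM.hasFDerivAt.comp z (hf.differentiable (by simp) z).hasFDerivAt).fderiv
  rw [h]; rfl

lemma conj_del_rc {f : Cn n → ℝ} (hf : SmR f) (k : Fin n) (z : Cn n) :
    starRingEnd ℂ (del k (rc f) z) = dbar k (rc f) z := by
  have := wirt_conj Complex.I k (hf.rc.differentiable z)
  simp only [conj_rc, Complex.conj_I] at this
  exact this.symm

lemma wirt_rc_comp {h : ℝ → ℝ} (hh : Differentiable ℝ h) {f : Cn n → ℝ} (hf : SmR f) (c : ℂ)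
    (k : Fin n) (z : Cn n) :
    wirt c k (rc fun z => h (f z)) z = rc (fun z => deriv h (f z)) z * wirt c k (rc f) z := by
  have h1 : HasFDerivAt (rc fun z => h (f z))
      (Complex.ofRealCLM.comp (deriv h (f z) • fderiv ℝ f z)) z :=
    Complex.ofRealCLM.hasFDerivAt.comp z
      ((hh (f z)).hasDerivAt.comp_hasFDerivAt z (hf.differentiable (by simp) z).hasFDerivAt)
  simp only [wirt, h1.fderiv, fderiv_rc hf, ContinuousLinearMap.comp_apply, smul_apply,
    Complex.ofRealCLM_apply, smul_eq_mul, rc]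
  push_cast
  ring

lemma wirt_congr {c : ℂ} {k : Fin n} {f g : Cn n → ℂ} {z : Cn n} (h : f =ᶠ[𝓝 z] g) :
    wirt c k f =ᶠ[𝓝 z] wirt c k g := by
  filter_upwards [h.fderiv (𝕜 := ℝ)] with y hy
  simp only [wirt, hy]

lemma levi_congr {f g : Cn n → ℂ} {z : Cn n} (h : f =ᶠ[𝓝 z] g) (β : Fin n → ℂ) :
    levi f z β = levi g z β := by
  simp only [levi]
  congr 1
  refine Finset.sum_congr rfl fun j _ => Finset.sum_congr rfl fun k _ => ?_
  have := (wirt_congr (c := Complex.I) (k := k)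
    (wirt_congr (c := -Complex.I) (k := j) h)).eq_of_nhds
  simp only [dbar, del]
  rw [this]

lemma levi_add {f g : Cn n → ℂ} (hf : Sm f) (hg : Sm g) (z : Cn n) (β : Fin n → ℂ) :
    levi (fun z => f z + g z) z β = levi f z β + levi g z β := by
  simp only [levi, ← Complex.add_re, ← Finset.sum_add_distrib]
  congr 1
  refine Finset.sum_congr rfl fun j _ => Finset.sum_congr rfl fun k _ => ?_
  have e : del j (fun z => f z + g z) = fun z => del j f z + del j g z := by
    funext z; exact wirt_add _ _ (hf.differentiable z) (hg.differentiable z)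
  rw [e]
  simp only [dbar]
  rw [wirt_add _ _ ((hf.wirt _ _).differentiable z) ((hg.wirt _ _).differentiable z)]
  ring

lemma SmR.comp1 {h : ℝ → ℝ} (hh : ContDiff ℝ (⊤ : ℕ∞) h) {f : Cn n → ℝ} (hf : SmR f) :
    SmR fun z => h (f z) := hh.comp hf

lemma contDiff_deriv_top {h : ℝ → ℝ} (hh : ContDiff ℝ (⊤ : ℕ∞) h) :
    ContDiff ℝ (⊤ : ℕ∞) (deriv h) :=
  (contDiff_infty_iff_deriv.1 hh).2

lemma levi_rc_comp {h : ℝ → ℝ} (hh : ContDiff ℝ (⊤ : ℕ∞) h) {f : Cn n → ℝ} (hf : SmR f)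
    (z : Cn n) (β : Fin n → ℂ) :
    levi (rc fun z => h (f z)) z β =
      deriv (deriv h) (f z) * ‖∑ j, β j * del j (rc f) z‖ ^ 2 + deriv h (f z) * levi (rc f) z β := by
  have h1 := contDiff_deriv_top hh
  have hd : Differentiable ℝ h := hh.differentiable (by simp)
  have hd1 : Differentiable ℝ (deriv h) := h1.differentiable (by simp)
  have e : ∀ j k, dbar k (del j (rc fun z => h (f z))) z =
      ((deriv (deriv h) (f z) : ℝ) : ℂ) * (dbar k (rc f) z * del j (rc f) z) +
        ((deriv h (f z) : ℝ) : ℂ) * dbar k (del j (rc f)) z := by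
    intro j k
    have e1 : del j (rc fun z => h (f z)) = fun z => rc (fun z => deriv h (f z)) z * del j (rc f) z :=
      funext fun z => wirt_rc_comp hd hf _ _ z
    rw [e1, dbar, wirt_mul _ _ ((SmR.comp1 h1 hf).rc.differentiable z)
      ((hf.rc.wirt _ _).differentiable z), wirt_rc_comp hd1 hf]
    simp only [rc]; ring
  have e2 : (∑ j, ∑ k, dbar k (del j (rc fun z => h (f z))) z * (β j * starRingEnd ℂ (β k))) =
      ((deriv (deriv h) (f z) : ℝ) : ℂ) * ((∑ j, β j * del j (rc f) z) *
        starRingEnd ℂ (∑ j, β j * del j (rc f) z)) +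
      ((deriv h (f z) : ℝ) : ℂ) * ∑ j, ∑ k, dbar k (del j (rc f)) z * (β j * starRingEnd ℂ (β k)) := by
    simp only [map_sum, map_mul, conj_del_rc hf]
    rw [Finset.sum_mul_sum]
    simp only [Finset.mul_sum, ← Finset.sum_add_distrib]
    refine Finset.sum_congr rfl fun j _ => Finset.sum_congr rfl fun k _ => ?_
    rw [e]; ring
  rw [levi, e2, Complex.mul_conj, Complex.add_re, Complex.re_ofReal_mul, Complex.re_ofReal_mul,
    Complex.ofReal_re, Complex.normSq_eq_norm_sq, levi]

lemma wirt_coord (c : ℂ) (k i : Fin n) (z : Cn n) :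
    wirt c k (fun z => z i) z = if i = k then (1 / 2) * (1 + c * Complex.I) else 0 := by
  have h : fderiv ℝ (fun z : Cn n => z i) z =
      ContinuousLinearMap.proj (R := ℝ) (φ := fun _ : Fin n => ℂ) i :=
    (ContinuousLinearMap.proj (R := ℝ) (φ := fun _ : Fin n => ℂ) i).hasFDerivAt.fderiv
  simp only [wirt, h, ContinuousLinearMap.proj_apply]
  split_ifs with hik
  · subst hik; simp
  · simp [Pi.single_eq_of_ne hik]

lemma sm_coord (i : Fin n) : Sm fun z : Cn n => z i := contDiff_apply ℝ ℂ i

lemma wirt_sum (c : ℂ) (k : Fin n) {ι : Type*} (s : Finset ι) {f : ι → Cn n → ℂ}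
    (hf : ∀ i, Sm (f i)) (z : Cn n) :
    wirt c k (fun z => ∑ i ∈ s, f i z) z = ∑ i ∈ s, wirt c k (f i) z := by
  simp only [wirt]
  rw [fderiv_fun_sum fun i _ => (hf i).differentiable z]
  simp only [_root_.sum_apply, Finset.mul_sum, Finset.sum_add_distrib, mul_add]

lemma del_nsq (j : Fin n) : del j (rc (nsq : Cn n → ℝ)) = fun z => starRingEnd ℂ (z j) := by
  have e : rc (nsq : Cn n → ℝ) = fun z => ∑ i, z i * starRingEnd ℂ (z i) := by
    funext z
    simp only [rc, nsq, Complex.ofReal_sum, Complex.mul_conj]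
  funext z
  rw [e, del, wirt_sum _ _ _ fun i => ContDiff.mul (sm_coord i) (sm_coord i).conj]
  rw [Finset.sum_eq_single j]
  · rw [wirt_mul _ _ ((sm_coord j).differentiable z) ((sm_coord j).conj.differentiable z),
      wirt_conj _ _ ((sm_coord j).differentiable z), wirt_coord, wirt_coord]
    simp
    ring
  · intro i _ hi
    rw [wirt_mul _ _ ((sm_coord i).differentiable z) ((sm_coord i).conj.differentiable z),
      wirt_conj _ _ ((sm_coord i).differentiable z), wirt_coord, wirt_coord]
    simp [hi]
  · simp

lemma levi_nsq (z : Cn n) (β : Fin n → ℂ) : levi (rc (nsq : Cn n → ℝ)) z β = nsq β := by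
  rw [levi, nsq, Complex.re_sum]
  refine Finset.sum_congr rfl fun j _ => ?_
  rw [Finset.sum_eq_single j]
  · rw [del_nsq, dbar, wirt_conj _ _ ((sm_coord j).differentiable z), wirt_coord]
    simp [Complex.mul_conj]
    ring
  · intro k _ hk
    rw [del_nsq, dbar, wirt_conj _ _ ((sm_coord j).differentiable z), wirt_coord]
    simp [hk.symm]
  · simp

lemma norm_mul_norm_le_nsq (β : Fin n → ℂ) (j k : Fin n) : ‖β j‖ * ‖β k‖ ≤ nsq β := by
  have h : ∀ i, ‖β i‖ ≤ ‖β‖ := fun i => norm_le_pi_norm β i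
  calc ‖β j‖ * ‖β k‖ ≤ ‖β‖ * ‖β‖ := mul_le_mul (h j) (h k) (norm_nonneg _) (norm_nonneg _)
    _ = ‖β‖ ^ 2 := by ring
    _ ≤ nsq β := norm_sq_le_nsq (n := n) β

lemma TF.exists_levi_ge {f : Cn n → ℂ} (hf : TF f) :
    ∃ C : ℝ, 0 ≤ C ∧ ∀ z β, -(C * nsq β) ≤ levi f z β := by
  have hb : ∀ j k, ∃ B : ℝ, ∀ z, ‖dbar k (del j f) z‖ ≤ B := fun j k =>
    ((hf.wirt _ j).wirt _ k).sm.continuous.bounded_above_of_compact_support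
      ((hf.wirt _ j).wirt _ k).cs
  choose B hB using hb
  have hB0 : ∀ j k, 0 ≤ B j k := fun j k => (norm_nonneg _).trans (hB j k 0)
  refine ⟨∑ j, ∑ k, B j k, Finset.sum_nonneg fun j _ => Finset.sum_nonneg fun k _ => hB0 j k,
    fun z β => ?_⟩
  have h1 : ‖∑ j, ∑ k, dbar k (del j f) z * (β j * starRingEnd ℂ (β k))‖ ≤
      (∑ j, ∑ k, B j k) * nsq β := by
    simp only [Finset.sum_mul]
    refine (norm_sum_le _ _).trans (Finset.sum_le_sum fun j _ => (norm_sum_le _ _).trans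
      (Finset.sum_le_sum fun k _ => ?_))
    rw [norm_mul, norm_mul, RCLike.norm_conj]
    exact mul_le_mul (hB j k z) (norm_mul_norm_le_nsq β j k) (by positivity) (hB0 j k)
  have h2 := Complex.abs_re_le_norm (∑ j, ∑ k, dbar k (del j f) z * (β j * starRingEnd ℂ (β k)))
  have h3 := neg_abs_le (∑ j, ∑ k, dbar k (del j f) z * (β j * starRingEnd ℂ (β k))).re
  rw [levi]; linarith

lemma Dt_exp_mul {ω f : Cn n → ℂ} (hω : Sm ω) (hf : Sm f) (k : Fin n) (z : Cn n) :
    Dt ω k (fun z => Complex.exp (-(1 / 2) * ω z) * f z) z =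
      Complex.exp (-(1 / 2) * ω z) * dbar k f z := by
  simp only [Dt, dbar, wirt_mul _ _ ((sm_exp hω _).differentiable z) (hf.differentiable z),
    wirt_exp hω]
  ring

section

/-- A smooth cutoff that is `1` where `|z|² ≤ (a - 1) ρ` and `0` where `|z|² ≥ a ρ`. -/
def cut (a ρ : ℝ) (z : Cn n) : ℝ := Real.smoothTransition (a - nsq z / ρ)

lemma smR_cut (a ρ : ℝ) : SmR (cut a ρ : Cn n → ℝ) :=
  Real.smoothTransition.contDiff.comp (contDiff_const.sub (contDiff_nsq.div_const ρ))

lemma cut_eq_one {a ρ : ℝ} (hρ : 0 < ρ) {z : Cn n} (hz : nsq z ≤ (a - 1) * ρ) : cut a ρ z = 1 :=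
  Real.smoothTransition.one_of_one_le (by
    have : nsq z / ρ ≤ a - 1 := (div_le_iff₀ hρ).2 hz
    linarith)

lemma cut_eq_zero {a ρ : ℝ} (hρ : 0 < ρ) {z : Cn n} (hz : a * ρ ≤ nsq z) : cut a ρ z = 0 :=
  Real.smoothTransition.zero_of_nonpos (by
    have : a ≤ nsq z / ρ := (le_div_iff₀ hρ).2 hz
    linarith)

lemma cut_nonneg (a ρ : ℝ) (z : Cn n) : 0 ≤ cut a ρ z := Real.smoothTransition.nonneg _

lemma cut_le_one (a ρ : ℝ) (z : Cn n) : cut a ρ z ≤ 1 := Real.smoothTransition.le_one _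

lemma hasCompactSupport_cut {a ρ : ℝ} (hρ : 0 < ρ) : HasCompactSupport (cut a ρ : Cn n → ℝ) := by
  refine HasCompactSupport.of_support_subset_isCompact
    (isCompact_closedBall (0 : Cn n) (Real.sqrt (a * ρ))) fun z hz => ?_
  rw [mem_closedBall_zero_iff]
  refine Real.le_sqrt_of_sq_le ((norm_sq_le_nsq z).trans ?_)
  by_contra! h
  exact hz (cut_eq_zero hρ h.le)

lemma dbar_cut_eq_zero (k : Fin n) {a ρ : ℝ} (hρ : 0 < ρ) {z : Cn n}
    (hz : nsq z ≤ (a - 1) * ρ ∨ a * ρ ≤ nsq z) : dbar k (rc (cut a ρ)) z = 0 := by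
  have h0 : fderiv ℝ (cut a ρ) z = 0 := by
    rcases hz with hz | hz
    · refine IsLocalMax.fderiv_eq_zero (Eventually.of_forall fun y => ?_)
      rw [cut_eq_one hρ hz]; exact cut_le_one _ _ _
    · refine IsLocalMin.fderiv_eq_zero (Eventually.of_forall fun y => ?_)
      rw [cut_eq_zero hρ hz]; exact cut_nonneg _ _ _
  simp [dbar, wirt, fderiv_rc (smR_cut a ρ), h0]

lemma TF.rc_mul_cut {a ρ : ℝ} (hρ : 0 < ρ) {f : Cn n → ℂ} (hf : Sm f) :
    TF fun z => rc (cut a ρ) z * f z :=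
  ⟨ContDiff.mul (smR_cut a ρ).rc hf,
    ((hasCompactSupport_cut hρ).comp_left (g := Complex.ofReal) Complex.ofReal_zero).mul_right⟩

lemma norm_sum_mul_conj_sq_le (β x : Fin n → ℂ) :
    ‖∑ k, β k * starRingEnd ℂ (x k)‖ ^ 2 ≤ (∑ k, ‖x k‖ ^ 2) * nsq β := by
  have h1 : ‖∑ k, β k * starRingEnd ℂ (x k)‖ ≤ ∑ k, ‖β k‖ * ‖x k‖ := by
    refine (norm_sum_le _ _).trans (le_of_eq ?_)
    simp
  have h2 := Finset.sum_mul_sq_le_sq_mul_sq Finset.univ (fun k => ‖β k‖) fun k => ‖x k‖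
  have h3 : nsq β = ∑ k, ‖β k‖ ^ 2 := by simp [nsq, Complex.normSq_eq_norm_sq]
  rw [h3, mul_comm]
  exact (pow_le_pow_left₀ (norm_nonneg _) h1 2).trans h2

section core

variable {ρ : ℝ} {u v : Cn n → ℝ} {κ χ : ℝ → ℝ}

/-- The exponential bump weight. -/
def expw (N ρ : ℝ) (z : Cn n) : ℝ := Real.exp (N * (nsq z / ρ - 1))

lemma smR_expw (N ρ : ℝ) : SmR (expw N ρ : Cn n → ℝ) :=
  Real.contDiff_exp.comp (contDiff_const.mul ((contDiff_nsq.div_const ρ).sub contDiff_const))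

lemma levi_expw_ge {N : ℝ} (hN : 0 ≤ N) (hρ : 0 < ρ) (z : Cn n) (β : Fin n → ℂ) :
    N / ρ * expw N ρ z * nsq β ≤ levi (rc (expw N ρ)) z β := by
  have hh : ContDiff ℝ (⊤ : ℕ∞) fun x : ℝ => Real.exp (N * (x / ρ - 1)) :=
    Real.contDiff_exp.comp (contDiff_const.mul ((contDiff_id.div_const ρ).sub contDiff_const))
  have hd : deriv (fun x : ℝ => Real.exp (N * (x / ρ - 1))) =
      fun x => N / ρ * Real.exp (N * (x / ρ - 1)) := by
    funext x
    have h1 : HasDerivAt (fun x : ℝ => N * (x / ρ - 1)) (N * (1 / ρ)) x :=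
      (((hasDerivAt_id x).div_const ρ).sub_const 1).const_mul N
    rw [h1.exp.deriv]; ring
  have hdd : ∀ x, 0 ≤ deriv (deriv fun x : ℝ => Real.exp (N * (x / ρ - 1))) x := by
    intro x
    rw [hd]
    have h1 : HasDerivAt (fun x : ℝ => N * (x / ρ - 1)) (N * (1 / ρ)) x :=
      (((hasDerivAt_id x).div_const ρ).sub_const 1).const_mul N
    rw [(h1.exp.const_mul (N / ρ)).deriv]
    positivity
  have := levi_rc_comp hh contDiff_nsq z β
  rw [show rc (expw N ρ) = rc fun z : Cn n => (fun x : ℝ => Real.exp (N * (x / ρ - 1))) (nsq z)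
    from rfl, this, levi_nsq, hd]
  have h2 := mul_nonneg (hdd (nsq z)) (sq_nonneg ‖∑ j, β j * del j (rc nsq) z‖)
  rw [hd] at h2
  simp only [expw]
  linarith

/-- Hörmander's estimate for the correction of `χ(v) F` to a holomorphic function, smooth case. -/
theorem core_smooth (hρ : 0 < ρ) (hu : SmR u) (hv : SmR v)
    (hul : ∀ z, nsq z < 4 * ρ → ∀ β, 0 ≤ levi (rc u) z β)
    (hvl : ∀ z, nsq z < 4 * ρ → ∀ β, 0 ≤ levi (rc v) z β)
    {F : Cn n → ℂ} (hF : Sm F) (hFd : ∀ z, nsq z < 4 * ρ → ∀ k, dbar k F z = 0)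
    (hκ : ContDiff ℝ (⊤ : ℕ∞) κ) (hκ1 : ∀ x, 0 ≤ deriv κ x) (hκ2 : ∀ x, 0 < deriv (deriv κ) x)
    (hχ : ContDiff ℝ (⊤ : ℕ∞) χ) {η : ℝ} (hη : 0 < η) {r : ℝ} (hr : 0 < r)
    (hrρ : ∀ z ∈ Metric.ball (0 : Cn n) r, nsq z ≤ ρ) :
    ∃ G : Cn n → ℂ, DifferentiableOn ℂ G (Metric.ball 0 r) ∧
      ∫⁻ z in Metric.ball (0 : Cn n) r,
        ‖(χ (v z) : ℂ) * F z - G z‖ₑ ^ 2 * ENNReal.ofReal (Real.exp (-(u z + κ (v z) + 1))) ≤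
      ENNReal.ofReal (η + ∫ z in {z : Cn n | nsq z < 2 * ρ},
        2 * ‖F z‖ ^ 2 * deriv χ (v z) ^ 2 / deriv (deriv κ) (v z) *
          Real.exp (-(u z + κ (v z)))) := by
  set w : Cn n → ℝ := fun z => u z + κ (v z) with hw
  have hws : SmR w := hu.add (SmR.comp1 hκ hv)
  have hwl : ∀ z, nsq z < 4 * ρ → ∀ β, deriv (deriv κ) (v z) * ‖∑ j, β j * del j (rc v) z‖ ^ 2 ≤
      levi (rc w) z β := by
    intro z hz β
    have e : rc w = fun z => rc u z + rc (fun z => κ (v z)) z := by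
      funext z; simp [rc, hw]
    rw [e, levi_add hu.rc (SmR.comp1 hκ hv).rc, levi_rc_comp hκ hv]
    have h1 := hul z hz β
    have h2 := mul_nonneg (hκ1 (v z)) (hvl z hz β)
    linarith
  -- the cut-off weight and the choice of the large parameter
  have hQ : TF fun z => rc (cut 4 ρ) z * rc w z := TF.rc_mul_cut hρ hws.rc
  obtain ⟨C, hC0, hC⟩ := hQ.exists_levi_ge
  set S : Cn n → ℝ := fun z => ∑ k, ‖dbar k (rc (cut 2 ρ)) z‖ ^ 2 with hS
  have hcut : TF (rc (cut 2 ρ) : Cn n → ℂ) := by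
    simpa using TF.rc_mul_cut (a := 2) hρ (f := fun _ : Cn n => (1 : ℂ)) contDiff_const
  have hSc : Continuous S := continuous_finsetSum _ fun k _ =>
    ((hcut.wirt _ k).sm.continuous.norm.pow 2)
  have hS0 : ∀ z, 0 ≤ S z := fun z => Finset.sum_nonneg fun k _ => sq_nonneg _
  have hSz : ∀ z, nsq z ≤ ρ ∨ 2 * ρ ≤ nsq z → S z = 0 := by
    intro z hz
    refine Finset.sum_eq_zero fun k _ => ?_
    have h : nsq z ≤ (2 - 1) * ρ ∨ 2 * ρ ≤ nsq z := by
      rwa [show (2 : ℝ) - 1 = 1 by norm_num, one_mul]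
    rw [dbar_cut_eq_zero k hρ h]
    simp
  have hSs : HasCompactSupport S := by
    refine HasCompactSupport.of_support_subset_isCompact
      (isCompact_closedBall (0 : Cn n) (Real.sqrt (2 * ρ))) fun z hz => ?_
    rw [mem_closedBall_zero_iff]
    refine Real.le_sqrt_of_sq_le ((norm_sq_le_nsq z).trans ?_)
    by_contra! h
    exact hz (hSz z (Or.inr h.le))
  set A₁ : Cn n → ℝ := fun z =>
    2 * ρ * (Real.exp (-w z) * ‖F z‖ ^ 2 * χ (v z) ^ 2) * S z with hA₁
  have hA₁i : Integrable A₁ := by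
    refine Continuous.integrable_of_hasCompactSupport ?_ hSs.mul_left
    exact (continuous_const.mul (((hws.continuous.neg.rexp).mul (hF.continuous.norm.pow 2)).mul
      ((hχ.continuous.comp hv.continuous).pow 2))).mul hSc
  have hA₁0 : ∀ z, 0 ≤ A₁ z := fun z => by have := hS0 z; positivity
  set a₂ : Cn n → ℝ := fun z => 2 * ‖F z‖ ^ 2 * deriv χ (v z) ^ 2 / deriv (deriv κ) (v z) *
          Real.exp (-w z) with ha₂
  have ha₂c : Continuous a₂ := by
    have h1 := (contDiff_deriv_top hχ).continuous.comp hv.continuous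
    have h2 := (contDiff_deriv_top (contDiff_deriv_top hκ)).continuous.comp hv.continuous
    exact (((continuous_const.mul (hF.continuous.norm.pow 2)).mul (h1.pow 2)).div h2
      fun z => (hκ2 _).ne').mul hws.continuous.neg.rexp
  have ha₂0 : ∀ z, 0 ≤ a₂ z := fun z => by have := hκ2 (v z); positivity
  set D : Set (Cn n) := {z | nsq z < 2 * ρ} with hD
  have hDm : MeasurableSet D := measurableSet_lt contDiff_nsq.continuous.measurable measurable_const
  have hDs : D ⊆ Metric.closedBall 0 (Real.sqrt (2 * ρ)) := fun z hz => by
    rw [mem_closedBall_zero_iff]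
    exact Real.le_sqrt_of_sq_le ((norm_sq_le_nsq z).trans (le_of_lt hz))
  have hA₂i : Integrable (D.indicator a₂) :=
    (integrable_indicator_iff hDm).2
      ((ha₂c.continuousOn.integrableOn_compact (isCompact_closedBall _ _)).mono_set hDs)
  obtain ⟨N, hN0, hNC, hNη⟩ : ∃ N : ℝ, 0 < N ∧ C ≤ N / ρ ∧ (∫ z, A₁ z) / N ≤ η := by
    refine ⟨max 1 (max (C * ρ) ((∫ z, A₁ z) / η)), by positivity, ?_, ?_⟩
    · rw [le_div_iff₀ hρ]
      exact (le_max_left _ _).trans (le_max_right _ _)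
    · rw [div_le_comm₀ (by positivity) hη]
      exact (le_max_right _ _).trans (le_max_right _ _)
  set W : Cn n → ℝ := fun z => cut 4 ρ z * w z + expw N ρ z with hW
  have hWs : SmR W := ((smR_cut 4 ρ).mul hws).add (smR_expw N ρ)
  have hWe : rc W = fun z => (fun z => rc (cut 4 ρ) z * rc w z) z + rc (expw N ρ) z := by
    funext z; simp [rc, hW]
  have hexp0 : ∀ z : Cn n, 0 < expw N ρ z := fun z => Real.exp_pos _
  have hexp1 : ∀ z : Cn n, ρ ≤ nsq z → 1 ≤ expw N ρ z := fun z hz => Real.one_le_exp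
    (mul_nonneg hN0.le (by have := (one_le_div hρ).2 hz; linarith))
  have hlow : ∀ z, nsq z < 3 * ρ → ∀ β, deriv (deriv κ) (v z) * ‖∑ j, β j * del j (rc v) z‖ ^ 2 +
      N / ρ * expw N ρ z * nsq β ≤ levi (rc W) z β := by
    intro z hz β
    rw [hWe, levi_add hQ.sm (smR_expw N ρ).rc]
    have e : (fun z => rc (cut 4 ρ) z * rc w z) =ᶠ[𝓝 z] rc w := by
      filter_upwards [(isOpen_lt contDiff_nsq.continuous continuous_const).mem_nhds hz] with y hy
      have hy' : nsq y < 3 * ρ := hy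
      have := cut_eq_one (a := 4) hρ (z := y) (by linarith)
      simp [rc, this]
    rw [levi_congr e]
    exact add_le_add (hwl z (by linarith) β) (levi_expw_ge hN0.le hρ z β)
  have hlevi : ∀ z β, 0 ≤ levi (rc W) z β := by
    intro z β
    by_cases hz : nsq z < 3 * ρ
    · refine le_trans ?_ (hlow z hz β)
      have := hκ2 (v z); have := hexp0 z; have := nsq_nonneg (n := n) β
      positivity
    · rw [hWe, levi_add hQ.sm (smR_expw N ρ).rc]
      have h1 := hC z β
      have h2 := levi_expw_ge hN0.le hρ z β
      have h3 : C * nsq β ≤ N / ρ * expw N ρ z * nsq β := by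
        refine mul_le_mul_of_nonneg_right ?_ (nsq_nonneg (n := n) β)
        calc C ≤ N / ρ * 1 := by simpa using hNC
          _ ≤ _ := mul_le_mul_of_nonneg_left (hexp1 z (by linarith)) (by positivity)
      linarith
  have hWlow : ∀ z, nsq z < 3 * ρ → w z ≤ W z := by
    intro z hz
    have := cut_eq_one (a := 4) hρ (z := z) (by linarith)
    simp only [hW, this]
    linarith [hexp0 z]
  set f : Cn n → ℂ := fun z => rc (fun z => χ (v z)) z * F z with hf
  have hfs : Sm f := ContDiff.mul (SmR.comp1 hχ hv).rc hF
  have hg : TF fun z => Complex.exp (-(1 / 2) * rc W z) * (rc (cut 2 ρ) z * f z) :=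
    TF.mul_left (sm_exp hWs.rc _) (TF.rc_mul_cut hρ hfs)
  have hnexp : ∀ z, ‖Complex.exp (-(1 / 2) * rc W z)‖ ^ 2 = Real.exp (-W z) := by
    intro z
    rw [Complex.norm_exp, ← Real.exp_nat_mul]
    congr 1
    simp [rc]
  have key : ∀ z (β : Fin n → ℂ), ‖∑ k, β k * starRingEnd ℂ
      (Dt (rc W) k (fun z => Complex.exp (-(1 / 2) * rc W z) * (rc (cut 2 ρ) z * f z)) z)‖ ^ 2 ≤
      (A₁ z / N + D.indicator a₂ z) * levi (rc W) z β := by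
    intro z β
    have hDt : ∀ k, Dt (rc W) k
        (fun z => Complex.exp (-(1 / 2) * rc W z) * (rc (cut 2 ρ) z * f z)) z =
        Complex.exp (-(1 / 2) * rc W z) * (dbar k (rc (cut 2 ρ)) z * f z +
          rc (cut 2 ρ) z * dbar k f z) := by
      intro k
      rw [Dt_exp_mul hWs.rc (TF.rc_mul_cut hρ hfs).sm]
      simp only [dbar]
      rw [wirt_mul _ _ (hcut.sm.differentiable z) (hfs.differentiable z)]
    by_cases hz : nsq z < 2 * ρ
    swap
    · have h0 : ∀ k, Dt (rc W) k
        (fun z => Complex.exp (-(1 / 2) * rc W z) * (rc (cut 2 ρ) z * f z)) z = 0 := by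
        intro k
        rw [hDt, dbar_cut_eq_zero _ hρ (Or.inr (not_lt.1 hz)),
          show rc (cut 2 ρ) z = 0 by simp [rc, cut_eq_zero hρ (not_lt.1 hz)]]
        ring
      simp only [h0, map_zero, mul_zero, Finset.sum_const_zero, norm_zero]
      refine le_trans (by simp) (mul_nonneg (add_nonneg (div_nonneg (hA₁0 z) hN0.le)
        (Set.indicator_nonneg (fun z _ => ha₂0 z) z)) (hlevi z β))
    have hdf : ∀ k, dbar k f z = rc (fun z => deriv χ (v z)) z * dbar k (rc v) z * F z := by
      intro k
      simp only [hf, dbar]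
      rw [wirt_mul _ _ ((SmR.comp1 hχ hv).rc.differentiable z) (hF.differentiable z),
        show wirt Complex.I k F z = 0 from hFd z (by linarith) k,
        wirt_rc_comp (hχ.differentiable (by simp)) hv]
      ring
    set X : ℂ := ∑ k, β k * starRingEnd ℂ (dbar k (rc (cut 2 ρ)) z) with hX
    set Y : ℂ := ∑ k, β k * del k (rc v) z with hY
    have hsum : ∑ k, β k * starRingEnd ℂ
      (Dt (rc W) k (fun z => Complex.exp (-(1 / 2) * rc W z) * (rc (cut 2 ρ) z * f z)) z) =
      starRingEnd ℂ (Complex.exp (-(1 / 2) * rc W z)) * starRingEnd ℂ (F z) *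
        ((χ (v z) : ℂ) * X + (cut 2 ρ z * deriv χ (v z) : ℝ) * Y) := by
      rw [hX, hY, mul_add, Finset.mul_sum, Finset.mul_sum, Finset.mul_sum, Finset.mul_sum,
        ← Finset.sum_add_distrib]
      refine Finset.sum_congr rfl fun k _ => ?_
      rw [hDt, hdf]
      simp only [map_mul, map_add, hf, conj_rc, ← conj_del_rc hv, Complex.conj_conj]
      simp only [rc]
      push_cast
      ring
    rw [hsum, norm_mul, norm_mul, RCLike.norm_conj, RCLike.norm_conj, mul_pow, mul_pow, hnexp]
    have hX2 : ‖X‖ ^ 2 ≤ S z * nsq β := norm_sum_mul_conj_sq_le β _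
    have hXY : ‖(χ (v z) : ℂ) * X + (cut 2 ρ z * deriv χ (v z) : ℝ) * Y‖ ^ 2 ≤
        2 * (χ (v z) ^ 2 * (S z * nsq β)) + 2 * (deriv χ (v z) ^ 2 * ‖Y‖ ^ 2) := by
      have h1 := norm_add_le ((χ (v z) : ℂ) * X) ((cut 2 ρ z * deriv χ (v z) : ℝ) * Y)
      have h2 : ‖(χ (v z) : ℂ) * X‖ ^ 2 ≤ χ (v z) ^ 2 * (S z * nsq β) := by
        rw [norm_mul, mul_pow, Complex.norm_real, Real.norm_eq_abs, sq_abs]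
        exact mul_le_mul_of_nonneg_left hX2 (sq_nonneg _)
      have h3 : ‖((cut 2 ρ z * deriv χ (v z) : ℝ) : ℂ) * Y‖ ^ 2 ≤ deriv χ (v z) ^ 2 * ‖Y‖ ^ 2 := by
        rw [norm_mul, mul_pow, Complex.norm_real, Real.norm_eq_abs, sq_abs, mul_pow]
        have h4 : cut 2 ρ z ^ 2 ≤ 1 := pow_le_one₀ (cut_nonneg _ _ _) (cut_le_one _ _ _)
        have := mul_le_mul_of_nonneg_right h4 (sq_nonneg (deriv χ (v z)))
        rw [one_mul] at this
        exact mul_le_mul_of_nonneg_right this (sq_nonneg _)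
      nlinarith [norm_nonneg ((χ (v z) : ℂ) * X + (cut 2 ρ z * deriv χ (v z) : ℝ) * Y),
        sq_nonneg (‖(χ (v z) : ℂ) * X‖ - ‖((cut 2 ρ z * deriv χ (v z) : ℝ) : ℂ) * Y‖)]
    have hl := hlow z (by linarith) β
    have hSexp : S z ≤ S z * expw N ρ z := by
      by_cases h : nsq z ≤ ρ
      · rw [hSz z (Or.inl h)]; simp
      · exact le_mul_of_one_le_right (hS0 z) (hexp1 z (not_le.1 h).le)
    have hk2 := hκ2 (v z)
    have hnb := nsq_nonneg (n := n) β
    have hee : Real.exp (-W z) ≤ Real.exp (-w z) :=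
      Real.exp_le_exp.2 (neg_le_neg (hWlow z (by linarith)))
    rw [Set.indicator_of_mem (show z ∈ D from hz)]
    calc Real.exp (-W z) * ‖F z‖ ^ 2 * _ ≤ Real.exp (-w z) * ‖F z‖ ^ 2 *
          (2 * (χ (v z) ^ 2 * (S z * nsq β)) + 2 * (deriv χ (v z) ^ 2 * ‖Y‖ ^ 2)) := by
          gcongr
      _ ≤ Real.exp (-w z) * ‖F z‖ ^ 2 *
          (2 * (χ (v z) ^ 2 * ((S z * expw N ρ z) * nsq β)) + 2 * (deriv χ (v z) ^ 2 * ‖Y‖ ^ 2)) := by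
          gcongr
      _ = A₁ z / N * (N / ρ * expw N ρ z * nsq β) + a₂ z * (deriv (deriv κ) (v z) * ‖Y‖ ^ 2) := by
          simp only [hA₁, ha₂]
          field_simp
      _ ≤ A₁ z / N * levi (rc W) z β + a₂ z * levi (rc W) z β := by
          have h1 : 0 ≤ A₁ z / N := div_nonneg (hA₁0 z) hN0.le
          have h2 := hexp0 z
          refine add_le_add (mul_le_mul_of_nonneg_left ?_ h1)
            (mul_le_mul_of_nonneg_left ?_ (ha₂0 z))
          · have : 0 ≤ deriv (deriv κ) (v z) * ‖Y‖ ^ 2 := by positivity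
            linarith
          · have : 0 ≤ N / ρ * expw N ρ z * nsq β := by positivity
            linarith
      _ = _ := by ring
  obtain ⟨G, hG, hGi⟩ := hormander hWs.rc (conj_rc W) hlevi hg
    (fun z => add_nonneg (div_nonneg (hA₁0 z) hN0.le)
        (Set.indicator_nonneg (fun z _ => ha₂0 z) z)) ((hA₁i.div_const N).add hA₂i) key hr
  refine ⟨G, hG, le_trans (setLIntegral_mono' measurableSet_ball fun z hz => ?_)
    (hGi.trans (ENNReal.ofReal_le_ofReal ?_))⟩
  · have hzρ := hrρ z hz
    have hc2 : cut 2 ρ z = 1 := cut_eq_one hρ (by linarith)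
    have hc4 : cut 4 ρ z = 1 := cut_eq_one hρ (by linarith)
    have he : Complex.exp (-(1 / 2) * rc W z) * (rc (cut 2 ρ) z * f z) -
        Complex.exp (-(1 / 2) * rc W z) * G z =
        Complex.exp (-(1 / 2) * rc W z) * ((χ (v z) : ℂ) * F z - G z) := by
      simp only [rc, hc2, hf]; push_cast; ring
    rw [he, enorm_mul, mul_pow, mul_comm]
    gcongr
    rw [← ofReal_norm, ← ENNReal.ofReal_pow (norm_nonneg _), hnexp]
    refine ENNReal.ofReal_le_ofReal (Real.exp_le_exp.2 (neg_le_neg ?_))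
    have : expw N ρ z ≤ 1 := Real.exp_le_one_iff.2
      (mul_nonpos_of_nonneg_of_nonpos hN0.le (by have := (div_le_one hρ).2 hzρ; linarith))
    simp only [hW, hc4]
    linarith
  · rw [integral_add (hA₁i.div_const N) hA₂i, integral_div, integral_indicator hDm]
    gcongr

end core

end

/-- The convex gauge `x ↦ 2 s x + t⁻¹ log (1 + e^{x + t})`. -/
def kap (s t x : ℝ) : ℝ := 2 * s * x + t⁻¹ * Real.log (1 + Real.exp (x + t))

lemma contDiff_kap (s t : ℝ) : ContDiff ℝ (⊤ : ℕ∞) (kap s t) := by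
  have h : ∀ x : ℝ, 1 + Real.exp (x + t) ≠ 0 := fun x => by positivity
  exact (contDiff_const.mul contDiff_id).add (contDiff_const.mul
    ((contDiff_const.add (Real.contDiff_exp.comp (contDiff_id.add contDiff_const))).log h))

lemma deriv_kap (s t : ℝ) :
    deriv (kap s t) = fun x => 2 * s + t⁻¹ * (1 - (1 + Real.exp (x + t))⁻¹) := by
  funext x
  have h0 : HasDerivAt (fun x : ℝ => 1 + Real.exp (x + t)) (Real.exp (x + t)) x := by
    simpa using ((hasDerivAt_id x).add_const t).exp.const_add 1
  have h1 : 1 + Real.exp (x + t) ≠ 0 := by positivity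
  have h2 := ((hasDerivAt_id x).const_mul (2 * s)).add ((h0.log h1).const_mul t⁻¹)
  have h3 : HasDerivAt (kap s t)
      (2 * s * 1 + t⁻¹ * (Real.exp (x + t) / (1 + Real.exp (x + t)))) x := h2
  rw [h3.deriv]
  field_simp
  ring

lemma deriv_deriv_kap (s t x : ℝ) :
    deriv (deriv (kap s t)) x = t⁻¹ * (Real.exp (x + t) / (1 + Real.exp (x + t)) ^ 2) := by
  rw [deriv_kap]
  have h0 : HasDerivAt (fun x : ℝ => 1 + Real.exp (x + t)) (Real.exp (x + t)) x := by
    simpa using ((hasDerivAt_id x).add_const t).exp.const_add 1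
  have h1 : 1 + Real.exp (x + t) ≠ 0 := by positivity
  have h2 := (((h0.inv h1).const_sub 1).const_mul t⁻¹).const_add (2 * s)
  have h3 : HasDerivAt (fun x => 2 * s + t⁻¹ * (1 - (1 + Real.exp (x + t))⁻¹))
    (t⁻¹ * -(-Real.exp (x + t) / (1 + Real.exp (x + t)) ^ 2)) x := h2
  rw [h3.deriv]
  ring

lemma deriv_kap_nonneg {s t : ℝ} (hs : 0 ≤ s) (ht : 0 < t) (x : ℝ) : 0 ≤ deriv (kap s t) x := by
  rw [deriv_kap]
  have h : (1 + Real.exp (x + t))⁻¹ ≤ 1 := inv_le_one_of_one_le₀ (by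
    have := Real.exp_pos (x + t); linarith)
  have : 0 ≤ 1 - (1 + Real.exp (x + t))⁻¹ := by linarith
  positivity

lemma deriv_deriv_kap_pos (s : ℝ) {t : ℝ} (ht : 0 < t) (x : ℝ) :
    0 < deriv (deriv (kap s t)) x := by
  rw [deriv_deriv_kap]; positivity

lemma inv_deriv_deriv_kap_le (s : ℝ) {t x : ℝ} (ht : 0 < t) (h1 : -t - 1 ≤ x) (h2 : x ≤ -t) :
    (deriv (deriv (kap s t)) x)⁻¹ ≤ 12 * t := by
  rw [deriv_deriv_kap]
  set y := Real.exp (x + t) with hy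
  have hy1 : y ≤ 1 := Real.exp_le_one_iff.2 (by linarith)
  have hy0 : 0 < y := Real.exp_pos _
  have hy2 : 1 / 3 ≤ y := by
    have h3 : Real.exp (-1) ≤ y := Real.exp_le_exp.2 (by linarith)
    have h4 : (1 : ℝ) / 3 ≤ Real.exp (-1) := by
      rw [Real.exp_neg, one_div]
      exact inv_anti₀ (Real.exp_pos 1) (by have := Real.exp_one_lt_d9; linarith)
    linarith
  rw [mul_inv, inv_inv, inv_div, mul_comm]
  refine mul_le_mul_of_nonneg_right ?_ ht.le
  rw [div_le_iff₀ hy0]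
  nlinarith

lemma le_kap (s : ℝ) {t : ℝ} (ht : 0 < t) (x : ℝ) : 2 * s * x ≤ kap s t x := by
  have : 0 ≤ Real.log (1 + Real.exp (x + t)) := Real.log_nonneg (by
    have := Real.exp_pos (x + t); linarith)
  have := mul_nonneg (inv_nonneg.2 ht.le) this
  simp only [kap]; linarith

lemma kap_le (s : ℝ) {t M : ℝ} (ht : 1 ≤ t) (hM : 0 ≤ M) {x : ℝ} (hx : x ≤ M) :
    kap s t x ≤ 2 * s * x + (2 + M) := by
  have h1 : Real.log (1 + Real.exp (x + t)) ≤ 1 + (M + t) := by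
    have h2 : 1 + Real.exp (x + t) ≤ Real.exp (1 + (M + t)) := by
      have h3 : Real.exp (x + t) ≤ Real.exp (M + t) := Real.exp_le_exp.2 (by linarith)
      have h4 : 1 ≤ Real.exp (M + t) := Real.one_le_exp (by linarith)
      have h5 : 2 ≤ Real.exp 1 := by have := Real.add_one_le_exp (1 : ℝ); linarith
      rw [Real.exp_add 1]
      nlinarith
    calc _ ≤ Real.log (Real.exp (1 + (M + t))) := Real.log_le_log (by positivity) h2
      _ = _ := Real.log_exp _
  have h2 : t⁻¹ * Real.log (1 + Real.exp (x + t)) ≤ t⁻¹ * (1 + (M + t)) :=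
    mul_le_mul_of_nonneg_left h1 (by positivity)
  have h3 : t⁻¹ * (1 + (M + t)) ≤ 2 + M := by
    rw [inv_mul_le_iff₀ (by linarith)]; nlinarith
  simp only [kap]; linarith

/-- A smooth cutoff that is `1` for `x ≤ -t - 1` and `0` for `x ≥ -t`. -/
def chi (t x : ℝ) : ℝ := Real.smoothTransition (-t - x)

lemma contDiff_chi (t : ℝ) : ContDiff ℝ (⊤ : ℕ∞) (chi t) :=
  Real.smoothTransition.contDiff.comp (contDiff_const.sub contDiff_id)

lemma chi_nonneg (t x : ℝ) : 0 ≤ chi t x := Real.smoothTransition.nonneg _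

lemma chi_le_one (t x : ℝ) : chi t x ≤ 1 := Real.smoothTransition.le_one _

lemma chi_eq_one {t x : ℝ} (h : x ≤ -t - 1) : chi t x = 1 :=
  Real.smoothTransition.one_of_one_le (by linarith)

lemma chi_eq_zero {t x : ℝ} (h : -t ≤ x) : chi t x = 0 :=
  Real.smoothTransition.zero_of_nonpos (by linarith)

lemma deriv_chi_eq_zero {t x : ℝ} (h : ¬ (-t - 1 ≤ x ∧ x ≤ -t)) : deriv (chi t) x = 0 := by
  rw [not_and_or, not_le, not_le] at h
  rcases h with h | h
  · refine IsLocalMax.deriv_eq_zero (Eventually.of_forall fun y => ?_)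
    rw [chi_eq_one h.le]; exact chi_le_one _ _
  · refine IsLocalMin.deriv_eq_zero (Eventually.of_forall fun y => ?_)
    rw [chi_eq_zero h.le]; exact chi_nonneg _ _

lemma exists_deriv_chi_le : ∃ B : ℝ, 0 ≤ B ∧ ∀ t x, deriv (chi t) x ^ 2 ≤ B := by
  have hc : Continuous (deriv (chi 0)) := (contDiff_deriv_top (contDiff_chi 0)).continuous
  obtain ⟨B, hB⟩ := hc.bounded_above_of_compact_support
    (HasCompactSupport.intro (isCompact_Icc (a := (-1 : ℝ)) (b := 0)) fun x hx =>
      deriv_chi_eq_zero (t := 0) fun h => hx ⟨by linarith [h.1], by linarith [h.2]⟩)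
  refine ⟨B ^ 2, sq_nonneg _, fun t x => ?_⟩
  have e : chi t = fun x => chi 0 (x + t) := by funext x; simp only [chi]; congr 1; ring
  rw [e, deriv_comp_add_const, ← sq_abs]
  exact pow_le_pow_left₀ (abs_nonneg _) (hB _) 2

lemma dbar_eq_zero_of_differentiableAt {f : Cn n → ℂ} {z : Cn n} (hf : DifferentiableAt ℂ f z)
    (k : Fin n) : dbar k f z = 0 := by
  have e : fderiv ℝ f z = (fderiv ℂ f z).restrictScalars ℝ := hf.fderiv_restrictScalars ℝ
  have h1 : (Pi.single k Complex.I : Cn n) = Complex.I • Pi.single k 1 := by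
    rw [← Pi.single_smul]; simp
  simp only [dbar, wirt, e, ContinuousLinearMap.coe_restrictScalars', h1, map_smul, smul_eq_mul,
    ← mul_assoc, Complex.I_mul_I]
  ring

lemma exists_smooth_extension {F : Cn n → ℂ} {R R' : ℝ} (hR : R' < R)
    (hF : DifferentiableOn ℂ F (Metric.ball 0 R)) :
    ∃ F₁ : Cn n → ℂ, Sm F₁ ∧ ∀ z ∈ Metric.ball (0 : Cn n) R', F₁ z = F z := by
  obtain ⟨δ, hδ0, hδ⟩ : ∃ δ, 0 < δ ∧ R' + δ < R := ⟨(R - R') / 2, by linarith, by linarith⟩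
  set R₁ := (R' + δ + R) / 2 with hR₁
  have hR₁R : R₁ < R := by rw [hR₁]; linarith
  have hR₁' : R' + δ < R₁ := by rw [hR₁]; linarith
  have hcb : Metric.closedBall (0 : Cn n) R₁ ⊆ Metric.ball 0 R :=
    Metric.closedBall_subset_ball hR₁R
  obtain ⟨M, hM⟩ := (isCompact_closedBall (0 : Cn n) R₁).exists_bound_of_continuousOn
    (hF.continuousOn.mono hcb)
  have hF' : DifferentiableOn ℂ F (Metric.ball 0 R₁) :=
    hF.mono (Metric.ball_subset_closedBall.trans hcb)
  set f := (Metric.ball (0 : Cn n) R₁).indicator F with hf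
  have hfi : LocallyIntegrable f := by
    refine Integrable.locallyIntegrable ((integrable_indicator_iff measurableSet_ball).2 ?_)
    exact ((hF.continuousOn.mono hcb).integrableOn_compact (isCompact_closedBall _ _)).mono_set
      Metric.ball_subset_closedBall
  refine ⟨mf δ f, sm_mf hδ0 hfi, fun z hz => ?_⟩
  rw [mem_ball_zero_iff] at hz
  rw [← integral_mol_holo hδ0 hF' (fun z hz => hM z (Metric.ball_subset_closedBall hz))
    (z := z) (by linarith), mf, ← integral_add_left_eq_self _ z]
  refine integral_congr_ae (Eventually.of_forall fun y => ?_)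
  simp only [molC, sub_add_cancel_left, mol_neg]
  by_cases hy : δ ≤ ‖y‖
  · rw [mol_eq_zero hδ0 hy]; simp
  · have h1 : z + y ∈ Metric.ball (0 : Cn n) R₁ := by
      rw [mem_ball_zero_iff]
      have := norm_add_le z y
      push Not at hy
      linarith
    rw [hf, Set.indicator_of_mem h1, Complex.real_smul, mul_comm]

/-- Functions that, near the origin, are a.e. limits from above of smooth functions with
nonnegative Levi form, uniformly bounded above. -/
def SPsh (u : Cn n → ℝ) : Prop :=
  ∃ R > 0, ∃ M : ℝ, ∃ U : ℕ → Cn n → ℝ, (∀ j, SmR (U j)) ∧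
    (∀ j, ∀ z ∈ Metric.ball (0 : Cn n) R, ∀ β, 0 ≤ levi (rc (U j)) z β) ∧
    (∀ j, ∀ z ∈ Metric.ball (0 : Cn n) R, U j z ≤ M) ∧
    ∀ᵐ z : Cn n, z ∈ Metric.ball (0 : Cn n) R →
      (∀ j, u z ≤ U j z) ∧ Tendsto (fun j => U j z) atTop (𝓝 (u z))

lemma levi_const_mul {f : Cn n → ℝ} (hf : SmR f) (c : ℝ) (z : Cn n) (β : Fin n → ℂ) :
    levi (rc fun z => c * f z) z β = c * levi (rc f) z β := by
  have h := levi_rc_comp (h := fun x => c * x) (contDiff_const.mul contDiff_id) hf z β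
  have hd : deriv (fun x : ℝ => c * x) = fun _ => c := by
    funext x; simp
  rw [hd] at h
  simpa using h

lemma SPsh.add {u v : Cn n → ℝ} (hu : SPsh u) (hv : SPsh v) : SPsh fun z => u z + v z := by
  obtain ⟨R, hR, M, U, h1, h2, h3, h4⟩ := hu
  obtain ⟨R', hR', M', V, h1', h2', h3', h4'⟩ := hv
  have hsub : Metric.ball (0 : Cn n) (min R R') ⊆ Metric.ball 0 R :=
    Metric.ball_subset_ball (min_le_left _ _)
  have hsub' : Metric.ball (0 : Cn n) (min R R') ⊆ Metric.ball 0 R' :=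
    Metric.ball_subset_ball (min_le_right _ _)
  refine ⟨min R R', lt_min hR hR', M + M', fun j z => U j z + V j z, fun j => (h1 j).add (h1' j),
    fun j z hz β => ?_, fun j z hz => add_le_add (h3 j z (hsub hz)) (h3' j z (hsub' hz)), ?_⟩
  · have e : rc (fun z => U j z + V j z) = fun z => rc (U j) z + rc (V j) z := by
      funext z; simp [rc]
    rw [e, levi_add (h1 j).rc (h1' j).rc]
    exact add_nonneg (h2 j z (hsub hz) β) (h2' j z (hsub' hz) β)
  · filter_upwards [h4, h4'] with z hz hz' hzb
    exact ⟨fun j => add_le_add ((hz (hsub hzb)).1 j) ((hz' (hsub' hzb)).1 j),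
      (hz (hsub hzb)).2.add (hz' (hsub' hzb)).2⟩

lemma SPsh.const_mul {u : Cn n → ℝ} (hu : SPsh u) {c : ℝ} (hc : 0 ≤ c) :
    SPsh fun z => c * u z := by
  obtain ⟨R, hR, M, U, h1, h2, h3, h4⟩ := hu
  refine ⟨R, hR, c * M, fun j z => c * U j z, fun j => contDiff_const.mul (h1 j),
    fun j z hz β => ?_, fun j z hz => mul_le_mul_of_nonneg_left (h3 j z hz) hc, ?_⟩
  · rw [levi_const_mul (h1 j)]; exact mul_nonneg hc (h2 j z hz β)
  · filter_upwards [h4] with z hz hzb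
    exact ⟨fun j => mul_le_mul_of_nonneg_left ((hz hzb).1 j) hc, (hz hzb).2.const_mul c⟩

lemma enorm_sq_eq_ofReal (x : ℂ) : ‖x‖ₑ ^ 2 = ENNReal.ofReal (‖x‖ ^ 2) := by
  rw [← ofReal_norm, ← ENNReal.ofReal_pow (norm_nonneg _)]

lemma enorm_sq_le_two_mul (x y : ℂ) : ‖y‖ₑ ^ 2 ≤ 2 * ‖x - y‖ₑ ^ 2 + 2 * ‖x‖ₑ ^ 2 := by
  simp only [enorm_sq_eq_ofReal]
  rw [← ENNReal.ofReal_ofNat, ← ENNReal.ofReal_mul (by norm_num), ← ENNReal.ofReal_mul (by norm_num),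
    ← ENNReal.ofReal_add (by positivity) (by positivity)]
  refine ENNReal.ofReal_le_ofReal ?_
  have h := norm_sub_norm_le x (x - y)
  have h1 : ‖y‖ ≤ ‖x - y‖ + ‖x‖ := by
    calc ‖y‖ = ‖x - (x - y)‖ := by congr 1; ring
      _ ≤ ‖x‖ + ‖x - y‖ := norm_sub_le _ _
      _ = _ := add_comm _ _
  nlinarith [norm_nonneg y, sq_nonneg (‖x - y‖ - ‖x‖)]

lemma tendsto_of_continuous_uncurry {X Y Z : Type*} [TopologicalSpace X] [TopologicalSpace Y]
    [TopologicalSpace Z] {f : X → Y → Z} (hf : Continuous fun p : X × Y => f p.1 p.2) {a : ℕ → X}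
    {b : ℕ → Y} {x : X} {y : Y} (ha : Tendsto a atTop (𝓝 x)) (hb : Tendsto b atTop (𝓝 y)) :
    Tendsto (fun j => f (a j) (b j)) atTop (𝓝 (f x y)) :=
  (hf.tendsto (x, y)).comp (ha.prodMk_nhds hb)

lemma SPsh.aestronglyMeasurable {u : Cn n → ℝ} (hu : SPsh u) :
    ∃ R > 0, AEStronglyMeasurable u (volume.restrict (Metric.ball 0 R)) := by
  obtain ⟨R, hR, M, U, h1, h2, h3, h4⟩ := hu
  refine ⟨R, hR, aestronglyMeasurable_of_tendsto_ae atTop (f := U)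
    (fun j => (h1 j).continuous.aestronglyMeasurable) ?_⟩
  rw [ae_restrict_iff' measurableSet_ball]
  filter_upwards [h4] with z hz hzb using (hz hzb).2

set_option maxHeartbeats 1600000 in
/-- Hörmander's estimate for the correction of `χₜ(v) F` to a holomorphic function. -/
theorem core_limit {u v : Cn n → ℝ} (hu : SPsh u) (hv : SPsh v) {F : Cn n → ℂ} {R : ℝ}
    (hR : 0 < R) (hF : DifferentiableOn ℂ F (Metric.ball 0 R))
    (hfin : ∫⁻ z in Metric.ball (0 : Cn n) R, ‖F z‖ₑ ^ 2 * ENNReal.ofReal (Real.exp (-u z)) < ⊤) :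
    ∃ r > 0, ∃ C : ℝ, 0 ≤ C ∧ ∀ s t : ℝ, 0 ≤ s → s ≤ 1 → 1 ≤ t → ∃ G : Cn n → ℂ,
      DifferentiableOn ℂ G (Metric.ball 0 r) ∧
      ∫⁻ z in Metric.ball (0 : Cn n) r, ‖(chi t (v z) : ℂ) * F z - G z‖ₑ ^ 2 *
        ENNReal.ofReal (Real.exp (-u z - 2 * s * v z)) ≤
      ENNReal.ofReal (C * (t * Real.exp (2 * s * (t + 1)))) *
        ∫⁻ z in Metric.ball (0 : Cn n) R, {z | -t - 1 ≤ v z ∧ v z ≤ -t}.indicator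
          (fun z => ‖F z‖ₑ ^ 2 * ENNReal.ofReal (Real.exp (-u z))) z := by
  obtain ⟨Ru, hRu, Mu, U, hU1, hU2, hU3, hU4⟩ := hu
  obtain ⟨Rv, hRv, Mv, V, hV1, hV2, hV3, hV4⟩ := hv
  obtain ⟨M, hM0, hMu, hMv⟩ : ∃ M : ℝ, 0 ≤ M ∧ Mu ≤ M ∧ Mv ≤ M :=
    ⟨max 0 (max Mu Mv), le_max_left _ _, (le_max_left _ _).trans (le_max_right _ _),
      (le_max_right _ _).trans (le_max_right _ _)⟩
  obtain ⟨R₂, hR₂, hR₂R, hR₂u, hR₂v⟩ : ∃ R₂ : ℝ, 0 < R₂ ∧ R₂ < R ∧ R₂ ≤ Ru ∧ R₂ ≤ Rv := by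
    refine ⟨min (R / 2) (min Ru Rv), by positivity, ?_, ?_, ?_⟩
    · exact (min_le_left _ _).trans_lt (by linarith)
    · exact (min_le_right _ _).trans (min_le_left _ _)
    · exact (min_le_right _ _).trans (min_le_right _ _)
  obtain ⟨F₁, hF₁s, hF₁⟩ := exists_smooth_extension hR₂R hF
  set ρ := R₂ ^ 2 / 4 with hρd
  have hρ : 0 < ρ := by positivity
  have hρball : ∀ z : Cn n, nsq z < 4 * ρ → z ∈ Metric.ball (0 : Cn n) R₂ := by
    intro z hz
    rw [mem_ball_zero_iff]
    have := norm_sq_le_nsq z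
    refine lt_of_pow_lt_pow_left₀ 2 hR₂.le ?_
    rw [hρd] at hz; linarith
  set r₁ := Real.sqrt (ρ / (n + 1)) with hr₁d
  have hr₁ : 0 < r₁ := Real.sqrt_pos.2 (by positivity)
  have hr₁ρ : ∀ z ∈ Metric.ball (0 : Cn n) r₁, nsq z ≤ ρ := by
    intro z hz
    rw [mem_ball_zero_iff] at hz
    have h1 : ‖z‖ ^ 2 ≤ ρ / (n + 1) := by
      rw [← Real.sq_sqrt (show 0 ≤ ρ / (n + 1) by positivity)]
      exact pow_le_pow_left₀ (norm_nonneg _) hz.le 2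
    rw [le_div_iff₀ (by positivity)] at h1
    have := nsq_le z
    nlinarith [sq_nonneg ‖z‖]
  have hball₁ : ∀ z ∈ Metric.ball (0 : Cn n) r₁, z ∈ Metric.ball (0 : Cn n) R₂ := fun z hz =>
    hρball z (by have := hr₁ρ z hz; linarith)
  obtain ⟨B, hB0, hB⟩ := exists_deriv_chi_le
  set D : Set (Cn n) := {z | nsq z < 2 * ρ} with hD
  have hDm : MeasurableSet D := measurableSet_lt contDiff_nsq.continuous.measurable measurable_const
  have hDR₂ : ∀ z ∈ D, z ∈ Metric.ball (0 : Cn n) R₂ := fun z hz =>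
    hρball z (by have : nsq z < 2 * ρ := hz; linarith)
  have hDR : D ⊆ Metric.ball (0 : Cn n) R := fun z hz =>
    Metric.ball_subset_ball hR₂R.le (hDR₂ z hz)
  -- a.e. convergence on the ball of radius `R₂`
  have hae : ∀ᵐ z : Cn n, z ∈ Metric.ball (0 : Cn n) R₂ →
      ((∀ j, u z ≤ U j z) ∧ Tendsto (fun j => U j z) atTop (𝓝 (u z))) ∧
      ((∀ j, v z ≤ V j z) ∧ Tendsto (fun j => V j z) atTop (𝓝 (v z))) := by
    filter_upwards [hU4, hV4] with z h1 h2 hz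
    exact ⟨h1 (Metric.ball_subset_ball hR₂u hz), h2 (Metric.ball_subset_ball hR₂v hz)⟩
  have hUM : ∀ j, ∀ z ∈ Metric.ball (0 : Cn n) R₂, U j z ≤ M := fun j z hz =>
    (hU3 j z (Metric.ball_subset_ball hR₂u hz)).trans hMu
  have hVM : ∀ j, ∀ z ∈ Metric.ball (0 : Cn n) R₂, V j z ≤ M := fun j z hz =>
    (hV3 j z (Metric.ball_subset_ball hR₂v hz)).trans hMv
  have haeD : ∀ᵐ z ∂(volume.restrict D), z ∈ Metric.ball (0 : Cn n) R₂ ∧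
      ((∀ j, u z ≤ U j z) ∧ Tendsto (fun j => U j z) atTop (𝓝 (u z))) ∧
      ((∀ j, v z ≤ V j z) ∧ Tendsto (fun j => V j z) atTop (𝓝 (v z))) := by
    rw [ae_restrict_iff' hDm]
    filter_upwards [hae] with z hz hzD
    exact ⟨hDR₂ z hzD, hz (hDR₂ z hzD)⟩
  have hum : AEStronglyMeasurable u (volume.restrict D) :=
    aestronglyMeasurable_of_tendsto_ae atTop (f := U)
      (fun j => (hU1 j).continuous.aestronglyMeasurable) (haeD.mono fun z hz => hz.2.1.2)
  have hvm : AEStronglyMeasurable v (volume.restrict D) :=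
    aestronglyMeasurable_of_tendsto_ae atTop (f := V)
      (fun j => (hV1 j).continuous.aestronglyMeasurable) (haeD.mono fun z hz => hz.2.2.2)
  have hEm : AEStronglyMeasurable (fun z => ‖F₁ z‖ ^ 2 * Real.exp (-u z)) (volume.restrict D) :=
    (hF₁s.continuous.norm.pow 2).aestronglyMeasurable.mul
      (Real.continuous_exp.comp_aestronglyMeasurable hum.neg)
  have hEofReal : ∀ z ∈ D, ENNReal.ofReal (‖F₁ z‖ ^ 2 * Real.exp (-u z)) =
      ‖F z‖ₑ ^ 2 * ENNReal.ofReal (Real.exp (-u z)) := by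
    intro z hz
    rw [ENNReal.ofReal_mul (by positivity), enorm_sq_eq_ofReal, hF₁ z (hDR₂ z hz)]
  have hEi : Integrable (fun z => ‖F₁ z‖ ^ 2 * Real.exp (-u z)) (volume.restrict D) := by
    refine ⟨hEm, ?_⟩
    rw [hasFiniteIntegral_iff_ofReal (Eventually.of_forall fun z => by positivity)]
    rw [setLIntegral_congr_fun hDm hEofReal]
    exact (lintegral_mono_set hDR).trans_lt hfin
  refine ⟨r₁ / 2 / 8, by positivity, Real.exp (3 + M) * (24 * B), by positivity,
    fun s t hs0 hs1 ht => ?_⟩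
  have ht0 : 0 < t := by linarith
  have hη : ∀ j : ℕ, (0 : ℝ) < 1 / (j + 1) := fun j => by positivity
  -- the smooth estimates
  choose G hG hGi using fun j : ℕ => core_smooth hρ (hU1 j) (hV1 j)
    (fun z hz β => hU2 j z (Metric.ball_subset_ball hR₂u (hρball z hz)) β)
    (fun z hz β => hV2 j z (Metric.ball_subset_ball hR₂v (hρball z hz)) β) hF₁s
    (fun z hz k => by
      have e : F₁ =ᶠ[𝓝 z] F := by
        filter_upwards [Metric.isOpen_ball.mem_nhds (hρball z hz)] with y hy using hF₁ y hy
      rw [show dbar k F₁ z = dbar k F z from (wirt_congr e).eq_of_nhds]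
      exact dbar_eq_zero_of_differentiableAt (hF.differentiableAt
        (Metric.isOpen_ball.mem_nhds (Metric.ball_subset_ball hR₂R.le (hρball z hz)))) k)
    (contDiff_kap s t) (deriv_kap_nonneg hs0 ht0) (deriv_deriv_kap_pos s ht0) (contDiff_chi t)
    (hη j) hr₁ hr₁ρ
  set bd : ℝ := 24 * B * (t * Real.exp (2 * s * (t + 1))) with hbd
  have hbd0 : 0 ≤ bd := by positivity
  set I : ℝ → ℝ → Cn n → ℝ := fun a b z => 2 * ‖F₁ z‖ ^ 2 * deriv (chi t) b ^ 2 /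
    deriv (deriv (kap s t)) b * Real.exp (-(a + kap s t b)) with hI
  have hI0 : ∀ a b z, 0 ≤ I a b z := fun a b z => by
    have := deriv_deriv_kap_pos s ht0 b
    positivity
  have hIb : ∀ a b z, I a b z ≤ {b : ℝ | -t - 1 ≤ b ∧ b ≤ -t}.indicator
      (fun _ => bd * (‖F₁ z‖ ^ 2 * Real.exp (-a))) b := by
    intro a b z
    by_cases hb : -t - 1 ≤ b ∧ b ≤ -t
    · rw [Set.indicator_of_mem (show b ∈ {b : ℝ | -t - 1 ≤ b ∧ b ≤ -t} from hb)]
      have h1 := inv_deriv_deriv_kap_le s ht0 hb.1 hb.2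
      have h2 := hB t b
      have h0 := deriv_deriv_kap_pos s ht0 b
      have h3 : Real.exp (-(a + kap s t b)) ≤ Real.exp (-a) * Real.exp (2 * s * (t + 1)) := by
        rw [← Real.exp_add]
        refine Real.exp_le_exp.2 ?_
        have := le_kap s ht0 b
        nlinarith [hb.1]
      calc I a b z = (2 * ‖F₁ z‖ ^ 2) * (deriv (chi t) b ^ 2 * (deriv (deriv (kap s t)) b)⁻¹) *
            Real.exp (-(a + kap s t b)) := by simp only [hI]; field_simp
        _ ≤ (2 * ‖F₁ z‖ ^ 2) * (B * (12 * t)) * (Real.exp (-a) * Real.exp (2 * s * (t + 1))) := by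
            gcongr
        _ = _ := by rw [hbd]; ring
    · rw [Set.indicator_of_notMem (show b ∉ {b : ℝ | -t - 1 ≤ b ∧ b ≤ -t} from hb)]
      simp [hI, deriv_chi_eq_zero hb]
  have hIc : ∀ z, Continuous fun p : ℝ × ℝ => I p.1 p.2 z := by
    intro z
    have h1 := (contDiff_deriv_top (contDiff_chi t)).continuous
    have h2 := (contDiff_deriv_top (contDiff_deriv_top (contDiff_kap s t))).continuous
    have h3 := (contDiff_kap s t).continuous
    exact ((continuous_const.mul ((h1.comp continuous_snd).pow 2)).div (h2.comp continuous_snd)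
      fun p => (deriv_deriv_kap_pos s ht0 _).ne').mul
      (Real.continuous_exp.comp (continuous_fst.add (h3.comp continuous_snd)).neg)
  have hIlim : Tendsto (fun j => ∫ z in D, I (U j z) (V j z) z) atTop
      (𝓝 (∫ z in D, I (u z) (v z) z)) := by
    refine tendsto_integral_of_dominated_convergence
      (fun z => bd * (‖F₁ z‖ ^ 2 * Real.exp (-u z))) (fun j => ?_) (hEi.const_mul bd)
      (fun j => ?_) ?_
    · have h1 := (contDiff_deriv_top (contDiff_chi t)).continuous
      have h2 := (contDiff_deriv_top (contDiff_deriv_top (contDiff_kap s t))).continuous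
      have h3 := (contDiff_kap s t).continuous
      exact ((((continuous_const.mul (hF₁s.continuous.norm.pow 2)).mul
        ((h1.comp (hV1 j).continuous).pow 2)).div (h2.comp (hV1 j).continuous)
          fun p => (deriv_deriv_kap_pos s ht0 _).ne').mul
        (Real.continuous_exp.comp ((hU1 j).continuous.add
          (h3.comp (hV1 j).continuous)).neg)).aestronglyMeasurable
    · filter_upwards [haeD] with z hz
      rw [Real.norm_of_nonneg (hI0 _ _ _)]
      refine (hIb _ _ _).trans (Set.indicator_apply_le' (fun _ => ?_) fun _ => by positivity)
      gcongr
      exact hz.2.1.1 j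
    · filter_upwards [haeD] with z hz
      exact tendsto_of_continuous_uncurry (f := fun a b => I a b z) (hIc z) hz.2.1.2 hz.2.2.2
  set K : ℝ := ∫ z in D, I (u z) (v z) z with hK
  have hKlim : Tendsto (fun j : ℕ => 1 / ((j : ℝ) + 1) + ∫ z in D, I (U j z) (V j z) z) atTop
      (𝓝 K) := by
    have h0 : Tendsto (fun j : ℕ => 1 / ((j : ℝ) + 1)) atTop (𝓝 0) :=
      tendsto_one_div_add_atTop_nhds_zero_nat
    have h := h0.add hIlim
    rwa [zero_add] at h
  have hKle : ENNReal.ofReal K ≤ ENNReal.ofReal bd *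
      ∫⁻ z in Metric.ball (0 : Cn n) R, {z | -t - 1 ≤ v z ∧ v z ≤ -t}.indicator
          (fun z => ‖F z‖ₑ ^ 2 * ENNReal.ofReal (Real.exp (-u z))) z := by
    have hIm : AEStronglyMeasurable (fun z => I (u z) (v z) z) (volume.restrict D) := by
      have h1 := (contDiff_deriv_top (contDiff_chi t)).continuous
      have h2 := (contDiff_deriv_top (contDiff_deriv_top (contDiff_kap s t))).continuous
      have h3 := (contDiff_kap s t).continuous
      exact (((continuous_const.mul (hF₁s.continuous.norm.pow 2)).aestronglyMeasurable.mul
        ((h1.comp_aestronglyMeasurable hvm).pow 2)).aemeasurable.div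
          (h2.comp_aestronglyMeasurable hvm).aemeasurable).aestronglyMeasurable.mul (Real.continuous_exp.comp_aestronglyMeasurable
          (hum.add (h3.comp_aestronglyMeasurable hvm)).neg)
    rw [hK, integral_eq_lintegral_of_nonneg_ae (Eventually.of_forall fun z => hI0 _ _ _) hIm]
    refine ENNReal.ofReal_toReal_le.trans ?_
    rw [← lintegral_const_mul' _ _ ENNReal.ofReal_ne_top]
    refine (setLIntegral_mono' hDm fun z hz => ?_).trans (lintegral_mono_set hDR)
    refine (ENNReal.ofReal_le_ofReal (hIb (u z) (v z) z)).trans ?_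
    by_cases hb : -t - 1 ≤ v z ∧ v z ≤ -t
    · rw [Set.indicator_of_mem (show v z ∈ {b : ℝ | -t - 1 ≤ b ∧ b ≤ -t} from hb),
        Set.indicator_of_mem (show z ∈ {z | -t - 1 ≤ v z ∧ v z ≤ -t} from hb),
        ENNReal.ofReal_mul hbd0, hEofReal z hz]
    · rw [Set.indicator_of_notMem (show v z ∉ {b : ℝ | -t - 1 ≤ b ∧ b ≤ -t} from hb)]
      simp
  -- uniform bounds for the corrections
  obtain ⟨M₁, hM₁⟩ : ∃ M₁ : ℝ, ∀ j, ∀ z ∈ Metric.ball (0 : Cn n) (r₁ / 2), ‖G j z‖ ≤ M₁ := by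
    obtain ⟨K', hK'⟩ := hKlim.bddAbove_range
    have hK'j : ∀ j, ∫⁻ z in Metric.ball (0 : Cn n) r₁, ‖(chi t (V j z) : ℂ) * F₁ z - G j z‖ₑ ^ 2 ≤
        ENNReal.ofReal (Real.exp (M + (2 * s * M + (2 + M)) + 1)) * ENNReal.ofReal K' := by
      intro j
      refine le_trans ?_ (mul_le_mul_right ((hGi j).trans
        (ENNReal.ofReal_le_ofReal (hK' ⟨j, rfl⟩))) _)
      rw [← lintegral_const_mul' _ _ ENNReal.ofReal_ne_top]
      refine setLIntegral_mono' measurableSet_ball fun z hz => ?_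
      have h1 := hUM j z (hball₁ z hz)
      have h2 := hVM j z (hball₁ z hz)
      have h3 := kap_le s ht hM0 h2
      have h4 : (1 : ℝ≥0∞) ≤ ENNReal.ofReal (Real.exp (M + (2 * s * M + (2 + M)) + 1)) *
          ENNReal.ofReal (Real.exp (-(U j z + kap s t (V j z) + 1))) := by
        rw [← ENNReal.ofReal_mul (Real.exp_pos _).le, ← Real.exp_add, ENNReal.one_le_ofReal]
        refine Real.one_le_exp ?_
        have : 2 * s * V j z ≤ 2 * s * M := mul_le_mul_of_nonneg_left h2 (by positivity)
        linarith
      calc ‖(chi t (V j z) : ℂ) * F₁ z - G j z‖ₑ ^ 2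
          ≤ ‖(chi t (V j z) : ℂ) * F₁ z - G j z‖ₑ ^ 2 * _ := le_mul_of_one_le_right' h4
        _ = _ := by ring
    obtain ⟨C₁, hC₁⟩ := exists_sup_le_L2 (n := n) (show r₁ / 2 < r₁ by linarith)
    have hFf : ∫⁻ z in Metric.ball (0 : Cn n) r₁, ‖F₁ z‖ₑ ^ 2 < ⊤ := by
      have h1 : IntegrableOn (fun z => ‖F₁ z‖ ^ 2) (Metric.closedBall (0 : Cn n) r₁) :=
        (hF₁s.continuous.norm.pow 2).continuousOn.integrableOn_compact (isCompact_closedBall _ _)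
      have h2 := (h1.mono_set Metric.ball_subset_closedBall).2
      rw [hasFiniteIntegral_iff_ofReal (Eventually.of_forall fun z => by positivity)] at h2
      simpa only [enorm_sq_eq_ofReal] using h2
    set T : ℝ≥0∞ := C₁ * (2 * (ENNReal.ofReal (Real.exp (M + (2 * s * M + (2 + M)) + 1)) *
      ENNReal.ofReal K') + 2 * ∫⁻ z in Metric.ball (0 : Cn n) r₁, ‖F₁ z‖ₑ ^ 2) with hT
    have hTf : T ≠ ⊤ := ENNReal.mul_ne_top ENNReal.coe_ne_top (ENNReal.add_ne_top.2
      ⟨ENNReal.mul_ne_top (by simp) (ENNReal.mul_ne_top (by simp) (by simp)),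
        ENNReal.mul_ne_top (by simp) hFf.ne⟩)
    refine ⟨Real.sqrt T.toReal, fun j z hz => Real.le_sqrt_of_sq_le ?_⟩
    rw [← ENNReal.ofReal_le_iff_le_toReal hTf, ← enorm_sq_eq_ofReal]
    refine (hC₁ (G j) (hG j) z hz).trans (mul_le_mul_right ?_ _)
    calc ∫⁻ y in Metric.ball (0 : Cn n) r₁, ‖G j y‖ₑ ^ 2
        ≤ ∫⁻ y in Metric.ball (0 : Cn n) r₁, (2 * ‖(chi t (V j y) : ℂ) * F₁ y - G j y‖ₑ ^ 2 +
          2 * ‖F₁ y‖ₑ ^ 2) := by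
          refine lintegral_mono fun y => (enorm_sq_le_two_mul
            ((chi t (V j y) : ℂ) * F₁ y) (G j y)).trans ?_
          gcongr
          rw [enorm_mul]
          refine mul_le_of_le_one_left' ?_
          rw [← ofReal_norm, Complex.norm_real, Real.norm_of_nonneg (chi_nonneg _ _)]
          exact ENNReal.ofReal_le_one.2 (chi_le_one _ _)
      _ = 2 * (∫⁻ y in Metric.ball (0 : Cn n) r₁, ‖(chi t (V j y) : ℂ) * F₁ y - G j y‖ₑ ^ 2) +
          2 * ∫⁻ y in Metric.ball (0 : Cn n) r₁, ‖F₁ y‖ₑ ^ 2 := by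
          rw [lintegral_add_right _ ((hF₁s.continuous.enorm.measurable.pow_const 2).const_mul 2),
            lintegral_const_mul' _ _ (by simp), lintegral_const_mul' _ _ (by simp)]
      _ ≤ _ := by
          gcongr
          exact hK'j j
  obtain ⟨φ, G₀, ε, hφ, hG₀, hε, hGε⟩ := montel (by positivity : 0 < r₁ / 2)
    (fun j => (hG j).mono (Metric.ball_subset_ball (by linarith))) hM₁
  refine ⟨G₀, hG₀, ?_⟩
  have hsub : Metric.ball (0 : Cn n) (r₁ / 2 / 8) ⊆ Metric.ball 0 r₁ :=
    Metric.ball_subset_ball (by linarith)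
  have hφt := hφ.tendsto_atTop
  set H : ℕ → Cn n → ℝ≥0∞ := fun j z => ‖(chi t (V j z) : ℂ) * F₁ z - G j z‖ₑ ^ 2 *
    ENNReal.ofReal (Real.exp (-(U j z + kap s t (V j z) + 1))) with hH
  have hHlim : ∀ᵐ z ∂(volume.restrict (Metric.ball (0 : Cn n) (r₁ / 2 / 8))),
      ‖(chi t (v z) : ℂ) * F z - G₀ z‖ₑ ^ 2 * ENNReal.ofReal (Real.exp (-u z - 2 * s * v z)) ≤
      ENNReal.ofReal (Real.exp (3 + M)) * liminf (fun j => H (φ j) z) atTop := by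
    rw [ae_restrict_iff' measurableSet_ball]
    filter_upwards [hae] with z hz hzb
    have hzR := hball₁ z (hsub hzb)
    obtain ⟨⟨-, h1⟩, -, h2⟩ := hz hzR
    have hGt : Tendsto (fun j => G (φ j) z) atTop (𝓝 (G₀ z)) := by
      rw [tendsto_iff_norm_sub_tendsto_zero]
      exact squeeze_zero (fun j => norm_nonneg _) (fun j => hGε j z hzb) hε
    have hvM : v z ≤ M := le_of_tendsto h2 (Eventually.of_forall fun j => hVM j z hzR)
    have hlim : Tendsto (fun j => H (φ j) z) atTop (𝓝 (‖(chi t (v z) : ℂ) * F₁ z - G₀ z‖ₑ ^ 2 *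
        ENNReal.ofReal (Real.exp (-(u z + kap s t (v z) + 1))))) := by
      have c1 : Continuous fun p : ℝ × ℂ => ENNReal.ofReal (‖(chi t p.1 : ℂ) * F₁ z - p.2‖ ^ 2) :=
        ENNReal.continuous_ofReal.comp ((((Complex.continuous_ofReal.comp
          ((contDiff_chi t).continuous.comp continuous_fst)).mul continuous_const).sub
            continuous_snd).norm.pow 2)
      have c2 : Continuous fun p : ℝ × ℝ =>
          ENNReal.ofReal (Real.exp (-(p.1 + kap s t p.2 + 1))) :=
        ENNReal.continuous_ofReal.comp (Real.continuous_exp.comp (((continuous_fst.add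
          ((contDiff_kap s t).continuous.comp continuous_snd)).add continuous_const).neg))
      have t1 := tendsto_of_continuous_uncurry
        (f := fun b g => ENNReal.ofReal (‖(chi t b : ℂ) * F₁ z - g‖ ^ 2)) c1 (h2.comp hφt) hGt
      have t2 := tendsto_of_continuous_uncurry
        (f := fun a b => ENNReal.ofReal (Real.exp (-(a + kap s t b + 1)))) c2 (h1.comp hφt)
        (h2.comp hφt)
      simp only [hH, enorm_sq_eq_ofReal]
      exact ENNReal.Tendsto.mul t1 (Or.inr ENNReal.ofReal_ne_top) t2 (Or.inr ENNReal.ofReal_ne_top)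
    rw [hlim.liminf_eq, hF₁ z hzR, mul_left_comm, ← ENNReal.ofReal_mul (Real.exp_pos _).le,
      ← Real.exp_add]
    gcongr
    have := kap_le s ht hM0 hvM
    linarith
  have hHm : ∀ j, AEMeasurable (H (φ j)) (volume.restrict (Metric.ball (0 : Cn n) (r₁ / 2 / 8))) := by
    intro j
    have h1 : AEStronglyMeasurable (G (φ j))
        (volume.restrict (Metric.ball (0 : Cn n) (r₁ / 2 / 8))) :=
      ((hG (φ j)).mono hsub).continuousOn.aestronglyMeasurable measurableSet_ball
    have h2 : Continuous fun z => (chi t (V (φ j) z) : ℂ) * F₁ z :=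
      (Complex.continuous_ofReal.comp ((contDiff_chi t).continuous.comp (hV1 _).continuous)).mul
        hF₁s.continuous
    have h3 : Continuous fun z => ENNReal.ofReal
        (Real.exp (-(U (φ j) z + kap s t (V (φ j) z) + 1))) :=
      ENNReal.continuous_ofReal.comp (Real.continuous_exp.comp ((((hU1 _).continuous.add
        ((contDiff_kap s t).continuous.comp (hV1 _).continuous)).add continuous_const).neg))
    exact ((h2.aestronglyMeasurable.sub h1).enorm.pow_const 2).mul h3.aemeasurable
  calc _ ≤ ∫⁻ z in Metric.ball (0 : Cn n) (r₁ / 2 / 8),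
        ENNReal.ofReal (Real.exp (3 + M)) * liminf (fun j => H (φ j) z) atTop :=
        lintegral_mono_ae hHlim
    _ = ENNReal.ofReal (Real.exp (3 + M)) *
        ∫⁻ z in Metric.ball (0 : Cn n) (r₁ / 2 / 8), liminf (fun j => H (φ j) z) atTop :=
        lintegral_const_mul' _ _ ENNReal.ofReal_ne_top
    _ ≤ ENNReal.ofReal (Real.exp (3 + M)) * ENNReal.ofReal K := by
        gcongr
        refine (lintegral_liminf_le' hHm).trans ?_
        have hlim : Tendsto (fun j => ENNReal.ofReal
            (1 / ((φ j : ℝ) + 1) + ∫ z in D, I (U (φ j) z) (V (φ j) z) z)) atTop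
            (𝓝 (ENNReal.ofReal K)) :=
          (ENNReal.continuous_ofReal.tendsto K).comp (hKlim.comp hφt)
        rw [← hlim.liminf_eq]
        exact liminf_le_liminf (Eventually.of_forall fun j =>
          (lintegral_mono_set hsub).trans (hGi (φ j)))
    _ ≤ ENNReal.ofReal (Real.exp (3 + M)) * (ENNReal.ofReal bd * _) := by gcongr
    _ = _ := by
        rw [← mul_assoc, ← ENNReal.ofReal_mul (Real.exp_pos _).le, hbd]
        congr 2
        ring

/-- A weight family for which finite weighted `L²` norm near the origin defines an ideal of germs. -/
structure WeightFamily (w : ℕ → Cn n → ℝ≥0∞) : Prop where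
  meas : ∀ i, ∃ r > 0, AEMeasurable (w i) (volume.restrict (Metric.ball 0 r))
  anti : ∀ i j, i ≤ j → ∃ r > 0, ∃ C : ℝ≥0, ∀ᵐ z, z ∈ Metric.ball (0 : Cn n) r → w j z ≤ C * w i z

/-- Continuous germs that are square integrable near the origin for some weight of a family. -/
def L2Germ (w : ℕ → Cn n → ℝ≥0∞) (f : Cn n → ℂ) : Prop :=
  (∃ r > 0, ContinuousOn f (Metric.ball 0 r)) ∧
    ∃ i, ∃ r > 0, ∫⁻ z in Metric.ball (0 : Cn n) r, ‖f z‖ₑ ^ 2 * w i z < ⊤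

lemma enorm_add_sq_le (x y : ℂ) : ‖x + y‖ₑ ^ 2 ≤ 2 * ‖x‖ₑ ^ 2 + 2 * ‖y‖ₑ ^ 2 := by
  have h2 := enorm_sq_le_two_mul y (x + y)
  rw [show y - (x + y) = -x by ring, enorm_neg] at h2
  exact h2

lemma WeightFamily.weaken {w : ℕ → Cn n → ℝ≥0∞} (hw : WeightFamily w) {f : Cn n → ℂ} {i j : ℕ}
    (hij : i ≤ j) {r : ℝ} (hr : 0 < r)
    (h : ∫⁻ z in Metric.ball (0 : Cn n) r, ‖f z‖ₑ ^ 2 * w i z < ⊤) :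
    ∃ r' > 0, ∫⁻ z in Metric.ball (0 : Cn n) r', ‖f z‖ₑ ^ 2 * w j z < ⊤ := by
  obtain ⟨r₁, hr₁, C, hC⟩ := hw.anti i j hij
  refine ⟨min r r₁, lt_min hr hr₁, ?_⟩
  calc _ ≤ ∫⁻ z in Metric.ball (0 : Cn n) (min r r₁), C * (‖f z‖ₑ ^ 2 * w i z) := by
        refine lintegral_mono_ae ((ae_restrict_iff' measurableSet_ball).2 ?_)
        filter_upwards [hC] with z hz hz'
        rw [mul_left_comm]
        gcongr
        exact hz (Metric.ball_subset_ball (min_le_right _ _) hz')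
    _ = C * ∫⁻ z in Metric.ball (0 : Cn n) (min r r₁), ‖f z‖ₑ ^ 2 * w i z :=
        lintegral_const_mul' _ _ ENNReal.coe_ne_top
    _ < ⊤ := ENNReal.mul_lt_top ENNReal.coe_lt_top
        (lt_of_le_of_lt (lintegral_mono_set (Metric.ball_subset_ball (min_le_left _ _))) h)

lemma WeightFamily.germIdeal {w : ℕ → Cn n → ℝ≥0∞} (hw : WeightFamily w) :
    GermIdeal (L2Germ w) where
  zero := ⟨⟨1, one_pos, continuousOn_const⟩, 0, 1, one_pos, by simp⟩
  add f g := by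
    rintro ⟨⟨r₁, hr₁, hf⟩, i, r₂, hr₂, hfi⟩ ⟨⟨r₃, hr₃, hg⟩, j, r₄, hr₄, hgi⟩
    refine ⟨⟨min r₁ r₃, lt_min hr₁ hr₃, (hf.mono (Metric.ball_subset_ball (min_le_left _ _))).add
      (hg.mono (Metric.ball_subset_ball (min_le_right _ _)))⟩, max i j, ?_⟩
    obtain ⟨r₅, hr₅, h₅⟩ := hw.weaken (le_max_left i j) hr₂ hfi
    obtain ⟨r₆, hr₆, h₆⟩ := hw.weaken (le_max_right i j) hr₄ hgi
    obtain ⟨r₇, hr₇, h₇⟩ := hw.meas (max i j)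
    set r := min (min r₁ r₇) (min r₅ r₆) with hr
    have hrr : r ≤ r₁ ∧ r ≤ r₇ ∧ r ≤ r₅ ∧ r ≤ r₆ := by
      simp [hr]
    refine ⟨r, by positivity, ?_⟩
    have hm : AEMeasurable (fun z => 2 * (‖f z‖ₑ ^ 2 * w (max i j) z))
        (volume.restrict (Metric.ball (0 : Cn n) r)) := by
      refine AEMeasurable.const_mul (AEMeasurable.mul ?_
        (h₇.mono_measure (Measure.restrict_mono (Metric.ball_subset_ball hrr.2.1) le_rfl))) _
      exact ((hf.mono (Metric.ball_subset_ball hrr.1)).aestronglyMeasurable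
        measurableSet_ball).enorm.pow_const 2
    calc _ ≤ ∫⁻ z in Metric.ball (0 : Cn n) r, (2 * (‖f z‖ₑ ^ 2 * w (max i j) z) +
          2 * (‖g z‖ₑ ^ 2 * w (max i j) z)) := by
          refine lintegral_mono fun z => ?_
          rw [← mul_assoc, ← mul_assoc, ← add_mul]
          exact mul_le_mul_left (enorm_add_sq_le _ _) _
      _ = 2 * (∫⁻ z in Metric.ball (0 : Cn n) r, ‖f z‖ₑ ^ 2 * w (max i j) z) +
          2 * ∫⁻ z in Metric.ball (0 : Cn n) r, ‖g z‖ₑ ^ 2 * w (max i j) z := by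
          rw [lintegral_add_left' hm, lintegral_const_mul' _ _ (by simp),
            lintegral_const_mul' _ _ (by simp)]
      _ < ⊤ := ENNReal.add_lt_top.2
          ⟨ENNReal.mul_lt_top (by simp) (lt_of_le_of_lt
            (lintegral_mono_set (Metric.ball_subset_ball hrr.2.2.1)) h₅),
          ENNReal.mul_lt_top (by simp) (lt_of_le_of_lt
            (lintegral_mono_set (Metric.ball_subset_ball hrr.2.2.2)) h₆)⟩
  congr f g := by
    rintro hfg ⟨⟨r₁, hr₁, hf⟩, i, r₂, hr₂, hfi⟩
    obtain ⟨r₃, hr₃, h₃⟩ := Metric.eventually_nhds_iff_ball.1 hfg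
    refine ⟨⟨min r₁ r₃, lt_min hr₁ hr₃, (hf.mono (Metric.ball_subset_ball (min_le_left _ _))).congr
      fun z hz => (h₃ z (Metric.ball_subset_ball (min_le_right _ _) hz)).symm⟩, i, min r₂ r₃,
      lt_min hr₂ hr₃, ?_⟩
    rw [setLIntegral_congr_fun (g := fun z => ‖f z‖ₑ ^ 2 * w i z) measurableSet_ball fun z hz => by
      simp only [h₃ z (Metric.ball_subset_ball (min_le_right _ _) hz)]]
    exact lt_of_le_of_lt (lintegral_mono_set (Metric.ball_subset_ball (min_le_left _ _))) hfi
  mul h f := by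
    rintro ⟨r₀, hr₀, hh⟩ ⟨⟨r₁, hr₁, hf⟩, i, r₂, hr₂, hfi⟩
    refine ⟨⟨min r₀ r₁, lt_min hr₀ hr₁, (hh.mono (Metric.ball_subset_ball (min_le_left _ _))).mul
      (hf.mono (Metric.ball_subset_ball (min_le_right _ _)))⟩, i, ?_⟩
    have hc : ContinuousAt h 0 := hh.continuousAt (Metric.ball_mem_nhds 0 hr₀)
    obtain ⟨r₃, hr₃, h₃⟩ := Metric.eventually_nhds_iff_ball.1
      (hc.norm.eventually (gt_mem_nhds (lt_add_one ‖h 0‖)))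
    refine ⟨min r₂ r₃, lt_min hr₂ hr₃, ?_⟩
    calc _ ≤ ∫⁻ z in Metric.ball (0 : Cn n) (min r₂ r₃),
          ENNReal.ofReal ((‖h 0‖ + 1) ^ 2) * (‖f z‖ₑ ^ 2 * w i z) := by
          refine setLIntegral_mono' measurableSet_ball fun z hz => ?_
          rw [enorm_mul, mul_pow, mul_assoc, enorm_sq_eq_ofReal (h z)]
          gcongr
          exact (h₃ z (Metric.ball_subset_ball (min_le_right _ _) hz)).le
      _ = ENNReal.ofReal ((‖h 0‖ + 1) ^ 2) *
          ∫⁻ z in Metric.ball (0 : Cn n) (min r₂ r₃), ‖f z‖ₑ ^ 2 * w i z :=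
          lintegral_const_mul' _ _ ENNReal.ofReal_ne_top
      _ < ⊤ := ENNReal.mul_lt_top ENNReal.ofReal_lt_top
        (lt_of_le_of_lt (lintegral_mono_set (Metric.ball_subset_ball (min_le_left _ _))) hfi)

lemma SPsh.exists_le {u : Cn n → ℝ} (hu : SPsh u) :
    ∃ R > 0, ∃ M : ℝ, 0 ≤ M ∧ ∀ᵐ z, z ∈ Metric.ball (0 : Cn n) R → u z ≤ M := by
  obtain ⟨R, hR, M, U, -, -, hM, h⟩ := hu
  refine ⟨R, hR, max M 0, le_max_right _ _, ?_⟩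
  filter_upwards [h] with z hz hzR
  exact ((hz hzR).1 0).trans ((hM 0 z hzR).trans (le_max_left _ _))

lemma aemeasurable_exp_weight {u v : Cn n → ℝ} (hu : SPsh u) (hv : SPsh v) :
    ∃ r > 0, ∀ s : ℝ, AEMeasurable (fun z => ENNReal.ofReal (Real.exp (-u z - s * v z)))
      (volume.restrict (Metric.ball (0 : Cn n) r)) := by
  obtain ⟨r₁, hr₁, h₁⟩ := hu.aestronglyMeasurable
  obtain ⟨r₂, hr₂, h₂⟩ := hv.aestronglyMeasurable
  refine ⟨min r₁ r₂, lt_min hr₁ hr₂, fun s => ?_⟩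
  have h₁' := (h₁.mono_measure (Measure.restrict_mono
    (Metric.ball_subset_ball (min_le_left r₁ r₂)) le_rfl)).aemeasurable
  have h₂' := (h₂.mono_measure (Measure.restrict_mono
    (Metric.ball_subset_ball (min_le_right r₁ r₂)) le_rfl)).aemeasurable
  exact ENNReal.measurable_ofReal.comp_aemeasurable (Real.measurable_exp.comp_aemeasurable
    (h₁'.neg.sub (h₂'.const_mul s)))

lemma weightFamily_exp {u v : Cn n → ℝ} (hu : SPsh u) (hv : SPsh v) {s : ℕ → ℝ}
    (hs : Antitone s) :
    WeightFamily fun i z => ENNReal.ofReal (Real.exp (-u z - s i * v z)) where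
  meas i := by
    obtain ⟨r, hr, h⟩ := aemeasurable_exp_weight hu hv
    exact ⟨r, hr, h _⟩
  anti i j hij := by
    obtain ⟨r, hr, M, hM, h⟩ := hv.exists_le
    refine ⟨r, hr, Real.toNNReal (Real.exp ((s i - s j) * M)), ?_⟩
    filter_upwards [h] with z hz hzr
    change _ ≤ ENNReal.ofReal _ * _
    rw [← ENNReal.ofReal_mul (Real.exp_pos _).le, ← Real.exp_add]
    gcongr
    have := mul_le_mul_of_nonneg_left (hz hzr) (sub_nonneg.2 (hs hij))
    linarith

lemma aemeasurable_sq_mul_exp {u v : Cn n → ℝ} {F : Cn n → ℂ} {ρ : ℝ} {s : ℝ}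
    (hw : AEMeasurable (fun z => ENNReal.ofReal (Real.exp (-u z - s * v z)))
      (volume.restrict (Metric.ball (0 : Cn n) ρ))) (hF : ContinuousOn F (Metric.ball 0 ρ)) :
    AEMeasurable (fun z => ‖F z‖ₑ ^ 2 * ENNReal.ofReal (Real.exp (-u z - s * v z)))
      (volume.restrict (Metric.ball (0 : Cn n) ρ)) :=
  ((hF.aestronglyMeasurable measurableSet_ball).enorm.pow_const 2).mul hw

lemma tendsto_lintegral_sublevel {v : Cn n → ℝ} {g : Cn n → ℝ≥0∞} {ρ : ℝ}
    (hv : AEMeasurable v (volume.restrict (Metric.ball (0 : Cn n) ρ)))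
    (hg : AEMeasurable g (volume.restrict (Metric.ball (0 : Cn n) ρ)))
    (hfin : ∫⁻ z in Metric.ball (0 : Cn n) ρ, g z < ⊤) {t : ℕ → ℝ} (ht : Tendsto t atTop atTop) :
    Tendsto (fun k => ∫⁻ z in Metric.ball (0 : Cn n) ρ, {z | v z ≤ -t k}.indicator g z) atTop
      (𝓝 0) := by
  rw [← lintegral_zero (μ := volume.restrict (Metric.ball (0 : Cn n) ρ))]
  refine tendsto_lintegral_of_dominated_convergence' g
    (fun k => hg.indicator₀ (nullMeasurableSet_le hv aemeasurable_const))
    (fun k => Eventually.of_forall fun z => Set.indicator_le_self _ _ _) hfin.ne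
    (Eventually.of_forall fun z => ?_)
  refine tendsto_const_nhds.congr' ?_
  filter_upwards [ht.eventually_gt_atTop (-v z)] with k hk
  rw [Set.indicator_of_notMem]
  simp only [Set.mem_ofPred_eq, not_le]
  linarith

theorem mem_of_shell_tendsto {u v : Cn n → ℝ} (hu : SPsh u) (hv : SPsh v) {R : ℝ} (hR : 0 < R)
    {F : Cn n → ℂ} (hF : DifferentiableOn ℂ F (Metric.ball 0 R))
    (hfin : ∫⁻ z in Metric.ball (0 : Cn n) R, ‖F z‖ₑ ^ 2 * ENNReal.ofReal (Real.exp (-u z)) < ⊤)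
    {P : (Cn n → ℂ) → Prop} (hP : GermIdeal P) {s t : ℕ → ℝ} (hs0 : ∀ k, 0 ≤ s k)
    (hs1 : ∀ k, s k ≤ 1) (ht1 : ∀ k, 1 ≤ t k) (ht : Tendsto t atTop atTop)
    (hsmall : Tendsto (fun k => ENNReal.ofReal (t k * Real.exp (2 * s k * (t k + 1))) *
      ∫⁻ z in Metric.ball (0 : Cn n) R, {z | -t k - 1 ≤ v z ∧ v z ≤ -t k}.indicator
        (fun z => ‖F z‖ₑ ^ 2 * ENNReal.ofReal (Real.exp (-u z))) z) atTop (𝓝 0))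
    (hPk : ∀ k f r, 0 < r → ContinuousOn f (Metric.ball 0 r) →
      ∫⁻ z in Metric.ball (0 : Cn n) r, ‖f z‖ₑ ^ 2 *
        ENNReal.ofReal (Real.exp (-u z - 2 * s k * v z)) < ⊤ → P f) : P F := by
  obtain ⟨r, hr, C, hC, hcore⟩ := core_limit hu hv hR hF hfin
  choose G hG hGi using fun k => hcore (s k) (t k) (hs0 k) (hs1 k) (ht1 k)
  obtain ⟨r₁, hr₁, Mu, hMu, hu1⟩ := hu.exists_le
  obtain ⟨r₂, hr₂, Mv, hMv, hv1⟩ := hv.exists_le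
  obtain ⟨r₃, hr₃, hw⟩ := aemeasurable_exp_weight hu hv
  obtain ⟨r₄, hr₄, hvm⟩ := hv.aestronglyMeasurable
  obtain ⟨r₅, hr₅, hFb⟩ := Metric.eventually_nhds_iff_ball.1
    ((hF.continuousOn.continuousAt (Metric.ball_mem_nhds 0 hR)).norm.eventually
      (gt_mem_nhds (lt_add_one ‖F 0‖)))
  set ρ := min (min (min r R) (min r₁ r₂)) (min (min r₃ r₄) r₅) with hρdef
  have hρ : 0 < ρ := by positivity
  have hρr : ρ ≤ r ∧ ρ ≤ R ∧ ρ ≤ r₁ ∧ ρ ≤ r₂ ∧ ρ ≤ r₃ ∧ ρ ≤ r₄ ∧ ρ ≤ r₅ := by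
    simp [hρdef]
  obtain ⟨ρr, ρR, ρ1, ρ2, ρ3, ρ4, ρ5⟩ := hρr
  have hw' : ∀ s : ℝ, AEMeasurable (fun z => ENNReal.ofReal (Real.exp (-u z - s * v z)))
      (volume.restrict (Metric.ball (0 : Cn n) ρ)) := fun s =>
    (hw s).mono_measure (Measure.restrict_mono (Metric.ball_subset_ball ρ3) le_rfl)
  have hvm' := (hvm.mono_measure
    (Measure.restrict_mono (Metric.ball_subset_ball ρ4) le_rfl)).aemeasurable
  have hFc : ContinuousOn F (Metric.ball 0 ρ) :=
    hF.continuousOn.mono (Metric.ball_subset_ball ρR)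
  set g : Cn n → ℝ≥0∞ := fun z => ‖F z‖ₑ ^ 2 * ENNReal.ofReal (Real.exp (-u z)) with hg
  have hgm : AEMeasurable g (volume.restrict (Metric.ball (0 : Cn n) ρ)) := by
    simpa using aemeasurable_sq_mul_exp (hw' 0) hFc
  have hgfin : ∫⁻ z in Metric.ball (0 : Cn n) ρ, g z < ⊤ :=
    lt_of_le_of_lt (lintegral_mono_set (Metric.ball_subset_ball ρR)) hfin
  set a : ℕ → ℝ≥0∞ := fun k => ∫⁻ z in Metric.ball (0 : Cn n) R,
    {z | -t k - 1 ≤ v z ∧ v z ≤ -t k}.indicator g z with ha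
  have hale : ∀ k, a k < ⊤ := fun k =>
    lt_of_le_of_lt (lintegral_mono fun z => Set.indicator_le_self _ _ _) hfin
  set Q : ℕ → ℝ≥0∞ := fun k => ENNReal.ofReal (C * (t k * Real.exp (2 * s k * (t k + 1)))) * a k
    with hQ
  have hQ0 : Tendsto Q atTop (𝓝 0) := by
    have := ENNReal.Tendsto.const_mul (a := ENNReal.ofReal C) hsmall (Or.inr ENNReal.ofReal_ne_top)
    rw [mul_zero] at this
    refine this.congr fun k => ?_
    simp only [hQ, ha]
    rw [ENNReal.ofReal_mul hC, ← mul_assoc]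
  have hGQ : ∀ k, ∫⁻ z in Metric.ball (0 : Cn n) ρ, ‖(chi (t k) (v z) : ℂ) * F z - G k z‖ₑ ^ 2 *
      ENNReal.ofReal (Real.exp (-u z - 2 * s k * v z)) ≤ Q k := fun k =>
    (lintegral_mono_set (Metric.ball_subset_ball ρr)).trans (hGi k)
  set T : ℕ → ℝ≥0∞ := fun k => ∫⁻ z in Metric.ball (0 : Cn n) ρ, {z | v z ≤ -t k}.indicator g z
    with hT
  have hT0 : Tendsto T atTop (𝓝 0) := tendsto_lintegral_sublevel hvm' hgm hgfin ht
  obtain ⟨Cs, hCs⟩ := exists_sup_le_L2 (n := n) (R' := ρ / 2) (R := ρ) (by linarith)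
  set K : ℝ≥0∞ := ENNReal.ofReal (2 * Real.exp (Mu + 2 * Mv)) with hK
  have hGL2 : ∀ k, ∫⁻ z in Metric.ball (0 : Cn n) ρ, ‖G k z‖ₑ ^ 2 ≤ K * (Q k + T k) := by
    intro k
    calc _ ≤ ∫⁻ z in Metric.ball (0 : Cn n) ρ, K * (‖(chi (t k) (v z) : ℂ) * F z - G k z‖ₑ ^ 2 *
          ENNReal.ofReal (Real.exp (-u z - 2 * s k * v z)) + {z | v z ≤ -t k}.indicator g z) := by
          refine lintegral_mono_ae ((ae_restrict_iff' measurableSet_ball).2 ?_)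
          filter_upwards [hu1, hv1] with z hz1 hz2 hz
          have hz1 := hz1 (Metric.ball_subset_ball ρ1 hz)
          have hz2 := hz2 (Metric.ball_subset_ball ρ2 hz)
          refine (enorm_sq_le_two_mul ((chi (t k) (v z) : ℂ) * F z) (G k z)).trans ?_
          rw [mul_add]
          gcongr ?_ + ?_
          · rw [mul_left_comm, mul_comm (2 : ℝ≥0∞)]
            gcongr
            rw [hK, ← ENNReal.ofReal_mul (by positivity), mul_assoc, ← Real.exp_add,
              ← ENNReal.ofReal_ofNat]
            refine ENNReal.ofReal_le_ofReal ?_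
            have h1 : s k * v z ≤ Mv := by
              rcases le_total 0 (v z) with h | h
              · nlinarith [hs0 k, hs1 k]
              · nlinarith [hs0 k, hs1 k]
            have := Real.one_le_exp (x := Mu + 2 * Mv + (-u z - 2 * s k * v z)) (by linarith)
            linarith
          · by_cases h : v z ≤ -t k
            · rw [Set.indicator_of_mem (by exact h), hg, mul_left_comm, mul_comm (2 : ℝ≥0∞), enorm_mul,
                mul_pow]
              have h1 : ‖(chi (t k) (v z) : ℂ)‖ₑ ^ 2 ≤ 1 := by
                rw [enorm_sq_eq_ofReal, Complex.norm_real, Real.norm_of_nonneg (chi_nonneg _ _),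
                  ENNReal.ofReal_le_one]
                exact pow_le_one₀ (chi_nonneg _ _) (chi_le_one _ _)
              gcongr
              · exact mul_le_of_le_one_left' h1
              rw [hK, ← ENNReal.ofReal_mul (by positivity), mul_assoc, ← Real.exp_add,
                ← ENNReal.ofReal_ofNat]
              refine ENNReal.ofReal_le_ofReal ?_
              have := Real.one_le_exp (x := Mu + 2 * Mv + -u z) (by linarith)
              linarith
            · rw [chi_eq_zero (by linarith)]
              simp
      _ = K * ∫⁻ z in Metric.ball (0 : Cn n) ρ, (‖(chi (t k) (v z) : ℂ) * F z - G k z‖ₑ ^ 2 *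
          ENNReal.ofReal (Real.exp (-u z - 2 * s k * v z)) + {z | v z ≤ -t k}.indicator g z) :=
          lintegral_const_mul' _ _ ENNReal.ofReal_ne_top
      _ ≤ K * (Q k + T k) := by
          rw [lintegral_add_right' _ (hgm.indicator₀ (nullMeasurableSet_le hvm' aemeasurable_const))]
          gcongr
          exact hGQ k
  set B : ℕ → ℝ≥0∞ := fun k => Cs * (K * (Q k + T k)) with hB
  have hB0 : Tendsto B atTop (𝓝 0) := by
    have h1 := hQ0.add hT0
    rw [add_zero] at h1
    have h2 := ENNReal.Tendsto.const_mul (a := K) h1 (Or.inr ENNReal.ofReal_ne_top)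
    have h3 := ENNReal.Tendsto.const_mul (a := (Cs : ℝ≥0∞)) h2 (Or.inr ENNReal.coe_ne_top)
    simpa using h3
  obtain ⟨k₀, hk₀⟩ := eventually_atTop.1 (hB0.eventually (gt_mem_nhds ENNReal.zero_lt_top))
  refine hP.closed (R := ρ / 2) (by positivity) (M := ‖F 0‖ + 1)
    (G := fun k z => F z - G (k + k₀) z) (ε := fun k => Real.sqrt (B (k + k₀)).toReal) ?_ ?_ ?_ ?_ ?_ ?_
  · have h1 := ((ENNReal.tendsto_toReal ENNReal.zero_ne_top).comp
      (hB0.comp (tendsto_add_atTop_nat k₀))).sqrt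
    simpa using h1
  · exact hF.mono (Metric.ball_subset_ball (by linarith))
  · exact fun z hz => (hFb z (Metric.ball_subset_ball (by linarith) hz)).le
  · exact fun k => (hF.mono (Metric.ball_subset_ball (by linarith))).sub
      ((hG _).mono (Metric.ball_subset_ball (by linarith)))
  · intro k z hz
    rw [show F z - G (k + k₀) z - F z = -G (k + k₀) z by ring, norm_neg]
    refine Real.le_sqrt_of_sq_le ?_
    have h1 := (hCs _ ((hG (k + k₀)).mono (Metric.ball_subset_ball ρr)) z hz).trans
      (mul_le_mul_right (hGL2 (k + k₀)) _)
    rw [enorm_sq_eq_ofReal] at h1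
    exact (ENNReal.ofReal_le_iff_le_toReal (hk₀ _ (by omega)).ne).1 h1
  · intro k
    generalize k + k₀ = k
    refine hPk k _ ρ hρ (hFc.sub ((hG k).continuousOn.mono (Metric.ball_subset_ball ρr))) ?_
    set K' : ℝ≥0∞ := ENNReal.ofReal (2 * Real.exp (2 * s k * (t k + 1))) with hK'
    calc _ ≤ ∫⁻ z in Metric.ball (0 : Cn n) ρ, (2 * (‖(chi (t k) (v z) : ℂ) * F z - G k z‖ₑ ^ 2 *
          ENNReal.ofReal (Real.exp (-u z - 2 * s k * v z))) + K' * g z) := by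
          refine lintegral_mono fun z => ?_
          have h0 : F z - G k z = ((chi (t k) (v z) : ℂ) * F z - G k z) +
            ((1 - chi (t k) (v z) : ℝ) : ℂ) * F z := by push_cast; ring
          rw [h0]
          refine (mul_le_mul_left (enorm_add_sq_le _ _) _).trans ?_
          rw [add_mul, mul_assoc]
          refine add_le_add le_rfl ?_
          by_cases h : v z ≤ -t k - 1
          · rw [chi_eq_one h]; simp
          push Not at h
          have h1 : ‖((1 - chi (t k) (v z) : ℝ) : ℂ)‖ₑ ^ 2 ≤ 1 := by
            rw [enorm_sq_eq_ofReal, Complex.norm_real, Real.norm_of_nonneg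
              (sub_nonneg.2 (chi_le_one _ _)), ENNReal.ofReal_le_one]
            exact pow_le_one₀ (sub_nonneg.2 (chi_le_one _ _)) (by linarith [chi_nonneg (t k) (v z)])
          rw [enorm_mul, mul_pow, hg, mul_left_comm K', mul_right_comm, mul_comm (_ * _)]
          gcongr ?_ * ?_
          · exact mul_le_of_le_one_left' h1
          rw [hK', ← ENNReal.ofReal_mul (by positivity), mul_assoc (2 : ℝ) (Real.exp _), ← Real.exp_add,
              ← ENNReal.ofReal_ofNat, ← ENNReal.ofReal_mul (by norm_num)]
          gcongr
          nlinarith [hs0 k]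
      _ = 2 * (∫⁻ z in Metric.ball (0 : Cn n) ρ, ‖(chi (t k) (v z) : ℂ) * F z - G k z‖ₑ ^ 2 *
          ENNReal.ofReal (Real.exp (-u z - 2 * s k * v z))) +
          K' * ∫⁻ z in Metric.ball (0 : Cn n) ρ, g z := by
          rw [lintegral_add_right' _ (hgm.const_mul _), lintegral_const_mul' _ _ (by simp),
            lintegral_const_mul' _ _ ENNReal.ofReal_ne_top]
      _ < ⊤ := by
          refine ENNReal.add_lt_top.2 ⟨ENNReal.mul_lt_top (by simp) (lt_of_le_of_lt (hGQ k) ?_),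
            ENNReal.mul_lt_top ENNReal.ofReal_lt_top hgfin⟩
          exact ENNReal.mul_lt_top ENNReal.ofReal_lt_top (hale k)

lemma exists_shell_small {v : Cn n → ℝ} {g : Cn n → ℝ≥0∞} {ρ : ℝ}
    (hv : AEMeasurable v (volume.restrict (Metric.ball (0 : Cn n) ρ)))
    (hg : AEMeasurable g (volume.restrict (Metric.ball (0 : Cn n) ρ)))
    (hfin : ∫⁻ z in Metric.ball (0 : Cn n) ρ, g z < ⊤) (k : ℕ) : ∃ j : ℕ, k + 1 ≤ j ∧
    ENNReal.ofReal (2 * (j : ℝ)) * ∫⁻ z in Metric.ball (0 : Cn n) ρ,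
      {z | -(2 * (j : ℝ)) - 1 ≤ v z ∧ v z ≤ -(2 * (j : ℝ))}.indicator g z ≤
        ENNReal.ofReal (1 / ((k : ℝ) + 1)) := by
  by_contra hcon
  push Not at hcon
  set S : ℕ → Set (Cn n) := fun j => {z | -(2 * (j : ℝ)) - 1 ≤ v z ∧ v z ≤ -(2 * (j : ℝ))} with hS
  set a : ℕ → ℝ≥0∞ := fun j => ∫⁻ z in Metric.ball (0 : Cn n) ρ, (S j).indicator g z with ha
  have hsum : ∑' j, a j ≤ ∫⁻ z in Metric.ball (0 : Cn n) ρ, g z := by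
    rw [ha, ← lintegral_tsum]
    · refine lintegral_mono fun z => ?_
      by_cases h : ∃ j, z ∈ S j
      · obtain ⟨j, hj⟩ := h
        rw [tsum_eq_single j]
        · exact Set.indicator_le_self _ _ _
        · intro i hij
          rw [Set.indicator_of_notMem]
          intro hi
          simp only [hS, Set.mem_ofPred_eq] at hi hj
          rcases lt_or_gt_of_ne hij with h | h
          · have : (i : ℝ) + 1 ≤ j := by exact_mod_cast h
            linarith
          · have : (j : ℝ) + 1 ≤ i := by exact_mod_cast h
            linarith
      · push Not at h
        simp [Set.indicator_of_notMem (h _)]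
    · exact fun j => hg.indicator₀
        ((nullMeasurableSet_le aemeasurable_const hv).inter (nullMeasurableSet_le hv aemeasurable_const))
  have hne : ∑' j, a j ≠ ⊤ := (lt_of_le_of_lt hsum hfin).ne
  have h1 := ENNReal.summable_toReal hne
  have h2 : Summable fun j : ℕ => 1 / ((k : ℝ) + 1) / 2 * (1 / (j : ℝ)) := by
    rw [← summable_nat_add_iff (k + 1)] at h1 ⊢
    refine Summable.of_nonneg_of_le (fun j => by positivity) (fun j => ?_) h1
    have h3 := (hcon (j + (k + 1)) (by omega)).le
    have hfj : a (j + (k + 1)) ≠ ⊤ := ENNReal.ne_top_of_tsum_ne_top hne _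
    have h4 := ENNReal.toReal_mono (ENNReal.mul_ne_top ENNReal.ofReal_ne_top hfj) h3
    rw [ENNReal.toReal_ofReal (by positivity), ENNReal.toReal_mul,
      ENNReal.toReal_ofReal (by positivity)] at h4
    have hp : (0 : ℝ) < ((j + (k + 1) : ℕ) : ℝ) := by positivity
    rw [show 1 / ((k : ℝ) + 1) / 2 * (1 / ((j + (k + 1) : ℕ) : ℝ)) =
      1 / ((k : ℝ) + 1) / (2 * ((j + (k + 1) : ℕ) : ℝ)) by field_simp, div_le_iff₀ (by positivity),
      mul_comm]
    exact h4
  have h5 := (summable_mul_left_iff (by positivity : 1 / ((k : ℝ) + 1) / 2 ≠ 0)).1 h2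
  exact Real.not_summable_one_div_natCast h5

/-- Strong openness of multiplier ideals. -/
theorem strong_openness {u v : Cn n → ℝ} (hu : SPsh u) (hv : SPsh v) {R : ℝ} (hR : 0 < R)
    {F : Cn n → ℂ} (hF : DifferentiableOn ℂ F (Metric.ball 0 R))
    (hfin : ∫⁻ z in Metric.ball (0 : Cn n) R, ‖F z‖ₑ ^ 2 * ENNReal.ofReal (Real.exp (-u z)) < ⊤) :
    ∃ ε > 0, ∃ r > 0, ∫⁻ z in Metric.ball (0 : Cn n) r, ‖F z‖ₑ ^ 2 *
      ENNReal.ofReal (Real.exp (-u z - ε * v z)) < ⊤ := by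
  obtain ⟨r₃, hr₃, hw⟩ := aemeasurable_exp_weight hu hv
  obtain ⟨r₄, hr₄, hvm⟩ := hv.aestronglyMeasurable
  set ρ := min R (min r₃ r₄) with hρdef
  have hρ : 0 < ρ := by positivity
  obtain ⟨ρR, ρ3, ρ4⟩ : ρ ≤ R ∧ ρ ≤ r₃ ∧ ρ ≤ r₄ := by simp [hρdef]
  have hvm' := (hvm.mono_measure
    (Measure.restrict_mono (Metric.ball_subset_ball ρ4) le_rfl)).aemeasurable
  have hF' := hF.mono (Metric.ball_subset_ball ρR)
  have hgm : AEMeasurable (fun z => ‖F z‖ₑ ^ 2 * ENNReal.ofReal (Real.exp (-u z)))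
      (volume.restrict (Metric.ball (0 : Cn n) ρ)) := by
    simpa using aemeasurable_sq_mul_exp ((hw 0).mono_measure
      (Measure.restrict_mono (Metric.ball_subset_ball ρ3) le_rfl)) hF'.continuousOn
  have hfin' := lt_of_le_of_lt (lintegral_mono_set (Metric.ball_subset_ball ρR)) hfin
  choose j hj hjs using exists_shell_small hvm' hgm hfin'
  have hj1 : ∀ k, (1 : ℝ) ≤ j k := fun k => by
    have : 1 ≤ j k := (Nat.le_add_left 1 k).trans (hj k)
    exact_mod_cast this
  have hanti : Antitone fun i : ℕ => 1 / ((i : ℝ) + 1) := fun a b h => by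
    have : (a : ℝ) ≤ b := by exact_mod_cast h
    exact one_div_le_one_div_of_le (by positivity) (by linarith)
  have key : L2Germ (fun (i : ℕ) z => ENNReal.ofReal (Real.exp (-u z - 1 / ((i : ℝ) + 1) * v z))) F := by
    refine mem_of_shell_tendsto hu hv hρ hF' hfin' (weightFamily_exp hu hv hanti).germIdeal
      (s := fun k => 1 / (2 * (j k : ℝ))) (t := fun k => 2 * (j k : ℝ)) (fun k => by positivity)
      (fun k => ?_) (fun k => by linarith [hj1 k]) ?_ ?_ ?_
    · rw [div_le_one (by linarith [hj1 k])]; linarith [hj1 k]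
    · refine Tendsto.const_mul_atTop two_pos (tendsto_natCast_atTop_atTop.comp ?_)
      exact tendsto_atTop_mono (fun k => (Nat.le_succ k).trans (hj k)) tendsto_id
    · have h0 : Tendsto (fun k : ℕ => ENNReal.ofReal (Real.exp 4) *
          ENNReal.ofReal (1 / ((k : ℝ) + 1))) atTop (𝓝 0) := by
        have h := ENNReal.Tendsto.const_mul (a := ENNReal.ofReal (Real.exp 4))
          ((ENNReal.continuous_ofReal.tendsto 0).comp tendsto_one_div_add_atTop_nhds_zero_nat)
          (Or.inr ENNReal.ofReal_ne_top)
        simpa using h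
      refine tendsto_of_tendsto_of_tendsto_of_le_of_le tendsto_const_nhds h0 (fun _ => zero_le)
        fun k => ?_
      have h1 : (0 : ℝ) < j k := by linarith [hj1 k]
      dsimp only
      rw [mul_comm (2 * (j k : ℝ)) (Real.exp _), ENNReal.ofReal_mul (Real.exp_pos _).le, mul_assoc]
      gcongr
      · rw [show 2 * (1 / (2 * (j k : ℝ))) * (2 * j k + 1) = 2 + 1 / j k by field_simp]
        have := (div_le_one h1).2 (hj1 k)
        linarith
      · exact hjs k
    · intro k f r hr hf hfi
      refine ⟨⟨r, hr, hf⟩, j k - 1, r, hr, ?_⟩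
      have h1 : 1 ≤ j k := (Nat.le_add_left 1 k).trans (hj k)
      have h2 : 1 / (((j k - 1 : ℕ) : ℝ) + 1) = 2 * (1 / (2 * (j k : ℝ))) := by
        have h3 : (0 : ℝ) < j k := by linarith [hj1 k]
        rw [Nat.cast_sub h1, Nat.cast_one, sub_add_cancel]
        field_simp
      beta_reduce
      rw [h2]
      exact hfi
  obtain ⟨-, i, r, hr, h⟩ := key
  exact ⟨_, by positivity, r, hr, h⟩

/-- Lower bound for the mass of the shells of a non-integrable weight. -/
theorem shell_lower_bound {u v : Cn n → ℝ} (hu : SPsh u) (hv : SPsh v) {R : ℝ} (hR : 0 < R)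
    {F : Cn n → ℂ} (hF : DifferentiableOn ℂ F (Metric.ball 0 R))
    (hfin : ∫⁻ z in Metric.ball (0 : Cn n) R, ‖F z‖ₑ ^ 2 * ENNReal.ofReal (Real.exp (-u z)) < ⊤)
    (hnon : ∀ r > 0, ∫⁻ z in Metric.ball (0 : Cn n) r, ‖F z‖ₑ ^ 2 *
      ENNReal.ofReal (Real.exp (-u z - 2 * v z)) = ⊤) :
    ∃ c > 0, ∃ T : ℝ, 1 ≤ T ∧ ∀ t, T ≤ t → ENNReal.ofReal (c * (Real.exp (-2 * t) / t)) ≤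
      ∫⁻ z in Metric.ball (0 : Cn n) R, {z | -t - 1 ≤ v z ∧ v z ≤ -t}.indicator
        (fun z => ‖F z‖ₑ ^ 2 * ENNReal.ofReal (Real.exp (-u z))) z := by
  by_contra hcon
  push Not at hcon
  have hk : ∀ k : ℕ, (0 : ℝ) < 1 / ((k : ℝ) + 1) := fun k => by positivity
  choose t ht hts using fun k : ℕ => hcon (1 / ((k : ℝ) + 1)) (hk k) ((k : ℝ) + 1)
    (by have : (0 : ℝ) ≤ k := by positivity
        linarith)
  have ht1 : ∀ k, 1 ≤ t k := fun k => le_trans (by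
    have : (0 : ℝ) ≤ k := by positivity
    linarith) (ht k)
  have key : L2Germ (fun (_ : ℕ) z => ENNReal.ofReal (Real.exp (-u z - 2 * v z))) F := by
    refine mem_of_shell_tendsto hu hv hR hF hfin
      (weightFamily_exp hu hv (s := fun _ => 2) antitone_const).germIdeal
      (s := fun _ => 1) (t := t) (fun k => by positivity) (fun k => le_rfl) ht1 ?_ ?_ ?_
    · exact tendsto_atTop_mono (fun k => (le_add_of_nonneg_right zero_le_one).trans (ht k))
        tendsto_natCast_atTop_atTop
    · have h0 : Tendsto (fun k : ℕ => ENNReal.ofReal (Real.exp 2 * (1 / ((k : ℝ) + 1)))) atTop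
          (𝓝 0) := by
        have h := (ENNReal.continuous_ofReal.tendsto _).comp
          (tendsto_one_div_add_atTop_nhds_zero_nat.const_mul (Real.exp 2))
        simpa [Function.comp_def] using h
      refine tendsto_of_tendsto_of_tendsto_of_le_of_le tendsto_const_nhds h0 (fun _ => zero_le)
        fun k => ?_
      have h1 : (0 : ℝ) < t k := by linarith [ht1 k]
      refine (mul_le_mul_right (hts k).le _).trans ?_
      rw [← ENNReal.ofReal_mul (by positivity)]
      refine ENNReal.ofReal_le_ofReal (le_of_eq ?_)
      rw [show t k * Real.exp (2 * 1 * (t k + 1)) * (1 / ((k : ℝ) + 1) * (Real.exp (-2 * t k) / t k)) =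
        (Real.exp (2 * 1 * (t k + 1)) * Real.exp (-2 * t k)) * (1 / ((k : ℝ) + 1)) by field_simp,
        ← Real.exp_add]
      congr 2
      ring
    · intro k f r hr hf hfi
      exact ⟨⟨r, hr, hf⟩, 0, r, hr, by simpa using hfi⟩
  obtain ⟨-, _, r, hr, h⟩ := key
  exact h.ne (hnon r hr)

section

lemma intervalIntegrable_usc_comp {X : Type*} [TopologicalSpace X] {h : X → ℝ} {K : Set X}
    (hK : IsCompact K) (hu : UpperSemicontinuousOn h K) {m : ℝ} (hm : ∀ x ∈ K, m ≤ h x)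
    {γ : ℝ → X} (hγ : Continuous γ) (hγK : ∀ θ, γ θ ∈ K) (a b : ℝ) :
    IntervalIntegrable (fun θ => h (γ θ)) volume a b := by
  obtain ⟨M, hM⟩ := hu.bddAbove_of_isCompact hK
  have hm' : Measurable fun θ => h (γ θ) := by
    have : UpperSemicontinuous (h ∘ γ) := by
      rw [← upperSemicontinuousOn_univ_iff]
      exact hu.comp hγ.continuousOn fun θ _ => hγK θ
    exact this.measurable
  have hb : ∀ θ, ‖h (γ θ)‖ ≤ max |m| |M| := fun θ =>
    abs_le_max_abs_abs (hm _ (hγK θ)) (hM ⟨_, hγK θ, rfl⟩)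
  exact intervalIntegrable_const (c := max |m| |M|) |>.mono_fun hm'.aestronglyMeasurable
    (Eventually.of_forall fun θ => (hb θ).trans (le_abs_self _))

/-- The maximum principle for upper semicontinuous functions with the local sub-mean value
property. -/
lemma le_zero_of_local_submean {k : ℂ → ℝ} (husc : UpperSemicontinuousOn k (Metric.closedBall 0 1))
    (hsub : ∀ ζ ∈ Metric.ball (0 : ℂ) 1, ∃ ε > 0, ∀ r : ℝ, 0 < r → r < ε →
      k ζ ≤ (2 * Real.pi)⁻¹ * ∫ θ in (0:ℝ)..(2 * Real.pi), k (ζ + r * Complex.exp (Complex.I * θ)))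
    (hbd : ∀ ζ, ‖ζ‖ = 1 → k ζ ≤ 0) : ∀ ζ ∈ Metric.closedBall (0 : ℂ) 1, k ζ ≤ 0 := by
  have hc : IsCompact (Metric.closedBall (0 : ℂ) 1) := isCompact_closedBall 0 1
  obtain ⟨ζ₀, hζ₀, hmax⟩ := husc.exists_isMaxOn ⟨0, by simp⟩ hc
  have hmax' : ∀ ζ ∈ Metric.closedBall (0 : ℂ) 1, k ζ ≤ k ζ₀ := hmax
  suffices h : k ζ₀ ≤ 0 from fun ζ hζ => (hmax' ζ hζ).trans h
  by_contra hpos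
  push Not at hpos
  obtain ⟨ζ, ⟨hζ, hζk⟩, hre⟩ := (husc.isCompact_inter_preimage_Ici hc (k ζ₀)).exists_isMaxOn
    ⟨ζ₀, hζ₀, le_refl (k ζ₀)⟩ Complex.continuous_re.continuousOn
  have hζk : k ζ = k ζ₀ := le_antisymm (hmax' ζ hζ) hζk
  have hζ1 : ‖ζ‖ < 1 := by
    refine lt_of_le_of_ne (mem_closedBall_zero_iff.1 hζ) fun h => ?_
    linarith [hbd ζ h]
  obtain ⟨ε, hε, hsub⟩ := hsub ζ (mem_ball_zero_iff.2 hζ1)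
  set r := min (ε / 2) ((1 - ‖ζ‖) / 2) with hr
  have hr0 : 0 < r := lt_min (by positivity) (by linarith)
  have hmem : ∀ θ : ℝ, ζ + r * Complex.exp (Complex.I * θ) ∈ Metric.closedBall (0 : ℂ) 1 := by
    intro θ
    rw [mem_closedBall_zero_iff]
    refine (norm_add_le _ _).trans ?_
    rw [norm_mul, norm_exp_I, mul_one, Complex.norm_real, Real.norm_of_nonneg hr0.le]
    linarith [min_le_right (ε / 2) ((1 - ‖ζ‖) / 2)]
  have h := hsub r hr0 (lt_of_le_of_lt (min_le_left _ _) (by linarith))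
  have hpi := Real.pi_pos
  by_cases hintg : IntervalIntegrable (fun θ : ℝ => k (ζ + r * Complex.exp (Complex.I * θ))) volume 0
      (2 * Real.pi)
  · have hintg' : IntervalIntegrable (fun θ : ℝ => k ζ₀ - k (ζ + r * Complex.exp (Complex.I * θ)))
      volume 0 (2 * Real.pi) := intervalIntegrable_const.sub hintg
    have h1 : 0 < ∫ θ in (0:ℝ)..(Real.pi / 2),
        (k ζ₀ - k (ζ + r * Complex.exp (Complex.I * θ))) := by
      refine intervalIntegral.intervalIntegral_pos_of_pos_on (hintg'.mono_set ?_) ?_ (by positivity)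
      · rw [Set.uIcc_of_le (by positivity), Set.uIcc_of_le (by positivity)]
        exact Set.Icc_subset_Icc le_rfl (by linarith)
      · intro θ hθ
        refine sub_pos.2 (lt_of_le_of_ne (hmax' _ (hmem θ)) fun he => ?_)
        have h2 := hre (show ζ + r * Complex.exp (Complex.I * θ) ∈ _ from ⟨hmem θ, he.ge⟩)
        have h3 : 0 < Real.cos θ := Real.cos_pos_of_mem_Ioo ⟨by linarith [hθ.1], hθ.2⟩
        have h4 : (ζ + r * Complex.exp (Complex.I * θ)).re = ζ.re + r * Real.cos θ := by
          rw [mul_comm Complex.I, Complex.add_re, Complex.re_ofReal_mul, Complex.exp_ofReal_mul_I_re]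
        simp only [Set.mem_ofPred_eq, h4] at h2
        nlinarith
    have h2 : (∫ θ in (0:ℝ)..(Real.pi / 2), (k ζ₀ - k (ζ + r * Complex.exp (Complex.I * θ)))) ≤
        ∫ θ in (0:ℝ)..(2 * Real.pi), (k ζ₀ - k (ζ + r * Complex.exp (Complex.I * θ))) :=
      intervalIntegral.integral_mono_interval le_rfl (by positivity) (by linarith)
        (Eventually.of_forall fun θ => sub_nonneg.2 (hmax' _ (hmem θ))) hintg'
    rw [intervalIntegral.integral_sub intervalIntegrable_const hintg,
      intervalIntegral.integral_const, smul_eq_mul] at h2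
    rw [hζk, inv_mul_eq_div, le_div_iff₀ (by positivity)] at h
    linarith
  · rw [intervalIntegral.integral_undef hintg, mul_zero] at h
    linarith

/-- The Lipschitz upper envelopes of a function on a metric space. -/
def supConv {X : Type*} [MetricSpace X] (h : X → ℝ) (k : ℕ) (x : X) : ℝ :=
  ⨆ y, (h y - k * dist x y)

section supConv

variable {X : Type*} [MetricSpace X] {h : X → ℝ} {M : ℝ}

lemma supConv_bddAbove (hM : ∀ x, h x ≤ M) (k : ℕ) (x : X) :
    BddAbove (Set.range fun y => h y - k * dist x y) := by
  refine ⟨M, ?_⟩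
  rintro _ ⟨y, rfl⟩
  have : 0 ≤ (k : ℝ) * dist x y := by positivity
  simp only
  linarith [hM y]

lemma le_supConv (hM : ∀ x, h x ≤ M) (k : ℕ) (x : X) : h x ≤ supConv h k x := by
  have := le_ciSup (supConv_bddAbove hM k x) x
  simpa [supConv] using this

lemma supConv_le [Nonempty X] (hM : ∀ x, h x ≤ M) (k : ℕ) (x : X) : supConv h k x ≤ M := by
  refine ciSup_le fun y => ?_
  have : 0 ≤ (k : ℝ) * dist x y := by positivity
  linarith [hM y]

lemma continuous_supConv [Nonempty X] (hM : ∀ x, h x ≤ M) (k : ℕ) : Continuous (supConv h k) := by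
  refine (LipschitzWith.of_le_add_mul k fun x x' => ?_).continuous
  refine ciSup_le fun y => ?_
  have h1 := le_ciSup (supConv_bddAbove hM k x') y
  have h2 := dist_triangle x' x y
  rw [dist_comm x' x] at h2
  have h3 : (k : ℝ) * dist x' y ≤ k * dist x x' + k * dist x y := by
    rw [← mul_add]; gcongr
  simp only [supConv, NNReal.coe_natCast] at h1 ⊢
  linarith

lemma tendsto_supConv [Nonempty X] (hM : ∀ x, h x ≤ M) (hu : UpperSemicontinuous h) (x : X) :
    Tendsto (fun k => supConv h k x) atTop (𝓝 (h x)) := by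
  refine tendsto_order.2 ⟨fun a ha => Eventually.of_forall fun k => lt_of_lt_of_le ha
    (le_supConv hM k x), fun a ha => ?_⟩
  obtain ⟨b, hb, hba⟩ := exists_between ha
  obtain ⟨δ, hδ, hball⟩ := Metric.eventually_nhds_iff_ball.1 (hu x b hb)
  obtain ⟨K, hK⟩ := exists_nat_gt ((M - b) / δ)
  filter_upwards [eventually_ge_atTop K] with k hk
  refine lt_of_le_of_lt (ciSup_le fun y => ?_) hba
  by_cases hy : dist x y < δ
  · have := hball y (by rwa [Metric.mem_ball, dist_comm])
    have h0 : 0 ≤ (k : ℝ) * dist x y := by positivity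
    linarith
  · push Not at hy
    have h1 : (M - b) ≤ k * dist x y := by
      have h2 : (K : ℝ) ≤ k := by exact_mod_cast hk
      calc M - b ≤ K * δ := by rw [← div_le_iff₀ hδ]; exact hK.le
        _ ≤ k * dist x y := by gcongr
    linarith [hM y]

end supConv

lemma exists_entire_of_mem_span {p : C(AddCircle (2 * Real.pi), ℂ)}
    (hp : p ∈ Submodule.span ℂ (Set.range (@fourier (2 * Real.pi)))) (c : ℂ) :
    ∃ q : ℂ → ℂ, Differentiable ℂ q ∧
      ∀ θ : ℝ, (c * p (θ : AddCircle (2 * Real.pi))).re = (q (Complex.exp (Complex.I * θ))).re := by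
  induction hp using Submodule.span_induction generalizing c with
  | mem x hx =>
    obtain ⟨j, rfl⟩ := hx
    have h1 : ∀ θ : ℝ, (fourier j (θ : AddCircle (2 * Real.pi)) : ℂ) =
        Complex.exp (j * (Complex.I * θ)) := fun θ => by
      rw [fourier_coe_apply]
      congr 1
      push_cast
      field_simp
    rcases Int.eq_nat_or_neg j with ⟨k, rfl | rfl⟩
    · refine ⟨fun z => c * z ^ k, by fun_prop, fun θ => ?_⟩
      beta_reduce
      rw [h1, ← Complex.exp_nat_mul]
      push_cast
      rfl
    · refine ⟨fun z => (starRingEnd ℂ c) * z ^ k, by fun_prop, fun θ => ?_⟩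
      beta_reduce
      rw [h1, ← Complex.exp_nat_mul, ← Complex.conj_re, map_mul, ← Complex.exp_conj]
      congr 3
      simp
  | zero => exact ⟨fun _ => 0, by fun_prop, fun θ => by simp⟩
  | add x y _ _ hx hy =>
    obtain ⟨q₁, h₁, e₁⟩ := hx c
    obtain ⟨q₂, h₂, e₂⟩ := hy c
    refine ⟨fun z => q₁ z + q₂ z, by fun_prop, fun θ => ?_⟩
    rw [ContinuousMap.add_apply, mul_add, Complex.add_re, e₁, e₂, Complex.add_re]
  | smul a x _ hx =>
    obtain ⟨q, h, e⟩ := hx (c * a)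
    refine ⟨q, h, fun θ => ?_⟩
    rw [← e, ContinuousMap.smul_apply, smul_eq_mul, mul_assoc]

lemma circle_average_entire {q : ℂ → ℂ} (hq : Differentiable ℂ q) (ζ : ℂ) (r : ℝ) :
    (2 * Real.pi)⁻¹ * ∫ θ in (0:ℝ)..(2 * Real.pi), (q (ζ + r * Complex.exp (Complex.I * θ))).re =
      (q ζ).re := by
  have h := circle_average_holo (n := 1) (F := fun w => q (w 0))
    (R := ‖(fun _ => ζ : Cn 1)‖ + ‖(fun _ => (r : ℂ) : Cn 1)‖ + 1)
    (z := fun _ => ζ) (y := fun _ => (r : ℂ)) (by fun_prop) (by linarith)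
  have h1 := congrArg Complex.re h
  rw [Complex.real_smul, Complex.re_ofReal_mul] at h1
  simp only [Pi.add_apply, Pi.smul_apply, smul_eq_mul] at h1
  rw [← h1]
  congr 1
  have hi : IntervalIntegrable (fun θ : ℝ => q (ζ + Complex.exp (Complex.I * θ) * r)) volume 0
      (2 * Real.pi) :=
    (hq.continuous.comp (by fun_prop)).intervalIntegrable _ _
  have h2 := Complex.reCLM.intervalIntegral_comp_comm hi
  simp only [Complex.reCLM_apply] at h2
  rw [← h2]
  simp only [mul_comm]

end

section

lemma disc_submean {h : ℂ → ℝ} (husc : UpperSemicontinuousOn h (Metric.closedBall 0 1)) {m : ℝ}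
    (hm : ∀ ζ ∈ Metric.closedBall (0 : ℂ) 1, m ≤ h ζ)
    (hsub : ∀ ζ ∈ Metric.ball (0 : ℂ) 1, ∃ ε > 0, ∀ r : ℝ, 0 < r → r < ε →
      h ζ ≤ (2 * Real.pi)⁻¹ * ∫ θ in (0:ℝ)..(2 * Real.pi), h (ζ + r * Complex.exp (Complex.I * θ))) :
    h 0 ≤ (2 * Real.pi)⁻¹ * ∫ θ in (0:ℝ)..(2 * Real.pi), h (Complex.exp (Complex.I * θ)) := by
  have : Fact (0 < 2 * Real.pi) := ⟨Real.two_pi_pos⟩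
  have hpi := Real.pi_pos
  have hc : IsCompact (Metric.closedBall (0 : ℂ) 1) := isCompact_closedBall 0 1
  set H : AddCircle (2 * Real.pi) → ℝ := fun x => h (fourier 1 x) with hH
  have hf1 : ∀ x : AddCircle (2 * Real.pi), (fourier 1 x : ℂ) ∈ Metric.closedBall (0 : ℂ) 1 := by
    intro x
    rw [mem_closedBall_zero_iff, fourier_apply]
    exact (Circle.norm_coe _).le
  have hHθ : ∀ θ : ℝ, H (θ : AddCircle (2 * Real.pi)) = h (Complex.exp (Complex.I * θ)) := by
    intro θ
    simp only [hH, fourier_coe_apply]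
    congr 2
    push_cast
    field_simp
  have hHu : UpperSemicontinuous H := by
    rw [← upperSemicontinuousOn_univ_iff]
    exact husc.comp (ContinuousMap.continuous (fourier 1)).continuousOn fun x _ => hf1 x
  obtain ⟨M, hM⟩ := husc.bddAbove_of_isCompact hc
  have hHM : ∀ x, H x ≤ M := fun x => hM ⟨_, hf1 x, rfl⟩
  have hstep : ∀ k : ℕ, h 0 ≤ (2 * Real.pi)⁻¹ * (∫ θ in (0:ℝ)..(2 * Real.pi),
      supConv H k (θ : AddCircle (2 * Real.pi))) + 2 * (1 / ((k : ℝ) + 1)) := by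
    intro k
    set e : ℝ := 1 / ((k : ℝ) + 1) with he
    have he0 : 0 < e := by positivity
    have hck : Continuous (supConv H k) := continuous_supConv hHM k
    set c : C(AddCircle (2 * Real.pi), ℂ) := ⟨fun x => ((supConv H k x + e : ℝ) : ℂ), by fun_prop⟩
      with hcdef
    have hcl : c ∈ (Submodule.span ℂ (Set.range (@fourier (2 * Real.pi)))).topologicalClosure := by
      rw [span_fourier_closure_eq_top]; trivial
    obtain ⟨p, hp, hpc⟩ := Metric.mem_closure_iff.1 hcl e he0
    have hpc' : ∀ x, |supConv H k x + e - (p x).re| < e := by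
      intro x
      have h1 := lt_of_le_of_lt (ContinuousMap.dist_apply_le_dist (f := c) (g := p) x) hpc
      rw [dist_eq_norm] at h1
      have h2 := (Complex.abs_re_le_norm (c x - p x)).trans_lt h1
      simpa [hcdef] using h2
    obtain ⟨q, hq, hqp⟩ := exists_entire_of_mem_span hp 1
    simp only [one_mul] at hqp
    have hqi : ∀ (ζ : ℂ) (r : ℝ), IntervalIntegrable
        (fun θ : ℝ => (q (ζ + r * Complex.exp (Complex.I * θ))).re) volume 0 (2 * Real.pi) :=
      fun ζ r => (Complex.continuous_re.comp (hq.continuous.comp (by fun_prop))).intervalIntegrable _ _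
    have hle := le_zero_of_local_submean (k := fun ζ => h ζ + -(q ζ).re)
      (husc.add (Complex.continuous_re.comp hq.continuous).neg.continuousOn.upperSemicontinuousOn)
      (fun ζ hζ => by
        obtain ⟨ε, hε, hs⟩ := hsub ζ hζ
        rw [mem_ball_zero_iff] at hζ
        refine ⟨min ε (1 - ‖ζ‖), lt_min hε (by linarith), fun r hr hrε => ?_⟩
        have h1 := hs r hr (hrε.trans_le (min_le_left _ _))
        have hneg : IntervalIntegrable (fun θ : ℝ => -(q (ζ + r * Complex.exp (Complex.I * θ))).re)
            volume 0 (2 * Real.pi) := (hqi ζ r).neg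
        rw [intervalIntegral.integral_add _ hneg, mul_add, intervalIntegral.integral_neg,
          mul_neg, circle_average_entire hq]
        · linarith
        · refine intervalIntegrable_usc_comp (γ := fun θ : ℝ => ζ + r * Complex.exp (Complex.I * θ))
            hc husc hm (by fun_prop) (fun θ => ?_) _ _
          rw [mem_closedBall_zero_iff]
          refine (norm_add_le _ _).trans ?_
          rw [norm_mul, norm_exp_I, mul_one, Complex.norm_real, Real.norm_of_nonneg hr.le]
          linarith [hrε.trans_le (min_le_right ε (1 - ‖ζ‖))])
      (fun ζ hζ => by
        have h1 : Complex.exp (Complex.I * (Complex.arg ζ : ℝ)) = ζ := by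
          have := Complex.norm_mul_exp_arg_mul_I ζ
          rw [hζ, Complex.ofReal_one, one_mul, mul_comm] at this
          exact this
        rw [← h1, ← hHθ, ← hqp]
        have h2 := le_supConv hHM k ((Complex.arg ζ : ℝ) : AddCircle (2 * Real.pi))
        have h3 := (abs_lt.1 (hpc' ((Complex.arg ζ : ℝ) : AddCircle (2 * Real.pi)))).2
        linarith)
      0 (by simp)
    have h4 := circle_average_entire hq 0 1
    simp only [Complex.ofReal_one, zero_add, one_mul, ← hqp] at h4
    have h0 : h 0 ≤ (q 0).re := by
      have h5 : h 0 + -(q 0).re ≤ 0 := hle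
      linarith
    rw [← h4] at h0
    refine h0.trans ?_
    have hmk : Continuous fun θ : ℝ => (θ : AddCircle (2 * Real.pi)) :=
      AddCircle.continuous_mk' (2 * Real.pi)
    have h5 : (∫ θ in (0:ℝ)..(2 * Real.pi), (p (θ : AddCircle (2 * Real.pi))).re) ≤
        ∫ θ in (0:ℝ)..(2 * Real.pi), (supConv H k (θ : AddCircle (2 * Real.pi)) + 2 * e) := by
      refine intervalIntegral.integral_mono_on (by positivity)
        ((Complex.continuous_re.comp (p.continuous.comp hmk)).intervalIntegrable _ _)
        (((hck.comp hmk).add continuous_const).intervalIntegrable _ _) fun θ _ => ?_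
      have := (abs_lt.1 (hpc' (θ : AddCircle (2 * Real.pi)))).1
      linarith
    have hsi : IntervalIntegrable (fun θ : ℝ => supConv H k (θ : AddCircle (2 * Real.pi))) volume
        0 (2 * Real.pi) := (hck.comp hmk).intervalIntegrable _ _
    rw [intervalIntegral.integral_add hsi
      intervalIntegrable_const, intervalIntegral.integral_const, smul_eq_mul, sub_zero] at h5
    have h6 := mul_le_mul_of_nonneg_left h5 (by positivity : 0 ≤ (2 * Real.pi)⁻¹)
    rw [mul_add, inv_mul_cancel_left₀ (by positivity)] at h6
    exact h6
  have hmk : Continuous fun θ : ℝ => (θ : AddCircle (2 * Real.pi)) :=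
    AddCircle.continuous_mk' (2 * Real.pi)
  have hlim : Tendsto (fun k : ℕ => ∫ θ in (0:ℝ)..(2 * Real.pi),
      supConv H k (θ : AddCircle (2 * Real.pi))) atTop
      (𝓝 (∫ θ in (0:ℝ)..(2 * Real.pi), h (Complex.exp (Complex.I * θ)))) := by
    refine intervalIntegral.tendsto_integral_filter_of_dominated_convergence
      (fun _ => max |m| |M|) ?_ ?_ intervalIntegrable_const ?_
    · exact Eventually.of_forall fun k =>
        ((continuous_supConv hHM k).comp hmk).aestronglyMeasurable
    · refine Eventually.of_forall fun k => Eventually.of_forall fun θ _ => ?_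
      exact abs_le_max_abs_abs ((hm _ (hf1 _)).trans (le_supConv hHM k _)) (supConv_le hHM k _)
    · refine Eventually.of_forall fun θ _ => ?_
      rw [← hHθ]
      exact tendsto_supConv hHM hHu _
  have hlim2 := (hlim.const_mul (2 * Real.pi)⁻¹).add
    (tendsto_one_div_add_atTop_nhds_zero_nat.const_mul (2 : ℝ))
  rw [mul_zero, add_zero] at hlim2
  exact ge_of_tendsto' hlim2 hstep

/-- The truncation of an extended-real-valued function from below at `-m`. -/
def trunc (u : Cn n → EReal) (m : ℕ) (z : Cn n) : ℝ :=
  (max (u z) ((-(m : ℝ) : ℝ) : EReal)).toReal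

lemma coe_trunc {u : Cn n → EReal} (m : ℕ) {z : Cn n} (hz : u z < ⊤) :
    ((trunc u m z : ℝ) : EReal) = max (u z) ((-(m : ℝ) : ℝ) : EReal) := by
  rw [trunc, EReal.coe_toReal]
  · exact (max_lt hz (EReal.coe_lt_top _)).ne
  · exact (lt_of_lt_of_le (EReal.bot_lt_coe _) (le_max_right _ _)).ne'

lemma trunc_lt_iff {u : Cn n → EReal} {m : ℕ} {z : Cn n} (hz : u z < ⊤) {y : ℝ} :
    trunc u m z < y ↔ u z < y ∧ -(m : ℝ) < y := by
  rw [← EReal.coe_lt_coe_iff, coe_trunc m hz, max_lt_iff, EReal.coe_lt_coe_iff]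

lemma neg_le_trunc {u : Cn n → EReal} (m : ℕ) {z : Cn n} (hz : u z < ⊤) : -(m : ℝ) ≤ trunc u m z := by
  rw [← EReal.coe_le_coe_iff, coe_trunc m hz]
  exact le_max_right _ _

lemma le_trunc {u : Cn n → EReal} (m : ℕ) {z : Cn n} (hz : u z < ⊤) :
    u z ≤ (trunc u m z : ℝ) := by
  rw [coe_trunc m hz]
  exact le_max_left _ _

variable {u : Cn n → EReal} {Ω : Set (Cn n)}

lemma PSHOn.trunc_usc (hu : PSHOn u Ω) (m : ℕ) : UpperSemicontinuousOn (trunc u m) Ω := by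
  intro z hz y hy
  obtain ⟨h1, h2⟩ := (trunc_lt_iff (hu.lt_top z hz)).1 hy
  filter_upwards [hu.usc z hz y h1, self_mem_nhdsWithin] with w hw hwΩ
  exact (trunc_lt_iff (hu.lt_top w hwΩ)).2 ⟨hw, h2⟩

/-- The sub-mean value inequality over all closed discs. -/
lemma PSHOn.trunc_submean (hu : PSHOn u Ω) (m : ℕ) {z w : Cn n}
    (hzw : ∀ ζ : ℂ, ‖ζ‖ ≤ 1 → z + ζ • w ∈ Ω) :
    trunc u m z ≤ (2 * Real.pi)⁻¹ * ∫ θ in (0:ℝ)..(2 * Real.pi),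
      trunc u m (z + Complex.exp (Complex.I * θ) • w) := by
  have h := disc_submean (h := fun ζ => trunc u m (z + ζ • w)) (m := -(m : ℝ)) ?_ ?_ ?_
  · simpa using h
  · exact (hu.trunc_usc m).comp (by fun_prop) fun ζ hζ => hzw ζ (mem_closedBall_zero_iff.1 hζ)
  · exact fun ζ hζ => neg_le_trunc m (hu.lt_top _ (hzw ζ (mem_closedBall_zero_iff.1 hζ)))
  · intro ζ hζ
    have hΩ := hzw ζ (mem_ball_zero_iff.1 hζ).le
    obtain ⟨ε, hε, hs⟩ := hu.submean _ hΩ w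
    refine ⟨ε, hε, fun r hr hrε => ?_⟩
    have h1 := (hs r hr hrε).trans (iInf_le _ m)
    have h2 : -(m : ℝ) ≤ circleAvg u (z + ζ • w) w r m := by
      have hpi := Real.pi_pos
      rw [circleAvg, inv_mul_eq_div, le_div_iff₀ (by positivity)]
      by_cases hintg : IntervalIntegrable (fun θ : ℝ => (max (u (z + ζ • w + ((r : ℂ) *
          Complex.exp (Complex.I * (θ : ℂ))) • w)) ((-(m : ℝ) : ℝ) : EReal)).toReal) volume 0
          (2 * Real.pi)
      · have h3 := intervalIntegral.integral_mono_on (a := 0) (b := 2 * Real.pi) (by positivity)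
          (intervalIntegrable_const (c := -(m : ℝ))) hintg fun θ _ => ?_
        · rw [intervalIntegral.integral_const, smul_eq_mul] at h3
          linarith
        · by_cases ht : u (z + ζ • w + ((r : ℂ) * Complex.exp (Complex.I * (θ : ℂ))) • w) = ⊤
          · simp [ht]
          · exact neg_le_trunc m (Ne.lt_top ht)
      · rw [intervalIntegral.integral_undef hintg]
        have : (0 : ℝ) ≤ m := by positivity
        nlinarith
    have h3 : trunc u m (z + ζ • w) ≤ circleAvg u (z + ζ • w) w r m := by
      rw [← EReal.coe_le_coe_iff, coe_trunc m (hu.lt_top _ hΩ)]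
      exact max_le h1 (EReal.coe_le_coe_iff.2 h2)
    refine h3.trans (le_of_eq ?_)
    simp only [circleAvg, trunc, add_smul, add_assoc]

end

lemma SmR.fderiv_apply {V : Cn n → ℝ} (hV : SmR V) (v : Cn n) : SmR fun z => fderiv ℝ V z v :=
  (ContDiff.fderiv_right (m := ((⊤ : ℕ∞) : WithTop ℕ∞)) hV (by exact le_rfl)).clm_apply
    contDiff_const

lemma SmR.hasFDerivAt_fderiv {V : Cn n → ℝ} (hV : SmR V) (z : Cn n) :
    HasFDerivAt (fderiv ℝ V) (fderiv ℝ (fderiv ℝ V) z) z :=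
  ((ContDiff.fderiv_right (m := 1) hV two_le_smooth).differentiable (by simp) z).hasFDerivAt

lemma levi_rc_eq {V : Cn n → ℝ} (hV : SmR V) (z : Cn n) (β : Cn n) :
    4 * levi (rc V) z β = fderiv ℝ (fderiv ℝ V) z β β +
      fderiv ℝ (fderiv ℝ V) z (Complex.I • β) (Complex.I • β) := by
  set B := fderiv ℝ (fderiv ℝ V) z with hB
  have h2 : ∀ v w : Cn n, fderiv ℝ (fun y => fderiv ℝ V y v) z w = B w v := by
    intro v w
    have h := ((hV.hasFDerivAt_fderiv z).clm_apply (hasFDerivAt_const v z)).fderiv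
    rw [h]; simp [hB]
  have hdel : ∀ j, del j (rc V) = fun z => (1 / 2) *
      (rc (fun y => fderiv ℝ V y (Pi.single j 1)) z +
        -Complex.I * rc (fun y => fderiv ℝ V y (Pi.single j Complex.I)) z) := by
    intro j; funext y
    simp only [del, wirt, fderiv_rc hV, rc]
  have hdd : ∀ j k, dbar k (del j (rc V)) z = (1 / 4) *
      (((B (Pi.single k 1) (Pi.single j 1) + B (Pi.single k Complex.I) (Pi.single j Complex.I) : ℝ) : ℂ)
      + Complex.I * ((B (Pi.single k Complex.I) (Pi.single j 1)
        - B (Pi.single k 1) (Pi.single j Complex.I) : ℝ) : ℂ)) := by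
    intro j k
    have d1 := fun v => (hV.fderiv_apply v).rc.differentiable z
    rw [hdel, dbar, wirt_const_mul _ _ ((d1 _).fun_add ((d1 _).const_mul _)),
      wirt_add _ _ (d1 _) ((d1 _).const_mul _), wirt_const_mul _ _ (d1 _)]
    simp only [wirt, fderiv_rc (hV.fderiv_apply _), h2]
    push_cast
    linear_combination (-1 / 4 * (B (Pi.single k Complex.I) (Pi.single j Complex.I) : ℂ)) *
      Complex.I_sq
  have hβ : β = ∑ j, ((β j).re • (Pi.single j 1 : Cn n) + (β j).im • (Pi.single j Complex.I : Cn n)) := by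
    funext i
    rw [Finset.sum_apply, Finset.sum_eq_single i]
    · apply Complex.ext <;> simp
    · intro j _ hji
      simp [Pi.single_eq_of_ne hji.symm]
    · simp
  have hIβ : Complex.I • β = ∑ j, ((β j).re • (Pi.single j Complex.I : Cn n) +
      (-(β j).im) • (Pi.single j 1 : Cn n)) := by
    funext i
    rw [Finset.sum_apply, Finset.sum_eq_single i]
    · apply Complex.ext <;> simp
    · intro j _ hji
      simp [Pi.single_eq_of_ne hji.symm]
    · simp
  have hR : B β β + B (Complex.I • β) (Complex.I • β) = ∑ j, ∑ k,
      (((β k).re * (β j).re + (β k).im * (β j).im) * (B (Pi.single k 1) (Pi.single j 1)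
        + B (Pi.single k Complex.I) (Pi.single j Complex.I)) +
      ((β k).re * (β j).im - (β k).im * (β j).re) * (B (Pi.single k 1) (Pi.single j Complex.I)
        - B (Pi.single k Complex.I) (Pi.single j 1))) := by
    rw [hIβ]
    conv_lhs => arg 1; rw [hβ]
    simp only [map_sum, map_add, map_smul, _root_.sum_apply, add_apply, smul_apply, smul_eq_mul,
      ← Finset.sum_add_distrib]
    refine Finset.sum_congr rfl fun j _ => ?_
    simp only [Finset.mul_sum, ← Finset.sum_add_distrib]
    refine Finset.sum_congr rfl fun k _ => ?_
    ring
  rw [hR, levi, Complex.re_sum, Finset.mul_sum]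
  refine Finset.sum_congr rfl fun j _ => ?_
  rw [Complex.re_sum, Finset.mul_sum]
  refine Finset.sum_congr rfl fun k _ => ?_
  rw [hdd]
  simp
  ring

lemma SmR.taylor_two {V : Cn n → ℝ} (hV : SmR V) (z : Cn n) {ε : ℝ} (hε : 0 < ε) :
    ∃ δ > 0, ∀ w : Cn n, ‖w‖ < δ →
      |V (z + w) - V z - fderiv ℝ V z w - 1 / 2 * fderiv ℝ (fderiv ℝ V) z w w| ≤ ε * ‖w‖ ^ 2 := by
  set B := fderiv ℝ (fderiv ℝ V) z with hB
  have hsym : ∀ v w, B v w = B w v := by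
    intro v w
    exact (hV.contDiffAt (x := z)).isSymmSndFDerivAt (by simp; exact two_le_smooth) v w
  have h1 := (hV.hasFDerivAt_fderiv z).isLittleO.def hε
  obtain ⟨δ, hδ, h2⟩ := Metric.eventually_nhds_iff.1 h1
  refine ⟨δ, hδ, fun w hw => ?_⟩
  set F : Cn n → ℝ := fun w => V (z + w) - V z - fderiv ℝ V z w - 1 / 2 * B w w with hF
  have hd : ∀ x, HasFDerivAt F (fderiv ℝ V (z + x) - fderiv ℝ V z - B x) x := by
    intro x
    have e1 : HasFDerivAt (fun w => V (z + w)) (fderiv ℝ V (z + x)) x := by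
      have := (hV.differentiable (by simp) (z + x)).hasFDerivAt
      exact (this.comp x ((hasFDerivAt_id x).const_add z)).congr_fderiv (by ext v; simp)
    have e2 : HasFDerivAt (fun w => B w w) ((2 : ℝ) • B x) x := by
      have := (B.hasFDerivAt (x := x)).clm_apply (hasFDerivAt_id x)
      refine this.congr_fderiv ?_
      ext v
      have := hsym v x
      simp
      linarith
    have := ((e1.sub_const (V z)).sub (fderiv ℝ V z).hasFDerivAt).sub (e2.const_mul (1 / 2))
    refine this.congr_fderiv ?_
    ext v
    simp
  have hmv := (convex_closedBall (0 : Cn n) ‖w‖).norm_image_sub_le_of_norm_hasFDerivWithin_le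
    (f := F) (C := ε * ‖w‖) (x := 0) (y := w) (fun x _ => (hd x).hasFDerivWithinAt)
    (fun x hx => by
      rw [mem_closedBall_zero_iff] at hx
      have := h2 (y := z + x) (by simpa using hx.trans_lt hw)
      rw [add_sub_cancel_left] at this
      exact this.trans (by gcongr))
    (by simp) (by simp)
  have hF0 : F 0 = 0 := by simp [hF]
  rw [hF0, sub_zero, sub_zero, Real.norm_eq_abs] at hmv
  refine hmv.trans (le_of_eq (by ring))

lemma levi_nonneg_of_submean {V : Cn n → ℝ} (hV : SmR V) {z β : Cn n} {r₀ : ℝ} (hr₀ : 0 < r₀)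
    (h : ∀ r : ℝ, 0 < r → r < r₀ → V z ≤ (2 * Real.pi)⁻¹ * ∫ θ in (0:ℝ)..(2 * Real.pi),
      V (z + Complex.exp (Complex.I * θ) • ((r : ℂ) • β))) : 0 ≤ levi (rc V) z β := by
  have hpi := Real.pi_pos
  set B := fderiv ℝ (fderiv ℝ V) z with hB
  set L := fderiv ℝ V z with hL
  have hlevi := levi_rc_eq hV z β
  rw [← hB] at hlevi
  by_contra hneg
  push Not at hneg
  set ε : ℝ := -levi (rc V) z β / (2 * (‖β‖ ^ 2 + 1)) with hεdef
  have hε : 0 < ε := by have := neg_pos.2 hneg; positivity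
  obtain ⟨δ, hδ, ht⟩ := hV.taylor_two z hε
  obtain ⟨r, hr, hrr⟩ : ∃ r : ℝ, 0 < r ∧ r < min r₀ (δ / (‖β‖ + 1)) :=
    exists_between (lt_min hr₀ (by positivity))
  have h1 := h r hr (hrr.trans_le (min_le_left _ _))
  have hrβ : r * ‖β‖ < δ := by
    have h2 := hrr.trans_le (min_le_right r₀ _)
    rw [lt_div_iff₀ (by positivity)] at h2
    nlinarith [norm_nonneg β]
  have hw : ∀ θ : ℝ, Complex.exp (Complex.I * θ) • ((r : ℂ) • β) =
      (r * Real.cos θ) • β + (r * Real.sin θ) • (Complex.I • β) := by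
    intro θ
    funext i
    rw [mul_comm Complex.I, Complex.exp_mul_I]
    simp
    ring
  have hn : ∀ θ : ℝ, ‖Complex.exp (Complex.I * θ) • ((r : ℂ) • β)‖ = r * ‖β‖ := by
    intro θ
    rw [norm_smul, norm_smul, norm_exp_I, one_mul, Complex.norm_real, Real.norm_of_nonneg hr.le]
  set G : ℝ → ℝ := fun θ => (V z + ε * (r * ‖β‖) ^ 2) + (r * L β) * Real.cos θ +
    (r * L (Complex.I • β)) * Real.sin θ +
    (1 / 2 * r ^ 2 * B β β) * Real.cos θ ^ 2 +
    (1 / 2 * r ^ 2 * B (Complex.I • β) (Complex.I • β)) * Real.sin θ ^ 2 +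
    (1 / 2 * r ^ 2 * (B β (Complex.I • β) + B (Complex.I • β) β)) * (Real.sin θ * Real.cos θ) with hG
  have hVG : ∀ θ : ℝ, V (z + Complex.exp (Complex.I * θ) • ((r : ℂ) • β)) ≤ G θ := by
    intro θ
    have h2 := (abs_le.1 (ht _ ((hn θ).trans_lt hrβ))).2
    rw [hn θ] at h2
    have h3 : L (Complex.exp (Complex.I * θ) • ((r : ℂ) • β)) =
        r * Real.cos θ * L β + r * Real.sin θ * L (Complex.I • β) := by
      rw [hw]; simp
    have h4 : B (Complex.exp (Complex.I * θ) • ((r : ℂ) • β))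
        (Complex.exp (Complex.I * θ) • ((r : ℂ) • β)) =
        r ^ 2 * (Real.cos θ ^ 2 * B β β + Real.sin θ ^ 2 * B (Complex.I • β) (Complex.I • β) +
          Real.sin θ * Real.cos θ * (B β (Complex.I • β) + B (Complex.I • β) β)) := by
      rw [hw]; simp only [map_add, map_smul, add_apply, smul_apply, smul_eq_mul]; ring
    rw [← hB, ← hL, h3, h4] at h2
    simp only [hG]
    linarith
  have h5 : (∫ θ in (0:ℝ)..(2 * Real.pi), V (z + Complex.exp (Complex.I * θ) • ((r : ℂ) • β))) ≤
      ∫ θ in (0:ℝ)..(2 * Real.pi), G θ := by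
    refine intervalIntegral.integral_mono_on (by positivity) ?_ ?_ fun θ _ => hVG θ
    · exact (hV.continuous.comp (by fun_prop)).intervalIntegrable _ _
    · exact Continuous.intervalIntegrable (by fun_prop) _ _
  have h6 : (∫ θ in (0:ℝ)..(2 * Real.pi), G θ) = 2 * Real.pi * (V z + ε * (r * ‖β‖) ^ 2) +
      Real.pi * (1 / 2 * r ^ 2 * (4 * levi (rc V) z β)) := by
    have i0 : ∀ g : ℝ → ℝ, Continuous g → IntervalIntegrable g volume 0 (2 * Real.pi) :=
      fun g hg => hg.intervalIntegrable _ _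
    simp only [hG]
    rw [intervalIntegral.integral_add (i0 _ (by fun_prop)) (i0 _ (by fun_prop)),
      intervalIntegral.integral_add (i0 _ (by fun_prop)) (i0 _ (by fun_prop)),
      intervalIntegral.integral_add (i0 _ (by fun_prop)) (i0 _ (by fun_prop)),
      intervalIntegral.integral_add (i0 _ (by fun_prop)) (i0 _ (by fun_prop)),
      intervalIntegral.integral_add (i0 _ (by fun_prop)) (i0 _ (by fun_prop))]
    simp only [intervalIntegral.integral_const_mul, intervalIntegral.integral_const, integral_cos,
      integral_sin, integral_cos_sq, integral_sin_sq, integral_sin_mul_cos₁, hlevi]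
    simp
    ring
  rw [h6] at h5
  have h7 : V z ≤ V z + ε * (r * ‖β‖) ^ 2 + r ^ 2 * levi (rc V) z β := by
    refine h1.trans ((mul_le_mul_of_nonneg_left h5 (by positivity)).trans (le_of_eq ?_))
    field_simp
    ring
  have h8 : ε * (‖β‖ ^ 2 + 1) = -levi (rc V) z β / 2 := by
    rw [hεdef]; field_simp
  have h9 : 0 < r ^ 2 := by positivity
  nlinarith [mul_pos h9 hε, mul_pos h9 (neg_pos.2 hneg)]

section

lemma integral_mol_le_circle {δ : ℝ} (hδ : 0 < δ) {f : Cn n → ℝ} (hf : Measurable f) {M : ℝ}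
    (hM : ∀ z, ‖f z‖ ≤ M) {γ : Cn n → ℝ → Cn n} (hγ : Measurable (Function.uncurry γ))
    {a : Cn n → ℝ} (ha : Integrable fun y => mol δ y * a y)
    (hle : ∀ y, ‖y‖ < δ → a y ≤ (2 * Real.pi)⁻¹ * ∫ θ in (0:ℝ)..(2 * Real.pi), f (γ y θ)) :
    ∫ y, mol δ y * a y ≤
      (2 * Real.pi)⁻¹ * ∫ θ in (0:ℝ)..(2 * Real.pi), ∫ y, mol δ y * f (γ y θ) := by
  have hpi : (0:ℝ) ≤ 2 * Real.pi := by positivity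
  have hI : Integrable (Function.uncurry fun (y : Cn n) (θ : ℝ) => mol δ y * f (γ y θ))
      (volume.prod (volume.restrict (Set.Ioc 0 (2 * Real.pi)))) := by
    have h1 : Integrable (fun p : Cn n × ℝ => mol δ p.1)
        (volume.prod (volume.restrict (Set.Ioc 0 (2 * Real.pi)))) := (integrable_mol hδ).comp_fst _
    exact h1.mul_bdd (c := M) (hf.comp hγ).aestronglyMeasurable (Eventually.of_forall fun y => hM _)
  have key := integral_integral_swap hI
  rw [intervalIntegral.integral_of_le hpi, ← key, ← integral_const_mul]
  refine integral_mono ha (hI.integral_prod_left.const_mul _) fun y => ?_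
  rcases lt_or_ge ‖y‖ δ with hy | hy
  · have h1 := mul_le_mul_of_nonneg_left (hle y hy) (mol_nonneg δ y)
    refine h1.trans (le_of_eq ?_)
    rw [intervalIntegral.integral_of_le hpi, integral_const_mul]
    ring
  · simp [mol_eq_zero hδ hy]

/-- The mollification of a truncated function restricted to `K`. -/
def mtrunc (u : Cn n → EReal) (K : Set (Cn n)) (m : ℕ) (δ : ℝ) (z : Cn n) : ℝ :=
  ∫ y, mol δ y * K.indicator (trunc u m) (z + y)

variable {u : Cn n → EReal} {Ω K : Set (Cn n)}

lemma PSHOn.exists_le_of_isCompact (hu : PSHOn u Ω) (hK : IsCompact K) (hKΩ : K ⊆ Ω) :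
    ∃ M : ℝ, 0 ≤ M ∧ ∀ z ∈ K, u z ≤ M := by
  obtain ⟨M, hM⟩ := ((hu.trunc_usc 0).mono hKΩ).bddAbove_of_isCompact hK
  refine ⟨max M 0, le_max_right _ _, fun z hz => ?_⟩
  refine (le_trunc 0 (hu.lt_top z (hKΩ hz))).trans (EReal.coe_le_coe_iff.2 ?_)
  exact (hM ⟨z, hz, rfl⟩).trans (le_max_left _ _)

lemma trunc_le_of_le {M : ℝ} (hM : 0 ≤ M) {m : ℕ} {z : Cn n} (hz : u z ≤ M) : trunc u m z ≤ M := by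
  rw [← EReal.coe_le_coe_iff, coe_trunc m (hz.trans_lt (EReal.coe_lt_top _))]
  refine max_le hz (EReal.coe_le_coe_iff.2 ?_)
  have : (0 : ℝ) ≤ m := by positivity
  linarith

lemma PSHOn.exists_bound (hu : PSHOn u Ω) (hK : IsCompact K) (hKΩ : K ⊆ Ω) (m : ℕ) :
    ∃ M : ℝ, ∀ z, ‖K.indicator (trunc u m) z‖ ≤ M := by
  obtain ⟨M, hM0, hM⟩ := hu.exists_le_of_isCompact hK hKΩ
  refine ⟨max m M, fun z => ?_⟩
  by_cases hz : z ∈ K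
  · rw [Set.indicator_of_mem hz, Real.norm_eq_abs, abs_le]
    exact ⟨(neg_le_neg (le_max_left _ _)).trans (neg_le_trunc m (hu.lt_top z (hKΩ hz))),
      (trunc_le_of_le hM0 (hM z hz)).trans (le_max_right _ _)⟩
  · rw [Set.indicator_of_notMem hz, norm_zero]
    exact hM0.trans (le_max_right _ _)

lemma PSHOn.measurable_indicator (hu : PSHOn u Ω) (hK : MeasurableSet K) (hKΩ : K ⊆ Ω) (m : ℕ) :
    Measurable (K.indicator (trunc u m)) := by
  refine measurable_of_restrict_of_restrict_compl hK ?_ ?_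
  · have h1 := upperSemicontinuousOn_iff_restrict.2 ((hu.trunc_usc m).mono hKΩ)
    have h2 : K.domRestrict (K.indicator (trunc u m)) = K.domRestrict (trunc u m) := by
      funext x; simp [Set.domRestrict]
    rw [h2]; exact h1.measurable
  · have h2 : Kᶜ.domRestrict (K.indicator (trunc u m)) = fun _ => 0 := by
      funext x
      exact Set.indicator_of_notMem x.2 _
    rw [h2]; exact measurable_const

lemma PSHOn.integrable_mtrunc (hu : PSHOn u Ω) (hK : IsCompact K) (hKΩ : K ⊆ Ω) (m : ℕ) {δ : ℝ}
    (hδ : 0 < δ) (z : Cn n) : Integrable fun y => mol δ y * K.indicator (trunc u m) (z + y) := by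
  obtain ⟨M, hM⟩ := hu.exists_bound hK hKΩ m
  exact integrable_mol_smul hδ (hu.measurable_indicator hK.measurableSet hKΩ m).stronglyMeasurable
    hM z

lemma PSHOn.smR_mtrunc (hu : PSHOn u Ω) (hK : IsCompact K) (hKΩ : K ⊆ Ω) (m : ℕ) {δ : ℝ}
    (hδ : 0 < δ) : SmR (mtrunc u K m δ) := by
  obtain ⟨M, hM⟩ := hu.exists_bound hK hKΩ m
  have hmeas := hu.measurable_indicator hK.measurableSet hKΩ m
  have hli : LocallyIntegrable (rc (K.indicator (trunc u m))) := by
    have h1 : LocallyIntegrable (fun _ : Cn n => M) := locallyIntegrable_const M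
    refine h1.mono (Complex.measurable_ofReal.comp hmeas).aestronglyMeasurable
      (Eventually.of_forall fun z => ?_)
    rw [rc, Complex.norm_real]
    exact (hM z).trans (le_abs_self M)
  have h := sm_mf hδ hli
  have e : mtrunc u K m δ = fun z => (mf δ (rc (K.indicator (trunc u m))) z).re := by
    funext z
    have : mf δ (rc (K.indicator (trunc u m))) z = ((mtrunc u K m δ z : ℝ) : ℂ) := by
      rw [mf, ← integral_add_left_eq_self _ z, mtrunc, ← integral_complex_ofReal]
      congr 1; funext y
      simp only [molC, rc, sub_add_cancel_left, mol_neg]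
      push_cast
      ring
    rw [this, Complex.ofReal_re]
  rw [e]
  exact Complex.reCLM.contDiff.comp h

lemma PSHOn.trunc_le_mtrunc (hu : PSHOn u Ω) (hK : IsCompact K) (hKΩ : K ⊆ Ω) (m : ℕ) {δ : ℝ}
    (hδ : 0 < δ) {z : Cn n} (hz : Metric.ball z δ ⊆ K) : trunc u m z ≤ mtrunc u K m δ z := by
  obtain ⟨M, hM⟩ := hu.exists_bound hK hKΩ m
  have hmeas := hu.measurable_indicator hK.measurableSet hKΩ m
  have hmem : ∀ y : Cn n, ‖y‖ < δ → ∀ ζ : ℂ, ‖ζ‖ ≤ 1 → z + ζ • y ∈ K := by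
    intro y hy ζ hζ
    refine hz ?_
    rw [mem_ball_iff_norm, add_sub_cancel_left, norm_smul]
    nlinarith [norm_nonneg y]
  have h := integral_mol_le_circle hδ hmeas hM
    (γ := fun y θ => z + Complex.exp (Complex.I * θ) • y) (by unfold Function.uncurry; fun_prop)
    (a := fun _ => trunc u m z) ((integrable_mol hδ).mul_const _) (fun y hy => by
      have h1 := hu.trunc_submean m (w := y) fun ζ hζ => hKΩ (hmem y hy ζ hζ)
      refine h1.trans (le_of_eq ?_)
      congr 1
      refine intervalIntegral.integral_congr fun θ _ => ?_
      exact (Set.indicator_of_mem (hmem y hy _ (norm_exp_I θ).le) _).symm)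
  rw [integral_mul_const, integral_mol hδ, one_mul] at h
  refine h.trans (le_of_eq ?_)
  have e := fun θ => integral_mol_rotate δ (K.indicator (trunc u m)) z θ
  simp only [smul_eq_mul] at e
  simp only [e]
  rw [intervalIntegral.integral_const, smul_eq_mul, sub_zero, inv_mul_cancel_left₀ (by positivity)]
  rfl

lemma PSHOn.mtrunc_le (hu : PSHOn u Ω) (hK : IsCompact K) (hKΩ : K ⊆ Ω) (m : ℕ) {δ : ℝ}
    (hδ : 0 < δ) {z : Cn n} (hz : Metric.ball z δ ⊆ K) {c : ℝ}
    (hc : ∀ w ∈ Metric.ball z δ, trunc u m w ≤ c) : mtrunc u K m δ z ≤ c := by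
  have h : mtrunc u K m δ z ≤ ∫ y : Cn n, mol δ y * c := by
    refine integral_mono (hu.integrable_mtrunc hK hKΩ m hδ z) ((integrable_mol hδ).mul_const _)
      fun y => ?_
    rcases lt_or_ge ‖y‖ δ with hy | hy
    · have hw : z + y ∈ Metric.ball z δ := by simpa using hy
      beta_reduce
      rw [Set.indicator_of_mem (hz hw)]
      exact mul_le_mul_of_nonneg_left (hc _ hw) (mol_nonneg δ y)
    · simp [mol_eq_zero hδ hy]
  rwa [integral_mul_const, integral_mol hδ, one_mul] at h

lemma PSHOn.levi_mtrunc_nonneg (hu : PSHOn u Ω) (hK : IsCompact K) (hKΩ : K ⊆ Ω) (m : ℕ) {δ ρ : ℝ}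
    (hδ : 0 < δ) (hρ : δ < ρ) {z : Cn n} (hz : Metric.ball z ρ ⊆ K) (β : Cn n) :
    0 ≤ levi (rc (mtrunc u K m δ)) z β := by
  obtain ⟨M, hM⟩ := hu.exists_bound hK hKΩ m
  have hmeas := hu.measurable_indicator hK.measurableSet hKΩ m
  refine levi_nonneg_of_submean (hu.smR_mtrunc hK hKΩ m hδ) (r₀ := (ρ - δ) / (‖β‖ + 1))
    (by have := sub_pos.2 hρ; positivity) fun r hr hrr => ?_
  rw [lt_div_iff₀ (by positivity)] at hrr
  have hmem : ∀ y : Cn n, ‖y‖ < δ → ∀ ζ : ℂ, ‖ζ‖ ≤ 1 → z + y + ζ • ((r : ℂ) • β) ∈ K := by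
    intro y hy ζ hζ
    refine hz ?_
    rw [mem_ball_iff_norm, add_assoc, add_sub_cancel_left]
    refine (norm_add_le _ _).trans_lt ?_
    rw [norm_smul, norm_smul, Complex.norm_real, Real.norm_of_nonneg hr.le]
    nlinarith [norm_nonneg β, mul_nonneg hr.le (norm_nonneg β)]
  have h := integral_mol_le_circle hδ hmeas hM
    (γ := fun y θ => z + y + Complex.exp (Complex.I * θ) • ((r : ℂ) • β))
    (by unfold Function.uncurry; fun_prop)
    (a := fun y => K.indicator (trunc u m) (z + y)) (hu.integrable_mtrunc hK hKΩ m hδ z)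
    (fun y hy => by
      have h1 := hu.trunc_submean m (z := z + y) (w := (r : ℂ) • β)
        fun ζ hζ => hKΩ (hmem y hy ζ hζ)
      have h0 : z + y ∈ K := by simpa using hmem y hy 0 (by simp)
      rw [Set.indicator_of_mem h0]
      refine h1.trans (le_of_eq ?_)
      congr 1
      refine intervalIntegral.integral_congr fun θ _ => ?_
      exact (Set.indicator_of_mem (hmem y hy _ (norm_exp_I θ).le) _).symm)
  refine h.trans (le_of_eq ?_)
  simp only [mtrunc]
  congr 1
  refine intervalIntegral.integral_congr fun θ _ => ?_
  congr 1; funext y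
  rw [add_right_comm]

end

section

lemma mol_pos {δ : ℝ} (hδ : 0 < δ) {y : Cn n} (hy : ‖y‖ < δ / (n + 1)) : 0 < mol δ y := by
  refine mul_pos (inv_pos.2 (integral_bmp_pos hδ)) (Real.smoothTransition.pos_of_pos ?_)
  have h1 : nsq y < δ ^ 2 := by
    rw [lt_div_iff₀ (by positivity)] at hy
    have h2 : (‖y‖ * (n + 1)) ^ 2 < δ ^ 2 := by gcongr
    have h3 : (0 : ℝ) ≤ n := by positivity
    nlinarith [nsq_le y, sq_nonneg ‖y‖, mul_nonneg h3 (sq_nonneg ‖y‖), sq_nonneg (n : ℝ),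
      mul_nonneg (sq_nonneg (n : ℝ)) (sq_nonneg ‖y‖), norm_nonneg y, nsq_nonneg y, sq_pos_of_pos hδ]
  rw [inv_pow, ← div_eq_inv_mul, sub_pos, div_lt_one (by positivity)]
  exact h1

variable {u : Cn n → EReal} {Ω : Set (Cn n)}

lemma trunc_eq_neg_of_bot {m : ℕ} {z : Cn n} (hz : u z = ⊥) : trunc u m z = -(m : ℝ) := by
  rw [trunc, hz, max_eq_right bot_le, EReal.toReal_coe]

lemma PSHOn.measurableSet_bot (hu : PSHOn u Ω) {K : Set (Cn n)} (hK : MeasurableSet K)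
    (hKΩ : K ⊆ Ω) : MeasurableSet {z | z ∈ K ∧ u z = ⊥} := by
  have e : {z | z ∈ K ∧ u z = ⊥} = K ∩ ⋂ m : ℕ, {z | K.indicator (trunc u m) z = -(m : ℝ)} := by
    ext z
    simp only [Set.mem_ofPred_eq, Set.mem_inter_iff, Set.mem_iInter]
    refine and_congr_right fun hz => ?_
    simp only [Set.indicator_of_mem hz]
    refine ⟨fun h m => trunc_eq_neg_of_bot h, fun h => ?_⟩
    by_contra hb
    lift u z to ℝ using ⟨(hu.lt_top z (hKΩ hz)).ne, hb⟩ with x hx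
    obtain ⟨m, hm⟩ := exists_nat_gt (-x)
    have h1 := le_trunc m (hu.lt_top z (hKΩ hz))
    rw [h m, ← hx, EReal.coe_le_coe_iff] at h1
    linarith
  rw [e]
  exact hK.inter (MeasurableSet.iInter fun m =>
    (hu.measurable_indicator hK hKΩ m) (measurableSet_singleton _))

lemma PSHOn.ae_ne_bot_of_ne_bot (hu : PSHOn u Ω) {w : Cn n} {δ : ℝ} (hδ : 0 < δ)
    (hw : Metric.closedBall w δ ⊆ Ω) (hb : u w ≠ ⊥) :
    ∀ᵐ z, z ∈ Metric.ball w (δ / (n + 1)) → u z ≠ ⊥ := by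
  set K := Metric.closedBall w δ with hKdef
  have hK : IsCompact K := isCompact_closedBall w δ
  obtain ⟨M, hM0, hM⟩ := hu.exists_le_of_isCompact hK hw
  set N : Set (Cn n) := {z | z ∈ K ∧ u z = ⊥} with hN
  have hNm : MeasurableSet N := hu.measurableSet_bot hK.measurableSet hw
  have hwK : w ∈ K := Metric.mem_closedBall_self hδ.le
  have hi : Integrable fun y => mol δ y * N.indicator (fun _ => (1 : ℝ)) (w + y) := by
    refine integrable_mol_smul hδ (f := N.indicator fun _ => (1 : ℝ))
      (stronglyMeasurable_const.indicator hNm) (M := 1) (fun z => ?_) w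
    by_cases hz : z ∈ N <;> simp [hz]
  set J : ℝ := ∫ y, mol δ y * N.indicator (fun _ => (1 : ℝ)) (w + y) with hJ
  have hJ0 : 0 ≤ J := integral_nonneg fun y =>
    mul_nonneg (mol_nonneg δ y) (Set.indicator_nonneg (fun _ _ => zero_le_one) _)
  obtain ⟨x, hx⟩ : ∃ x : ℝ, (x : EReal) = u w :=
    ⟨(u w).toReal, EReal.coe_toReal (hu.lt_top w (hw hwK)).ne hb⟩
  have hbound : ∀ m : ℕ, x ≤ M - m * J := by
    intro m
    have h1 : x ≤ trunc u m w := by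
      rw [← EReal.coe_le_coe_iff, hx]
      exact le_trunc m (hu.lt_top w (hw hwK))
    refine (h1.trans (hu.trunc_le_mtrunc hK hw m hδ Metric.ball_subset_closedBall)).trans ?_
    have h2 : mtrunc u K m δ w ≤
        ∫ y, (mol δ y * M - m * (mol δ y * N.indicator (fun _ => (1 : ℝ)) (w + y))) := by
      refine integral_mono (hu.integrable_mtrunc hK hw m hδ w)
        (((integrable_mol hδ).mul_const _).sub (hi.const_mul _)) fun y => ?_
      have e : mol δ y * M - m * (mol δ y * N.indicator (fun _ => (1 : ℝ)) (w + y)) =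
        mol δ y * (M - m * N.indicator (fun _ => (1 : ℝ)) (w + y)) := by ring
      beta_reduce
      rw [e]
      refine mul_le_mul_of_nonneg_left ?_ (mol_nonneg δ y)
      by_cases hz : w + y ∈ K
      · rw [Set.indicator_of_mem hz]
        by_cases hzb : u (w + y) = ⊥
        · rw [Set.indicator_of_mem (show w + y ∈ N from ⟨hz, hzb⟩), trunc_eq_neg_of_bot hzb]
          linarith
        · rw [Set.indicator_of_notMem (show w + y ∉ N from fun h => hzb h.2)]
          linarith [trunc_le_of_le hM0 (hM _ hz) (m := m)]
      · rw [Set.indicator_of_notMem hz,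
          Set.indicator_of_notMem (show w + y ∉ N from fun h => hz h.1)]
        linarith
    rwa [integral_sub ((integrable_mol hδ).mul_const _) (hi.const_mul _), integral_const_mul,
      integral_mul_const, integral_mol hδ, one_mul] at h2
  have hJz : J = 0 := by
    refine le_antisymm (le_of_not_gt fun hpos => ?_) hJ0
    obtain ⟨m, hm⟩ := exists_nat_gt ((M - x) / J)
    rw [div_lt_iff₀ hpos] at hm
    linarith [hbound m]
  have hae := (integral_eq_zero_iff_of_nonneg (fun y => mul_nonneg (mol_nonneg δ y)
    (Set.indicator_nonneg (fun _ _ => zero_le_one) _)) hi).1 hJz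
  have h3 : ∀ᵐ y : Cn n, w + y ∈ Metric.ball w (δ / (n + 1)) → u (w + y) ≠ ⊥ := by
    filter_upwards [hae] with y hy hyb hbot
    have hyn : ‖y‖ < δ / (n + 1) := by simpa using hyb
    have hyK : w + y ∈ K := by
      rw [hKdef, mem_closedBall_iff_norm, add_sub_cancel_left]
      refine hyn.le.trans (div_le_self hδ.le ?_)
      have : (0 : ℝ) ≤ n := by positivity
      linarith
    rw [Pi.zero_apply, Set.indicator_of_mem (show w + y ∈ N from ⟨hyK, hbot⟩), mul_one] at hy
    exact (mol_pos hδ hyn).ne' hy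
  have h4 := (measurePreserving_add_left (volume : Measure (Cn n)) (-w)).quasiMeasurePreserving.ae h3
  filter_upwards [h4] with z hz
  simpa using hz

lemma PSHNear.ae_ne_bot (hu : PSHNear u) :
    ∃ R > 0, ∀ᵐ z, z ∈ Metric.ball (0 : Cn n) R → u z ≠ ⊥ := by
  obtain ⟨Ω, hΩ0, hΩ, hu⟩ := hu
  set A : Set (Cn n) := {z | ∃ r > 0, ∀ᵐ w, w ∈ Metric.ball z r → u w ≠ ⊥} with hA
  have hAo : IsOpen A := by
    rw [Metric.isOpen_iff]
    rintro z ⟨r, hr, h⟩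
    refine ⟨r / 2, half_pos hr, fun w hw => ⟨r / 2, half_pos hr, ?_⟩⟩
    filter_upwards [h] with x hx hxw
    refine hx (Metric.ball_subset_ball' ?_ hxw)
    rw [Metric.mem_ball] at hw
    linarith
  have hBo : IsOpen (Ω ∩ Aᶜ) := by
    rw [Metric.isOpen_iff]
    rintro z ⟨hzΩ, hzA⟩
    obtain ⟨d, hd, hball⟩ := Metric.isOpen_iff.1 hΩ z hzΩ
    set δ := d / 3 with hδ
    have hδ0 : 0 < δ := by positivity
    have hle : δ / (n + 1) ≤ δ := div_le_self hδ0.le (by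
      have : (0 : ℝ) ≤ n := by positivity
      linarith)
    have hbot : ∀ w ∈ Metric.ball z (δ / (n + 1)), u w = ⊥ := by
      intro w hw
      by_contra hwb
      have hdist := Metric.mem_ball.1 hw
      have hsub : Metric.closedBall w δ ⊆ Ω := by
        refine (Metric.closedBall_subset_ball' ?_).trans hball
        linarith
      refine hzA ⟨δ / (n + 1) - dist w z, by linarith, ?_⟩
      filter_upwards [hu.ae_ne_bot_of_ne_bot hδ0 hsub hwb] with x hx hxz
      refine hx (Metric.ball_subset_ball' ?_ hxz)
      rw [dist_comm z w]; linarith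
    refine ⟨δ / (n + 1), by positivity, fun w hw => ⟨hball ?_, ?_⟩⟩
    · exact Metric.ball_subset_ball (by linarith) hw
    · rintro ⟨r, hr, hae⟩
      have hdist := Metric.mem_ball.1 hw
      have hpos : 0 < min r (δ / (n + 1) - dist w z) := lt_min hr (by linarith)
      have hvol : volume (Metric.ball w (min r (δ / (n + 1) - dist w z))) = 0 := by
        refine measure_mono_null (fun x hx => ?_) (ae_iff.1 hae)
        simp only [Set.mem_ofPred_eq, not_forall, not_not]
        refine ⟨Metric.ball_subset_ball (min_le_left _ _) hx, hbot x ?_⟩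
        refine Metric.ball_subset_ball' ?_ hx
        linarith [min_le_right r (δ / (n + 1) - dist w z)]
      exact (Metric.measure_ball_pos volume w hpos).ne' hvol
  have h0 : (0 : Cn n) ∈ Ω := mem_of_mem_nhds hΩ0
  obtain ⟨w, hwC, hwb⟩ := hu.not_botOnComponents 0 h0
  have hCΩ := connectedComponentIn_subset Ω (0 : Cn n)
  have hwA : w ∈ A := by
    obtain ⟨d, hd, hball⟩ := Metric.isOpen_iff.1 hΩ w (hCΩ hwC)
    exact ⟨d / 2 / (n + 1), by positivity, hu.ae_ne_bot_of_ne_bot (half_pos hd)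
      ((Metric.closedBall_subset_ball (by linarith)).trans hball) hwb⟩
  have h0A : (0 : Cn n) ∈ A := by
    by_contra hc
    obtain ⟨x, hx⟩ := (isPreconnected_connectedComponentIn (F := Ω) (x := (0 : Cn n))) A (Ω ∩ Aᶜ) hAo hBo
      (fun z hz => by
        by_cases h : z ∈ A
        · exact Or.inl h
        · exact Or.inr ⟨hCΩ hz, h⟩)
      ⟨w, hwC, hwA⟩ ⟨0, mem_connectedComponentIn h0, h0, hc⟩
    exact hx.2.2.2 hx.2.1
  exact h0A

lemma PSHNear.spsh (hu : PSHNear u) : SPsh fun z => (u z).toReal := by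
  obtain ⟨R₁, hR₁, hae⟩ := hu.ae_ne_bot
  obtain ⟨Ω, hΩ0, hΩ, hu⟩ := hu
  obtain ⟨d, hd, hball⟩ := Metric.isOpen_iff.1 hΩ 0 (mem_of_mem_nhds hΩ0)
  set ρ : ℝ := min R₁ d / 4 with hρ
  have hρ0 : 0 < ρ := by positivity
  have hρ1 : ρ ≤ R₁ := by have := min_le_left R₁ d; linarith
  set K := Metric.closedBall (0 : Cn n) (3 * ρ) with hKdef
  have hK : IsCompact K := isCompact_closedBall _ _
  have hKΩ : K ⊆ Ω := (Metric.closedBall_subset_ball (by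
    have := min_le_right R₁ d; linarith)).trans hball
  obtain ⟨M, hM0, hM⟩ := hu.exists_le_of_isCompact hK hKΩ
  set δ : ℕ → ℝ := fun j => ρ / ((j : ℝ) + 1) with hδ
  have hδ0 : ∀ j, 0 < δ j := fun j => by positivity
  have hδρ : ∀ j, δ j ≤ ρ := fun j => div_le_self hρ0.le (by
    have : (0 : ℝ) ≤ j := by positivity
    linarith)
  have hsub : ∀ z ∈ Metric.ball (0 : Cn n) ρ, Metric.ball z (2 * ρ) ⊆ K := by
    intro z hz
    refine (Metric.ball_subset_ball' ?_).trans Metric.ball_subset_closedBall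
    rw [Metric.mem_ball] at hz; linarith
  have hsub' : ∀ z ∈ Metric.ball (0 : Cn n) ρ, ∀ j, Metric.ball z (δ j) ⊆ K := fun z hz j =>
    (Metric.ball_subset_ball (by linarith [hδρ j])).trans (hsub z hz)
  have hδlim : Tendsto δ atTop (𝓝 0) :=
    tendsto_const_nhds.div_atTop (tendsto_atTop_add_const_right _ _ tendsto_natCast_atTop_atTop)
  refine ⟨ρ, hρ0, M, fun j => mtrunc u K j (δ j), fun j => hu.smR_mtrunc hK hKΩ j (hδ0 j),
    fun j z hz β => hu.levi_mtrunc_nonneg hK hKΩ j (hδ0 j) (by linarith [hδρ j]) (hsub z hz) β,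
    fun j z hz => hu.mtrunc_le hK hKΩ j (hδ0 j) (hsub' z hz j)
      fun w hw => trunc_le_of_le hM0 (hM w (hsub' z hz j hw)), ?_⟩
  filter_upwards [hae] with z hzb hz
  have hzK : z ∈ K := hsub' z hz 0 (Metric.mem_ball_self (hδ0 0))
  have hzb := hzb (Metric.ball_subset_ball hρ1 hz)
  have hzt := hu.lt_top z (hKΩ hzK)
  have hx : (((u z).toReal : ℝ) : EReal) = u z := EReal.coe_toReal hzt.ne hzb
  have hlow : ∀ j, (u z).toReal ≤ mtrunc u K j (δ j) z := fun j => by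
    refine le_trans ?_ (hu.trunc_le_mtrunc hK hKΩ j (hδ0 j) (hsub' z hz j))
    rw [← EReal.coe_le_coe_iff, hx]
    exact le_trunc j hzt
  refine ⟨hlow, ?_⟩
  refine tendsto_order.2 ⟨fun a ha => Eventually.of_forall fun j => ha.trans_le (hlow j),
    fun a ha => ?_⟩
  obtain ⟨c, hc1, hc2⟩ := exists_between ha
  have h1 := hu.usc z (hKΩ hzK) (c : EReal) (by beta_reduce; rw [← hx]; exact EReal.coe_lt_coe_iff.2 hc1)
  rw [hΩ.nhdsWithin_eq (hKΩ hzK)] at h1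
  obtain ⟨η, hη, h2⟩ := Metric.eventually_nhds_iff_ball.1 h1
  obtain ⟨m₀, hm₀⟩ := exists_nat_gt (-c)
  filter_upwards [hδlim.eventually (gt_mem_nhds hη), eventually_ge_atTop m₀] with j hj hjm
  refine (hu.mtrunc_le hK hKΩ j (hδ0 j) (hsub' z hz j) (c := c) fun w hw => ?_).trans_lt hc2
  refine ((trunc_lt_iff (hu.lt_top w (hKΩ (hsub' z hz j hw)))).2
    ⟨h2 w (Metric.ball_subset_ball hj.le hw), ?_⟩).le
  have : (m₀ : ℝ) ≤ j := by exact_mod_cast hjm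
  linarith

end

section

/-- The part of plurisubharmonicity that does not exclude the function `-∞`. -/
structure SubMeanOn (u : Cn n → EReal) (Ω : Set (Cn n)) : Prop where
  usc : UpperSemicontinuousOn u Ω
  lt_top : ∀ z ∈ Ω, u z < ⊤
  submean : ∀ z ∈ Ω, ∀ w : Cn n, ∃ ε > 0, ∀ r : ℝ, 0 < r → r < ε → ∀ m : ℕ,
    u z ≤ ((circleAvg u z w r m : ℝ) : EReal)

variable {u v : Cn n → EReal} {Ω : Set (Cn n)}

lemma PSHOn.subMeanOn (hu : PSHOn u Ω) : SubMeanOn u Ω :=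
  ⟨hu.usc, hu.lt_top, fun z hz w => by
    obtain ⟨ε, hε, h⟩ := hu.submean z hz w
    exact ⟨ε, hε, fun r hr hrε m => (h r hr hrε).trans (iInf_le _ m)⟩⟩

lemma SubMeanOn.mono (hu : SubMeanOn u Ω) {Ω' : Set (Cn n)} (h : Ω' ⊆ Ω) : SubMeanOn u Ω' :=
  ⟨hu.usc.mono h, fun z hz => hu.lt_top z (h hz), fun z hz => hu.submean z (h hz)⟩

lemma trunc_usc_of_usc (husc : UpperSemicontinuousOn u Ω) (hlt : ∀ z ∈ Ω, u z < ⊤) (m : ℕ) :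
    UpperSemicontinuousOn (trunc u m) Ω := by
  intro z hz y hy
  obtain ⟨h1, h2⟩ := (trunc_lt_iff (hlt z hz)).1 hy
  filter_upwards [husc z hz y h1, self_mem_nhdsWithin] with w hw hwΩ
  exact (trunc_lt_iff (hlt w hwΩ)).2 ⟨hw, h2⟩

/-- Small circles around `z` lie in `Ω`, and dominated functions have dominated averages. -/
lemma exists_le_circleAvg (hΩ : IsOpen Ω) (husc : UpperSemicontinuousOn v Ω)
    (hlt : ∀ z ∈ Ω, v z < ⊤) {z : Cn n} (hz : z ∈ Ω) (w : Cn n) :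
    ∃ ε > 0, ∀ r : ℝ, 0 < r → r < ε →
      (∀ θ : ℝ, z + ((r : ℂ) * Complex.exp (Complex.I * (θ : ℂ))) • w ∈ Ω) ∧
      ∀ m : ℕ, IntervalIntegrable (fun θ : ℝ => trunc v m
        (z + ((r : ℂ) * Complex.exp (Complex.I * (θ : ℂ))) • w)) volume 0 (2 * Real.pi) ∧
      ∀ f : ℝ → ℝ, IntervalIntegrable f volume 0 (2 * Real.pi) →
      (∀ θ : ℝ, f θ ≤ trunc v m (z + ((r : ℂ) * Complex.exp (Complex.I * (θ : ℂ))) • w)) →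
      (2 * Real.pi)⁻¹ * (∫ θ in (0:ℝ)..(2 * Real.pi), f θ) ≤ circleAvg v z w r m := by
  obtain ⟨δ, hδ, hball⟩ := Metric.isOpen_iff.1 hΩ z hz
  have hpi := Real.pi_pos
  refine ⟨δ / (‖w‖ + 1), by positivity, fun r hr hrε => ?_⟩
  have hmem : ∀ θ : ℝ, z + ((r : ℂ) * Complex.exp (Complex.I * (θ : ℂ))) • w ∈
      Metric.closedBall z (r * ‖w‖) := by
    intro θ
    rw [mem_closedBall_iff_norm, add_sub_cancel_left, norm_smul, norm_mul, Complex.norm_real,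
      Real.norm_of_nonneg hr.le, mul_comm Complex.I, Complex.norm_exp_ofReal_mul_I, mul_one]
  have hsub : Metric.closedBall z (r * ‖w‖) ⊆ Ω := by
    refine (Metric.closedBall_subset_ball ?_).trans hball
    rw [lt_div_iff₀ (by positivity)] at hrε
    nlinarith [norm_nonneg w]
  have hintg : ∀ m : ℕ, IntervalIntegrable (fun θ : ℝ => trunc v m
        (z + ((r : ℂ) * Complex.exp (Complex.I * (θ : ℂ))) • w)) volume 0 (2 * Real.pi) :=
    fun m => intervalIntegrable_usc_comp (isCompact_closedBall z (r * ‖w‖))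
      ((trunc_usc_of_usc husc hlt m).mono hsub) (fun x hx => neg_le_trunc m (hlt x (hsub hx)))
      (γ := fun θ : ℝ => z + ((r : ℂ) * Complex.exp (Complex.I * (θ : ℂ))) • w)
      (by fun_prop) hmem _ _
  refine ⟨fun θ => hsub (hmem θ), fun m => ⟨hintg m, fun f hf hle => ?_⟩⟩
  exact mul_le_mul_of_nonneg_left (intervalIntegral.integral_mono_on (by positivity) hf (hintg m)
    fun θ _ => hle θ) (by positivity)

lemma trunc_mono (m : ℕ) {z : Cn n} (h : u z ≤ v z) (hv : v z < ⊤) : trunc u m z ≤ trunc v m z := by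
  rw [← EReal.coe_le_coe_iff, coe_trunc m hv, coe_trunc m (h.trans_lt hv)]
  exact max_le_max_right _ h

lemma SubMeanOn.max (hΩ : IsOpen Ω) (hu : SubMeanOn u Ω) (hv : SubMeanOn v Ω) :
    SubMeanOn (fun z => max (u z) (v z)) Ω := by
  have husc : UpperSemicontinuousOn (fun z => Max.max (u z) (v z)) Ω := hu.usc.sup hv.usc
  have hlt : ∀ z ∈ Ω, Max.max (u z) (v z) < ⊤ := fun z hz => max_lt (hu.lt_top z hz) (hv.lt_top z hz)
  refine ⟨husc, hlt, fun z hz w => ?_⟩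
  obtain ⟨ε, hε, h⟩ := exists_le_circleAvg hΩ husc hlt hz w
  obtain ⟨ε₁, hε₁, h₁⟩ := exists_le_circleAvg hΩ hu.usc hu.lt_top hz w
  obtain ⟨ε₂, hε₂, h₂⟩ := exists_le_circleAvg hΩ hv.usc hv.lt_top hz w
  obtain ⟨ε₃, hε₃, h₃⟩ := hu.submean z hz w
  obtain ⟨ε₄, hε₄, h₄⟩ := hv.submean z hz w
  refine ⟨min ε (min (min ε₁ ε₂) (min ε₃ ε₄)), by positivity, fun r hr hrε m => ?_⟩
  simp only [lt_min_iff] at hrε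
  obtain ⟨hr0, ⟨hr1, hr2⟩, hr3, hr4⟩ := hrε
  obtain ⟨hmem, hall⟩ := h r hr hr0
  refine max_le ((h₃ r hr hr3 m).trans ?_) ((h₄ r hr hr4 m).trans ?_)
  · exact EReal.coe_le_coe_iff.2 ((hall m).2 _ ((h₁ r hr hr1).2 m).1 fun θ =>
      trunc_mono m (le_max_left _ _) (hlt _ (hmem θ)))
  · exact EReal.coe_le_coe_iff.2 ((hall m).2 _ ((h₂ r hr hr2).2 m).1 fun θ =>
      trunc_mono m (le_max_right _ _) (hlt _ (hmem θ)))

lemma coe_mul_lt_coe_iff {c : ℝ} (hc : 0 < c) {x : EReal} {y : ℝ} :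
    (c : EReal) * x < y ↔ x < ((y / c : ℝ) : EReal) := by
  induction x with
  | bot => rw [EReal.coe_mul_bot_of_pos hc]; simp
  | top => rw [EReal.coe_mul_top_of_pos hc]; simp
  | coe x => rw [← EReal.coe_mul, EReal.coe_lt_coe_iff, EReal.coe_lt_coe_iff, lt_div_iff₀ hc, mul_comm]

lemma SubMeanOn.const_mul (hΩ : IsOpen Ω) (hu : SubMeanOn u Ω) {c : ℝ} (hc : 0 < c) :
    SubMeanOn (fun z => (c : EReal) * u z) Ω := by
  have husc : UpperSemicontinuousOn (fun z => (c : EReal) * u z) Ω := by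
    intro z hz y hy
    obtain ⟨x, hx1, hx2⟩ := EReal.lt_iff_exists_real_btwn.1 hy
    filter_upwards [hu.usc z hz _ ((coe_mul_lt_coe_iff hc).1 hx1)] with a ha
    exact ((coe_mul_lt_coe_iff hc).2 ha).trans hx2
  have hlt : ∀ z ∈ Ω, (c : EReal) * u z < ⊤ := by
    intro z hz
    obtain ⟨x, hx1, hx2⟩ := EReal.lt_iff_exists_real_btwn.1 (hu.lt_top z hz)
    have : (c : EReal) * u z < ((c * x : ℝ) : EReal) := by
      rw [coe_mul_lt_coe_iff hc, mul_div_cancel_left₀ _ hc.ne']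
      exact hx1
    exact this.trans (EReal.coe_lt_top _)
  refine ⟨husc, hlt, fun z hz w => ?_⟩
  obtain ⟨ε, hε, h⟩ := exists_le_circleAvg hΩ husc hlt hz w
  obtain ⟨ε₁, hε₁, h₁⟩ := exists_le_circleAvg hΩ hu.usc hu.lt_top hz w
  obtain ⟨ε₃, hε₃, h₃⟩ := hu.submean z hz w
  refine ⟨min ε (min ε₁ ε₃), by positivity, fun r hr hrε m => ?_⟩
  simp only [lt_min_iff] at hrε
  obtain ⟨hr0, hr1, hr3⟩ := hrε
  obtain ⟨hmem, hall⟩ := h r hr hr0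
  obtain ⟨m', hm'⟩ := exists_nat_ge (m / c : ℝ)
  rw [div_le_iff₀ hc] at hm'
  have hle := (hall m).2 _ (((h₁ r hr hr1).2 m').1.const_mul c) fun θ => by
    rw [← EReal.coe_le_coe_iff, coe_trunc m (hlt _ (hmem θ)), EReal.coe_mul,
      coe_trunc m' (hu.lt_top _ (hmem θ))]
    rcases max_cases (u (z + ((r : ℂ) * Complex.exp (Complex.I * (θ : ℂ))) • w))
      ((-(m' : ℝ) : ℝ) : EReal) with ⟨h5, -⟩ | ⟨h5, -⟩
    · rw [h5]; exact le_max_left _ _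
    · rw [h5, ← EReal.coe_mul]
      exact le_max_of_le_right (EReal.coe_le_coe_iff.2 (by linarith))
  rw [intervalIntegral.integral_const_mul, mul_left_comm] at hle
  have h6 := mul_le_mul_of_nonneg_left (h₃ r hr hr3 m')
    (EReal.coe_nonneg.2 hc.le : (0 : EReal) ≤ (c : EReal))
  rw [← EReal.coe_mul] at h6
  exact h6.trans (EReal.coe_le_coe_iff.2 hle)

lemma log_enorm_of_ne_zero {z : Cn n} (hz : z ≠ 0) :
    ENNReal.log ‖z‖ₑ = ((Real.log ‖z‖ : ℝ) : EReal) := by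
  rw [ENNReal.log_pos_real (by simpa using hz) enorm_ne_top, toReal_enorm]

lemma exists_norm_apply_eq {z : Cn n} (hz : z ≠ 0) : ∃ i, ‖z i‖ = ‖z‖ := by
  by_contra! hne
  exact lt_irrefl _ ((pi_norm_lt_iff (norm_pos_iff.2 hz)).2 fun i =>
    lt_of_le_of_ne (norm_le_pi_norm z i) (hne i))

lemma subMeanOn_log_norm : SubMeanOn (fun z : Cn n => ENNReal.log ‖z‖ₑ) Set.univ := by
  have hcont : Continuous fun z : Cn n => ENNReal.log ‖z‖ₑ :=
    ENNReal.continuous_log.comp continuous_enorm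
  have husc : UpperSemicontinuousOn (fun z : Cn n => ENNReal.log ‖z‖ₑ) Set.univ :=
    hcont.upperSemicontinuous.upperSemicontinuousOn _
  have hlt : ∀ z ∈ Set.univ, ENNReal.log ‖(z : Cn n)‖ₑ < ⊤ := by
    intro z _
    rw [lt_top_iff_ne_top, Ne, ENNReal.log_eq_top_iff]
    exact enorm_ne_top
  refine ⟨husc, hlt, fun z hz w => ?_⟩
  by_cases h0 : z = 0
  · exact ⟨1, one_pos, fun r _ _ m => by simp [h0]⟩
  have hzpos : 0 < ‖z‖ := norm_pos_iff.2 h0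
  obtain ⟨i, hi⟩ := exists_norm_apply_eq h0
  obtain ⟨ε, hε, h⟩ := exists_le_circleAvg isOpen_univ husc hlt hz w
  refine ⟨min ε (‖z‖ / (‖w‖ + 1)), by positivity, fun r hr hrε m => ?_⟩
  obtain ⟨hmem, hall⟩ := h r hr (hrε.trans_le (min_le_left _ _))
  have hrz : r * (‖w‖ + 1) < ‖z‖ := by
    rw [← lt_div_iff₀ (by positivity)]
    exact hrε.trans_le (min_le_right _ _)
  have hne : ∀ ζ : ℂ, ‖ζ‖ ≤ r → z i + ζ * w i ≠ 0 := by
    intro ζ hζ h7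
    have h8 : z i = -(ζ * w i) := eq_neg_of_add_eq_zero_left h7
    have h9 : ‖z‖ ≤ r * ‖w‖ := by
      rw [← hi, h8, norm_neg, norm_mul]
      exact mul_le_mul hζ (norm_le_pi_norm w i) (norm_nonneg _) hr.le
    nlinarith
  have hnorm : ∀ θ : ℝ, ‖(r : ℂ) * Complex.exp (Complex.I * (θ : ℂ))‖ = r := fun θ => by
    rw [norm_mul, Complex.norm_real, Real.norm_of_nonneg hr.le, mul_comm Complex.I,
      Complex.norm_exp_ofReal_mul_I, mul_one]
  have hcirc := AnalyticOnNhd.circleAverage_log_norm_of_ne_zero (c := 0) (R := r)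
    (g := fun ζ : ℂ => z i + ζ * w i)
    (fun ζ _ => (by fun_prop : Differentiable ℂ fun ζ : ℂ => z i + ζ * w i).analyticAt ζ)
    (fun ζ hζ => hne ζ (by simpa [abs_of_pos hr] using hζ))
  simp only [Real.circleAverage, zero_mul, add_zero, smul_eq_mul, circleMap, zero_add, hi,
    mul_comm _ Complex.I] at hcirc
  rw [log_enorm_of_ne_zero h0, EReal.coe_le_coe_iff, ← hcirc]
  refine (hall m).2 _ ?_ fun θ => ?_
  · refine Continuous.intervalIntegrable ?_ _ _
    exact Continuous.log (by fun_prop) fun θ => norm_ne_zero_iff.2 (hne _ (hnorm θ).le)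
  · have h10 := hne _ (hnorm θ).le
    have h11 : z + ((r : ℂ) * Complex.exp (Complex.I * (θ : ℂ))) • w ≠ 0 := by
      intro h12
      exact h10 (by simpa using congrFun h12 i)
    refine le_trans ?_ (EReal.coe_le_coe_iff.1 ((le_of_eq (log_enorm_of_ne_zero h11).symm).trans
      (le_trunc (u := fun z : Cn n => ENNReal.log ‖z‖ₑ) m (hlt _ (Set.mem_univ _)))))
    refine Real.log_le_log (norm_pos_iff.2 h10) ?_
    simpa using norm_le_pi_norm (z + ((r : ℂ) * Complex.exp (Complex.I * (θ : ℂ))) • w) i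

/-- A function with the sub-mean value property which is larger than a plurisubharmonic function
is plurisubharmonic. -/
lemma PSHNear.of_le (hu : PSHNear u) (hΩ : Ω ∈ 𝓝 0) (hv : SubMeanOn v Ω) (h : ∀ z, u z ≤ v z) :
    PSHNear v := by
  obtain ⟨R, hR, hae⟩ := hu.ae_ne_bot
  obtain ⟨δ, hδ, hball⟩ := Metric.mem_nhds_iff.1 hΩ
  have hB : Metric.ball (0 : Cn n) (min R δ) ⊆ Ω :=
    (Metric.ball_subset_ball (min_le_right _ _)).trans hball
  have hpos : 0 < min R δ := lt_min hR hδ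
  refine ⟨Metric.ball 0 (min R δ), Metric.ball_mem_nhds _ hpos, Metric.isOpen_ball,
    hv.usc.mono hB, fun z hz => hv.lt_top z (hB hz), fun z hz => ?_, fun z hz w => ?_⟩
  · have hconn : connectedComponentIn (Metric.ball (0 : Cn n) (min R δ)) z =
        Metric.ball (0 : Cn n) (min R δ) :=
      (convex_ball (0 : Cn n) _).isPreconnected.connectedComponentIn hz
    rw [hconn]
    by_contra! hbot
    have h0 : volume (Metric.ball (0 : Cn n) (min R δ)) = 0 := by
      refine measure_mono_null (fun x hx => ?_) hae
      have h1 : u x = ⊥ := le_bot_iff.1 ((h x).trans_eq (hbot x hx))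
      exact fun h2 => h2 (Metric.ball_subset_ball (min_le_left _ _) hx) h1
    exact (Metric.measure_ball_pos volume (0 : Cn n) hpos).ne' h0
  · obtain ⟨ε, hε, hs⟩ := hv.submean z (hB hz) w
    exact ⟨ε, hε, fun r hr hrε => le_iInf fun m => hs r hr hrε m⟩

lemma PSHNear.max (hu : PSHNear u) (hΩ : Ω ∈ 𝓝 0) (hv : SubMeanOn v Ω) :
    PSHNear fun z => Max.max (u z) (v z) := by
  obtain ⟨V, hV, hVo, huV⟩ := hu
  obtain ⟨Ω', hΩ', hΩ'o, h0⟩ := mem_nhds_iff.1 hΩ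
  exact PSHNear.of_le ⟨V, hV, hVo, huV⟩ (inter_mem hV (hΩ'o.mem_nhds h0))
    ((huV.subMeanOn.mono Set.inter_subset_left).max (hVo.inter hΩ'o)
      (hv.mono (Set.inter_subset_right.trans hΩ'))) fun z => le_max_left _ _

end

section

/-- The filter of properties that hold almost everywhere near the origin. -/
def nearAE (n : ℕ) : Filter (Cn n) := 𝓝 0 ⊓ ae volume

lemma eventually_nearAE_of_ball {p : Cn n → Prop} {R : ℝ} (hR : 0 < R)
    (h : ∀ᵐ z, z ∈ Metric.ball (0 : Cn n) R → p z) : ∀ᶠ z in nearAE n, p z := by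
  filter_upwards [Filter.le_def.1 inf_le_right _ h,
    Filter.le_def.1 inf_le_left _ (Metric.ball_mem_nhds (0 : Cn n) hR)] with z h1 h2
  exact h1 h2

lemma eventually_nearAE_of_nhds {p : Cn n → Prop} (h : ∀ᶠ z in 𝓝 (0 : Cn n), p z) :
    ∀ᶠ z in nearAE n, p z := Filter.le_def.1 inf_le_left _ h

lemma eventually_small_ball {P : ℝ → Prop} {R : ℝ} (hR : 0 < R) (h : ∀ r, 0 < r → r ≤ R → P r) :
    ∀ᶠ r in 𝓝[>] (0 : ℝ), P r := by
  filter_upwards [Ioc_mem_nhdsGT hR] with r hr using h r hr.1 hr.2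

lemma eventually_nearAE_iff {p : Cn n → Prop} : (∀ᶠ z in nearAE n, p z) ↔
    ∀ᶠ r in 𝓝[>] (0 : ℝ), ∀ᵐ z, z ∈ Metric.ball (0 : Cn n) r → p z := by
  constructor
  · intro h
    obtain ⟨s, hs, t, ht, hst⟩ := Filter.mem_inf_iff.1 h
    obtain ⟨R, hR, hb⟩ := Metric.mem_nhds_iff.1 hs
    refine eventually_small_ball hR fun r _ hr => ?_
    filter_upwards [ht] with z hz hzr
    have : z ∈ s ∩ t := ⟨hb (Metric.ball_subset_ball hr hzr), hz⟩
    rwa [← hst] at this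
  · intro h
    obtain ⟨r, h1, h2⟩ := (h.and self_mem_nhdsWithin).exists
    exact eventually_nearAE_of_ball h2 h1

lemma intNear_iff {g : Cn n → ℝ≥0∞} : IntNear g ↔
    ∀ᶠ r in 𝓝[>] (0 : ℝ), ∫⁻ z in Metric.ball (0 : Cn n) r, g z < ⊤ := by
  constructor
  · rintro ⟨U, hU, h⟩
    obtain ⟨R, hR, hb⟩ := Metric.mem_nhds_iff.1 hU
    exact eventually_small_ball hR fun r _ hr => (lintegral_mono_set
      ((Metric.ball_subset_ball hr).trans hb)).trans_lt h
  · intro h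
    obtain ⟨r, h1, h2⟩ := (h.and self_mem_nhdsWithin).exists
    exact ⟨_, Metric.ball_mem_nhds _ h2, h1⟩

lemma IntNear.mono {f g : Cn n → ℝ≥0∞} (hg : IntNear g) {C : ℝ}
    (h : ∀ᶠ z in nearAE n, f z ≤ ENNReal.ofReal C * g z) : IntNear f := by
  rw [intNear_iff] at hg ⊢
  filter_upwards [hg, eventually_nearAE_iff.1 h] with r h1 h2
  refine lt_of_le_of_lt (setLIntegral_mono_ae' measurableSet_ball h2) ?_
  rw [lintegral_const_mul' _ _ ENNReal.ofReal_ne_top]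
  exact ENNReal.mul_lt_top ENNReal.ofReal_lt_top h1

lemma IntNear.mono' {f g : Cn n → ℝ≥0∞} (hg : IntNear g) (h : ∀ᶠ z in nearAE n, f z ≤ g z) :
    IntNear f := hg.mono (C := 1) (by simpa using h)

lemma SPsh.eventually_aemeasurable {a : Cn n → ℝ} (ha : SPsh a) :
    ∀ᶠ r in 𝓝[>] (0 : ℝ), AEMeasurable a (volume.restrict (Metric.ball (0 : Cn n) r)) := by
  obtain ⟨R, hR, h⟩ := ha.aestronglyMeasurable
  exact eventually_small_ball hR fun r _ hr => (h.mono_measure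
    (Measure.restrict_mono (Metric.ball_subset_ball hr) le_rfl)).aemeasurable

lemma SPsh.eventually_le {a : Cn n → ℝ} (ha : SPsh a) :
    ∃ M : ℝ, 0 ≤ M ∧ ∀ᶠ z in nearAE n, a z ≤ M := by
  obtain ⟨R, hR, M, hM, h⟩ := ha.exists_le
  exact ⟨M, hM, eventually_nearAE_of_ball hR h⟩

/-- The weight `|f|² e^{-a}`. -/
def tupWt {ι : Type*} [Fintype ι] (f : ι → Cn n → ℂ) (a : Cn n → ℝ) (z : Cn n) : ℝ≥0∞ :=
  (∑ j, ‖f j z‖ₑ ^ 2) * ENNReal.ofReal (Real.exp (-a z))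

section
variable {ι : Type*} [Fintype ι] {f : ι → Cn n → ℂ} {a b : Cn n → ℝ}

lemma tupWt_le_mul {C : ℝ} {z : Cn n} (h : b z ≤ a z + C) :
    tupWt f a z ≤ ENNReal.ofReal (Real.exp C) * tupWt f b z := by
  rw [tupWt, tupWt, mul_left_comm, ← ENNReal.ofReal_mul (Real.exp_pos _).le, ← Real.exp_add]
  gcongr
  linarith

lemma IntNear.tupWt_mono {C : ℝ} (hb : IntNear (tupWt f b)) (h : ∀ᶠ z in nearAE n, b z ≤ a z + C) :
    IntNear (tupWt f a) :=
  hb.mono (h.mono fun _ hz => tupWt_le_mul hz)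

lemma eventually_differentiableOn (hf : ∀ j, HoloNear (f j)) : ∀ᶠ r in 𝓝[>] (0 : ℝ), ∀ j,
    DifferentiableOn ℂ (f j) (Metric.ball 0 r) := by
  rw [eventually_all]
  intro j
  obtain ⟨U, hU, -, h⟩ := hf j
  obtain ⟨R, hR, hb⟩ := Metric.mem_nhds_iff.1 hU
  exact eventually_small_ball hR fun r _ hr => h.mono ((Metric.ball_subset_ball hr).trans hb)

lemma eventually_aemeasurable_term (hf : ∀ j, HoloNear (f j)) (ha : SPsh a) :
    ∀ᶠ r in 𝓝[>] (0 : ℝ), ∀ j, AEMeasurable (fun z => ‖f j z‖ₑ ^ 2 *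
      ENNReal.ofReal (Real.exp (-a z))) (volume.restrict (Metric.ball (0 : Cn n) r)) := by
  filter_upwards [eventually_differentiableOn hf, ha.eventually_aemeasurable] with r h1 h2 j
  exact (((h1 j).continuousOn.aestronglyMeasurable measurableSet_ball).enorm.pow_const 2).mul
    (ENNReal.measurable_ofReal.comp_aemeasurable (Real.measurable_exp.comp_aemeasurable h2.neg))

lemma eventually_aemeasurable_tupWt (hf : ∀ j, HoloNear (f j)) (ha : SPsh a) :
    ∀ᶠ r in 𝓝[>] (0 : ℝ), AEMeasurable (tupWt f a) (volume.restrict (Metric.ball (0 : Cn n) r)) := by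
  filter_upwards [eventually_aemeasurable_term hf ha] with r h
  refine (Finset.aemeasurable_fun_sum Finset.univ fun j _ => h j).congr
    (Eventually.of_forall fun z => ?_)
  simp only [tupWt, Finset.sum_mul]

lemma intNear_tupWt_iff (hf : ∀ j, HoloNear (f j)) (ha : SPsh a) :
    IntNear (tupWt f a) ↔ ∀ j, IntNear fun z => ‖f j z‖ₑ ^ 2 * ENNReal.ofReal (Real.exp (-a z)) := by
  constructor
  · intro h j
    refine h.mono' (Eventually.of_forall fun z => ?_)
    exact mul_le_mul_left (Finset.single_le_sum (f := fun j => ‖f j z‖ₑ ^ 2)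
      (fun _ _ => zero_le) (Finset.mem_univ j)) _
  · intro h
    rw [intNear_iff]
    filter_upwards [eventually_aemeasurable_term hf ha, eventually_all.2 fun j => intNear_iff.1 (h j)]
      with r h1 h2
    simp only [tupWt, Finset.sum_mul]
    rw [lintegral_finsetSum' _ fun j _ => h1 j]
    exact ENNReal.sum_lt_top.2 fun j _ => h2 j

/-- Strong openness for tuples. -/
lemma tupWt_strong_openness (hf : ∀ j, HoloNear (f j)) (ha : SPsh a) (hb : SPsh b)
    (h : IntNear (tupWt f a)) : ∃ ε > 0, IntNear (tupWt f fun z => a z + ε * b z) := by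
  obtain ⟨M, hM, hbM⟩ := hb.eventually_le
  have hj : ∀ j, ∃ ε > 0, IntNear fun z => ‖f j z‖ₑ ^ 2 *
      ENNReal.ofReal (Real.exp (-a z - ε * b z)) := by
    intro j
    obtain ⟨R, ⟨h1, h2⟩, hR⟩ := (((eventually_differentiableOn hf).and
      (intNear_iff.1 ((intNear_tupWt_iff hf ha).1 h j))).and self_mem_nhdsWithin).exists
    obtain ⟨ε, hε, r, hr, h3⟩ := strong_openness ha hb hR (h1 j) h2
    exact ⟨ε, hε, _, Metric.ball_mem_nhds _ hr, h3⟩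
  choose ε hε hintg using hj
  obtain ⟨e, h1, h2⟩ := ((eventually_all.2 fun j => eventually_small_ball (P := fun e => e ≤ ε j)
    (hε j) fun r _ hr => hr).and self_mem_nhdsWithin).exists
  have he : 0 < e := h2
  refine ⟨e, he, (intNear_tupWt_iff hf (ha.add (hb.const_mul he.le))).2 fun j => ?_⟩
  refine (hintg j).mono (C := Real.exp ((ε j - e) * M)) (hbM.mono fun z hz => ?_)
  rw [mul_left_comm, ← ENNReal.ofReal_mul (Real.exp_pos _).le, ← Real.exp_add]
  gcongr
  nlinarith [mul_le_mul_of_nonneg_left hz (sub_nonneg.2 (h1 j))]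

end

lemma PSHNear.eventually_coe_toReal {u : Cn n → EReal} (hu : PSHNear u) :
    ∀ᶠ z in nearAE n, (((u z).toReal : ℝ) : EReal) = u z := by
  obtain ⟨R, hR, h⟩ := hu.ae_ne_bot
  obtain ⟨U, hU, -, hpsh⟩ := hu
  filter_upwards [eventually_nearAE_of_ball hR h, eventually_nearAE_of_nhds hU] with z h1 h2
  exact EReal.coe_toReal (hpsh.lt_top z h2).ne h1

lemma wexp_of_coe {u : Cn n → EReal} {z : Cn n} (h : (((u z).toReal : ℝ) : EReal) = u z) (c : ℝ) :
    wexp c u z = ENNReal.ofReal (Real.exp (c * (u z).toReal)) := by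
  rw [wexp, ← h, ← EReal.coe_mul, expE, if_neg (EReal.coe_ne_bot _), if_neg (EReal.coe_ne_top _),
    EReal.toReal_coe, EReal.toReal_coe]

lemma eventually_dens0_eq {m : ℕ} {f₀ : Fin m → Cn n → ℂ} {φ₀ : Cn n → EReal} (hφ : PSHNear φ₀) :
    ∀ᶠ z in nearAE n, dens0 f₀ φ₀ z = tupWt f₀ (fun z => 2 * (φ₀ z).toReal) z := by
  filter_upwards [hφ.eventually_coe_toReal] with z hz
  rw [dens0, wexp_of_coe hz, tupWt, normSq2, neg_mul]
  rfl

lemma eventually_dens0_mul_wexp_eq {m : ℕ} {f₀ : Fin m → Cn n → ℂ} {φ₀ u : Cn n → EReal}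
    (hφ : PSHNear φ₀) (hu : PSHNear u) : ∀ᶠ z in nearAE n, dens0 f₀ φ₀ z * wexp (-2) u z =
      tupWt f₀ (fun z => 2 * (φ₀ z).toReal + 2 * (u z).toReal) z := by
  filter_upwards [eventually_dens0_eq (f₀ := f₀) hφ, hu.eventually_coe_toReal] with z h1 h2
  rw [h1, wexp_of_coe h2, tupWt, tupWt, mul_assoc, ← ENNReal.ofReal_mul (Real.exp_pos _).le,
    ← Real.exp_add]
  congr 4
  ring

lemma intNear_congr {f g : Cn n → ℝ≥0∞} (h : ∀ᶠ z in nearAE n, f z = g z) :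
    IntNear f ↔ IntNear g :=
  ⟨fun hf => hf.mono' (h.mono fun _ hz => hz.ge), fun hg => hg.mono' (h.mono fun _ hz => hz.le)⟩

end

section

lemma IntNear.add {f g : Cn n → ℝ≥0∞} (hf : IntNear f) (hg : IntNear g)
    (hm : ∀ᶠ r in 𝓝[>] (0 : ℝ), AEMeasurable f (volume.restrict (Metric.ball (0 : Cn n) r))) :
    IntNear fun z => f z + g z := by
  rw [intNear_iff] at *
  filter_upwards [hf, hg, hm] with r h1 h2 h3
  rw [lintegral_add_left' h3]
  exact ENNReal.add_lt_top.2 ⟨h1, h2⟩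

section
variable {m : ℕ} {f₀ : Fin m → Cn n → ℂ} {φ₀ Φ ψ : Cn n → EReal}

/-- The weight of a Zhou weight cannot be improved: any strictly larger psh weight is integrable. -/
lemma IsLocalZhouWeight.leO_or_intNear (hΦ : IsLocalZhouWeight f₀ φ₀ Φ) {Ω : Set (Cn n)}
    (hΩ : Ω ∈ 𝓝 0) {v : Cn n → EReal} (hv : SubMeanOn v Ω) :
    leO v Φ ∨ IntNear (tupWt f₀ fun z => 2 * (φ₀ z).toReal + 2 * (max (Φ z) (v z)).toReal) := by
  have hpsh : PSHNear fun z => max (Φ z) (v z) := hΦ.zhou.psh.max hΩ hv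
  by_cases h : IntNear fun z => dens0 f₀ φ₀ z * wexp (-2) (fun z => max (Φ z) (v z)) z
  · exact Or.inr ((intNear_congr (eventually_dens0_mul_wexp_eq hΦ.psh₀ hpsh)).1 h)
  · obtain ⟨C, hC⟩ := (hΦ.zhou.maximal _ hpsh
      ⟨0, Eventually.of_forall fun z => by simp⟩ h).1
    exact Or.inl ⟨C, hC.mono fun z hz => (le_max_right _ _).trans hz⟩

lemma IsLocalZhouWeight.not_intNear (hΦ : IsLocalZhouWeight f₀ φ₀ Φ) :
    ¬ IntNear (tupWt f₀ fun z => 2 * (φ₀ z).toReal + 2 * (Φ z).toReal) := fun h =>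
  hΦ.zhou.nonint ((intNear_congr (eventually_dens0_mul_wexp_eq hΦ.psh₀ hΦ.zhou.psh)).2 h)

lemma IsLocalZhouWeight.intNear (hΦ : IsLocalZhouWeight f₀ φ₀ Φ) :
    IntNear (tupWt f₀ fun z => 2 * (φ₀ z).toReal) :=
  (intNear_congr (eventually_dens0_eq hΦ.psh₀)).1 hΦ.int₀

lemma IsLocalZhouWeight.log_norm_leO (hΦ : IsLocalZhouWeight f₀ φ₀ Φ) :
    ∃ N : ℝ, 0 < N ∧ leO (fun z => (N : EReal) * ENNReal.log ‖z‖ₑ) Φ := by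
  obtain ⟨N₁, hN₁⟩ := hΦ.zhou.intN
  set N₀ := N₁ + 1 with hN₀
  have hintg := hN₁ N₀ (Nat.le_succ N₁)
  set P : Cn n → ℝ := fun z => 2 * (φ₀ z).toReal with hP
  set p : Cn n → ℝ := fun z => (Φ z).toReal with hp
  have hPs : SPsh P := hΦ.psh₀.spsh.const_mul zero_le_two
  have hps : SPsh p := hΦ.zhou.psh.spsh
  set g : Fin m × Fin n → Cn n → ℂ := fun k z => f₀ k.1 z * z k.2 ^ N₀ with hg
  have hgh : ∀ k, HoloNear (g k) := by
    intro k
    obtain ⟨U, hU, hUo, h⟩ := hΦ.holo k.1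
    exact ⟨U, hU, hUo, h.mul (DifferentiableOn.pow (by fun_prop) _)⟩
  have hgsum : ∀ z, ∑ k, ‖g k z‖ₑ ^ 2 = (∑ j, ‖f₀ j z‖ₑ ^ 2) * ∑ i, ‖z i‖ₑ ^ (2 * N₀) := by
    intro z
    rw [Fintype.sum_prod_type, Finset.sum_mul]
    refine Finset.sum_congr rfl fun j _ => ?_
    rw [Finset.mul_sum]
    refine Finset.sum_congr rfl fun i _ => ?_
    simp only [hg]
    rw [enorm_mul, enorm_pow, mul_pow, ← pow_mul, mul_comm N₀]
  have hgint : IntNear (tupWt g fun z => P z + 2 * p z) := by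
    refine hintg.mono (C := n) ?_
    filter_upwards [eventually_dens0_mul_wexp_eq (f₀ := f₀) hΦ.psh₀ hΦ.zhou.psh] with z hz
    rw [mul_right_comm, hz, tupWt, tupWt, hgsum, mul_left_comm, mul_right_comm]
    refine mul_le_mul_right ?_ _
    have hle : ∀ i ∈ Finset.univ, ‖z i‖ₑ ^ (2 * N₀) ≤ ENNReal.ofReal (‖z‖ ^ (2 * N₀)) := by
      intro i _
      rw [← ofReal_norm, ← ENNReal.ofReal_pow (norm_nonneg _)]
      gcongr
      exact norm_le_pi_norm z i
    simpa using Finset.sum_le_card_nsmul _ _ _ hle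
  obtain ⟨ε, hε, hεint⟩ := tupWt_strong_openness hgh (hPs.add (hps.const_mul zero_le_two)) hps hgint
  refine ⟨2 * N₀ / ε, by positivity, ?_⟩
  set N : ℝ := 2 * N₀ / ε with hN
  have hNpos : 0 < N := by positivity
  have hv := subMeanOn_log_norm (n := n).const_mul isOpen_univ hNpos
  refine (hΦ.leO_or_intNear univ_mem hv).resolve_right fun hcon => hΦ.not_intNear ?_
  have hpsh : PSHNear fun z => max (Φ z) ((N : EReal) * ENNReal.log ‖z‖ₑ) :=
    hΦ.zhou.psh.max univ_mem hv
  refine (hcon.add hεint (eventually_aemeasurable_tupWt hΦ.holo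
    (hPs.add (hpsh.spsh.const_mul zero_le_two)))).mono' ?_
  filter_upwards [hΦ.zhou.psh.eventually_coe_toReal] with z hz
  rcases le_total ((N : EReal) * ENNReal.log ‖z‖ₑ) (Φ z) with h | h
  · simp only [tupWt, max_eq_left h]
    exact le_self_add
  · refine le_trans ?_ le_add_self
    have hz0 : z ≠ 0 := by
      rintro rfl
      rw [← hz, enorm_zero, ENNReal.log_zero, EReal.coe_mul_bot_of_pos hNpos, le_bot_iff] at h
      exact EReal.coe_ne_bot _ h
    rw [← hz, log_enorm_of_ne_zero hz0, ← EReal.coe_mul, EReal.coe_le_coe_iff] at h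
    obtain ⟨i, hi⟩ := exists_norm_apply_eq hz0
    rw [tupWt, tupWt, hgsum, mul_assoc]
    refine mul_le_mul_right ?_ _
    refine le_trans ?_ (mul_le_mul_left (Finset.single_le_sum (f := fun i => ‖z i‖ₑ ^ (2 * N₀))
      (fun _ _ => zero_le) (Finset.mem_univ i)) _)
    have hzp : 0 < ‖z‖ := norm_pos_iff.2 hz0
    rw [← ofReal_norm, hi, ← ENNReal.ofReal_pow hzp.le, ← ENNReal.ofReal_mul (by positivity)]
    refine ENNReal.ofReal_le_ofReal ?_
    rw [← Real.exp_log (pow_pos hzp _), ← Real.exp_add, Real.log_pow]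
    refine Real.exp_le_exp.2 ?_
    have h3 : ε * (Φ z).toReal ≤ ε * (N * Real.log ‖z‖) := mul_le_mul_of_nonneg_left h hε.le
    have h4 : ε * (N * Real.log ‖z‖) = 2 * N₀ * Real.log ‖z‖ := by
      rw [hN]; field_simp
    simp only [hp]
    push_cast
    linarith

lemma IsLocalZhouWeight.exists_intNear_of_not_leO (hΦ : IsLocalZhouWeight f₀ φ₀ Φ)
    (hψ : PSHNear ψ) {b : ℝ} (hb : 0 < b) (h : ¬ leO ψ fun z => (b : EReal) * Φ z) :
    ∃ ε > 0, IntNear (tupWt f₀ fun z => 2 * (φ₀ z).toReal +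
      (2 + ε) * max (Φ z).toReal (b⁻¹ * (ψ z).toReal)) := by
  obtain ⟨V, hV, hVo, hψV⟩ := id hψ
  have hv := hψV.subMeanOn.const_mul hVo (inv_pos.2 hb)
  have hintg := (hΦ.leO_or_intNear hV hv).resolve_left fun ⟨C, hC⟩ => h ⟨b * C, by
    filter_upwards [hC] with z hz
    have h1 := mul_le_mul_of_nonneg_left hz (EReal.coe_nonneg.2 hb.le : (0 : EReal) ≤ (b : EReal))
    rwa [← mul_assoc, ← EReal.coe_mul, mul_inv_cancel₀ hb.ne', EReal.coe_one, one_mul,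
      EReal.left_distrib_of_nonneg_of_ne_top (EReal.coe_nonneg.2 hb.le) (EReal.coe_ne_top _),
      ← EReal.coe_mul] at h1⟩
  have hs := (hΦ.zhou.psh.max hV hv).spsh
  obtain ⟨ε, hε, h2⟩ := tupWt_strong_openness hΦ.holo
    ((hΦ.psh₀.spsh.const_mul zero_le_two).add (hs.const_mul zero_le_two)) hs hintg
  refine ⟨ε, hε, (intNear_congr ?_).1 h2⟩
  filter_upwards [hΦ.zhou.psh.eventually_coe_toReal, hψ.eventually_coe_toReal] with z h3 h4
  have h5 : (max (Φ z) (((b⁻¹ : ℝ) : EReal) * ψ z)).toReal =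
      max (Φ z).toReal (b⁻¹ * (ψ z).toReal) := by
    rw [← h3, ← h4, ← EReal.coe_mul, EReal.toReal_coe, EReal.toReal_coe,
      ← EReal.coe_strictMono.monotone.map_max, EReal.toReal_coe]
  simp only [tupWt, h5]
  ring_nf

lemma IsLocalZhouWeight.lt_of_leO (hΦ : IsLocalZhouWeight f₀ φ₀ Φ) (hψ : PSHNear ψ) {ε : ℝ}
    (hε : 0 < ε) (hintg : IntNear (tupWt f₀ fun z => 2 * (φ₀ z).toReal + ε * (ψ z).toReal))
    {b : ℝ} (h : leO ψ fun z => (b : EReal) * Φ z) : b < 2 / ε := by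
  by_contra! hb
  rw [div_le_iff₀ hε] at hb
  obtain ⟨C, hC⟩ := h
  obtain ⟨M, hM, hpM⟩ := hΦ.zhou.psh.spsh.eventually_le
  refine hΦ.not_intNear (hintg.tupWt_mono (C := (b * ε - 2) * M + ε * C) ?_)
  filter_upwards [hpM, eventually_nearAE_of_nhds hC, hΦ.zhou.psh.eventually_coe_toReal,
    hψ.eventually_coe_toReal] with z h1 h2 h3 h4
  rw [← h3, ← h4, ← EReal.coe_mul, ← EReal.coe_add, EReal.coe_le_coe_iff] at h2
  nlinarith [mul_le_mul_of_nonneg_left h2 hε.le, mul_le_mul_of_nonneg_left h1 (sub_nonneg.2 hb)]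

lemma PSHNear.leO_zero (hψ : PSHNear ψ) : leO ψ fun z => ((0 : ℝ) : EReal) * Φ z := by
  obtain ⟨V, hV, hVo, hψV⟩ := hψ
  obtain ⟨x, hx, -⟩ := EReal.lt_iff_exists_real_btwn.1 (hψV.lt_top 0 (mem_of_mem_nhds hV))
  refine ⟨x, ?_⟩
  have h := hψV.usc 0 (mem_of_mem_nhds hV) _ hx
  rw [nhdsWithin_eq_nhds.2 hV] at h
  filter_upwards [h] with z hz
  simpa using le_of_lt hz
end

end

section

section
variable {α : Type*} [MeasurableSpace α] {μ : Measure α} {w q : α → ℝ} {E : ℝ → Set α}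
  {σ M ε₀ c : ℝ}

lemma integrable_mul_of_exp (hw : ∀ x, 0 ≤ w x) (hq : AEMeasurable q μ) (hM : 0 ≤ M)
    (hqM : ∀ᵐ x ∂μ, q x ≤ M) (hwi : Integrable w μ) (hε : 0 < ε₀)
    (hexp : Integrable (fun x => w x * Real.exp (-ε₀ * q x)) μ) :
    Integrable (fun x => w x * -q x) μ := by
  refine Integrable.mono' ((hwi.const_mul M).add (hexp.const_mul ε₀⁻¹))
    (hwi.aestronglyMeasurable.mul hq.neg.aestronglyMeasurable) ?_
  filter_upwards [hqM] with x hx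
  have h1 : -ε₀ * q x ≤ Real.exp (-ε₀ * q x) := by linarith [Real.add_one_le_exp (-ε₀ * q x)]
  have h2 : |q x| ≤ M + ε₀⁻¹ * Real.exp (-ε₀ * q x) := by
    have h3 : -q x ≤ ε₀⁻¹ * Real.exp (-ε₀ * q x) := by
      rw [inv_mul_eq_div, le_div_iff₀ hε]; linarith
    have h4 : 0 ≤ ε₀⁻¹ * Real.exp (-ε₀ * q x) := by positivity
    exact abs_le.2 ⟨by linarith, by linarith⟩
  rw [Real.norm_eq_abs, abs_mul, abs_neg, abs_of_nonneg (hw x)]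
  have := mul_le_mul_of_nonneg_left h2 (hw x)
  simp only [Pi.add_apply]
  linarith

/-- The averages of `-q / t` over a family of sets `E t` whose mass decays at most like
`e^{-2t} / t`, when the mass of `E t ∩ {q < -bt}` decays faster for `b > σ`. -/
lemma tendsto_weighted_average (hw : ∀ x, 0 ≤ w x) (hE : ∀ t, MeasurableSet (E t))
    (hq : AEMeasurable q μ) (hM : 0 ≤ M) (hqM : ∀ᵐ x ∂μ, q x ≤ M) (hwi : Integrable w μ)
    (hε : 0 < ε₀) (hexp : Integrable (fun x => w x * Real.exp (-ε₀ * q x)) μ) (hσ : 0 ≤ σ)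
    (hc : 0 < c) (hlow : ∀ᶠ t in atTop, c * (Real.exp (-2 * t) / t) ≤ ∫ x in E t, w x ∂μ)
    (hsup : ∀ b, σ < b → ∃ ε > 0, ∃ G : α → ℝ, Integrable G μ ∧ (∀ x, 0 ≤ G x) ∧
      ∀ᶠ t in atTop, ∀ᵐ x ∂μ, x ∈ E t → q x < -(b * t) → w x ≤ Real.exp (-(2 + ε) * t) * G x)
    (hinf : ∀ b, b < σ → ∃ C : ℝ, ∀ᶠ t in atTop, ∀ᵐ x ∂μ, x ∈ E t → b * t - C ≤ -q x) :
    Tendsto (fun t => (∫ x in E t, w x * -q x ∂μ) / (t * ∫ x in E t, w x ∂μ)) atTop (𝓝 σ) := by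
  have hwq := integrable_mul_of_exp hw hq hM hqM hwi hε hexp
  rw [tendsto_order]
  constructor
  · intro a ha
    obtain ⟨b, hab, hbσ⟩ := exists_between ha
    obtain ⟨C, hC⟩ := hinf b hbσ
    have hlim : Tendsto (fun t : ℝ => b - C / t) atTop (𝓝 (b - 0)) :=
      tendsto_const_nhds.sub (tendsto_const_nhds.div_atTop tendsto_id)
    rw [sub_zero] at hlim
    filter_upwards [hlow, hC, hlim.eventually (lt_mem_nhds hab), eventually_gt_atTop 0]
      with t h1 h2 h3 ht
    have hI : 0 < ∫ x in E t, w x ∂μ := lt_of_lt_of_le (by positivity) h1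
    refine h3.trans_le ?_
    rw [le_div_iff₀ (by positivity)]
    have h4 : ∫ x in E t, w x * (b * t - C) ∂μ ≤ ∫ x in E t, w x * -q x ∂μ := by
      refine integral_mono_ae (hwi.mul_const _).integrableOn hwq.integrableOn ?_
      rw [EventuallyLE, ae_restrict_iff' (hE t)]
      filter_upwards [h2] with x hx hxE
      exact mul_le_mul_of_nonneg_left (hx hxE) (hw x)
    rw [integral_mul_const] at h4
    refine le_trans (le_of_eq ?_) h4
    field_simp
  · intro a ha
    obtain ⟨b, hσb, hba⟩ := exists_between ha
    obtain ⟨ε, hεp, G, hG, hG0, hev⟩ := hsup b hσb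
    set K := ∫ x, G x ∂μ
    set L := ∫ x, w x * Real.exp (-ε₀ * q x) ∂μ
    have hlim : Tendsto (fun t : ℝ => b + c⁻¹ * (3 / ε₀ * K * (t * Real.exp (-ε * t)) +
        ε₀⁻¹ * L * Real.exp (-t))) atTop (𝓝 (b + c⁻¹ * (3 / ε₀ * K * 0 + ε₀⁻¹ * L * 0))) := by
      refine tendsto_const_nhds.add (Tendsto.const_mul _ (Tendsto.add (Tendsto.const_mul _ ?_)
        (Tendsto.const_mul _ (Real.tendsto_exp_neg_atTop_nhds_zero))))
      simpa using tendsto_rpow_mul_exp_neg_mul_atTop_nhds_zero 1 ε hεp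
    simp only [mul_zero, add_zero] at hlim
    filter_upwards [hlow, hev, hlim.eventually (gt_mem_nhds hba), eventually_gt_atTop 0]
      with t h1 h2 h3 ht
    have hI : 0 < ∫ x in E t, w x ∂μ := lt_of_lt_of_le (by positivity) h1
    refine lt_of_le_of_lt ?_ h3
    rw [div_le_iff₀ (by positivity)]
    set δ : ℝ := 3 / ε₀ * t * Real.exp (-(2 + ε) * t) with hδ
    set η : ℝ := ε₀⁻¹ * Real.exp (-3 * t) with hη
    have h4 : ∫ x in E t, w x * -q x ∂μ ≤ ∫ x in E t, (b * t * w x + δ * G x +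
        η * (w x * Real.exp (-ε₀ * q x))) ∂μ := by
      refine integral_mono_ae hwq.integrableOn (((hwi.const_mul _).add (hG.const_mul _)).add
        (hexp.const_mul _)).integrableOn ?_
      rw [EventuallyLE, ae_restrict_iff' (hE t)]
      filter_upwards [h2] with x hx hxE
      have h5 : 0 ≤ δ * G x := mul_nonneg (by positivity) (hG0 x)
      have h6 : 0 ≤ η * (w x * Real.exp (-ε₀ * q x)) :=
        mul_nonneg (by positivity) (mul_nonneg (hw x) (Real.exp_pos _).le)
      have h7 : 0 ≤ b * t * w x := mul_nonneg (mul_nonneg (hσ.trans hσb.le) ht.le) (hw x)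
      rcases lt_or_ge (q x) (-(b * t)) with h8 | h8
      · have h9 := Real.add_one_le_exp (-ε₀ * q x - 3 * t)
        have h10 : -q x ≤ 3 / ε₀ * t + η * Real.exp (-ε₀ * q x) := by
          rw [hη, mul_assoc, ← Real.exp_add, show -3 * t + -ε₀ * q x = -ε₀ * q x - 3 * t by ring,
            show 3 / ε₀ * t + ε₀⁻¹ * Real.exp (-ε₀ * q x - 3 * t) =
              (3 * t + Real.exp (-ε₀ * q x - 3 * t)) / ε₀ by field_simp, le_div_iff₀ hε]
          linarith
        have h11 := mul_le_mul_of_nonneg_left h10 (hw x)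
        have h12 := mul_le_mul_of_nonneg_left (hx hxE h8) (by positivity : 0 ≤ 3 / ε₀ * t)
        have h13 : 3 / ε₀ * t * (Real.exp (-(2 + ε) * t) * G x) = δ * G x := by rw [hδ]; ring
        have h14 : w x * (3 / ε₀ * t + η * Real.exp (-ε₀ * q x)) =
          3 / ε₀ * t * w x + η * (w x * Real.exp (-ε₀ * q x)) := by ring
        linarith
      · have h9 := mul_le_mul_of_nonneg_left (by linarith : -q x ≤ b * t) (hw x)
        linarith
    rw [integral_add ((hwi.const_mul _).fun_add (hG.const_mul _)).integrableOn
      (hexp.const_mul _).integrableOn, integral_add (hwi.const_mul _).integrableOn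
      (hG.const_mul _).integrableOn, integral_const_mul, integral_const_mul,
      integral_const_mul] at h4
    have hK : ∫ x in E t, G x ∂μ ≤ K := setIntegral_le_integral hG (Eventually.of_forall hG0)
    have hL : ∫ x in E t, w x * Real.exp (-ε₀ * q x) ∂μ ≤ L := setIntegral_le_integral hexp
      (Eventually.of_forall fun x => mul_nonneg (hw x) (Real.exp_pos _).le)
    have hK0 : 0 ≤ K := integral_nonneg hG0
    have hL0 : 0 ≤ L := integral_nonneg fun x => mul_nonneg (hw x) (Real.exp_pos _).le
    have h5 : c * Real.exp (-2 * t) ≤ t * ∫ x in E t, w x ∂μ := by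
      have := mul_le_mul_of_nonneg_left h1 ht.le
      refine le_trans (le_of_eq ?_) this
      field_simp
    have h6 := mul_le_mul_of_nonneg_left h5 (by positivity : 0 ≤ c⁻¹ * (3 / ε₀ * K *
      (t * Real.exp (-ε * t)) + ε₀⁻¹ * L * Real.exp (-t)))
    have h7 : c⁻¹ * (3 / ε₀ * K * (t * Real.exp (-ε * t)) + ε₀⁻¹ * L * Real.exp (-t)) *
        (c * Real.exp (-2 * t)) = δ * K + η * L := by
      rw [hδ, hη, show -(2 + ε) * t = -ε * t + -2 * t by ring, show -3 * t = -t + -2 * t by ring,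
        Real.exp_add, Real.exp_add]
      field_simp
    have h8 := mul_le_mul_of_nonneg_left hK (by positivity : 0 ≤ δ)
    have h9 := mul_le_mul_of_nonneg_left hL (by positivity : 0 ≤ η)
    rw [add_mul]
    linarith
end

end

section

section
variable {m : ℕ} {f₀ : Fin m → Cn n → ℂ} {φ₀ Φ ψ : Cn n → EReal}

lemma eventually_sublevel_subset {N C : ℝ} (hN : 0 < N) {B V : Set (Cn n)}
    (h : ∀ z ∈ B, (N : EReal) * ENNReal.log ‖z‖ₑ ≤ Φ z + C) (hV : V ∈ 𝓝 0) :
    ∀ᶠ t : ℝ in atTop, {z | Φ z < ((-t : ℝ) : EReal)} ∩ B ⊆ V := by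
  obtain ⟨δ, hδ, hb⟩ := Metric.mem_nhds_iff.1 hV
  filter_upwards [eventually_ge_atTop (C - N * Real.log δ)] with t ht z hz
  refine hb ?_
  rw [mem_ball_zero_iff]
  by_contra! hzδ
  have hz0 : z ≠ 0 := norm_pos_iff.1 (hδ.trans_le hzδ)
  have h1 := h z hz.2
  have h2' : Φ z + C < ((-t : ℝ) : EReal) + C :=
    EReal.add_lt_add_right_coe hz.1 C
  have h3 := h1.trans_lt h2'
  rw [log_enorm_of_ne_zero hz0, ← EReal.coe_mul, ← EReal.coe_add, EReal.coe_lt_coe_iff] at h3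
  have h4 := mul_le_mul_of_nonneg_left (Real.log_le_log hδ hzδ) hN.le
  linarith

lemma toReal_tupWt {ι : Type*} [Fintype ι] (f : ι → Cn n → ℂ) (a : Cn n → ℝ) (z : Cn n) :
    (tupWt f a z).toReal = (∑ j, ‖f j z‖ₑ ^ 2).toReal * Real.exp (-a z) := by
  rw [tupWt, ENNReal.toReal_mul, ENNReal.toReal_ofReal (Real.exp_pos _).le]

lemma exp_div_shift_le {c t : ℝ} (hc : 0 < c) (ht : 1 ≤ t) :
    c * Real.exp (-2) / 2 * (Real.exp (-2 * t) / t) ≤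
      c * (Real.exp (-2 * (t + 1)) / (t + 1)) := by
  rw [show -2 * (t + 1) = -2 * t + -2 by ring, Real.exp_add,
    show c * Real.exp (-2) / 2 * (Real.exp (-2 * t) / t) =
      c * (Real.exp (-2 * t) * Real.exp (-2) / (2 * t)) by field_simp]
  gcongr
  linarith

/-- Lower bound for the mass of sublevel sets of a Zhou weight. -/
lemma IsLocalZhouWeight.mass_lower_bound (hΦ : IsLocalZhouWeight f₀ φ₀ Φ) {R : ℝ} (hR : 0 < R)
    (hf : ∀ j, DifferentiableOn ℂ (f₀ j) (Metric.ball 0 R))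
    (hfin : ∫⁻ z in Metric.ball (0 : Cn n) R, tupWt f₀ (fun z => 2 * (φ₀ z).toReal) z < ⊤)
    (hcoe : ∀ᵐ z, z ∈ Metric.ball (0 : Cn n) R → (((Φ z).toReal : ℝ) : EReal) = Φ z)
    (hE : ∀ t : ℝ, MeasurableSet ({z | Φ z < ((-t : ℝ) : EReal)} ∩ Metric.ball 0 R)) :
    ∃ c > 0, ∀ᶠ t : ℝ in atTop, ENNReal.ofReal (c * (Real.exp (-2 * t) / t)) ≤
      ∫⁻ z in {z | Φ z < ((-t : ℝ) : EReal)} ∩ Metric.ball 0 R,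
        tupWt f₀ (fun z => 2 * (φ₀ z).toReal) z := by
  have hP := hΦ.psh₀.spsh.const_mul zero_le_two
  have hp := hΦ.zhou.psh.spsh
  have hle : ∀ j z, ‖f₀ j z‖ₑ ^ 2 * ENNReal.ofReal (Real.exp (-(2 * (φ₀ z).toReal))) ≤
      tupWt f₀ (fun z => 2 * (φ₀ z).toReal) z := fun j z =>
    mul_le_mul_left (Finset.single_le_sum (f := fun j => ‖f₀ j z‖ₑ ^ 2)
      (fun _ _ => zero_le) (Finset.mem_univ j)) _
  have hnon := hΦ.not_intNear
  rw [intNear_tupWt_iff hΦ.holo (hP.add (hp.const_mul zero_le_two))] at hnon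
  push Not at hnon
  obtain ⟨j, hj⟩ := hnon
  obtain ⟨c, hc, T, hT, h⟩ := shell_lower_bound hP hp hR (hf j)
    ((lintegral_mono (hle j)).trans_lt hfin) fun r hr => by
      by_contra hne
      refine hj ⟨_, Metric.ball_mem_nhds _ hr, ?_⟩
      simpa only [neg_add'] using Ne.lt_top hne
  refine ⟨c * Real.exp (-2) / 2, by positivity, ?_⟩
  filter_upwards [eventually_ge_atTop T] with t ht
  refine (ENNReal.ofReal_le_ofReal (exp_div_shift_le hc (hT.trans ht))).trans
    ((h (t + 1) (by linarith)).trans ?_)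
  rw [← lintegral_indicator measurableSet_ball, ← lintegral_indicator (hE t)]
  refine lintegral_mono_ae ?_
  filter_upwards [hcoe] with z hz
  by_cases hzB : z ∈ Metric.ball (0 : Cn n) R
  · rw [Set.indicator_of_mem hzB]
    refine Set.indicator_apply_le' (fun hzs => ?_) fun _ => zero_le
    rw [Set.indicator_of_mem]
    · exact hle j z
    · refine ⟨?_, hzB⟩
      rw [Set.mem_ofPred_eq, ← hz hzB, EReal.coe_lt_coe_iff]
      linarith [hzs.2]
  · rw [Set.indicator_of_notMem hzB]
    exact zero_le

end

end

/-- integral formula for Zhou numbers. -/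
theorem statement2 {n m : ℕ} (f₀ : Fin m → Cn n → ℂ) (φ₀ Φ : Cn n → EReal)
    (hΦ : IsLocalZhouWeight f₀ φ₀ Φ) (ψ : Cn n → EReal) (hψ : PSHNear ψ) :
    ∃ U₀ ∈ 𝓝 (0 : Cn n), ∀ U ∈ 𝓝 (0 : Cn n), U ⊆ U₀ →
      Tendsto (fun t : ℝ =>
          (∫ z in {z : Cn n | Φ z < ((-t : ℝ) : EReal)} ∩ U,
              (dens0 f₀ φ₀ z).toReal * (-(ψ z).toReal)) /
            (t * ∫ z in {z : Cn n | Φ z < ((-t : ℝ) : EReal)} ∩ U, (dens0 f₀ φ₀ z).toReal))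
        atTop (𝓝 (zhouNumber ψ Φ)) := by
  set P : Cn n → ℝ := fun z => 2 * (φ₀ z).toReal with hPdef
  have hP : SPsh P := hΦ.psh₀.spsh.const_mul zero_le_two
  have hp := hΦ.zhou.psh.spsh
  have hq := hψ.spsh
  obtain ⟨ε₀, hε₀, hintg₀⟩ := tupWt_strong_openness hΦ.holo hP hq hΦ.intNear
  have hPq := hP.add (hq.const_mul hε₀.le)
  obtain ⟨M, hM, hqM⟩ := hq.eventually_le
  obtain ⟨N, hN, C, hlog⟩ := hΦ.log_norm_leO
  obtain ⟨V, hV, -, hΦV⟩ := id hΦ.zhou.psh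
  obtain ⟨ρ, hρ, hb⟩ := Metric.mem_nhds_iff.1 (inter_mem hV hlog)
  obtain ⟨R, hRf, hR1, hR2, hR3, hR4, hR5, hR6, hR7, hRpos⟩ :=
    ((eventually_differentiableOn hΦ.holo).and <| (intNear_iff.1 hΦ.intNear).and <|
      (eventually_aemeasurable_tupWt hΦ.holo hP).and <| (intNear_iff.1 hintg₀).and <|
      (eventually_aemeasurable_tupWt hΦ.holo hPq).and <| hq.eventually_aemeasurable.and <|
      (eventually_nearAE_iff.1 (hΦ.zhou.psh.eventually_coe_toReal.and <|
        hψ.eventually_coe_toReal.and <| (eventually_dens0_eq (f₀ := f₀) hΦ.psh₀).and hqM)).and <|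
      (eventually_small_ball (P := fun r => r ≤ ρ) hρ fun r _ hr => hr).and
      self_mem_nhdsWithin).exists
  replace hR7 := fun z (hz : z ∈ Metric.ball (0 : Cn n) R) => hb (Metric.ball_subset_ball hR7 hz)
  set B := Metric.ball (0 : Cn n) R with hB
  have hBV : B ⊆ V := fun z hz => (hR7 z hz).1
  have hBlog := fun z hz => (hR7 z hz).2
  set E : ℝ → Set (Cn n) := fun t => {z | Φ z < ((-t : ℝ) : EReal)} ∩ B with hEdef
  have hE : ∀ t, MeasurableSet (E t) := by
    intro t
    obtain ⟨O, hO, hOe⟩ := upperSemicontinuousOn_iff_preimage_Iio.1 (hΦV.usc.mono hBV)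
      ((-t : ℝ) : EReal)
    have h1 : E t = O ∩ B := by
      rw [hEdef, Set.inter_comm O, ← hOe, Set.inter_comm]
      rfl
    rw [h1]
    exact (hO.inter Metric.isOpen_ball).measurableSet
  have hsub : ∀ W ∈ 𝓝 (0 : Cn n), ∀ᶠ t in atTop, E t ⊆ W := fun W hW =>
    eventually_sublevel_subset hN hBlog hW
  have hae := (ae_restrict_iff' (μ := volume) (measurableSet_ball (x := (0 : Cn n)) (ε := R))).2 hR6
  refine ⟨B, Metric.ball_mem_nhds _ hRpos, fun U hU hUB => ?_⟩
  have hwi : Integrable (fun z => (dens0 f₀ φ₀ z).toReal) (volume.restrict B) := by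
    refine (integrable_toReal_of_lintegral_ne_top hR2 hR1.ne).congr ?_
    filter_upwards [hae] with z hz
    rw [hz.2.2.1]
  have hexp : Integrable (fun z => (dens0 f₀ φ₀ z).toReal * Real.exp (-ε₀ * (ψ z).toReal))
      (volume.restrict B) := by
    refine (integrable_toReal_of_lintegral_ne_top hR4 hR3.ne).congr ?_
    filter_upwards [hae] with z hz
    rw [hz.2.2.1, toReal_tupWt, toReal_tupWt, mul_assoc, ← Real.exp_add]
    congr 2
    ring
  obtain ⟨c, hc, hlow⟩ := hΦ.mass_lower_bound hRpos hRf hR1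
    (hR6.mono fun z hz hzB => (hz hzB).1) hE
  set S : Set ℝ := {b : ℝ | 0 ≤ b ∧ leO ψ fun z => (b : EReal) * Φ z} with hS
  have hS0 : (0 : ℝ) ∈ S := ⟨le_rfl, hψ.leO_zero⟩
  have hSb : BddAbove S := ⟨2 / ε₀, fun b hb => (hΦ.lt_of_leO hψ hε₀ hintg₀ hb.2).le⟩
  have hσ : 0 ≤ zhouNumber ψ Φ := le_csSup hSb hS0
  have hrestr : ∀ t, (volume.restrict B).restrict (E t) = volume.restrict (E t) := fun t => by
    rw [Measure.restrict_restrict (hE t), Set.inter_eq_left.2 Set.inter_subset_right]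
  have key := tendsto_weighted_average (E := E) (fun z => ENNReal.toReal_nonneg) hE hR5 hM
    (hae.mono fun z hz => hz.2.2.2) hwi hε₀ hexp hσ hc ?_ ?_ ?_
  · refine key.congr' ?_
    filter_upwards [hsub U hU] with t ht
    have hEU : {z | Φ z < ((-t : ℝ) : EReal)} ∩ U = E t :=
      Set.Subset.antisymm (Set.inter_subset_inter_right _ hUB) fun z hz => ⟨hz.1, ht hz⟩
    rw [hEU, hrestr]
  · filter_upwards [hlow] with t ht
    rw [hrestr]
    have hae' := ae_restrict_of_ae_restrict_of_subset (Set.inter_subset_right : E t ⊆ B) hae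
    have hm : AEMeasurable (tupWt f₀ P) (volume.restrict (E t)) :=
      hR2.mono_measure (Measure.restrict_mono Set.inter_subset_right le_rfl)
    have hfin : ∫⁻ z in E t, tupWt f₀ P z < ⊤ :=
      (lintegral_mono_set Set.inter_subset_right).trans_lt hR1
    have h1 : ∫ z in E t, (dens0 f₀ φ₀ z).toReal = (∫⁻ z in E t, tupWt f₀ P z).toReal := by
      rw [← integral_toReal hm (ae_lt_top' hm hfin.ne)]
      refine integral_congr_ae ?_
      filter_upwards [hae'] with z hz
      rw [hz.2.2.1]
    rw [h1]
    exact (ENNReal.ofReal_le_iff_le_toReal hfin.ne).1 ht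
  · intro b hb
    have hbpos : 0 < b := hσ.trans_lt hb
    obtain ⟨ε, hε, hintg⟩ := hΦ.exists_intNear_of_not_leO hψ hbpos fun hcon =>
      hb.not_ge (le_csSup hSb ⟨hbpos.le, hcon⟩)
    set s : Cn n → ℝ := fun z => max (Φ z).toReal (b⁻¹ * (ψ z).toReal) with hs
    obtain ⟨r, ⟨⟨⟨h1, h2⟩, h3⟩, hrR⟩, hr⟩ := ((((intNear_iff.1 hintg).and
      hp.eventually_aemeasurable).and (eventually_aemeasurable_tupWt hΦ.holo hP)).and
      (eventually_small_ball (P := fun r => r ≤ R) hRpos fun r _ h => h)).and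
        self_mem_nhdsWithin |>.exists
    have hqr := hR5.mono_measure (Measure.restrict_mono
      (Metric.ball_subset_ball hrR : Metric.ball (0 : Cn n) r ⊆ B) le_rfl)
    have hm : AEMeasurable (tupWt f₀ fun z => P z + (2 + ε) * s z)
        (volume.restrict (Metric.ball (0 : Cn n) r)) := by
      have h4 : (tupWt f₀ fun z => P z + (2 + ε) * s z) = fun z => tupWt f₀ P z *
          ENNReal.ofReal (Real.exp (-((2 + ε) * s z))) := by
        funext z
        rw [tupWt, tupWt, mul_assoc, ← ENNReal.ofReal_mul (Real.exp_pos _).le, ← Real.exp_add,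
          ← neg_add]
      rw [h4]
      exact h3.mul (ENNReal.measurable_ofReal.comp_aemeasurable (Real.measurable_exp.comp_aemeasurable
        ((h2.max (hqr.const_mul _)).const_mul _).neg))
    refine ⟨ε, hε, (Metric.ball (0 : Cn n) r).indicator fun z =>
      (tupWt f₀ (fun z => P z + (2 + ε) * s z) z).toReal, ?_, ?_, ?_⟩
    · refine ((integrable_indicator_iff measurableSet_ball).2 ?_).restrict
      exact integrable_toReal_of_lintegral_ne_top hm h1.ne
    · exact fun z => Set.indicator_nonneg (fun _ _ => ENNReal.toReal_nonneg) z
    · filter_upwards [hsub _ (Metric.ball_mem_nhds (0 : Cn n) hr)] with t ht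
      filter_upwards [hae] with z hz hzE hqz
      rw [Set.indicator_of_mem (ht hzE), hz.2.2.1, toReal_tupWt, toReal_tupWt, mul_left_comm,
        ← Real.exp_add]
      refine mul_le_mul_of_nonneg_left (Real.exp_le_exp.2 ?_) ENNReal.toReal_nonneg
      have h5 : (Φ z).toReal < -t := by
        rw [← EReal.coe_lt_coe_iff, hz.1]; exact hzE.1
      have h6 : b⁻¹ * (ψ z).toReal < -t := by
        rw [inv_mul_eq_div, div_lt_iff₀ hbpos]; linarith
      have h7 : s z < -t := max_lt h5 h6
      nlinarith
  · intro b hb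
    obtain ⟨b', ⟨hb'0, C', hC'⟩, hbb'⟩ := exists_lt_of_lt_csSup ⟨0, hS0⟩ hb
    refine ⟨C', ?_⟩
    filter_upwards [hsub _ hC', eventually_ge_atTop 0] with t ht ht0
    filter_upwards [hae] with z hz hzE
    have h1 := ht hzE
    have h5 : (Φ z).toReal < -t := by
      rw [← EReal.coe_lt_coe_iff, hz.1]; exact hzE.1
    rw [Set.mem_ofPred_eq, ← hz.1, ← hz.2.1, ← EReal.coe_mul, ← EReal.coe_add,
      EReal.coe_le_coe_iff] at h1
    nlinarith [mul_le_mul_of_nonneg_left h5.le hb'0, mul_le_mul_of_nonneg_right hbb'.le ht0]
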